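/- Let Ω ⊂ ℝ³ be a bounded open set with Lipschitz boundary, let 0 ≤ α < 6/5, and let F : Ω → ℝ^{3×3} be measurable with ∫_Ω d^{−α/2} |F|^{3/2} dx < ∞. Then there exists a weak solution v ∈ W^{1,3}_{0,σ}(Ω, d^α) of the system ω × v + curl(d^α |ω| ω) + ∇π = div F, div v = 0, v|_{∂Ω} = 0, with ω = curl v; that is, for every φ ∈ C^∞_{0,σ}(Ω): ∫_Ω [ (ω × v) · φ + d^α |ω| ω · curl φ ] dx = −∫_Ω F : ∇φ dx. Moreover the energy-type equality ∫_Ω d^α |ω|³ dx = −∫_Ω F : ∇v dx holds. -/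

import Mathlib

noncomputable section

open MeasureTheory Real Filter Topology Bornology ENNReal NNReal

/-- Euclidean 3-space. -/
abbrev E3 : Type := EuclideanSpace ℝ (Fin 3)

/-- Euclidean 2-space. -/
abbrev E2 : Type := EuclideanSpace ℝ (Fin 2)

/-- The `i`-th standard basis vector of `E3`. -/
def ee (i : Fin 3) : E3 := EuclideanSpace.single i 1

/-- Partial derivative `∂ᵢ f` of a scalar function. -/
def pds (f : E3 → ℝ) (i : Fin 3) (x : E3) : ℝ := fderiv ℝ f x (ee i)

/-- Partial derivative `∂ᵢ vⱼ` of a vector field. -/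
def pd (v : E3 → E3) (i j : Fin 3) (x : E3) : ℝ := fderiv ℝ v x (ee i) j

/-- Build a vector of `E3` from coordinates. -/
def mk3 (a b c : ℝ) : E3 := (WithLp.equiv 2 (Fin 3 → ℝ)).symm ![a, b, c]

/-- Build a vector of `E2` from coordinates. -/
def mk2 (a b : ℝ) : E2 := (WithLp.equiv 2 (Fin 2 → ℝ)).symm ![a, b]

/-- First two coordinates `x'` of a point of `E3`. -/
def proj12 (y : E3) : E2 := mk2 (y 0) (y 1)

/-- Gradient of a scalar function, as a vector field. -/
def grad3 (f : E3 → ℝ) (x : E3) : E3 := mk3 (pds f 0 x) (pds f 1 x) (pds f 2 x)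

/-- Gradient matrix `(∇v)ᵢⱼ = ∂ᵢ vⱼ` of a vector field. -/
def gradv (v : E3 → E3) (x : E3) (i j : Fin 3) : ℝ := pd v i j x

/-- Divergence of a vector field. -/
def vdiv (v : E3 → E3) (x : E3) : ℝ := ∑ i, pd v i i x

/-- Curl `∇ × v` of a vector field. -/
def vcurl (v : E3 → E3) (x : E3) : E3 :=
  mk3 (pd v 1 2 x - pd v 2 1 x) (pd v 2 0 x - pd v 0 2 x) (pd v 0 1 x - pd v 1 0 x)

/-- Curl computed from a (weak) gradient matrix `G`, `(curl v)₁ = G₂₃ - G₃₂` etc. -/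
def curlOf (G : E3 → Fin 3 → Fin 3 → ℝ) (x : E3) : E3 :=
  mk3 (G x 1 2 - G x 2 1) (G x 2 0 - G x 0 2) (G x 0 1 - G x 1 0)

/-- Divergence computed from a (weak) gradient matrix. -/
def divOf (G : E3 → Fin 3 → Fin 3 → ℝ) (x : E3) : ℝ := ∑ i, G x i i

/-- Cross product on `E3`. -/
def cross3 (a b : E3) : E3 :=
  mk3 (a 1 * b 2 - a 2 * b 1) (a 2 * b 0 - a 0 * b 2) (a 0 * b 1 - a 1 * b 0)

/-- Euclidean dot product on `E3`. -/
def dot3 (a b : E3) : ℝ := ∑ i, a i * b i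

/-- Frobenius (double-dot) product of two 3×3 matrices. -/
def mdot (A B : Fin 3 → Fin 3 → ℝ) : ℝ := ∑ i, ∑ j, A i j * B i j

/-- Frobenius (Euclidean) norm of a 3×3 matrix. -/
def frob (M : Fin 3 → Fin 3 → ℝ) : ℝ := Real.sqrt (∑ i, ∑ j, (M i j) ^ 2)

/-- Symmetric part of a 3×3 matrix. -/
def symm3 (M : Fin 3 → Fin 3 → ℝ) (i j : Fin 3) : ℝ := (M i j + M j i) / 2

/-- Distance to the boundary of `Ω`. -/
def dB (Ω : Set E3) (x : E3) : ℝ := Metric.infDist x (frontier Ω)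

/-- Scalar test functions: smooth compactly supported inside `Ω`. -/
structure IsTestS (Ω : Set E3) (ψ : E3 → ℝ) : Prop where
  smooth : ContDiff ℝ (⊤ : ℕ∞) ψ
  compsupp : HasCompactSupport ψ
  suppin : tsupport ψ ⊆ Ω

/-- Vector test functions: smooth compactly supported inside `Ω`. -/
structure IsTest (Ω : Set E3) (φ : E3 → E3) : Prop where
  smooth : ContDiff ℝ (⊤ : ℕ∞) φ
  compsupp : HasCompactSupport φ
  suppin : tsupport φ ⊆ Ω

/-- Solenoidal (divergence-free) vector test functions `C^∞_{0,σ}(Ω)`. -/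
structure IsTestSol (Ω : Set E3) (φ : E3 → E3) extends IsTest Ω φ : Prop where
  sol : ∀ x, vdiv φ x = 0

/-- `G` is the distributional gradient of the vector field `v` on `Ω`. -/
def HasWeakGrad (Ω : Set E3) (v : E3 → E3) (G : E3 → Fin 3 → Fin 3 → ℝ) : Prop :=
  ∀ ψ : E3 → ℝ, IsTestS Ω ψ → ∀ i j,
    ∫ x in Ω, v x j * pds ψ i x = - ∫ x in Ω, G x i j * ψ x

/-- `G` is the distributional gradient of the scalar function `u` on `Ω`. -/
def HasWeakGradS (Ω : Set E3) (u : E3 → ℝ) (G : E3 → E3) : Prop :=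
  ∀ ψ : E3 → ℝ, IsTestS Ω ψ → ∀ i,
    ∫ x in Ω, u x * pds ψ i x = - ∫ x in Ω, G x i * ψ x

/-- Membership `v ∈ W^{1,p}_{0,σ}(Ω, d^α)` (with distributional gradient `G`):
`v` is measurable, `G` is its distributional gradient, the weighted norm is finite and
`v` is approximated by smooth compactly supported *solenoidal* fields in the weighted norm.
The unweighted space corresponds to `α = 0`. -/
structure MemW1pSigma (Ω : Set E3) (p α : ℝ) (v : E3 → E3)
    (G : E3 → Fin 3 → Fin 3 → ℝ) : Prop where
  meas : AEStronglyMeasurable v (volume.restrict Ω)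
  weak_grad : HasWeakGrad Ω v G
  finite : IntegrableOn (fun x => dB Ω x ^ α * (‖v x‖ ^ p + frob (G x) ^ p)) Ω
  approx : ∃ φ : ℕ → E3 → E3, (∀ n, IsTestSol Ω (φ n)) ∧
    Tendsto (fun n => ∫ x in Ω, dB Ω x ^ α *
        (‖v x - φ n x‖ ^ p + frob (fun i j => G x i j - gradv (φ n) x i j) ^ p))
      atTop (nhds 0)

/-- Membership `v ∈ W^{1,p}_0(Ω, d^α)` (with distributional gradient `G`):
as `MemW1pSigma` but approximating fields need not be divergence free. -/
structure MemW1p0 (Ω : Set E3) (p α : ℝ) (v : E3 → E3)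
    (G : E3 → Fin 3 → Fin 3 → ℝ) : Prop where
  meas : AEStronglyMeasurable v (volume.restrict Ω)
  weak_grad : HasWeakGrad Ω v G
  finite : IntegrableOn (fun x => dB Ω x ^ α * (‖v x‖ ^ p + frob (G x) ^ p)) Ω
  approx : ∃ φ : ℕ → E3 → E3, (∀ n, IsTest Ω (φ n)) ∧
    Tendsto (fun n => ∫ x in Ω, dB Ω x ^ α *
        (‖v x - φ n x‖ ^ p + frob (fun i j => G x i j - gradv (φ n) x i j) ^ p))
      atTop (nhds 0)

/-- A bounded open set of `ℝ³` with Lipschitz (`C^{0,1}`) boundary: near every boundary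
point, after a rigid change of coordinates, the boundary is the graph of a Lipschitz
function `a` (with Lipschitz constant `r < 1`) and `Ω` lies locally above the graph. -/
structure IsLipschitzDomain (Ω : Set E3) : Prop where
  nonempty : Ω.Nonempty
  isOpen : IsOpen Ω
  isBounded : IsBounded Ω
  charts : ∀ P ∈ frontier Ω, ∃ (f : E3 ≃ᵢ E3) (R R' r : ℝ) (a : E2 → ℝ),
    f P = 0 ∧ 0 < R ∧ 0 < R' ∧ 0 < r ∧ r < 1 ∧
    LipschitzWith (Real.toNNReal r) a ∧
    (∀ x' : E2, ‖x'‖ < R → |a x'| < R') ∧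
    (∀ y : E3, ‖proj12 y‖ < R → |y 2| < R' →
      (f.symm y ∈ frontier Ω ↔ y 2 = a (proj12 y))) ∧
    (∀ y : E3, ‖proj12 y‖ < R →
      a (proj12 y) < y 2 → y 2 < a (proj12 y) + R' → f.symm y ∈ Ω)

/-- A bounded open set of `ℝ³` with smooth (`C^∞`) boundary. -/
structure IsSmoothDomain (Ω : Set E3) : Prop where
  nonempty : Ω.Nonempty
  isOpen : IsOpen Ω
  isBounded : IsBounded Ω
  charts : ∀ P ∈ frontier Ω, ∃ (f : E3 ≃ᵢ E3) (R R' : ℝ) (a : E2 → ℝ),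
    f P = 0 ∧ 0 < R ∧ 0 < R' ∧ ContDiff ℝ (⊤ : ℕ∞) a ∧
    (∀ x' : E2, ‖x'‖ < R → |a x'| < R') ∧
    (∀ y : E3, ‖proj12 y‖ < R → |y 2| < R' →
      (f.symm y ∈ frontier Ω ↔ y 2 = a (proj12 y))) ∧
    (∀ y : E3, ‖proj12 y‖ < R →
      a (proj12 y) < y 2 → y 2 < a (proj12 y) + R' → f.symm y ∈ Ω)

/-- The axis-parallel closed cube with center `c` and half side-length `h`. -/
def cube (c : E3) (h : ℝ) : Set E3 := {x | ∀ i, |x i - c i| ≤ h}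

/-- Average of (the nonnegative part of) `f` over a set, valued in `ℝ≥0∞`. -/
def lavg (s : Set E3) (f : E3 → ℝ) : ℝ≥0∞ :=
  (∫⁻ x in s, ENNReal.ofReal (f x)) / volume s

/-- The Muckenhoupt `A_p` condition for a weight `w` on `ℝ³`:
`(⨍_Q w)(⨍_Q w^{-1/(p-1)})^{p-1} ≤ C` uniformly over all cubes `Q`. -/
def IsMuckenhouptAp (w : E3 → ℝ) (p : ℝ) : Prop :=
  ∃ C : ℝ, ∀ (c : E3) (h : ℝ), 0 < h →
    lavg (cube c h) w * (lavg (cube c h) (fun x => w x ^ (-1 / (p - 1)))) ^ (p - 1)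
      ≤ ENNReal.ofReal C


section AuxProof

open MeasureTheory Real Filter Topology Bornology ENNReal NNReal

section Brouwer

variable {E : Type*} [NormedAddCommGroup E] [InnerProductSpace ℝ E] [FiniteDimensional ℝ E]

/-- `det (1 + t A)` is a polynomial in `t`. -/
lemma exists_poly_det (A : E →L[ℝ] E) :
    ∃ p : Polynomial ℝ, p.natDegree ≤ Module.finrank ℝ E ∧
      ∀ t : ℝ, p.eval t = (ContinuousLinearMap.id ℝ E + t • A).det := by
  classical
  let b := Module.finBasis ℝ E
  let M := LinearMap.toMatrix b b (A : E →ₗ[ℝ] E)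
  refine ⟨Matrix.det ((Polynomial.X : Polynomial ℝ) • M.map Polynomial.C +
    (1 : Matrix _ _ ℝ).map Polynomial.C), ?_, ?_⟩
  · exact (Polynomial.natDegree_det_X_add_C_le M 1).trans (by simp)
  · intro t
    have h1 : (ContinuousLinearMap.id ℝ E + t • A).det
        = Matrix.det (1 + t • M) := by
      rw [ContinuousLinearMap.det, ← LinearMap.det_toMatrix b]
      congr 1
      simp [M, LinearMap.toMatrix_id, LinearMap.toMatrix_one]
    rw [h1, ← Polynomial.coe_evalRingHom, RingHom.map_det]
    congr 1
    ext i j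
    simp [Matrix.map_apply, Matrix.one_apply]
    by_cases h : i = j <;> simp [h, mul_comm, add_comm]

lemma det_pos_of_small (A : E →L[ℝ] E) (t : ℝ) (ht : 0 ≤ t) (h : t * ‖A‖ < 1) :
    0 < (ContinuousLinearMap.id ℝ E + t • A).det := by
  obtain ⟨p, -, hp⟩ := exists_poly_det A
  have hne : ∀ s, 0 ≤ s → s ≤ t → p.eval s ≠ 0 := by
    intro s hs hst h0
    rw [hp] at h0
    have hk := LinearMap.bot_lt_ker_of_det_eq_zero (f := ((ContinuousLinearMap.id ℝ E + s • A : E →L[ℝ] E) : E →ₗ[ℝ] E)) h0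
    obtain ⟨x, hx, hx0⟩ := (Submodule.ne_bot_iff _).1 hk.ne'
    have hx1 : x + s • A x = 0 := by simpa using hx
    have h2 : ‖x‖ = s * ‖A x‖ := by
      have e := congrArg norm (eq_neg_of_add_eq_zero_left hx1)
      rwa [norm_neg, norm_smul, Real.norm_of_nonneg hs] at e
    have h3 : s * ‖A x‖ ≤ t * (‖A‖ * ‖x‖) :=
      mul_le_mul hst (A.le_opNorm x) (norm_nonneg _) ht
    have h4 : 0 < ‖x‖ := norm_pos_iff.2 hx0
    nlinarith
  have h0 : p.eval 0 = 1 := by rw [hp]; simp [ContinuousLinearMap.det]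
  rw [← hp]
  by_contra hcon
  push Not at hcon
  have : (0:ℝ) ∈ (fun s => p.eval s) '' Set.Icc 0 t := by
    apply intermediate_value_Icc' ht p.continuous.continuousOn
    exact ⟨hcon, by simp [h0]⟩
  obtain ⟨s, hs, hs0⟩ := this
  exact hne s hs.1 hs.2 hs0

/-- Extension by zero of a Lipschitz map vanishing on the unit sphere. -/
lemma lipschitz_indicator_ball (g : E → E) (L : ℝ≥0)
    (hL : LipschitzOnWith L g (Metric.closedBall 0 1)) (h0 : ∀ x, ‖x‖ = 1 → g x = 0) :
    LipschitzWith L ((Metric.closedBall (0:E) 1).indicator g) := by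
  have key : ∀ x y, x ∈ Metric.closedBall (0:E) 1 → y ∉ Metric.closedBall (0:E) 1 →
      ‖g x‖ ≤ L * ‖x - y‖ := by
    intro x y hx hy
    have hx' : ‖x‖ ≤ 1 := by simpa using hx
    have hy' : 1 < ‖y‖ := by simpa using hy
    have : (1:ℝ) ∈ (fun s : ℝ => ‖x + s • (y - x)‖) '' Set.Icc 0 1 := by
      apply intermediate_value_Icc zero_le_one (by fun_prop)
      simp [hx', hy'.le]
    obtain ⟨s, hs, hs1⟩ := this
    have hz := hL.dist_le_mul x hx (x + s • (y - x)) (by simp [hs1])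
    rw [h0 _ hs1, dist_zero_right, dist_eq_norm] at hz
    refine hz.trans ?_
    gcongr
    rw [show x - (x + s • (y - x)) = s • (x - y) by simp only [smul_sub]; abel, norm_smul,
      Real.norm_of_nonneg hs.1]
    exact mul_le_of_le_one_left (norm_nonneg _) hs.2
  apply LipschitzWith.of_dist_le_mul
  intro x y
  rw [dist_eq_norm, dist_eq_norm]
  by_cases hx : x ∈ Metric.closedBall (0:E) 1 <;> by_cases hy : y ∈ Metric.closedBall (0:E) 1
  · rw [Set.indicator_of_mem hx, Set.indicator_of_mem hy, ← dist_eq_norm, ← dist_eq_norm]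
    exact hL.dist_le_mul x hx y hy
  · rw [Set.indicator_of_mem hx, Set.indicator_of_notMem hy, sub_zero]
    exact key x y hx hy
  · rw [Set.indicator_of_notMem hx, Set.indicator_of_mem hy, zero_sub, norm_neg, norm_sub_rev]
    exact key y x hy hx
  · rw [Set.indicator_of_notMem hx, Set.indicator_of_notMem hy]
    simp; positivity

lemma image_ball_eq (g : E → E) (L : ℝ≥0)
    (hL : LipschitzOnWith L g (Metric.closedBall 0 1)) (h0 : ∀ x, ‖x‖ = 1 → g x = 0)
    (hr : ∀ x, ‖x‖ ≤ 1 → ‖x + g x‖ ≤ 1)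
    (t : ℝ) (ht : 0 ≤ t) (ht1 : t ≤ 1) (htL : t * L < 1) :
    Set.InjOn (fun x => x + t • g x) (Metric.closedBall (0:E) 1) ∧
    (fun x => x + t • g x) '' (Metric.closedBall (0:E) 1) = Metric.closedBall (0:E) 1 := by
  have hG := lipschitz_indicator_ball g L hL h0
  set G := (Metric.closedBall (0:E) 1).indicator g with hGdef
  constructor
  · intro x hx y hy hxy
    simp only at hxy
    have h1 : x - y = t • (g y - g x) := by
      rw [smul_sub]
      have := sub_eq_zero.2 hxy
      rw [← sub_eq_zero]
      rw [← this]; abel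
    have h2 : ‖x - y‖ ≤ t * (L * ‖x - y‖) := by
      conv_lhs => rw [h1]
      rw [norm_smul, Real.norm_of_nonneg ht]
      gcongr
      have := hL.dist_le_mul y hy x hx
      rwa [dist_eq_norm, dist_eq_norm, norm_sub_rev y x] at this
    by_contra hne
    have : 0 < ‖x - y‖ := norm_pos_iff.2 (sub_ne_zero.2 hne)
    nlinarith
  · apply Set.Subset.antisymm
    · rintro _ ⟨x, hx, rfl⟩
      have hx' : ‖x‖ ≤ 1 := by simpa using hx
      have : x + t • g x = (1 - t) • x + t • (x + g x) := by
        simp only [sub_smul, smul_add, one_smul]; abel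
      simp only [mem_closedBall_zero_iff, this]
      calc _ ≤ ‖(1 - t) • x‖ + ‖t • (x + g x)‖ := norm_add_le _ _
        _ = (1 - t) * ‖x‖ + t * ‖x + g x‖ := by
          rw [norm_smul, norm_smul, Real.norm_of_nonneg ht, Real.norm_of_nonneg (by linarith)]
        _ ≤ (1 - t) * 1 + t * 1 := by
          gcongr
          exact hr x hx'
        _ = 1 := by ring
    · intro y hy
      have hc : ContractingWith (Real.toNNReal t * L) (fun x => y - t • G x) := by
        refine ⟨?_, ?_⟩
        · rw [← NNReal.coe_lt_coe]; simpa [Real.coe_toNNReal _ ht] using htL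
        · apply LipschitzWith.of_dist_le_mul
          intro a b
          have := hG.dist_le_mul a b
          rw [dist_eq_norm] at this ⊢
          rw [show y - t • G a - (y - t • G b) = - (t • (G a - G b)) by
            rw [smul_sub]; abel, norm_neg, norm_smul, Real.norm_of_nonneg ht]
          simp only [NNReal.coe_mul, Real.coe_toNNReal _ ht, mul_assoc]
          gcongr
      obtain ⟨x, hx⟩ : ∃ x, y - t • G x = x := ⟨hc.fixedPoint, hc.fixedPoint_isFixedPt⟩
      by_cases hxB : x ∈ Metric.closedBall (0:E) 1
      · refine ⟨x, hxB, ?_⟩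
        rw [hGdef, Set.indicator_of_mem hxB] at hx
        simp only
        nth_rewrite 1 [← hx]; abel
      · rw [hGdef, Set.indicator_of_notMem hxB] at hx
        simp at hx
        subst hx
        exact absurd hy hxB

/-- No `C^1` retraction of the ball onto the sphere. -/
theorem no_retraction [MeasurableSpace E] [BorelSpace E] (r : E → E) (hr : ContDiff ℝ 1 r)
    (h1 : ∀ x, ‖r x‖ = 1) (hs : ∀ x, ‖x‖ = 1 → r x = x) : False := by
  classical
  let μ : Measure E := Measure.addHaar
  set B := Metric.closedBall (0:E) 1 with hB
  have hBc : IsCompact B := isCompact_closedBall _ _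
  set g : E → E := fun x => r x - x with hg
  have hgd : ContDiff ℝ 1 g := hr.sub contDiff_id
  obtain ⟨L, hLb⟩ : ∃ L : ℝ≥0, ∀ x ∈ B, ‖fderiv ℝ g x‖₊ ≤ L := by
    obtain ⟨C, hC⟩ := hBc.exists_bound_of_continuousOn
      (f := fun x => fderiv ℝ g x) (hgd.continuous_fderiv one_ne_zero).continuousOn
    refine ⟨Real.toNNReal C, fun x hx => ?_⟩
    rw [← NNReal.coe_le_coe]
    exact (hC x hx).trans (Real.le_coe_toNNReal C)
  have hLip : LipschitzOnWith L g B :=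
    (convex_closedBall (0:E) 1).lipschitzOnWith_of_nnnorm_fderiv_le
      (fun x _ => (hgd.differentiable one_ne_zero) x) hLb
  have hg0 : ∀ x, ‖x‖ = 1 → g x = 0 := fun x hx => by simp [hg, hs x hx]
  have hgr : ∀ x, ‖x‖ ≤ 1 → ‖x + g x‖ ≤ 1 := fun x _ => by simp [hg, h1 x]
  have hder : ∀ (t : ℝ) (x : E), HasFDerivAt (fun x => x + t • g x)
      (ContinuousLinearMap.id ℝ E + t • fderiv ℝ g x) x := fun t x =>
    (hasFDerivAt_id x).add (((hgd.differentiable one_ne_zero) x).hasFDerivAt.const_smul t)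
  have hsmall : ∀ t : ℝ, 0 ≤ t → t ≤ 1 → t * L < 1 →
      ∫ x in B, (ContinuousLinearMap.id ℝ E + t • fderiv ℝ g x).det ∂μ = ∫ x in B, (1:ℝ) ∂μ := by
    intro t ht ht1 htL
    obtain ⟨hinj, himg⟩ := image_ball_eq g L hLip hg0 hgr t ht ht1 htL
    have := integral_image_eq_integral_abs_det_fderiv_smul μ (measurableSet_closedBall)
      (fun x _ => (hder t x).hasFDerivWithinAt) hinj (fun _ => (1:ℝ))
    rw [himg] at this
    rw [this]
    apply setIntegral_congr_fun measurableSet_closedBall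
    intro x hx
    simp only [smul_eq_mul, mul_one]
    rw [abs_of_pos]
    apply det_pos_of_small _ _ ht
    refine lt_of_le_of_lt ?_ htL
    gcongr
    exact_mod_cast hLb x hx
  have hone : ∀ x, (ContinuousLinearMap.id ℝ E + (1:ℝ) • fderiv ℝ g x).det = 0 := by
    intro x
    have hd : ContinuousLinearMap.id ℝ E + (1:ℝ) • fderiv ℝ g x = fderiv ℝ r x := by
      have e : fderiv ℝ g x = fderiv ℝ r x - ContinuousLinearMap.id ℝ E := by
        rw [hg]
        rw [fderiv_fun_sub ((hr.differentiable one_ne_zero) x) differentiableAt_fun_id]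
        simp
      rw [e]; simp
    rw [hd]
    by_contra hne
    have hsurj : Function.Surjective (fderiv ℝ r x) := by
      have hu : IsUnit (LinearMap.det ((fderiv ℝ r x : E →L[ℝ] E) : E →ₗ[ℝ] E)) :=
        isUnit_iff_ne_zero.2 hne
      have := (LinearEquiv.ofIsUnitDet (f := ((fderiv ℝ r x : E →L[ℝ] E) : E →ₗ[ℝ] E))
        (v := Module.finBasis ℝ E) (v' := Module.finBasis ℝ E)
        (by rwa [LinearMap.det_toMatrix])).surjective
      intro y
      obtain ⟨z, hz⟩ := this y
      exact ⟨z, by simpa using hz⟩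
    obtain ⟨h, hh⟩ := hsurj (r x)
    have hrd := ((hr.differentiable one_ne_zero) x).hasFDerivAt
    have h2 := hrd.inner ℝ hrd
    have h3 : (fun y => inner ℝ (r y) (r y)) = fun _ => (1:ℝ) := by
      funext y; rw [real_inner_self_eq_norm_sq, h1]; norm_num
    rw [h3] at h2
    have h4 := h2.unique (hasFDerivAt_const (1:ℝ) x)
    have h5 := congrArg (fun T : E →L[ℝ] ℝ => T h) h4
    simp [hh, real_inner_self_eq_norm_sq, h1] at h5
  -- interpolation nodes
  set n := Module.finrank ℝ E
  have hδ : ∃ δ : ℝ, 0 < δ ∧ δ ≤ 1 ∧ δ * L < 1 := by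
    refine ⟨1 / (1 + L), by positivity, ?_, ?_⟩
    · rw [div_le_one (by positivity)]; simp
    · rw [one_div, inv_mul_lt_iff₀ (by positivity)]; linarith
  obtain ⟨δ, hδ0, hδ1, hδL⟩ := hδ
  let v : ℕ → ℝ := fun k => δ / (k + 1)
  have hv0 : ∀ k, 0 ≤ v k := fun k => by positivity
  have hvδ : ∀ k, v k ≤ δ := fun k => div_le_self hδ0.le (by linarith [(Nat.cast_nonneg k : (0:ℝ) ≤ k)])
  have hvinj : Set.InjOn v (Finset.range (n + 1)) := by
    intro a _ b _ hab
    simp only [v] at hab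
    rw [div_eq_div_iff (by positivity) (by positivity)] at hab
    have := mul_left_cancel₀ hδ0.ne' hab
    exact_mod_cast (by linarith : (a:ℝ) = b)
  set c : ℕ → ℝ := fun k => (Lagrange.basis (Finset.range (n+1)) v k).eval 1 with hc
  have hIntg : ∀ p : Polynomial ℝ, p.natDegree ≤ n →
      p.eval 1 = ∑ k ∈ Finset.range (n+1), c k * p.eval (v k) := by
    intro p hp
    have hdeg : p.degree < (Finset.range (n+1)).card := by
      rw [Finset.card_range]
      exact lt_of_le_of_lt (Polynomial.degree_le_of_natDegree_le hp) (by exact_mod_cast Nat.lt_succ_self n)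
    have := Lagrange.eq_interpolate hvinj hdeg
    conv_lhs => rw [this]
    rw [Lagrange.interpolate_apply, Polynomial.eval_finsetSum]
    simp [hc, mul_comm]
  have hcont : ∀ t : ℝ, IntegrableOn
      (fun x => (ContinuousLinearMap.id ℝ E + t • fderiv ℝ g x).det) B μ := by
    intro t
    apply ContinuousOn.integrableOn_compact hBc
    apply Continuous.continuousOn
    have := hgd.continuous_fderiv one_ne_zero
    exact ContinuousLinearMap.continuous_det.comp (by fun_prop)
  have hfin : ∫ x in B, (ContinuousLinearMap.id ℝ E + (1:ℝ) • fderiv ℝ g x).det ∂μ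
      = ∫ x in B, (1:ℝ) ∂μ := by
    have e1 : ∀ x, (ContinuousLinearMap.id ℝ E + (1:ℝ) • fderiv ℝ g x).det =
        ∑ k ∈ Finset.range (n+1), c k * (ContinuousLinearMap.id ℝ E + v k • fderiv ℝ g x).det := by
      intro x
      obtain ⟨p, hp, hpe⟩ := exists_poly_det (fderiv ℝ g x)
      rw [← hpe, hIntg p hp]
      simp [hpe]
    simp_rw [e1]
    rw [integral_finsetSum _ (fun k _ => (hcont (v k)).const_mul (c k))]
    simp_rw [integral_const_mul]
    rw [Finset.sum_congr rfl (fun k _ => by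
      rw [hsmall (v k) (hv0 k) ((hvδ k).trans hδ1)
        (lt_of_le_of_lt (mul_le_mul_of_nonneg_right (hvδ k) L.2) hδL)]), ← Finset.sum_mul]
    have := hIntg 1 (by simp)
    simp at this
    rw [← this, one_mul]
  simp_rw [hone] at hfin
  simp only [integral_zero, integral_const, smul_eq_mul, mul_one] at hfin
  have hpos : 0 < μ.real B := by
    have : μ B ≠ 0 := (Metric.measure_closedBall_pos μ 0 one_pos).ne'
    exact ENNReal.toReal_pos this hBc.measure_lt_top.ne
  simp at hfin
  rw [← hfin] at hpos
  exact lt_irrefl _ hpos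

theorem exists_zero_unit [MeasurableSpace E] [BorelSpace E] (P : E → E) (hP : Continuous P)
    (hc : ∀ x, ‖x‖ = 1 → 0 ≤ inner ℝ (P x) x) : ∃ x, ‖x‖ ≤ 1 ∧ P x = 0 := by
  by_contra hcon
  push Not at hcon
  let χ : E → ℝ := fun x => max 0 (min 1 (‖x‖ - 1))
  let q : E → E := fun x => (max 1 ‖x‖)⁻¹ • x
  let Q : E → E := fun x => (1 - χ x) • P (q x) + χ x • x
  have hmaxpos : ∀ x : E, (0:ℝ) < max 1 ‖x‖ := fun x => lt_of_lt_of_le one_pos (le_max_left _ _)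
  have hqc : Continuous q :=
    ((continuous_const.max continuous_norm).inv₀ (fun x => (hmaxpos x).ne')).smul continuous_id
  have hχc : Continuous χ := by fun_prop
  have hQc : Continuous Q := by
    have := hP.comp hqc
    exact ((continuous_const.sub hχc).smul this).add (hχc.smul continuous_id)
  have hχ1 : ∀ x, χ x ≤ 1 := fun x => max_le zero_le_one (min_le_left _ _)
  have hχ0 : ∀ x, 0 ≤ χ x := fun x => le_max_left _ _
  have hQ2 : ∀ x : E, 2 ≤ ‖x‖ → Q x = x := by
    intro x hx
    have : χ x = 1 := by
      simp only [χ]; rw [min_eq_left (by linarith)]; simp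
    simp [Q, this]
  have hQ0 : ∀ x, Q x ≠ 0 := by
    intro x h
    rcases le_or_gt ‖x‖ 1 with hx | hx
    · have h1 : χ x = 0 := by
        simp only [χ]; apply max_eq_left; exact (min_le_right _ _).trans (by linarith)
      have h2 : q x = x := by simp [q, max_eq_left hx]
      simp only [Q, h1, h2, sub_zero, one_smul, zero_smul, add_zero] at h
      exact hcon x hx h
    · have hχp : 0 < χ x := lt_max_of_lt_right (lt_min one_pos (by linarith))
      have hq : q x = ‖x‖⁻¹ • x := by simp [q, max_eq_right hx.le]
      have hxp : 0 < ‖x‖ := by linarith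
      have hq1 : ‖q x‖ = 1 := by
        rw [hq, norm_smul, norm_inv, norm_norm, inv_mul_cancel₀ hxp.ne']
      have h3 := hc _ hq1
      have hx' : x = ‖x‖ • q x := by rw [hq, smul_smul, mul_inv_cancel₀ hxp.ne', one_smul]
      have h4 : 0 ≤ inner ℝ (P (q x)) x := by
        rw [hx', inner_smul_right, ← hx']; positivity
      have h5 : inner ℝ (Q x) x = 0 := by rw [h, inner_zero_left]
      simp only [Q, inner_add_left, inner_smul_left, real_inner_self_eq_norm_sq] at h5
      simp only [RCLike.conj_to_real] at h5
      have : 0 ≤ (1 - χ x) * inner ℝ (P (q x)) x := mul_nonneg (by linarith [hχ1 x]) h4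
      have : 0 < χ x * ‖x‖ ^ 2 := by positivity
      linarith
  obtain ⟨m, hm0, hm2, hm⟩ : ∃ m : ℝ, 0 < m ∧ m ≤ 2 ∧ ∀ x, m ≤ ‖Q x‖ := by
    obtain ⟨x0, _, hx0⟩ := (isCompact_closedBall (0:E) 2).exists_isMinOn
      (Metric.nonempty_closedBall.2 (by norm_num)) (f := fun x => ‖Q x‖) hQc.norm.continuousOn
    refine ⟨min ‖Q x0‖ 2, lt_min (norm_pos_iff.2 (hQ0 x0)) (by norm_num), min_le_right _ _, ?_⟩
    intro x
    rcases le_or_gt ‖x‖ 2 with hx | hx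
    · exact (min_le_left _ _).trans (hx0 (by simpa using hx))
    · rw [hQ2 x hx.le]; exact (min_le_right _ _).trans hx.le
  obtain ⟨g, hgd, hgc⟩ := hQc.exists_contDiff_approx 1 (ε := fun _ => m / 2) continuous_const
    (fun _ => by positivity)
  let b : ContDiffBump (0:E) := ⟨2, 3, by norm_num, by norm_num⟩
  let w : E → E := fun x => b x • g x + (1 - b x) • x
  have hbd : ContDiff ℝ 1 b := b.contDiff
  have hwd : ContDiff ℝ 1 w :=
    (hbd.smul (by exact_mod_cast hgd)).add ((contDiff_const.sub hbd).smul contDiff_id)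
  have hg : ∀ x, ‖g x - Q x‖ < m / 2 := by
    intro x
    have := hgc.1 x
    rwa [dist_eq_norm] at this
  have hw0 : ∀ x, w x ≠ 0 := by
    intro x hx
    have key : ‖w x - Q x‖ < m / 2 := by
      rcases le_or_gt ‖x‖ 2 with hx2 | hx2
      · have : b x = 1 := b.one_of_mem_closedBall (by simpa [b] using hx2)
        simp only [w, this, one_smul, sub_self, zero_smul, add_zero]
        exact hg x
      · have e : w x - Q x = b x • (g x - Q x) := by
          rw [hQ2 x hx2.le]; simp only [w, sub_smul, smul_sub, one_smul]; abel
        rw [e, norm_smul, Real.norm_of_nonneg b.nonneg]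
        calc _ ≤ 1 * ‖g x - Q x‖ := by gcongr; exact b.le_one
          _ < m / 2 := by rw [one_mul]; exact hg x
    rw [hx, zero_sub, norm_neg] at key
    linarith [hm x]
  have hw3 : ∀ x, ‖x‖ = 3 → w x = x := by
    intro x hx
    have : b x = 0 := b.zero_of_le_dist (by simp [b, hx])
    simp [w, this]
  have hw3d : ContDiff ℝ 1 (fun x : E => w ((3:ℝ) • x)) :=
    hwd.comp (contDiff_const_smul (3:ℝ))
  refine no_retraction (fun x => ‖w ((3:ℝ) • x)‖⁻¹ • w ((3:ℝ) • x)) ?_ ?_ ?_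
  · exact ((hw3d.norm ℝ (fun x => hw0 _)).inv (fun x => norm_ne_zero_iff.2 (hw0 _))).smul hw3d
  · intro x
    rw [norm_smul, norm_inv, norm_norm, inv_mul_cancel₀ (norm_ne_zero_iff.2 (hw0 _))]
  · intro x hx
    rw [hw3 _ (by rw [norm_smul, hx]; norm_num), norm_smul, hx, smul_smul]
    norm_num

theorem exists_zero_of_coercive [MeasurableSpace E] [BorelSpace E] (P : E → E)
    (hP : Continuous P) (R : ℝ) (hR : 0 < R)
    (hc : ∀ x, ‖x‖ = R → 0 ≤ inner ℝ (P x) x) : ∃ x, ‖x‖ ≤ R ∧ P x = 0 := by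
  obtain ⟨x, hx, hx0⟩ := exists_zero_unit (fun x => P (R • x)) (by fun_prop) (by
    intro x hx
    have := hc (R • x) (by rw [norm_smul, hx, Real.norm_of_nonneg hR.le, mul_one])
    rw [inner_smul_right] at this
    exact nonneg_of_mul_nonneg_right this hR)
  refine ⟨R • x, ?_, hx0⟩
  rw [norm_smul, Real.norm_of_nonneg hR.le]
  nlinarith

end Brouwer

section Abstract

/-- Clarkson-type inequality of order `3`. -/
def Clarkson3 (Z : Type*) [NormedAddCommGroup Z] [NormedSpace ℝ Z] : Prop :=
  ∀ a b : Z, ‖(1/2:ℝ) • (a + b)‖ ^ 3 + ‖(1/2:ℝ) • (a - b)‖ ^ 3 ≤ (‖a‖ ^ 3 + ‖b‖ ^ 3) / 2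

variable {Z : Type*} [NormedAddCommGroup Z] [NormedSpace ℝ Z]

/-- Weak ultrafilter limits of bounded families in spaces with Clarkson inequality. -/
theorem weak_limit [CompleteSpace Z] (hZ : Clarkson3 Z) {I : Type*} (U : Ultrafilter I)
    (z : I → Z) (M : ℝ) (hM : ∀ i, ‖z i‖ ≤ M) :
    ∃ x : Z, (∀ S ∈ U, x ∈ closure (convexHull ℝ (z '' S))) ∧
      ∀ l : Z →L[ℝ] ℝ, Tendsto (fun i => l (z i)) U (𝓝 (l x)) := by
  let C : Set I → Set Z := fun S => closure (convexHull ℝ (z '' S))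
  have hCne : ∀ S ∈ U, (C S).Nonempty := by
    intro S hS
    obtain ⟨i, hi⟩ := U.nonempty_of_mem hS
    exact ⟨z i, subset_closure (subset_convexHull ℝ _ ⟨i, hi, rfl⟩)⟩
  have hCmono : ∀ S S', S ⊆ S' → C S ⊆ C S' := fun S S' h =>
    closure_mono (convexHull_mono (Set.image_mono h))
  have hCconv : ∀ S, Convex ℝ (C S) := fun S => (convex_convexHull ℝ _).closure
  have hCb : ∀ S, ∀ x ∈ C S, ‖x‖ ≤ M := by
    intro S x hx
    have : C S ⊆ Metric.closedBall 0 M := by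
      apply closure_minimal _ Metric.isClosed_closedBall
      apply convexHull_min _ (convex_closedBall _ _)
      rintro _ ⟨i, _, rfl⟩
      simpa using hM i
    simpa using this hx
  let δ : Set I → ℝ := fun S => Metric.infDist 0 (C S)
  have hδle : ∀ S, ∀ x ∈ C S, δ S ≤ ‖x‖ := by
    intro S x hx
    simpa using Metric.infDist_le_dist_of_mem (x := (0:Z)) hx
  have hδM : ∀ S ∈ U, δ S ≤ M := by
    intro S hS
    obtain ⟨x, hx⟩ := hCne S hS
    exact (hδle S x hx).trans (hCb S x hx)
  let A : Set ℝ := δ '' {S | S ∈ U}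
  have hAne : A.Nonempty := ⟨_, Set.univ, Filter.univ_mem (f := (U : Filter I)), rfl⟩
  have hAb : BddAbove A := ⟨M, by rintro _ ⟨S, hS, rfl⟩; exact hδM S hS⟩
  set D := sSup A with hD
  have hδD : ∀ S ∈ U, δ S ≤ D := fun S hS => le_csSup hAb ⟨S, hS, rfl⟩
  have hD0 : 0 ≤ D := Metric.infDist_nonneg.trans (hδD Set.univ (Filter.univ_mem (f := (U : Filter I))))
  have happ : ∀ ε > 0, ∀ S ∈ U, ∃ x ∈ C S, ‖x‖ < D + ε := by
    intro ε hε S hS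
    obtain ⟨x, hx, hx'⟩ := (Metric.infDist_lt_iff (hCne S hS)).1
      (lt_of_le_of_lt (hδD S hS) (by linarith : D < D + ε))
    exact ⟨x, hx, by simpa using hx'⟩
  have hclose : ∀ ε > 0, ∃ S ∈ U, ∀ S' ⊆ S, S' ∈ U → D - ε < δ S' := by
    intro ε hε
    obtain ⟨_, ⟨S, hS, rfl⟩, hS'⟩ := exists_lt_of_lt_csSup hAne (by linarith : D - ε < sSup A)
    refine ⟨S, hS, fun S' hSS' hS'U => lt_of_lt_of_le hS' ?_⟩
    exact Metric.infDist_le_infDist_of_subset (hCmono _ _ hSS') (hCne S' hS'U)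
  -- key quantitative estimate
  have hkey : ∀ η > 0, ∃ ε > 0, ∃ S ∈ U, ∀ x ∈ C S, ∀ y ∈ C S, ‖x‖ < D + ε → ‖y‖ < D + ε →
      ‖x - y‖ < η := by
    intro η hη
    have hcont : ContinuousAt (fun ε : ℝ => (D + ε) ^ 3 - (max 0 (D - ε)) ^ 3) 0 := by fun_prop
    have h0 : (fun ε : ℝ => (D + ε) ^ 3 - (max 0 (D - ε)) ^ 3) 0 < (η / 2) ^ 3 := by
      simp [hD0]; positivity
    have := hcont.eventually_lt continuousAt_const h0
    obtain ⟨ε, hε0, hε⟩ : ∃ ε > 0, (D + ε) ^ 3 - (max 0 (D - ε)) ^ 3 < (η / 2) ^ 3 := by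
      obtain ⟨r, hr, hb⟩ := Metric.eventually_nhds_iff.1 this
      refine ⟨r / 2, by positivity, hb ?_⟩
      rw [dist_zero_right, Real.norm_of_nonneg (by positivity)]; linarith
    obtain ⟨S, hS, hS'⟩ := hclose ε hε0
    refine ⟨ε, hε0, S, hS, ?_⟩
    intro x hx y hy hxD hyD
    have hmid : (1/2:ℝ) • (x + y) ∈ C S := by
      have := hCconv S hx hy (by norm_num : (0:ℝ) ≤ 1/2) (by norm_num : (0:ℝ) ≤ 1/2) (by norm_num)
      rwa [← smul_add] at this
    have h1 : max 0 (D - ε) ≤ ‖(1/2:ℝ) • (x + y)‖ :=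
      max_le (norm_nonneg _) ((hS' S subset_rfl hS).le.trans (hδle S _ hmid))
    have h2 := hZ x y
    have h3 : (max 0 (D - ε)) ^ 3 ≤ ‖(1/2:ℝ) • (x + y)‖ ^ 3 := by gcongr
    have h4 : ‖x‖ ^ 3 ≤ (D + ε) ^ 3 := by gcongr
    have h5 : ‖y‖ ^ 3 ≤ (D + ε) ^ 3 := by gcongr
    have h6 : ‖(1/2:ℝ) • (x - y)‖ ^ 3 < (η / 2) ^ 3 := by linarith
    have h7 := lt_of_pow_lt_pow_left₀ 3 (by positivity) h6
    rw [norm_smul, Real.norm_of_nonneg (by norm_num)] at h7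
    linarith
  -- Cauchy filter
  choose xx hxx1 hxx2 using happ
  have hseq : ∃ x, ∀ S ∈ U, x ∈ C S := by
    have hk : ∀ n : ℕ, (0:ℝ) < 1 / (n + 1) := fun n => by positivity
    choose ε hε0 S hS hkS using fun n : ℕ => hkey (1 / (n + 1)) (hk n)
    let S' : ℕ → Set I := fun n => ⋂ k ∈ Finset.range (n + 1), S k
    have hS'U : ∀ n, S' n ∈ U := fun n =>
      (Filter.biInter_finset_mem (f := (U : Filter I)) _).2 (fun k _ => hS k)
    have hS'S : ∀ n m, n ≤ m → S' m ⊆ S n := fun n m h =>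
      Set.biInter_subset_of_mem (by simpa using Nat.lt_succ_of_le h)
    let e : ℕ → ℝ := fun n => (Finset.range (n + 1)).inf' ⟨0, by simp⟩ ε
    have he0 : ∀ n, 0 < e n := fun n => by
      exact (Finset.lt_inf'_iff _).2 fun k _ => hε0 k
    have heε : ∀ n m, n ≤ m → e m ≤ ε n := fun n m h =>
      Finset.inf'_le _ (by simpa using Nat.lt_succ_of_le h)
    let x : ℕ → Z := fun n => xx (e n) (he0 n) (S' n) (hS'U n)
    have hx : ∀ n m, n ≤ m → x m ∈ C (S n) ∧ ‖x m‖ < D + ε n := fun n m h =>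
      ⟨hCmono _ _ (hS'S n m h) (hxx1 _ _ _ _),
        lt_of_lt_of_le (hxx2 (e m) (he0 m) (S' m) (hS'U m)) (by linarith [heε n m h])⟩
    have hcau : CauchySeq x := by
      apply cauchySeq_of_le_tendsto_0 (fun n : ℕ => 1 / ((n:ℝ) + 1))
      · intro n m N hn hm
        rw [dist_eq_norm]
        exact (hkS N _ (hx N n hn).1 _ (hx N m hm).1 (hx N n hn).2 (hx N m hm).2).le
      · exact tendsto_one_div_add_atTop_nhds_zero_nat
    obtain ⟨y, hy⟩ := cauchySeq_tendsto_of_complete hcau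
    refine ⟨y, fun T hT => ?_⟩
    let x' : ℕ → Z := fun n => xx (e n) (he0 n) (S' n ∩ T) (inter_mem (hS'U n) hT)
    have hx' : ∀ n, x' n ∈ C (S n) ∧ ‖x' n‖ < D + ε n := fun n =>
      ⟨hCmono _ _ (Set.inter_subset_left.trans (hS'S n n le_rfl)) (hxx1 _ _ _ _),
        lt_of_lt_of_le (hxx2 (e n) (he0 n) _ (inter_mem (hS'U n) hT)) (by linarith [heε n n le_rfl])⟩
    have hd : Tendsto (fun n => x' n - x n) atTop (𝓝 0) := by
      apply squeeze_zero_norm (a := fun n : ℕ => 1 / ((n:ℝ) + 1))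
      · intro n
        exact (hkS n _ (hx' n).1 _ (hx n n le_rfl).1 (hx' n).2 (hx n n le_rfl).2).le
      · exact tendsto_one_div_add_atTop_nhds_zero_nat
    have hy' : Tendsto x' atTop (𝓝 y) := by
      have := hd.add hy
      simpa using this
    exact isClosed_closure.mem_of_tendsto hy'
      (Eventually.of_forall fun n => hCmono _ _ Set.inter_subset_right (hxx1 _ _ _ _))
  obtain ⟨x, hx⟩ := hseq
  refine ⟨x, hx, fun l => ?_⟩
  have hbd : ∀ i, l (z i) ∈ Metric.closedBall (0:ℝ) (‖l‖ * M) := by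
    intro i
    rw [mem_closedBall_zero_iff]
    exact (l.le_opNorm _).trans (by gcongr; exact hM i)
  obtain ⟨L, _, hL⟩ := (isCompact_closedBall (0:ℝ) (‖l‖ * M)).ultrafilter_le_nhds
    (U.map fun i => l (z i)) (by simp only [le_principal_iff, Ultrafilter.mem_coe, Ultrafilter.mem_map]; exact Filter.univ_mem' hbd)
  have hL' : Tendsto (fun i => l (z i)) U (𝓝 L) := hL
  have : l x = L := by
    apply eq_of_forall_dist_le
    intro ε hε
    have hS : {i | l (z i) ∈ Metric.closedBall L ε} ∈ U :=
      hL' (Metric.closedBall_mem_nhds L hε)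
    have h1 := hx _ hS
    have h2 : C {i | l (z i) ∈ Metric.closedBall L ε} ⊆ l ⁻¹' Metric.closedBall L ε := by
      apply closure_minimal _ (Metric.isClosed_closedBall.preimage l.continuous)
      apply convexHull_min
      · rintro _ ⟨i, hi, rfl⟩; exact hi
      · exact (convex_closedBall L ε).linear_preimage l.toLinearMap
    exact h2 h1
  rw [this]; exact hL'

variable {Y : Type*} [NormedAddCommGroup Y] [NormedSpace ℝ Y]

/-- Galerkin approximation in a finite dimensional space. -/
theorem galerkin_fin (K : Z →L[ℝ] Y) (b : Z →L[ℝ] Z →L[ℝ] Z →L[ℝ] ℝ) (hb : ∀ z, b z z z = 0)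
    (a : Y → Y →L[ℝ] ℝ) (hac : ∀ y', Continuous fun y => a y y') (ha : ∀ y, a y y = ‖y‖ ^ 3)
    (F : Z →L[ℝ] ℝ) (V : Submodule ℝ Z) [FiniteDimensional ℝ V]
    (C : ℝ) (hC : 0 < C) (hK : ∀ z ∈ V, ‖z‖ ≤ C * ‖K z‖) :
    ∃ z ∈ V, ∀ w ∈ V, b z z w + a (K z) (K w) + F w = 0 := by
  classical
  let n := Module.finrank ℝ V
  let e := Module.finBasis ℝ V
  let J₀ : EuclideanSpace ℝ (Fin n) ≃ₗ[ℝ] V :=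
    (EuclideanSpace.basisFun (Fin n) ℝ).toBasis.equiv e (Equiv.refl _)
  let J : EuclideanSpace ℝ (Fin n) ≃L[ℝ] V := J₀.toContinuousLinearEquiv
  let P : EuclideanSpace ℝ (Fin n) → EuclideanSpace ℝ (Fin n) := fun c =>
    WithLp.toLp 2 (fun k => b (J c) (J c) (e k) + a (K (J c)) (K (e k)) + F (e k))
  have hJ : ∀ c : EuclideanSpace ℝ (Fin n), J c = ∑ k, c k • e k := by
    intro c
    have h1 : c = ∑ k, c k • (EuclideanSpace.basisFun (Fin n) ℝ) k := by
      ext i; simp [Finset.sum_apply, Pi.single_apply]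
    conv_lhs => rw [h1]
    rw [map_sum]
    refine Finset.sum_congr rfl fun k _ => ?_
    rw [map_smul]
    congr 1
    have := (EuclideanSpace.basisFun (Fin n) ℝ).toBasis.equiv_apply k e (Equiv.refl _)
    simpa [J, J₀] using this
  have hPin : ∀ c c', inner ℝ (P c) c' = b (J c) (J c) (J c') + a (K (J c)) (K (J c')) + F (J c') := by
    intro c c'
    rw [hJ c']
    simp only [P, PiLp.inner_apply, Submodule.coe_sum, Submodule.coe_smul, map_sum, map_smul,
      smul_eq_mul, RCLike.inner_apply, conj_trivial]
    rw [← Finset.sum_add_distrib, ← Finset.sum_add_distrib]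
    exact Finset.sum_congr rfl fun k _ => by ring
  have hPc : Continuous P := by
    apply (PiLp.continuous_toLp 2 _).comp
    apply continuous_pi
    intro k
    have hJc : Continuous fun c => ((J c : V) : Z) := continuous_subtype_val.comp J.continuous
    refine Continuous.add (Continuous.add ?_ ?_) continuous_const
    · fun_prop
    · exact (hac _).comp (K.continuous.comp hJc)
  -- choose the radius
  have hJlow : ∀ c, ‖c‖ ≤ ‖(J.symm : V →L[ℝ] EuclideanSpace ℝ (Fin n))‖ * ‖J c‖ := fun c => by
    have := (J.symm : V →L[ℝ] EuclideanSpace ℝ (Fin n)).le_opNorm (J c)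
    simpa using this
  set N := ‖(J.symm : V →L[ℝ] EuclideanSpace ℝ (Fin n))‖ with hN
  have hN0 : 0 ≤ N := norm_nonneg (J.symm : V →L[ℝ] EuclideanSpace ℝ (Fin n))
  set m := C ^ 3 * ‖F‖ + 1 with hm
  have hm1 : 1 ≤ m := by have : 0 ≤ C ^ 3 * ‖F‖ := by positivity
                         linarith
  obtain ⟨c, _, hc⟩ := exists_zero_of_coercive P hPc ((N + 1) * m) (by positivity) (by
    intro c hc
    rw [hPin, hb, ha, zero_add]
    set z : Z := (J c : Z)
    have hz : m ≤ ‖z‖ := by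
      have h1 := hJlow c
      rw [hc] at h1
      have h2 : ‖J c‖ = ‖z‖ := rfl
      rw [h2] at h1
      by_contra hcon
      push Not at hcon
      nlinarith [norm_nonneg z]
    have h1 := hK z (J c).2
    have h2 : ‖z‖ ^ 3 ≤ C ^ 3 * ‖K z‖ ^ 3 := by
      rw [← mul_pow]; gcongr
    have h3 : -(‖F‖ * ‖z‖) ≤ F z := by
      have := F.le_opNorm z
      rw [Real.norm_eq_abs] at this
      linarith [neg_abs_le (F z)]
    have h4 : C ^ 3 * (‖F‖ * ‖z‖) ≤ ‖z‖ ^ 3 := by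
      have : C ^ 3 * ‖F‖ ≤ m := by linarith
      have h5 : m ≤ ‖z‖ ^ 2 := by nlinarith
      calc C ^ 3 * (‖F‖ * ‖z‖) = (C ^ 3 * ‖F‖) * ‖z‖ := by ring
        _ ≤ ‖z‖ ^ 2 * ‖z‖ := by gcongr; linarith
        _ = ‖z‖ ^ 3 := by ring
    have h6 : ‖F‖ * ‖z‖ ≤ ‖K z‖ ^ 3 := by
      have := h4.trans h2
      exact le_of_mul_le_mul_left this (by positivity)
    linarith)
  refine ⟨J c, (J c).2, fun w hw => ?_⟩
  have := hPin c (J.symm ⟨w, hw⟩)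
  rw [hc, inner_zero_left] at this
  simpa using this.symm

/-- Abstract existence theorem. -/
theorem galerkin [CompleteSpace Z] (hZ : Clarkson3 Z)
    (K : Z →L[ℝ] Y) (b : Z →L[ℝ] Z →L[ℝ] Z →L[ℝ] ℝ) (hb : ∀ z, b z z z = 0)
    (a : Y → Y →L[ℝ] ℝ) (hac : ∀ y', Continuous fun y => a y y') (ha : ∀ y, a y y = ‖y‖ ^ 3)
    (hab : ∀ y, ‖a y‖ ≤ ‖y‖ ^ 2)
    (hmono : ∀ y y', (1/2) * ‖y - y'‖ ^ 3 ≤ (a y - a y') (y - y'))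
    (F : Z →L[ℝ] ℝ) (S : Submodule ℝ Z)
    (C : ℝ) (hC : 0 < C) (hK : ∀ z ∈ S, ‖z‖ ≤ C * ‖K z‖)
    (hcomp : ∀ (U : Ultrafilter (Finset S)) (z : Finset S → Z) (M : ℝ), (∀ i, z i ∈ S) →
      (∀ i, ‖z i‖ ≤ M) → ∀ x : Z, (∀ l : Z →L[ℝ] ℝ, Tendsto (fun i => l (z i)) U (𝓝 (l x))) →
      ∀ w ∈ S, Tendsto (fun i => b (z i) (z i) w) U (𝓝 (b x x w))) :
    ∃ z ∈ closure (S : Set Z), ∀ w ∈ closure (S : Set Z), b z z w + a (K z) (K w) + F w = 0 := by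
  classical
  let V : Finset S → Submodule ℝ Z := fun s => Submodule.span ℝ ((s.image (fun x : S => (x:Z)) : Finset Z) : Set Z)
  have hVS : ∀ s, V s ≤ S := by
    intro s
    rw [Submodule.span_le]
    intro x hx
    simp only [Finset.coe_image, Set.mem_image] at hx
    obtain ⟨y, _, rfl⟩ := hx
    exact y.2
  have hfin : ∀ s, FiniteDimensional ℝ (V s) := fun s => FiniteDimensional.span_finset ℝ _
  choose z hzV hz using fun s => galerkin_fin K b hb a hac ha F (V s) C hC
    (fun z hz => hK z (hVS s hz))
  have hzS : ∀ s, z s ∈ S := fun s => hVS s (hzV s)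
  have hen : ∀ s, ‖K (z s)‖ ^ 3 = - F (z s) := by
    intro s
    have := hz s (z s) (hzV s)
    rw [hb, ha] at this
    linarith
  obtain ⟨M, hM⟩ : ∃ M, ∀ s, ‖z s‖ ≤ M := by
    refine ⟨C ^ 3 * ‖F‖ + 1, fun s => ?_⟩
    have h1 := hK _ (hzS s)
    have h2 : ‖z s‖ ^ 3 ≤ C ^ 3 * ‖K (z s)‖ ^ 3 := by rw [← mul_pow]; gcongr
    have h3 : - F (z s) ≤ ‖F‖ * ‖z s‖ := by
      have := F.le_opNorm (z s)
      rw [Real.norm_eq_abs] at this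
      linarith [neg_abs_le (F (z s))]
    rw [hen] at h2
    have h4 : ‖z s‖ ^ 3 ≤ C ^ 3 * ‖F‖ * ‖z s‖ := by
      calc _ ≤ _ := h2
        _ ≤ C ^ 3 * (‖F‖ * ‖z s‖) := by gcongr
        _ = _ := by ring
    by_contra hcon
    push Not at hcon
    have h5 : 0 ≤ C ^ 3 * ‖F‖ := by positivity
    have h6 : 1 < ‖z s‖ := by linarith
    nlinarith [mul_pos (by linarith : 0 < ‖z s‖) (by nlinarith : 0 < ‖z s‖ ^ 2 - C ^ 3 * ‖F‖)]
  let U : Ultrafilter (Finset S) := Ultrafilter.of atTop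
  have hU : (U : Filter (Finset S)) ≤ atTop := Ultrafilter.of_le _
  obtain ⟨x, hx, hxl⟩ := weak_limit hZ U z M hM
  have hxS : x ∈ closure (S : Set Z) := by
    have := hx Set.univ (Filter.univ_mem (f := (U : Filter (Finset S))))
    refine closure_mono (convexHull_min ?_ S.convex) this
    rintro _ ⟨i, _, rfl⟩; exact hzS i
  have hwV : ∀ w ∈ S, ∀ᶠ s in (U : Filter (Finset S)), w ∈ V s := by
    intro w hw
    apply hU
    filter_upwards [eventually_ge_atTop ({⟨w, hw⟩} : Finset S)] with s hs
    apply Submodule.subset_span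
    simp only [Finset.coe_image, Set.mem_image]
    exact ⟨⟨w, hw⟩, hs (by simp), rfl⟩
  have hbl := hcomp U z M hzS hM x hxl
  let R : Z → ℝ := fun w => - F x + b x x w + F w - a (K w) (K x - K w)
  -- strong convergence
  have hest : ∀ w ∈ S, ∀ η > 0, ∀ᶠ s in (U : Filter (Finset S)),
      ‖z s - w‖ ^ 3 ≤ 2 * C ^ 3 * (R w + η) := by
    intro w hw η hη
    have hlim : Tendsto (fun s => - F (z s) + b (z s) (z s) w + F w - a (K w) (K (z s) - K w)) U
        (𝓝 (R w)) := by
      have h1 := hxl F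
      have h2 := hxl ((a (K w)).comp K)
      have h2' : Tendsto (fun s => a (K w) (K (z s) - K w)) U (𝓝 (a (K w) (K x - K w))) := by
        simp only [map_sub]
        exact h2.sub_const _
      exact (((h1.neg).add (hbl w hw)).add_const _).sub h2'
    filter_upwards [hlim.eventually_lt_const (by linarith : R w < R w + η), hwV w hw] with s hs hsV
    have h1 := hz s w hsV
    have h2 := hmono (K (z s)) (K w)
    have h3 : (a (K (z s)) - a (K w)) (K (z s) - K w) =
        - F (z s) + b (z s) (z s) w + F w - a (K w) (K (z s) - K w) := by
      rw [sub_apply, map_sub (a (K (z s))), ha, hen]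
      linarith
    have h4 := hK _ (S.sub_mem (hzS s) hw)
    rw [map_sub] at h4
    calc ‖z s - w‖ ^ 3 ≤ (C * ‖K (z s) - K w‖) ^ 3 := by gcongr
      _ = C ^ 3 * ‖K (z s) - K w‖ ^ 3 := by ring
      _ ≤ C ^ 3 * (2 * (R w + η)) := by gcongr; linarith
      _ = _ := by ring
  have hR0 : Tendsto R (𝓝 x) (𝓝 0) := by
    have h1 : Tendsto (fun w => a (K w) (K x - K w)) (𝓝 x) (𝓝 0) := by
      have h2 : Tendsto (fun w => ‖K w‖ ^ 2 * ‖K x - K w‖) (𝓝 x) (𝓝 0) := by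
        have : Continuous fun w => ‖K w‖ ^ 2 * ‖K x - K w‖ := by fun_prop
        simpa using this.tendsto x
      apply squeeze_zero_norm _ h2
      intro w
      exact ((a (K w)).le_opNorm _).trans (by gcongr; exact hab _)
    have h3 : Tendsto (fun w => - F x + b x x w + F w) (𝓝 x) (𝓝 0) := by
      have : Continuous fun w => - F x + b x x w + F w := by fun_prop
      simpa [hb] using this.tendsto x
    have h4 := h3.sub h1
    rwa [sub_zero] at h4
  have hstrong : Tendsto z U (𝓝 x) := by
    rw [Metric.tendsto_nhds]
    intro ε hε
    have hA : 0 < (ε / 2) ^ 3 / (2 * C ^ 3) / 2 := by positivity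
    have h1 : ∀ᶠ w in 𝓝 x, R w < (ε / 2) ^ 3 / (2 * C ^ 3) / 2 ∧ dist w x < ε / 2 :=
      (hR0.eventually_lt_const hA).and (Metric.ball_mem_nhds x (by positivity))
    obtain ⟨w, hw, hwS⟩ := mem_closure_iff_frequently.1 hxS |>.and_eventually h1 |>.exists
    filter_upwards [hest w hw _ (half_pos hA)] with s hs
    have h2 : ‖z s - w‖ ^ 3 < (ε / 2) ^ 3 := by
      refine lt_of_le_of_lt hs ?_
      have : R w + (ε / 2) ^ 3 / (2 * C ^ 3) / 2 / 2 < (ε / 2) ^ 3 / (2 * C ^ 3) := by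
        linarith [hwS.1]
      calc _ < 2 * C ^ 3 * ((ε / 2) ^ 3 / (2 * C ^ 3)) := by gcongr
        _ = _ := by field_simp
    have h3 := lt_of_pow_lt_pow_left₀ 3 (by positivity) h2
    rw [← dist_eq_norm] at h3
    linarith [dist_triangle (z s) w x, hwS.2]
  have heq : ∀ w ∈ S, b x x w + a (K x) (K w) + F w = 0 := by
    intro w hw
    have h1 : Tendsto (fun s => b (z s) (z s) w + a (K (z s)) (K w) + F w) U
        (𝓝 (b x x w + a (K x) (K w) + F w)) :=
      ((hbl w hw).add ((((hac (K w)).tendsto _).comp (K.continuous.tendsto x)).comp hstrong)).add_const _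
    have h2 : Tendsto (fun s => b (z s) (z s) w + a (K (z s)) (K w) + F w) U (𝓝 0) := by
      apply Tendsto.congr' _ tendsto_const_nhds
      filter_upwards [hwV w hw] with s hs
      exact (hz s w hs).symm
    exact tendsto_nhds_unique h1 h2
  refine ⟨x, hxS, ?_⟩
  have hcl : IsClosed {w | b x x w + a (K x) (K w) + F w = 0} :=
    isClosed_eq (by fun_prop) continuous_const
  exact fun w hw => closure_minimal heq hcl hw

end Abstract

section Geo

lemma lint_abs_rpow (s : ℝ) (hs : s < 1) (ρ : ℝ) (hρ : 0 < ρ) :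
    ∫⁻ t in Metric.closedBall (0:ℝ) ρ, ENNReal.ofReal (|t| ^ (-s))
      = ENNReal.ofReal (2 / (1 - s) * ρ ^ (1 - s)) := by
  have h1 : IntervalIntegrable (fun t : ℝ => |t| ^ (-s)) volume 0 ρ := by
    have := intervalIntegral.intervalIntegrable_rpow' (a := 0) (b := ρ) (by linarith : -1 < -s)
    apply this.congr_uIoo
    intro t ht
    rw [Set.uIoo_of_le hρ.le] at ht
    simp [abs_of_pos ht.1]
  have h2 : IntervalIntegrable (fun t : ℝ => |t| ^ (-s)) volume (-ρ) 0 := by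
    have := h1.comp_sub_left 0
    simp at this
    exact this.symm
  have h3 : ∫ t in (0:ℝ)..ρ, |t| ^ (-s) = ρ ^ (1 - s) / (1 - s) := by
    rw [intervalIntegral.integral_congr_uIoo (g := fun t => t ^ (-s))]
    · rw [integral_rpow (Or.inl (by linarith))]
      rw [Real.zero_rpow (by linarith)]
      ring_nf
    · intro t ht
      rw [Set.uIoo_of_le hρ.le] at ht
      simp [abs_of_pos ht.1]
  have h4 : ∫ t in (-ρ)..0, |t| ^ (-s) = ρ ^ (1 - s) / (1 - s) := by
    rw [← h3]
    have := intervalIntegral.integral_comp_neg (a := 0) (b := ρ) (fun t : ℝ => |t| ^ (-s))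
    simp at this
    exact this.symm
  have h5 := h2.trans h1
  rw [intervalIntegrable_iff_integrableOn_Icc_of_le (by linarith)] at h5
  rw [Real.closedBall_eq_Icc, zero_sub, zero_add,
    ← ofReal_integral_eq_lintegral_ofReal h5
      (Eventually.of_forall fun t => Real.rpow_nonneg (abs_nonneg t) _),
    integral_Icc_eq_integral_Ioc, ← intervalIntegral.integral_of_le (by linarith),
    ← intervalIntegral.integral_add_adjacent_intervals h2 h1, h3, h4]
  congr 1; ring

lemma lint_abs_rpow_ball (s : ℝ) (hs0 : 0 ≤ s) (hs : s < 1) (ρ : ℝ) (hρ : 0 < ρ) (c a : ℝ) :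
    ∫⁻ t in Metric.closedBall c ρ, ENNReal.ofReal (|t - a| ^ (-s))
      ≤ ENNReal.ofReal ((2 / (1 - s) + 2) * ρ ^ (1 - s)) := by
  have h1 : ∀ t, ENNReal.ofReal (|t - a| ^ (-s)) ≤
      (Metric.closedBall (0:ℝ) ρ).indicator (fun t => ENNReal.ofReal (|t| ^ (-s))) (t - a)
      + ENNReal.ofReal (ρ ^ (-s)) := by
    intro t
    by_cases h : t - a ∈ Metric.closedBall (0:ℝ) ρ
    · rw [Set.indicator_of_mem h]; exact le_self_add
    · rw [Set.indicator_of_notMem h, zero_add]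
      apply ENNReal.ofReal_le_ofReal
      simp at h
      exact Real.rpow_le_rpow_of_nonpos hρ h.le (by linarith)
  calc _ ≤ ∫⁻ t in Metric.closedBall c ρ, ((Metric.closedBall (0:ℝ) ρ).indicator (fun t => ENNReal.ofReal (|t| ^ (-s))) (t - a)
      + ENNReal.ofReal (ρ ^ (-s))) := lintegral_mono h1
    _ = (∫⁻ t in Metric.closedBall c ρ, (Metric.closedBall (0:ℝ) ρ).indicator (fun t => ENNReal.ofReal (|t| ^ (-s))) (t - a)) + ENNReal.ofReal (ρ ^ (-s)) * volume (Metric.closedBall c ρ) := by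
        rw [lintegral_add_right _ measurable_const, lintegral_const, Measure.restrict_apply_univ]
    _ ≤ (∫⁻ t, (Metric.closedBall (0:ℝ) ρ).indicator (fun t => ENNReal.ofReal (|t| ^ (-s))) (t - a)) + ENNReal.ofReal (ρ ^ (-s)) * volume (Metric.closedBall c ρ) := by
        gcongr; exact Measure.restrict_le_self
    _ = ENNReal.ofReal (2 / (1 - s) * ρ ^ (1 - s)) + ENNReal.ofReal (ρ ^ (-s) * (2 * ρ)) := by
        rw [lintegral_sub_right_eq_self (fun t => (Metric.closedBall (0:ℝ) ρ).indicator (fun t => ENNReal.ofReal (|t| ^ (-s))) t) a,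
          lintegral_indicator measurableSet_closedBall, lint_abs_rpow s hs ρ hρ, Real.volume_closedBall,
          ENNReal.ofReal_mul (p := ρ ^ (-s)) (by positivity)]
    _ = _ := by
        have : 0 < 1 - s := by linarith
        rw [← ENNReal.ofReal_add (by positivity) (by positivity)]
        congr 1
        rw [sub_eq_add_neg, Real.rpow_add hρ, Real.rpow_one]; ring

lemma lintegral_slice (g : E3 → ℝ≥0∞) (hg : Measurable g) :
    ∫⁻ y, g y = ∫⁻ w : Fin 2 → ℝ, ∫⁻ t : ℝ, g (mk3 (w 0) (w 1) t) := by
  rw [← (PiLp.volume_preserving_toLp (Fin 3)).lintegral_comp hg]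
  have hm : Measurable fun y : Fin 3 → ℝ => g (WithLp.toLp 2 y) :=
    hg.comp (PiLp.volume_preserving_toLp (Fin 3)).measurable
  have h := (volume_preserving_piFinSuccAbove (fun _ : Fin 3 => ℝ) 2).symm
  rw [← h.lintegral_comp hm]
  have hm2 : Measurable fun p : ℝ × (Fin 2 → ℝ) => g (WithLp.toLp 2 ((MeasurableEquiv.piFinSuccAbove (fun _ : Fin 3 => ℝ) 2).symm p)) :=
    hm.comp (MeasurableEquiv.measurable _)
  refine (lintegral_prod_symm' _ hm2).trans ?_
  refine lintegral_congr fun w => lintegral_congr fun t => ?_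
  congr 1
  ext i
  fin_cases i <;> simp [mk3, MeasurableEquiv.piFinSuccAbove, Fin.insertNthEquiv, Fin.insertNth, Fin.succAboveCases]

@[simp] lemma mk3_apply0 (a b c : ℝ) : mk3 a b c 0 = a := rfl
@[simp] lemma mk3_apply1 (a b c : ℝ) : mk3 a b c 1 = b := rfl
@[simp] lemma mk3_apply2 (a b c : ℝ) : mk3 a b c 2 = c := rfl

lemma coord_dist_le (x y : E3) (i : Fin 3) : |x i - y i| ≤ dist x y := by
  rw [dist_eq_norm]
  have := PiLp.norm_apply_le (x - y) i
  simpa using this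

lemma continuous_proj12 : Continuous proj12 := by
  unfold proj12 mk2
  apply (PiLp.continuous_toLp 2 _).comp
  apply continuous_pi
  intro i
  fin_cases i <;> simp <;> fun_prop

lemma lint_graph (s : ℝ) (hs0 : 0 ≤ s) (hs : s < 1) (ρ : ℝ) (hρ : 0 < ρ) (c : E3)
    (a : E2 → ℝ) (ha : Continuous a) :
    ∫⁻ y in Metric.ball c ρ, ENNReal.ofReal (|y 2 - a (proj12 y)| ^ (-s))
      ≤ ENNReal.ofReal (4 * (2 / (1 - s) + 2) * ρ ^ (3 - s)) := by
  have hmeas : Measurable fun y : E3 => ENNReal.ofReal (|y 2 - a (proj12 y)| ^ (-s)) := by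
    have : Continuous fun y : E3 => |y 2 - a (proj12 y)| := by
      have h1 := ha.comp continuous_proj12
      have h2 : Continuous fun y : E3 => y 2 := by fun_prop
      exact (h2.sub h1).abs
    exact (this.measurable.pow_const _).ennreal_ofReal
  rw [← lintegral_indicator measurableSet_ball, lintegral_slice _ (hmeas.indicator measurableSet_ball)]
  let cc : Fin 2 → ℝ := ![c 0, c 1]
  let D : Set (Fin 2 → ℝ) := Set.univ.pi fun i => Metric.closedBall (cc i) ρ
  have hDm : MeasurableSet D := MeasurableSet.univ_pi fun i => measurableSet_closedBall
  have hD : volume D = ENNReal.ofReal (4 * ρ ^ 2) := by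
    simp only [D]
    rw [volume_pi_pi, Fin.prod_univ_two, Real.volume_closedBall, Real.volume_closedBall,
      ← ENNReal.ofReal_mul (by positivity)]
    congr 1; ring
  have hs1 : 0 < 1 - s := by linarith
  have hbd : ∀ w : Fin 2 → ℝ, ∫⁻ t : ℝ, (Metric.ball c ρ).indicator
      (fun y : E3 => ENNReal.ofReal (|y 2 - a (proj12 y)| ^ (-s))) (mk3 (w 0) (w 1) t) ≤
      D.indicator (fun _ => ENNReal.ofReal ((2 / (1 - s) + 2) * ρ ^ (1 - s))) w := by
    intro w
    by_cases hw : w ∈ D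
    · rw [Set.indicator_of_mem hw]
      refine le_trans ?_ (lint_abs_rpow_ball s hs0 hs ρ hρ (c 2) (a (mk2 (w 0) (w 1))))
      rw [← lintegral_indicator measurableSet_closedBall]
      refine lintegral_mono fun t => ?_
      by_cases ht : mk3 (w 0) (w 1) t ∈ Metric.ball c ρ
      · have : t ∈ Metric.closedBall (c 2) ρ := by
          rw [Metric.mem_closedBall, Real.dist_eq]
          exact (coord_dist_le (mk3 (w 0) (w 1) t) c 2).trans (Metric.mem_ball.1 ht).le
        rw [Set.indicator_of_mem ht, Set.indicator_of_mem this]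
        rfl
      · rw [Set.indicator_of_notMem ht]; exact zero_le
    · rw [Set.indicator_of_notMem hw]
      refine le_of_eq ?_
      rw [lintegral_eq_zero_iff']
      · refine Eventually.of_forall fun t => ?_
        apply Set.indicator_of_notMem
        intro ht
        apply hw
        intro i _
        rw [Metric.mem_closedBall, Real.dist_eq]
        have h0 := (coord_dist_le (mk3 (w 0) (w 1) t) c 0).trans (Metric.mem_ball.1 ht).le
        have h1 := (coord_dist_le (mk3 (w 0) (w 1) t) c 1).trans (Metric.mem_ball.1 ht).le
        fin_cases i
        · exact h0
        · exact h1
      · have : Measurable fun t : ℝ => mk3 (w 0) (w 1) t := by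
          unfold mk3
          refine (PiLp.continuous_toLp 2 _).measurable.comp ?_
          rw [measurable_pi_iff]
          intro i
          fin_cases i <;> simp <;> fun_prop
        exact ((hmeas.indicator measurableSet_ball).comp this).aemeasurable
  refine (lintegral_mono hbd).trans ?_
  rw [lintegral_indicator hDm, setLIntegral_const, hD, ← ENNReal.ofReal_mul (by positivity)]
  apply ENNReal.ofReal_le_ofReal
  apply le_of_eq
  rw [show (3 - s) = (1 - s) + (2:ℕ) by push_cast; ring, Real.rpow_add_natCast hρ.ne']
  ring

lemma proj12_sub (x y : E3) : proj12 x - proj12 y = proj12 (x - y) := by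
  ext i; fin_cases i <;> simp [proj12, mk2]

lemma norm_proj12_le (x : E3) : ‖proj12 x‖ ≤ ‖x‖ := by
  rw [EuclideanSpace.norm_eq, EuclideanSpace.norm_eq]
  apply Real.sqrt_le_sqrt
  simp [Fin.sum_univ_three, Fin.sum_univ_two, proj12, mk2]
  positivity

variable {Ω : Set E3}

lemma frontier_nonempty (hΩ : IsLipschitzDomain Ω) : (frontier Ω).Nonempty := by
  rw [nonempty_frontier_iff]
  refine ⟨hΩ.nonempty, ?_⟩
  intro h
  have := hΩ.isBounded
  rw [h] at this
  exact NormedSpace.unbounded_univ ℝ E3 this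

lemma dB_pos (hΩ : IsLipschitzDomain Ω) {x : E3} (hx : x ∈ Ω) : 0 < dB Ω x := by
  have h : x ∉ frontier Ω := fun h => by
    rw [frontier, hΩ.isOpen.interior_eq] at h
    exact h.2 hx
  exact (isClosed_frontier.notMem_iff_infDist_pos (frontier_nonempty hΩ)).1 h

lemma isCompact_frontier' (hΩ : IsLipschitzDomain Ω) : IsCompact (frontier Ω) :=
  Metric.isCompact_of_isClosed_isBounded isClosed_frontier
    (hΩ.isBounded.closure.subset frontier_subset_closure)

lemma continuous_dB (Ω : Set E3) : Continuous (dB Ω) := Metric.continuous_infDist_pt _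

lemma dB_nonneg (Ω : Set E3) (x : E3) : 0 ≤ dB Ω x := Metric.infDist_nonneg

lemma dB_lip (Ω : Set E3) (x y : E3) : dB Ω x ≤ dB Ω y + dist x y := Metric.infDist_le_infDist_add_dist

lemma chart_local (hΩ : IsLipschitzDomain Ω) (P : E3) (hP : P ∈ frontier Ω) :
    ∃ (f : E3 ≃ᵢ E3) (a : E2 → ℝ) (η : ℝ), Continuous a ∧ 0 < η ∧
      ∀ x ∈ Metric.ball P η, x ∈ Ω → 0 < |(f x) 2 - a (proj12 (f x))| ∧
        |(f x) 2 - a (proj12 (f x))| ≤ 2 * dB Ω x := by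
  obtain ⟨f, R, R', r, a, hfP, hR, hR', hr0, hr1, hLip, -, hfr, -⟩ := hΩ.charts P hP
  refine ⟨f, a, min R R' / 2, hLip.continuous, by positivity, ?_⟩
  intro x hx hxΩ
  have hnb : ∀ x, dist x P < min R R' → ‖proj12 (f x)‖ < R ∧ |(f x) 2| < R' := by
    intro x hx
    have h1 : ‖f x‖ < min R R' := by
      rw [← dist_zero_right, ← hfP, f.dist_eq]; exact hx
    refine ⟨(norm_proj12_le _).trans_lt (h1.trans_le (min_le_left _ _)), ?_⟩
    have := coord_dist_le (f x) 0 2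
    rw [dist_zero_right] at this
    simp at this
    exact this.trans_lt (h1.trans_le (min_le_right _ _))
  have hmin : 0 < min R R' := lt_min hR hR'
  have hx' : dist x P < min R R' / 2 := hx
  constructor
  · rw [abs_pos, sub_ne_zero]
    intro h
    obtain ⟨h1, h2⟩ := hnb x (by linarith)
    have := (hfr (f x) h1 h2).2 h
    rw [f.symm_apply_apply] at this
    rw [frontier, hΩ.isOpen.interior_eq] at this
    exact this.2 hxΩ
  · obtain ⟨Q, hQ, hQd⟩ := (isCompact_frontier' hΩ).exists_infDist_eq_dist ⟨P, hP⟩ x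
    have h1 : dB Ω x ≤ dist x P := Metric.infDist_le_dist_of_mem hP
    have h2 : dist Q P < min R R' := by
      have := dist_triangle Q x P
      rw [dist_comm Q x, ← hQd] at this
      change dist Q P ≤ dB Ω x + _ at this
      linarith
    obtain ⟨h3, h4⟩ := hnb Q h2
    have h5 := (hfr (f Q) h3 h4).1 (by rw [f.symm_apply_apply]; exact hQ)
    have h6 := coord_dist_le (f x) (f Q) 2
    have h7 := hLip.dist_le_mul (proj12 (f Q)) (proj12 (f x))
    rw [Real.dist_eq, dist_eq_norm, proj12_sub, Real.coe_toNNReal _ hr0.le] at h7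
    have h8 := norm_proj12_le (f Q - f x)
    rw [← dist_eq_norm, dist_comm] at h8
    have h9 : dist (f x) (f Q) = dB Ω x := by rw [f.dist_eq, ← hQd]; rfl
    rw [h9] at h6 h8
    have h10 : r * ‖proj12 (f Q - f x)‖ ≤ 1 * dB Ω x := by
      gcongr
    calc |(f x) 2 - a (proj12 (f x))| = |((f x) 2 - (f Q) 2) + (a (proj12 (f Q)) - a (proj12 (f x)))| := by
          rw [h5]; congr 1; ring
      _ ≤ |(f x) 2 - (f Q) 2| + |a (proj12 (f Q)) - a (proj12 (f x))| := abs_add_le _ _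
      _ ≤ 2 * dB Ω x := by linarith

lemma isometry_measurePreserving (f : E3 ≃ᵢ E3) : MeasurePreserving f volume volume := by
  have h := f.toRealLinearIsometryEquiv.measurePreserving
  have h2 := (measurePreserving_add_right (volume : Measure E3) (f 0)).comp h
  have e : ((fun x => x + f 0) ∘ ⇑f.toRealLinearIsometryEquiv) = f := by
    funext x
    simp
  rw [e] at h2
  exact h2

/-- Integrability of negative powers of the distance function, with the scaling-correct bound. -/
theorem lint_dB (hΩ : IsLipschitzDomain Ω) (s : ℝ) (hs0 : 0 ≤ s) (hs : s < 1) :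
    ∃ C : ℝ, 0 < C ∧ ∀ (z : E3) (ρ : ℝ), 0 < ρ →
      ∫⁻ x in Ω ∩ Metric.ball z ρ, ENNReal.ofReal (dB Ω x ^ (-s)) ≤ ENNReal.ofReal (C * ρ ^ (3 - s)) := by
  choose! f a η ha hη hloc using chart_local hΩ
  obtain ⟨t, htc⟩ := (isCompact_frontier' hΩ).elim_nhds_subcover' (fun P _ => Metric.ball P (η P))
    (fun P hP => Metric.ball_mem_nhds P (hη P hP))
  have hs1 : 0 < 1 - s := by linarith
  set C1 : ℝ := 2 ^ s * (4 * (2 / (1 - s) + 2)) with hC1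
  have hC10 : 0 < C1 := by positivity
  have hmeasd : Measurable fun x => ENNReal.ofReal (dB Ω x ^ (-s)) :=
    ((continuous_dB Ω).measurable.pow_const _).ennreal_ofReal
  have hpart : ∀ P ∈ frontier Ω, ∀ (z : E3) (ρ : ℝ), 0 < ρ →
      ∫⁻ x in (Ω ∩ Metric.ball z ρ) ∩ Metric.ball P (η P), ENNReal.ofReal (dB Ω x ^ (-s)) ≤
        ENNReal.ofReal (C1 * ρ ^ (3 - s)) := by
    intro P hP z ρ hρ
    let g : E3 → ℝ≥0∞ := fun y => ENNReal.ofReal (2 ^ s) * ENNReal.ofReal (|y 2 - a P (proj12 y)| ^ (-s))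
    have h1 : ∀ x ∈ (Ω ∩ Metric.ball z ρ) ∩ Metric.ball P (η P),
        ENNReal.ofReal (dB Ω x ^ (-s)) ≤ (Metric.ball (f P z) ρ).indicator g (f P x) := by
      rintro x ⟨⟨hx, hxz⟩, hxP⟩
      have : f P x ∈ Metric.ball (f P z) ρ := by
        rw [Metric.mem_ball, (f P).dist_eq]; exact hxz
      rw [Set.indicator_of_mem this]
      simp only [g]
      rw [← ENNReal.ofReal_mul (by positivity)]
      apply ENNReal.ofReal_le_ofReal
      obtain ⟨h2, h3⟩ := hloc P hP x hxP hx
      have h4 := Real.rpow_le_rpow_of_nonpos h2 h3 (by linarith : -s ≤ 0)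
      rw [Real.mul_rpow (by norm_num) (dB_nonneg _ _)] at h4
      calc dB Ω x ^ (-s) = 2 ^ s * (2 ^ (-s) * dB Ω x ^ (-s)) := by
            rw [← mul_assoc, ← Real.rpow_add (by norm_num)]; simp
        _ ≤ _ := by gcongr
    have hmeasg : Measurable fun y : E3 => ENNReal.ofReal (|y 2 - a P (proj12 y)| ^ (-s)) := by
      have : Continuous fun y : E3 => |y 2 - a P (proj12 y)| := by
        have h1 := (ha P hP).comp continuous_proj12
        have h2 : Continuous fun y : E3 => y 2 := by fun_prop
        exact (h2.sub h1).abs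
      exact (this.measurable.pow_const _).ennreal_ofReal
    have hg : Measurable g := hmeasg.const_mul _
    calc _ ≤ ∫⁻ x in (Ω ∩ Metric.ball z ρ) ∩ Metric.ball P (η P), (Metric.ball (f P z) ρ).indicator g (f P x) :=
          setLIntegral_mono' ((hΩ.isOpen.measurableSet.inter measurableSet_ball).inter measurableSet_ball) h1
      _ ≤ ∫⁻ x, (Metric.ball (f P z) ρ).indicator g (f P x) := setLIntegral_le_lintegral _ _
      _ = ∫⁻ y, (Metric.ball (f P z) ρ).indicator g y :=
          (isometry_measurePreserving (f P)).lintegral_comp (hg.indicator measurableSet_ball)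
      _ = ENNReal.ofReal (2 ^ s) * ∫⁻ y in Metric.ball (f P z) ρ, ENNReal.ofReal (|y 2 - a P (proj12 y)| ^ (-s)) := by
          rw [lintegral_indicator measurableSet_ball, lintegral_const_mul _ hmeasg]
      _ ≤ ENNReal.ofReal (2 ^ s) * ENNReal.ofReal (4 * (2 / (1 - s) + 2) * ρ ^ (3 - s)) := by
          gcongr; exact lint_graph s hs0 hs ρ hρ _ _ (ha P hP)
      _ = _ := by
          rw [← ENNReal.ofReal_mul (by positivity)]; congr 1; rw [hC1]; ring
  -- interior part
  let W : Set E3 := ⋃ P ∈ t, Metric.ball (P : E3) (η P)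
  have hWo : IsOpen W := isOpen_biUnion fun P _ => Metric.isOpen_ball
  have hKc : IsCompact (closure Ω \ W) := (hΩ.isBounded.isCompact_closure).diff hWo
  obtain ⟨d0, hd0, hd0K⟩ : ∃ d0 > 0, ∀ x ∈ closure Ω \ W, d0 ≤ dB Ω x := by
    rcases (closure Ω \ W).eq_empty_or_nonempty with h | h
    · exact ⟨1, one_pos, by simp [h]⟩
    · obtain ⟨x, hx, hxm⟩ := hKc.exists_isMinOn h (continuous_dB Ω).continuousOn
      refine ⟨dB Ω x, ?_, fun y hy => hxm hy⟩
      have : x ∉ frontier Ω := fun hxf => hx.2 (htc hxf)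
      exact (isClosed_frontier.notMem_iff_infDist_pos (frontier_nonempty hΩ)).1 this
  set v1 := (volume (Metric.ball (0:E3) 1)).toReal with hv1
  set v2 := (volume Ω).toReal with hv2
  have hvΩ : volume Ω ≠ ⊤ := hΩ.isBounded.measure_lt_top.ne
  have hvb : volume (Metric.ball (0:E3) 1) ≠ ⊤ := measure_ball_lt_top.ne
  set C2 : ℝ := d0 ^ (-s) * (v1 + v2) with hC2
  have hC20 : 0 ≤ C2 := by positivity
  have hIntg : ∀ (z : E3) (ρ : ℝ), 0 < ρ →
      ∫⁻ x in (Ω ∩ Metric.ball z ρ) \ W, ENNReal.ofReal (dB Ω x ^ (-s)) ≤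
        ENNReal.ofReal (C2 * ρ ^ (3 - s)) := by
    intro z ρ hρ
    have h1 : volume ((Ω ∩ Metric.ball z ρ) \ W) ≤ ENNReal.ofReal ((v1 + v2) * ρ ^ (3 - s)) := by
      rcases le_or_gt ρ 1 with h | h
      · calc _ ≤ volume (Metric.ball z ρ) := measure_mono fun x hx => hx.1.2
          _ = ENNReal.ofReal (ρ ^ 3) * volume (Metric.ball (0:E3) 1) := by
            rw [Measure.addHaar_ball _ _ hρ.le]; simp
          _ = ENNReal.ofReal (ρ ^ 3 * v1) := by
            rw [ENNReal.ofReal_mul (by positivity), hv1, ENNReal.ofReal_toReal hvb]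
          _ ≤ _ := by
            apply ENNReal.ofReal_le_ofReal
            have : ρ ^ 3 ≤ ρ ^ (3 - s) := by
              rw [← Real.rpow_natCast]
              apply Real.rpow_le_rpow_of_exponent_ge hρ h
              push_cast; linarith
            calc ρ ^ 3 * v1 ≤ ρ ^ (3 - s) * (v1 + v2) := by
                  gcongr; linarith [ENNReal.toReal_nonneg (a := volume Ω)]
              _ = _ := mul_comm _ _
      · calc _ ≤ volume Ω := measure_mono fun x hx => hx.1.1
          _ = ENNReal.ofReal v2 := by rw [hv2, ENNReal.ofReal_toReal hvΩ]
          _ ≤ _ := by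
            apply ENNReal.ofReal_le_ofReal
            have : 1 ≤ ρ ^ (3 - s) := Real.one_le_rpow h.le (by linarith)
            calc v2 = v2 * 1 := (mul_one _).symm
              _ ≤ (v1 + v2) * ρ ^ (3 - s) := by
                gcongr; linarith [ENNReal.toReal_nonneg (a := volume (Metric.ball (0:E3) 1))]
    calc _ ≤ ∫⁻ x in (Ω ∩ Metric.ball z ρ) \ W, ENNReal.ofReal (d0 ^ (-s)) := by
          apply setLIntegral_mono' ((hΩ.isOpen.measurableSet.inter measurableSet_ball).diff hWo.measurableSet)
          intro x hx
          apply ENNReal.ofReal_le_ofReal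
          exact Real.rpow_le_rpow_of_nonpos hd0 (hd0K x ⟨subset_closure hx.1.1, hx.2⟩) (by linarith)
      _ ≤ ENNReal.ofReal (d0 ^ (-s)) * ENNReal.ofReal ((v1 + v2) * ρ ^ (3 - s)) := by
          rw [setLIntegral_const]; gcongr
      _ = _ := by rw [← ENNReal.ofReal_mul (by positivity)]; congr 1; rw [hC2]; ring
  refine ⟨t.card * C1 + C2 + 1, by positivity, fun z ρ hρ => ?_⟩
  have hcov : Ω ∩ Metric.ball z ρ ⊆ ((Ω ∩ Metric.ball z ρ) \ W) ∪
      ⋃ P : t, ((Ω ∩ Metric.ball z ρ) ∩ Metric.ball ((P : frontier Ω) : E3) (η (P : frontier Ω))) := by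
    intro x hx
    by_cases hW : x ∈ W
    · right
      simp only [W, Set.mem_iUnion] at hW
      obtain ⟨P, hP, hxP⟩ := hW
      exact Set.mem_iUnion.2 ⟨⟨P, hP⟩, hx, hxP⟩
    · left; exact ⟨hx, hW⟩
  calc _ ≤ _ := lintegral_mono_set hcov
    _ ≤ _ := lintegral_union_le _ _ _
    _ ≤ ENNReal.ofReal (C2 * ρ ^ (3 - s)) + ∑ P : t, ENNReal.ofReal (C1 * ρ ^ (3 - s)) := by
      gcongr
      · exact hIntg z ρ hρ
      · refine (lintegral_iUnion_le _ _).trans ?_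
        rw [tsum_fintype]
        exact Finset.sum_le_sum fun P _ => hpart _ (P : frontier Ω).2 z ρ hρ
    _ = ENNReal.ofReal ((t.card * C1 + C2) * ρ ^ (3 - s)) := by
      rw [Finset.sum_const, Finset.card_univ, Fintype.card_coe, nsmul_eq_mul, ← ENNReal.ofReal_natCast, ← ENNReal.ofReal_mul (by positivity),
        ← ENNReal.ofReal_add (by positivity) (by positivity)]
      congr 1; ring
    _ ≤ _ := by
      apply ENNReal.ofReal_le_ofReal
      apply mul_le_mul_of_nonneg_right _ (by positivity)
      linarith

end Geo

section SchurSec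

variable {Ω : Set E3}

lemma tsum_geo_ofReal (q : ℝ) (hq0 : 0 ≤ q) (hq : q < 1) (A : ℝ) (hA : 0 ≤ A) :
    ∑' n : ℕ, ENNReal.ofReal (A * q ^ n) = ENNReal.ofReal (A * (1 - q)⁻¹) := by
  rw [← ENNReal.ofReal_tsum_of_nonneg (fun n => by positivity)
    ((summable_geometric_of_lt_one hq0 hq).mul_left A),
    ((hasSum_geometric_of_lt_one hq0 hq).mul_left A).tsum_eq]

lemma meas_dB_rpow (Ω : Set E3) (s : ℝ) : Measurable fun x => ENNReal.ofReal (dB Ω x ^ s) :=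
  ((continuous_dB Ω).measurable.pow_const _).ennreal_ofReal

/-- Near part of the potential estimate. -/
lemma pot_near (hΩ : IsLipschitzDomain Ω) (s m : ℝ) (hs0 : 0 ≤ s) (hs : s < 1) (hm : 0 < m)
    (hms : m < 3 - s) :
    ∃ C : ℝ, 0 < C ∧ ∀ (z : E3) (r : ℝ), 0 < r →
      ∫⁻ x in Ω ∩ Metric.ball z r, ENNReal.ofReal (dist x z ^ (-m) * dB Ω x ^ (-s)) ≤
        ENNReal.ofReal (C * r ^ (3 - s - m)) := by
  obtain ⟨C, hC, hb⟩ := lint_dB hΩ s hs0 hs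
  set q : ℝ := (1/2:ℝ) ^ (3 - s - m) with hq
  have hq0 : 0 < q := by positivity
  have hq1 : q < 1 := Real.rpow_lt_one (by norm_num) (by norm_num) (by linarith)
  set A : ℝ := C * 2 ^ (3 - s) * 2 ^ m with hA
  have hA0 : 0 < A := by positivity
  refine ⟨A * (1 - q)⁻¹, mul_pos hA0 (inv_pos.2 (by linarith)), ?_⟩
  intro z r hr
  let ρ : ℕ → ℝ := fun n => (1/2:ℝ) ^ n * r
  have hρ : ∀ n, 0 < ρ n := fun n => by positivity
  have hpt : ∀ x ∈ Ω ∩ Metric.ball z r, ENNReal.ofReal (dist x z ^ (-m) * dB Ω x ^ (-s)) ≤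
      ∑' n, (Ω ∩ Metric.ball z (2 * ρ n)).indicator (fun x => ENNReal.ofReal ((ρ n / 2) ^ (-m)) *
        ENNReal.ofReal (dB Ω x ^ (-s))) x := by
    rintro x ⟨hxΩ, hx⟩
    rcases eq_or_ne x z with rfl | hne
    · rw [dist_self, Real.zero_rpow (by linarith), zero_mul, ENNReal.ofReal_zero]; exact zero_le
    have hd : 0 < dist x z := dist_pos.2 hne
    obtain ⟨n, hn1, hn2⟩ := exists_nat_pow_near_of_lt_one (x := dist x z / r) (y := (1/2:ℝ))
      (by positivity) ((div_le_one hr).2 (Metric.mem_ball.1 hx).le) (by norm_num) (by norm_num)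
    rw [lt_div_iff₀ hr] at hn1
    rw [div_le_iff₀ hr] at hn2
    refine le_trans ?_ (ENNReal.le_tsum n)
    have hmem : x ∈ Ω ∩ Metric.ball z (2 * ρ n) := ⟨hxΩ, by
      rw [Metric.mem_ball]; have := hρ n; simp only [ρ] at this ⊢; linarith⟩
    rw [Set.indicator_of_mem hmem, ← ENNReal.ofReal_mul (by have := hρ n; positivity)]
    apply ENNReal.ofReal_le_ofReal
    apply mul_le_mul_of_nonneg_right _ (Real.rpow_nonneg (dB_nonneg _ _) _)
    apply Real.rpow_le_rpow_of_nonpos (by have := hρ n; positivity) _ (by linarith)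
    simp only [ρ]; rw [pow_succ] at hn1; linarith
  calc _ ≤ ∫⁻ x, ∑' n, (Ω ∩ Metric.ball z (2 * ρ n)).indicator (fun x => ENNReal.ofReal ((ρ n / 2) ^ (-m)) *
        ENNReal.ofReal (dB Ω x ^ (-s))) x :=
        (setLIntegral_mono' (hΩ.isOpen.measurableSet.inter measurableSet_ball) hpt).trans
          (setLIntegral_le_lintegral _ _)
    _ = ∑' n, ENNReal.ofReal ((ρ n / 2) ^ (-m)) * ∫⁻ x in Ω ∩ Metric.ball z (2 * ρ n), ENNReal.ofReal (dB Ω x ^ (-s)) := by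
        rw [lintegral_tsum]
        · congr 1; funext n
          rw [lintegral_indicator (hΩ.isOpen.measurableSet.inter measurableSet_ball),
            lintegral_const_mul _ (meas_dB_rpow Ω _)]
        · intro n
          exact (((meas_dB_rpow Ω _).const_mul _).indicator
            (hΩ.isOpen.measurableSet.inter measurableSet_ball)).aemeasurable
    _ ≤ ∑' n, ENNReal.ofReal ((A * r ^ (3 - s - m)) * q ^ n) := by
        apply ENNReal.tsum_le_tsum
        intro n
        have hρn := hρ n
        calc _ ≤ ENNReal.ofReal ((ρ n / 2) ^ (-m)) * ENNReal.ofReal (C * (2 * ρ n) ^ (3 - s)) := by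
              gcongr; exact hb z _ (by linarith)
          _ = _ := by
              rw [← ENNReal.ofReal_mul (by positivity)]
              congr 1
              have e1 : q ^ n = ((1/2:ℝ) ^ n) ^ (3 - s - m) := by
                rw [hq, ← Real.rpow_natCast, ← Real.rpow_natCast, ← Real.rpow_mul (by norm_num),
                  ← Real.rpow_mul (by norm_num), mul_comm]
              rw [e1, hA, Real.div_rpow hρn.le (by norm_num), Real.mul_rpow (by norm_num) hρn.le,
                mul_assoc (C * 2 ^ (3 - s) * 2 ^ m), ← Real.mul_rpow hr.le (by positivity),
                show r * (1/2:ℝ) ^ n = ρ n by simp only [ρ]; ring,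
                show 3 - s - m = (3 - s) + (-m) by ring, Real.rpow_add hρn, Real.rpow_neg (by norm_num : (0:ℝ) ≤ 2)]
              field_simp
    _ = _ := by
        rw [tsum_geo_ofReal q hq0.le hq1 _ (by positivity)]; congr 1; ring

/-- Far part of the potential estimate. -/
lemma pot_far (hΩ : IsLipschitzDomain Ω) (s m : ℝ) (hs0 : 0 ≤ s) (hs : s < 1)
    (hms : 3 - s < m) :
    ∃ C : ℝ, 0 < C ∧ ∀ (z : E3) (r : ℝ), 0 < r →
      ∫⁻ x in Ω ∩ (Metric.ball z r)ᶜ, ENNReal.ofReal (dist x z ^ (-m) * dB Ω x ^ (-s)) ≤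
        ENNReal.ofReal (C * r ^ (3 - s - m)) := by
  obtain ⟨C, hC, hb⟩ := lint_dB hΩ s hs0 hs
  set q : ℝ := (2:ℝ) ^ (3 - s - m) with hq
  have hq0 : 0 < q := by positivity
  have hq1 : q < 1 := Real.rpow_lt_one_of_one_lt_of_neg (by norm_num) (by linarith)
  set A : ℝ := C * 2 ^ (3 - s) with hA
  have hA0 : 0 < A := by positivity
  refine ⟨A * (1 - q)⁻¹, mul_pos hA0 (inv_pos.2 (by linarith)), ?_⟩
  intro z r hr
  let ρ : ℕ → ℝ := fun n => (2:ℝ) ^ n * r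
  have hρ : ∀ n, 0 < ρ n := fun n => by positivity
  have hpt : ∀ x ∈ Ω ∩ (Metric.ball z r)ᶜ, ENNReal.ofReal (dist x z ^ (-m) * dB Ω x ^ (-s)) ≤
      ∑' n, (Ω ∩ Metric.ball z (2 * ρ n)).indicator (fun x => ENNReal.ofReal ((ρ n) ^ (-m)) *
        ENNReal.ofReal (dB Ω x ^ (-s))) x := by
    rintro x ⟨hxΩ, hx⟩
    have hd : r ≤ dist x z := by simpa using hx
    obtain ⟨n, hn1, hn2⟩ := exists_nat_pow_near (x := dist x z / r) (y := (2:ℝ))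
      ((one_le_div hr).2 hd) (by norm_num)
    rw [le_div_iff₀ hr] at hn1
    rw [div_lt_iff₀ hr] at hn2
    refine le_trans ?_ (ENNReal.le_tsum n)
    have hmem : x ∈ Ω ∩ Metric.ball z (2 * ρ n) := ⟨hxΩ, by
      rw [Metric.mem_ball]; simp only [ρ]; rw [pow_succ] at hn2; linarith⟩
    rw [Set.indicator_of_mem hmem, ← ENNReal.ofReal_mul (by have := hρ n; positivity)]
    apply ENNReal.ofReal_le_ofReal
    apply mul_le_mul_of_nonneg_right _ (Real.rpow_nonneg (dB_nonneg _ _) _)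
    exact Real.rpow_le_rpow_of_nonpos (hρ n) hn1 (by linarith)
  calc _ ≤ ∫⁻ x, ∑' n, (Ω ∩ Metric.ball z (2 * ρ n)).indicator (fun x => ENNReal.ofReal ((ρ n) ^ (-m)) *
        ENNReal.ofReal (dB Ω x ^ (-s))) x :=
        (setLIntegral_mono' (hΩ.isOpen.measurableSet.inter measurableSet_ball.compl) hpt).trans
          (setLIntegral_le_lintegral _ _)
    _ = ∑' n, ENNReal.ofReal ((ρ n) ^ (-m)) * ∫⁻ x in Ω ∩ Metric.ball z (2 * ρ n), ENNReal.ofReal (dB Ω x ^ (-s)) := by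
        rw [lintegral_tsum]
        · congr 1; funext n
          rw [lintegral_indicator (hΩ.isOpen.measurableSet.inter measurableSet_ball),
            lintegral_const_mul _ (meas_dB_rpow Ω _)]
        · intro n
          exact (((meas_dB_rpow Ω _).const_mul _).indicator
            (hΩ.isOpen.measurableSet.inter measurableSet_ball)).aemeasurable
    _ ≤ ∑' n, ENNReal.ofReal ((A * r ^ (3 - s - m)) * q ^ n) := by
        apply ENNReal.tsum_le_tsum
        intro n
        have hρn := hρ n
        calc _ ≤ ENNReal.ofReal ((ρ n) ^ (-m)) * ENNReal.ofReal (C * (2 * ρ n) ^ (3 - s)) := by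
              gcongr; exact hb z _ (by linarith)
          _ = _ := by
              rw [← ENNReal.ofReal_mul (by positivity)]
              congr 1
              have e1 : q ^ n = ((2:ℝ) ^ n) ^ (3 - s - m) := by
                rw [hq, ← Real.rpow_natCast, ← Real.rpow_natCast, ← Real.rpow_mul (by norm_num),
                  ← Real.rpow_mul (by norm_num), mul_comm]
              rw [e1, hA, Real.mul_rpow (by norm_num) hρn.le,
                mul_assoc (C * 2 ^ (3 - s)), ← Real.mul_rpow hr.le (by positivity),
                show r * (2:ℝ) ^ n = ρ n by simp only [ρ]; ring,
                show 3 - s - m = (3 - s) + (-m) by ring, Real.rpow_add hρn]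
              ring
    _ = _ := by
        rw [tsum_geo_ofReal q hq0.le hq1 _ (by positivity)]; congr 1; ring

/-- Schur test for `L^3`. -/
lemma schur_core (μ : Measure E3) [SFinite μ] (k : E3 → E3 → ℝ≥0∞)
    (hk : Measurable (Function.uncurry k)) (w : E3 → ℝ) (hw : ∀ x, 0 < w x) (hwm : Measurable w)
    (C : ℝ≥0∞)
    (h1 : ∀ᵐ y ∂μ, ∫⁻ x, k x y * ENNReal.ofReal (w x ^ 3) ∂μ ≤ C * ENNReal.ofReal (w y ^ 3))
    (h2 : ∀ᵐ x ∂μ, ∫⁻ y, k x y * ENNReal.ofReal (w y ^ (3/2:ℝ)) ∂μ ≤ C * ENNReal.ofReal (w x ^ (3/2:ℝ)))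
    (f g : E3 → ℝ≥0∞) (hf : Measurable f) (hg : Measurable g) :
    ∫⁻ x, ∫⁻ y, k x y * f y * g x ∂μ ∂μ ≤
      C * (∫⁻ y, f y ^ (3:ℝ) ∂μ) ^ (1/3:ℝ) * (∫⁻ x, g x ^ (3/2:ℝ) ∂μ) ^ (2/3:ℝ) := by
  let W : E3 → ℝ≥0∞ := fun x => ENNReal.ofReal (w x)
  have hW0 : ∀ x, W x ≠ 0 := fun x => by simp [W, hw x]
  have hWt : ∀ x, W x ≠ ⊤ := fun x => by simp [W]
  have hWm : Measurable W := hwm.ennreal_ofReal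
  let A : E3 × E3 → ℝ≥0∞ := fun p => k p.1 p.2 ^ (1/3:ℝ) * f p.2 * (W p.1 * (W p.2)⁻¹)
  let B : E3 × E3 → ℝ≥0∞ := fun p => k p.1 p.2 ^ (2/3:ℝ) * g p.1 * (W p.2 * (W p.1)⁻¹)
  have hk' : Measurable fun p : E3 × E3 => k p.1 p.2 := hk
  have hAm : Measurable A := by fun_prop
  have hBm : Measurable B := by fun_prop
  have hAB : ∀ p : E3 × E3, k p.1 p.2 * f p.2 * g p.1 = (A * B) p := by
    intro p
    simp only [Pi.mul_apply, A, B]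
    have e1 : k p.1 p.2 ^ (1/3:ℝ) * k p.1 p.2 ^ (2/3:ℝ) = k p.1 p.2 := by
      rw [← ENNReal.rpow_add_of_nonneg _ _ (by norm_num) (by norm_num)]; norm_num
    have e2 := ENNReal.mul_inv_cancel (hW0 p.1) (hWt p.1)
    have e3 := ENNReal.mul_inv_cancel (hW0 p.2) (hWt p.2)
    calc _ = (k p.1 p.2 ^ (1/3:ℝ) * k p.1 p.2 ^ (2/3:ℝ)) * f p.2 * g p.1 * (W p.1 * (W p.1)⁻¹) * (W p.2 * (W p.2)⁻¹) := by
          rw [e1, e2, e3]; ring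
      _ = _ := by ring
  have hconj : (3:ℝ).HolderConjugate (3/2) := by
    rw [Real.holderConjugate_iff]; norm_num
  have hA3 : ∫⁻ p, A p ^ (3:ℝ) ∂(μ.prod μ) ≤ C * ∫⁻ y, f y ^ (3:ℝ) ∂μ := by
    rw [lintegral_prod_symm' _ (by fun_prop), ← lintegral_const_mul _ (by fun_prop)]
    apply lintegral_mono_ae
    filter_upwards [h1] with y hy
    have e : ∀ x, A (x, y) ^ (3:ℝ) = (f y ^ (3:ℝ) * (W y ^ (3:ℝ))⁻¹) * (k x y * ENNReal.ofReal (w x ^ 3)) := by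
      intro x
      simp only [A]
      rw [ENNReal.mul_rpow_of_nonneg _ _ (by norm_num), ENNReal.mul_rpow_of_nonneg _ _ (by norm_num),
        ENNReal.mul_rpow_of_nonneg _ _ (by norm_num), ← ENNReal.rpow_mul, ENNReal.inv_rpow]
      have : ENNReal.ofReal (w x ^ 3) = W x ^ (3:ℝ) := by
        simp only [W]
        rw [ENNReal.ofReal_rpow_of_pos (hw x)]; norm_num
      rw [this]
      norm_num
      ring
    simp_rw [e]
    rw [lintegral_const_mul _ (by fun_prop)]
    calc _ ≤ (f y ^ (3:ℝ) * (W y ^ (3:ℝ))⁻¹) * (C * ENNReal.ofReal (w y ^ 3)) := by gcongr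
      _ = C * f y ^ (3:ℝ) * (W y ^ (3:ℝ) * (W y ^ (3:ℝ))⁻¹) := by
          have : ENNReal.ofReal (w y ^ 3) = W y ^ (3:ℝ) := by
            simp only [W]
            rw [ENNReal.ofReal_rpow_of_pos (hw y)]; norm_num
          rw [this]; ring
      _ ≤ C * f y ^ (3:ℝ) * 1 := by gcongr; exact ENNReal.mul_inv_le_one _
      _ = _ := mul_one _
  have hB3 : ∫⁻ p, B p ^ (3/2:ℝ) ∂(μ.prod μ) ≤ C * ∫⁻ x, g x ^ (3/2:ℝ) ∂μ := by
    rw [lintegral_prod _ (by fun_prop), ← lintegral_const_mul _ (by fun_prop)]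
    apply lintegral_mono_ae
    filter_upwards [h2] with x hx
    have hWe : ∀ x, ENNReal.ofReal (w x ^ (3/2:ℝ)) = W x ^ (3/2:ℝ) := fun x => by
      simp only [W]
      rw [ENNReal.ofReal_rpow_of_pos (hw x)]
    have e : ∀ y, B (x, y) ^ (3/2:ℝ) = (g x ^ (3/2:ℝ) * (W x ^ (3/2:ℝ))⁻¹) * (k x y * ENNReal.ofReal (w y ^ (3/2:ℝ))) := by
      intro y
      simp only [B]
      rw [ENNReal.mul_rpow_of_nonneg _ _ (by norm_num), ENNReal.mul_rpow_of_nonneg _ _ (by norm_num),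
        ENNReal.mul_rpow_of_nonneg _ _ (by norm_num), ← ENNReal.rpow_mul, ENNReal.inv_rpow, hWe]
      norm_num
      ring
    simp_rw [e]
    rw [lintegral_const_mul _ (by fun_prop)]
    calc _ ≤ (g x ^ (3/2:ℝ) * (W x ^ (3/2:ℝ))⁻¹) * (C * ENNReal.ofReal (w x ^ (3/2:ℝ))) := by gcongr
      _ = C * g x ^ (3/2:ℝ) * (W x ^ (3/2:ℝ) * (W x ^ (3/2:ℝ))⁻¹) := by
          rw [hWe]; ring
      _ ≤ C * g x ^ (3/2:ℝ) * 1 := by gcongr; exact ENNReal.mul_inv_le_one _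
      _ = _ := mul_one _
  calc _ = ∫⁻ p, (A * B) p ∂(μ.prod μ) := by
        rw [lintegral_prod _ (hAm.mul hBm).aemeasurable]
        refine lintegral_congr fun x => lintegral_congr fun y => ?_
        exact hAB (x, y)
    _ ≤ (∫⁻ p, A p ^ (3:ℝ) ∂(μ.prod μ)) ^ (1/(3:ℝ)) * (∫⁻ p, B p ^ (3/2:ℝ) ∂(μ.prod μ)) ^ (1/(3/2:ℝ)) :=
        ENNReal.lintegral_mul_le_Lp_mul_Lq _ hconj hAm.aemeasurable hBm.aemeasurable
    _ ≤ (C * ∫⁻ y, f y ^ (3:ℝ) ∂μ) ^ (1/(3:ℝ)) * (C * ∫⁻ x, g x ^ (3/2:ℝ) ∂μ) ^ (1/(3/2:ℝ)) := by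
        gcongr
    _ = (C ^ (1/3:ℝ) * C ^ (2/3:ℝ)) * (∫⁻ y, f y ^ (3:ℝ) ∂μ) ^ (1/3:ℝ) * (∫⁻ x, g x ^ (3/2:ℝ) ∂μ) ^ (2/3:ℝ) := by
        rw [ENNReal.mul_rpow_of_nonneg _ _ (by norm_num), ENNReal.mul_rpow_of_nonneg _ _ (by norm_num)]
        norm_num
        ring
    _ = _ := by
        rw [← ENNReal.rpow_add_of_nonneg _ _ (by norm_num) (by norm_num)]; norm_num

lemma rpow_diff_le_one {a b β : ℝ} (ha : 0 < a) (hb : 0 < b) (hβ0 : 0 ≤ β) (hβ : β ≤ 1) :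
    |a ^ β - b ^ β| * b ^ (-β) ≤ |a - b| * b⁻¹ := by
  have h : ∀ s : ℝ, 0 < s → |s ^ β - 1| ≤ |s - 1| := by
    intro s hs
    rcases le_total 1 s with h1 | h1
    · have e1 : 1 ≤ s ^ β := Real.one_le_rpow h1 hβ0
      have e2 : s ^ β ≤ s := by simpa using Real.rpow_le_rpow_of_exponent_le h1 hβ
      rw [abs_of_nonneg (by linarith), abs_of_nonneg (by linarith)]; linarith
    · have e1 : s ^ β ≤ 1 := Real.rpow_le_one hs.le h1 hβ0
      have e2 : s ≤ s ^ β := by simpa using Real.rpow_le_rpow_of_exponent_ge hs h1 hβ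
      rw [abs_of_nonpos (by linarith), abs_of_nonpos (by linarith)]; linarith
  have h2 := h (a / b) (by positivity)
  rw [Real.div_rpow ha.le hb.le] at h2
  have hbp : 0 < b ^ β := by positivity
  have e1 : a ^ β / b ^ β - 1 = (a ^ β - b ^ β) * b ^ (-β) := by
    rw [Real.rpow_neg hb.le]; field_simp
  have e2 : a / b - 1 = (a - b) * b⁻¹ := by field_simp
  rw [e1, e2, abs_mul, abs_mul, abs_of_pos (by positivity : 0 < b ^ (-β)),
    abs_of_pos (by positivity : 0 < b⁻¹)] at h2
  exact h2

lemma rpow_diff_le_two {a b β : ℝ} (ha : 0 < a) (hb : 0 < b) (hβ0 : 0 ≤ β) (hβ : β ≤ 1) :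
    |a ^ β - b ^ β| ≤ |a - b| ^ β := by
  wlog h : b ≤ a generalizing a b
  · rw [abs_sub_comm, abs_sub_comm a b]; exact this hb ha (le_of_not_ge h)
  rw [abs_of_nonneg (by have := Real.rpow_le_rpow hb.le h hβ0; linarith), abs_of_nonneg (by linarith)]
  have := Real.rpow_add_le_add_rpow (by linarith : 0 ≤ a - b) hb.le hβ0 hβ
  rw [sub_add_cancel] at this
  linarith

lemma split_ball (hΩ : IsLipschitzDomain Ω) (z : E3) (r : ℝ) (f : E3 → ℝ≥0∞) :
    ∫⁻ x in Ω, f x = (∫⁻ x in Ω ∩ Metric.ball z r, f x) + ∫⁻ x in Ω ∩ (Metric.ball z r)ᶜ, f x := by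
  rw [← lintegral_inter_add_sdiff f Ω (measurableSet_ball (x := z) (ε := r)), Set.sdiff_eq]

lemma abs_dB_sub_le (Ω : Set E3) (x y : E3) : |dB Ω x - dB Ω y| ≤ dist x y := by
  have h1 := dB_lip Ω x y
  have h2 := dB_lip Ω y x
  rw [dist_comm] at h2
  rw [abs_le]; constructor <;> linarith

lemma lint_le_of_pt (A : Set E3) (hA : MeasurableSet A) (f g : E3 → ℝ) (c K : ℝ) (hc : 0 ≤ c)
    (hpt : ∀ x ∈ A, f x ≤ c * g x) (hg : Measurable g)
    (hb : ∫⁻ x in A, ENNReal.ofReal (g x) ≤ ENNReal.ofReal K) :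
    ∫⁻ x in A, ENNReal.ofReal (f x) ≤ ENNReal.ofReal (c * K) := by
  calc _ ≤ ∫⁻ x in A, ENNReal.ofReal c * ENNReal.ofReal (g x) := by
        apply setLIntegral_mono' hA
        intro x hx
        rw [← ENNReal.ofReal_mul hc]
        exact ENNReal.ofReal_le_ofReal (hpt x hx)
    _ = ENNReal.ofReal c * ∫⁻ x in A, ENNReal.ofReal (g x) :=
        lintegral_const_mul _ hg.ennreal_ofReal
    _ ≤ ENNReal.ofReal c * ENNReal.ofReal K := by gcongr
    _ = _ := (ENNReal.ofReal_mul hc).symm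

lemma meas_pot (Ω : Set E3) (z : E3) (m s : ℝ) : Measurable fun x => dist x z ^ m * dB Ω x ^ s :=
  ((measurable_id.dist measurable_const).pow_const _).mul ((continuous_dB Ω).measurable.pow_const _)

def kerA (Ω : Set E3) (β : ℝ) (x y : E3) : ℝ :=
  dist x y ^ (-3:ℝ) * |dB Ω x ^ β - dB Ω y ^ β| * dB Ω y ^ (-β)

lemma kerA_nonneg (Ω : Set E3) (β : ℝ) (x y : E3) : 0 ≤ kerA Ω β x y := by
  unfold kerA
  have := dB_nonneg Ω y
  positivity

lemma kerA_one {β : ℝ} (hβ0 : 0 ≤ β) (hβ : β ≤ 1) {x y : E3} (hx : 0 < dB Ω x) (hy : 0 < dB Ω y) :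
    kerA Ω β x y ≤ dist x y ^ (-2:ℝ) * (dB Ω y)⁻¹ := by
  unfold kerA
  rcases eq_or_ne x y with rfl | hne
  · simp
  have hd : 0 < dist x y := dist_pos.2 hne
  calc _ = dist x y ^ (-3:ℝ) * (|dB Ω x ^ β - dB Ω y ^ β| * dB Ω y ^ (-β)) := by ring
    _ ≤ dist x y ^ (-3:ℝ) * (dist x y * (dB Ω y)⁻¹) := by
        refine mul_le_mul_of_nonneg_left ((rpow_diff_le_one hx hy hβ0 hβ).trans ?_) (by positivity)
        exact mul_le_mul_of_nonneg_right (abs_dB_sub_le Ω x y) (by positivity)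
    _ = _ := by
        rw [← mul_assoc, ← Real.rpow_add_one hd.ne']; norm_num

lemma kerA_two {β : ℝ} (hβ0 : 0 ≤ β) (hβ : β ≤ 1) {x y : E3} (hx : 0 < dB Ω x) (hy : 0 < dB Ω y)
    (hne : x ≠ y) :
    kerA Ω β x y ≤ dist x y ^ (-(3-β)) * (dB Ω y) ^ (-β) := by
  unfold kerA
  have hd : 0 < dist x y := dist_pos.2 hne
  calc _ ≤ dist x y ^ (-3:ℝ) * dist x y ^ β * dB Ω y ^ (-β) := by
        gcongr
        exact (rpow_diff_le_two hx hy hβ0 hβ).trans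
          (Real.rpow_le_rpow (abs_nonneg _) (abs_dB_sub_le Ω x y) hβ0)
    _ = _ := by
        rw [← Real.rpow_add hd]; congr 2; ring

lemma kerA_I (hΩ : IsLipschitzDomain Ω) (β : ℝ) (hβ0 : 0 ≤ β) (hβ : β < 2/5) :
    ∃ C : ℝ, 0 < C ∧ ∀ y ∈ Ω, ∫⁻ x in Ω, ENNReal.ofReal (kerA Ω β x y * dB Ω x ^ (-(1/2:ℝ))) ≤
      ENNReal.ofReal (C * dB Ω y ^ (-(1/2:ℝ))) := by
  obtain ⟨C1, hC1, h1⟩ := pot_near hΩ (1/2) 2 (by norm_num) (by norm_num) (by norm_num) (by norm_num)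
  obtain ⟨C2, hC2, h2⟩ := pot_far hΩ (1/2) (3-β) (by norm_num) (by norm_num) (by linarith)
  refine ⟨C1 + C2, by positivity, ?_⟩
  intro y hy
  have hdy := dB_pos hΩ hy
  set d := dB Ω y
  rw [split_ball hΩ y d, add_mul, ENNReal.ofReal_add (by positivity) (by positivity)]
  have hm := hΩ.isOpen.measurableSet
  apply add_le_add
  · refine (lint_le_of_pt _ (hm.inter measurableSet_ball) _ _ d⁻¹ _ (by positivity) ?_
      (meas_pot Ω y (-2) (-(1/2))) (h1 y d hdy)).trans_eq ?_
    · rintro x ⟨hx, -⟩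
      have hdx := dB_pos hΩ hx
      calc _ ≤ (dist x y ^ (-2:ℝ) * d⁻¹) * dB Ω x ^ (-(1/2:ℝ)) := by
            gcongr; exact kerA_one hβ0 (by linarith) hdx hdy
        _ = _ := by ring
    · congr 1
      rw [mul_left_comm, ← Real.rpow_neg_one d, ← Real.rpow_add hdy]; norm_num
  · refine (lint_le_of_pt _ (hm.inter measurableSet_ball.compl) _ _ (d ^ (-β)) _ (by positivity) ?_
      (meas_pot Ω y (-(3-β)) (-(1/2))) (h2 y d hdy)).trans_eq ?_
    · rintro x ⟨hx, hxy⟩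
      have hdx := dB_pos hΩ hx
      have hne : x ≠ y := by rintro rfl; exact hxy (Metric.mem_ball_self hdy)
      calc _ ≤ (dist x y ^ (-(3-β)) * d ^ (-β)) * dB Ω x ^ (-(1/2:ℝ)) := by
            gcongr; exact kerA_two hβ0 (by linarith) hdx hdy hne
        _ = _ := by ring
    · congr 1
      rw [mul_left_comm, ← Real.rpow_add hdy]; congr 2; ring

lemma kerA_II (hΩ : IsLipschitzDomain Ω) (β : ℝ) (hβ0 : 0 ≤ β) (hβ : β < 2/5) :
    ∃ C : ℝ, 0 < C ∧ ∀ x ∈ Ω, ∫⁻ y in Ω, ENNReal.ofReal (kerA Ω β x y * dB Ω y ^ (-(1/4:ℝ))) ≤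
      ENNReal.ofReal (C * dB Ω x ^ (-(1/4:ℝ))) := by
  obtain ⟨C1, hC1, h1⟩ := pot_near hΩ (1/4) 2 (by norm_num) (by norm_num) (by norm_num) (by norm_num)
  obtain ⟨C2, hC2, h2⟩ := pot_far hΩ (β + 1/4) (3-β) (by linarith) (by linarith) (by linarith)
  refine ⟨2 * C1 * (1/2) ^ (3/4:ℝ) + C2 * (1/2) ^ (-(1/4:ℝ)), by positivity, ?_⟩
  intro x hx
  have hdx := dB_pos hΩ hx
  set d := dB Ω x
  rw [split_ball hΩ x (1/2*d), add_mul, ENNReal.ofReal_add (by positivity) (by positivity)]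
  have hm := hΩ.isOpen.measurableSet
  apply add_le_add
  · refine (lint_le_of_pt _ (hm.inter measurableSet_ball) _ _ (2*d⁻¹) _ (by positivity) ?_
      (meas_pot Ω x (-2) (-(1/4))) (h1 x (1/2*d) (by positivity))).trans_eq ?_
    · rintro y ⟨hy, hyx⟩
      have hdy := dB_pos hΩ hy
      have hle : d / 2 ≤ dB Ω y := by
        have := dB_lip Ω x y
        rw [dist_comm] at this
        have h3 := Metric.mem_ball.1 hyx
        simp only [d] at h3 ⊢; linarith
      calc _ ≤ (dist x y ^ (-2:ℝ) * (dB Ω y)⁻¹) * dB Ω y ^ (-(1/4:ℝ)) := by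
            gcongr; exact kerA_one hβ0 (by linarith) hdx hdy
        _ ≤ (dist x y ^ (-2:ℝ) * (d/2)⁻¹) * dB Ω y ^ (-(1/4:ℝ)) := by gcongr
        _ = _ := by rw [dist_comm x y, inv_div]; ring
    · congr 1
      rw [Real.mul_rpow (by norm_num) hdx.le]
      calc _ = 2 * C1 * (1/2) ^ (3 - 1/4 - 2:ℝ) * (d⁻¹ * d ^ (3 - 1/4 - 2:ℝ)) := by ring
        _ = _ := by
          rw [← Real.rpow_neg_one d, ← Real.rpow_add hdx]; norm_num
  · refine (lint_le_of_pt _ (hm.inter measurableSet_ball.compl) _ _ 1 _ (by positivity) ?_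
      (meas_pot Ω x (-(3-β)) (-(β+1/4))) (h2 x (1/2*d) (by positivity))).trans_eq ?_
    · rintro y ⟨hy, hyx⟩
      have hdy := dB_pos hΩ hy
      have hne : x ≠ y := by rintro rfl; exact hyx (Metric.mem_ball_self (by positivity))
      calc _ ≤ (dist x y ^ (-(3-β)) * dB Ω y ^ (-β)) * dB Ω y ^ (-(1/4:ℝ)) := by
            gcongr; exact kerA_two hβ0 (by linarith) hdx hdy hne
        _ = _ := by
            rw [mul_assoc, ← Real.rpow_add hdy, dist_comm, one_mul]; congr 2; ring
    · congr 1
      rw [one_mul, show 3 - (β + 1/4) - (3 - β) = -(1/4:ℝ) by ring,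
        Real.mul_rpow (by norm_num) hdx.le, mul_assoc]

lemma measurable_kerA (Ω : Set E3) (β : ℝ) : Measurable fun p : E3 × E3 => kerA Ω β p.1 p.2 := by
  unfold kerA
  have h1 : Measurable fun p : E3 × E3 => dB Ω p.1 := (continuous_dB Ω).measurable.comp measurable_fst
  have h2 : Measurable fun p : E3 × E3 => dB Ω p.2 := (continuous_dB Ω).measurable.comp measurable_snd
  have h3 : Measurable fun p : E3 × E3 => dist p.1 p.2 := measurable_fst.dist measurable_snd
  have h4 : Measurable fun p : E3 × E3 => |dB Ω p.1 ^ β - dB Ω p.2 ^ β| := by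
    simp_rw [← Real.norm_eq_abs]
    exact ((h1.pow_const _).sub (h2.pow_const _)).norm
  exact ((h3.pow_const _).mul h4).mul (h2.pow_const _)

open Classical in
/-- Auxiliary Schur weight. -/
def schurW (Ω : Set E3) (s : ℝ) (x : E3) : ℝ := if x ∈ Ω then dB Ω x ^ (-s) else 1

lemma schurW_pos (hΩ : IsLipschitzDomain Ω) (s : ℝ) (x : E3) : 0 < schurW Ω s x := by
  unfold schurW; split_ifs with h
  · have := dB_pos hΩ h; positivity
  · norm_num

lemma schurW_meas (hΩ : IsLipschitzDomain Ω) (s : ℝ) : Measurable (schurW Ω s) := by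
  unfold schurW
  exact Measurable.ite hΩ.isOpen.measurableSet ((continuous_dB Ω).measurable.pow_const _) measurable_const

/-- Schur test for a general kernel with distance weights. -/
lemma schur_gen (hΩ : IsLipschitzDomain Ω) (K : E3 → E3 → ℝ) (hK0 : ∀ x y, 0 ≤ K x y)
    (hKm : Measurable fun p : E3 × E3 => K p.1 p.2) (s : ℝ) (C1 C2 : ℝ) (hC1 : 0 < C1) (hC2 : 0 < C2)
    (h1 : ∀ y ∈ Ω, ∫⁻ x in Ω, ENNReal.ofReal (K x y * dB Ω x ^ (-(3 * s))) ≤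
      ENNReal.ofReal (C1 * dB Ω y ^ (-(3 * s))))
    (h2 : ∀ x ∈ Ω, ∫⁻ y in Ω, ENNReal.ofReal (K x y * dB Ω y ^ (-(3/2*s))) ≤
      ENNReal.ofReal (C2 * dB Ω x ^ (-(3/2*s)))) 
    (f g : E3 → ℝ≥0∞) (hf : Measurable f) (hg : Measurable g) :
    ∫⁻ x in Ω, ∫⁻ y in Ω, ENNReal.ofReal (K x y) * f y * g x ≤
      ENNReal.ofReal (C1 + C2) * (∫⁻ y in Ω, f y ^ (3:ℝ)) ^ (1/3:ℝ) *
        (∫⁻ x in Ω, g x ^ (3/2:ℝ)) ^ (2/3:ℝ) := by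
  have hm := hΩ.isOpen.measurableSet
  have hw3 : ∀ x ∈ Ω, schurW Ω s x ^ 3 = dB Ω x ^ (-(3*s)) := by
    intro x hx
    rw [schurW, if_pos hx, ← Real.rpow_natCast, ← Real.rpow_mul (dB_nonneg _ _)]
    congr 1; push_cast; ring
  have hw32 : ∀ x ∈ Ω, schurW Ω s x ^ (3/2:ℝ) = dB Ω x ^ (-(3/2*s)) := by
    intro x hx
    rw [schurW, if_pos hx, ← Real.rpow_mul (dB_nonneg _ _)]
    congr 1; ring
  apply schur_core (volume.restrict Ω) (fun x y => ENNReal.ofReal (K x y)) hKm.ennreal_ofReal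
    (schurW Ω s) (schurW_pos hΩ s) (schurW_meas hΩ s) _ _ _ f g hf hg
  · filter_upwards [ae_restrict_mem hm] with y hy
    rw [hw3 y hy, ← ENNReal.ofReal_mul (by positivity)]
    refine le_trans ?_ ((h1 y hy).trans ?_)
    · apply setLIntegral_mono' hm
      intro x hx
      rw [← ENNReal.ofReal_mul (hK0 _ _), hw3 x hx]
    · apply ENNReal.ofReal_le_ofReal
      have := dB_nonneg Ω y
      gcongr; linarith
  · filter_upwards [ae_restrict_mem hm] with x hx
    rw [hw32 x hx, ← ENNReal.ofReal_mul (by positivity)]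
    refine le_trans ?_ ((h2 x hx).trans ?_)
    · apply setLIntegral_mono' hm
      intro y hy
      rw [← ENNReal.ofReal_mul (hK0 _ _), hw32 y hy]
    · apply ENNReal.ofReal_le_ofReal
      have := dB_nonneg Ω x
      gcongr; linarith

theorem schur_a (hΩ : IsLipschitzDomain Ω) (β : ℝ) (hβ0 : 0 ≤ β) (hβ : β < 2/5) :
    ∃ C : ℝ, 0 < C ∧ ∀ f g : E3 → ℝ≥0∞, Measurable f → Measurable g →
    ∫⁻ x in Ω, ∫⁻ y in Ω, ENNReal.ofReal (kerA Ω β x y) * f y * g x ≤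
      ENNReal.ofReal C * (∫⁻ y in Ω, f y ^ (3:ℝ)) ^ (1/3:ℝ) *
        (∫⁻ x in Ω, g x ^ (3/2:ℝ)) ^ (2/3:ℝ) := by
  obtain ⟨C1, hC1, h1⟩ := kerA_I hΩ β hβ0 hβ
  obtain ⟨C2, hC2, h2⟩ := kerA_II hΩ β hβ0 hβ
  refine ⟨C1 + C2, by positivity, fun f g hf hg => ?_⟩
  apply schur_gen hΩ (kerA Ω β) (kerA_nonneg Ω β) (measurable_kerA Ω β) (1/6) C1 C2 hC1 hC2 _ _ f g hf hg
  · intro y hy; convert h1 y hy using 6 <;> norm_num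
  · intro y hy; convert h2 y hy using 6 <;> norm_num

def kerB (Ω : Set E3) (β : ℝ) (x y : E3) : ℝ :=
  dB Ω x ^ (-(β/2)) * dist x y ^ (-2:ℝ) * dB Ω y ^ (-β)

lemma pot_sup (hΩ : IsLipschitzDomain Ω) (s : ℝ) (hs0 : 0 ≤ s) (hs : s < 1) :
    ∃ C : ℝ, 0 < C ∧ ∀ z ∈ Ω, 
      ∫⁻ x in Ω, ENNReal.ofReal (dist x z ^ (-2:ℝ) * dB Ω x ^ (-s)) ≤ ENNReal.ofReal C := by
  obtain ⟨C, hC, h⟩ := pot_near hΩ s 2 hs0 hs (by norm_num) (by linarith)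
  obtain ⟨D, hD⟩ := hΩ.isBounded.subset_ball (0:E3)
  set R := max D 1 with hR
  have hR0 : 0 < R := lt_of_lt_of_le one_pos (le_max_right _ _)
  have hsub : ∀ z ∈ Ω, Ω ∩ Metric.ball z (2*R) = Ω := by
    intro z hz
    rw [Set.inter_eq_left]
    intro x hx
    have h1 := Metric.mem_ball.1 (hD hx)
    have h2 := Metric.mem_ball.1 (hD hz)
    have h3 : D ≤ R := le_max_left _ _
    have h4 := dist_triangle_right x z 0
    rw [Metric.mem_ball]; linarith
  refine ⟨C * (2*R) ^ (3-s-2), by positivity, fun z hz => ?_⟩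
  have := h z (2*R) (by positivity)
  rwa [hsub z hz] at this

theorem schur_b (hΩ : IsLipschitzDomain Ω) (β : ℝ) (hβ0 : 0 ≤ β) (hβ : β < 2/5) :
    ∃ C : ℝ, 0 < C ∧ ∀ f g : E3 → ℝ≥0∞, Measurable f → Measurable g →
    ∫⁻ x in Ω, ∫⁻ y in Ω, ENNReal.ofReal (kerB Ω β x y) * f y * g x ≤
      ENNReal.ofReal C * (∫⁻ y in Ω, f y ^ (3:ℝ)) ^ (1/3:ℝ) *
        (∫⁻ x in Ω, g x ^ (3/2:ℝ)) ^ (2/3:ℝ) := by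
  obtain ⟨C1, hC1, h1⟩ := pot_sup hΩ (3/2*β) (by linarith) (by linarith)
  have hm := hΩ.isOpen.measurableSet
  refine ⟨C1 + C1, by positivity, fun f g hf hg => ?_⟩
  apply schur_gen hΩ (kerB Ω β) _ _ (β/3) C1 C1 hC1 hC1 _ _ f g hf hg
  · intro x y
    unfold kerB
    have h1 := dB_nonneg Ω x
    have h2 := dB_nonneg Ω y
    positivity
  · unfold kerB
    have h1 : Measurable fun p : E3 × E3 => dB Ω p.1 := (continuous_dB Ω).measurable.comp measurable_fst
    have h2 : Measurable fun p : E3 × E3 => dB Ω p.2 := (continuous_dB Ω).measurable.comp measurable_snd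
    have h3 : Measurable fun p : E3 × E3 => dist p.1 p.2 := measurable_fst.dist measurable_snd
    exact ((h1.pow_const _).mul (h3.pow_const _)).mul (h2.pow_const _)
  · intro y hy
    have hdy := dB_pos hΩ hy
    refine (lint_le_of_pt _ hm _ _ (dB Ω y ^ (-β)) _ (by positivity) ?_
      (meas_pot Ω y (-2) (-(3/2*β))) (h1 y hy)).trans_eq ?_
    · intro x hx
      have hdx := dB_pos hΩ hx
      unfold kerB
      apply le_of_eq
      rw [show -(3/2*β) = -(β/2) + -(3*(β/3)) by ring, Real.rpow_add hdx]; ring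
    · rw [mul_comm]; congr 3; ring
  · intro x hx
    have hdx := dB_pos hΩ hx
    refine (lint_le_of_pt _ hm _ _ (dB Ω x ^ (-(β/2))) _ (by positivity) ?_
      (meas_pot Ω x (-2) (-(3/2*β))) (h1 x hx)).trans_eq ?_
    · intro y hy
      have hdy := dB_pos hΩ hy
      unfold kerB
      apply le_of_eq
      rw [show -(3/2*β) = -β + -(3/2*(β/3)) by ring, Real.rpow_add hdy, dist_comm]; ring
    · rw [mul_comm]; congr 3; ring

end SchurSec

section HeatSec

/-- Heat kernel. -/
def hk (t : ℝ) (z : E3) : ℝ := (4 * π * t) ^ (-(3/2:ℝ)) * Real.exp (-(‖z‖ ^ 2 / (4 * t)))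

def hk1 (t : ℝ) (i : Fin 3) (z : E3) : ℝ := -(z i / (2 * t)) * hk t z

def hk2 (t : ℝ) (i k : Fin 3) (z : E3) : ℝ :=
  (z i * z k / (4 * t ^ 2) - (if i = k then 1 else 0) / (2 * t)) * hk t z

def hkt (t : ℝ) (z : E3) : ℝ := ∑ i, hk2 t i i z

lemma hk_pos {t : ℝ} (ht : 0 < t) (z : E3) : 0 < hk t z := by unfold hk; positivity

lemma coord_le_norm (z : E3) (i : Fin 3) : |z i| ≤ ‖z‖ := by
  simpa using PiLp.norm_apply_le z i

lemma norm_sq_sum (z : E3) : ‖z‖ ^ 2 = ∑ i, z i ^ 2 := by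
  rw [EuclideanSpace.norm_sq_eq]; simp

lemma contDiff_hk (t : ℝ) : ContDiff ℝ (⊤ : ℕ∞) (hk t) := by
  unfold hk
  exact contDiff_const.mul (((contDiff_norm_sq ℝ).div_const _).neg.exp)

lemma contDiff_coord (i : Fin 3) : ContDiff ℝ (⊤ : ℕ∞) (fun z : E3 => z i) :=
  (EuclideanSpace.proj i : E3 →L[ℝ] ℝ).contDiff

lemma contDiff_hk1 (t : ℝ) (i : Fin 3) : ContDiff ℝ (⊤ : ℕ∞) (hk1 t i) := by
  unfold hk1
  exact ((contDiff_coord i).div_const _).neg.mul (contDiff_hk t)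

lemma contDiff_hk2 (t : ℝ) (i k : Fin 3) : ContDiff ℝ (⊤ : ℕ∞) (hk2 t i k) := by
  unfold hk2
  exact ((((contDiff_coord i).mul (contDiff_coord k)).div_const _).sub contDiff_const).mul (contDiff_hk t)

lemma continuous_hkt (t : ℝ) : Continuous (hkt t) := by
  unfold hkt
  exact continuous_finsetSum _ fun i _ => (contDiff_hk2 t i i).continuous

lemma pds_hk (t : ℝ) (i : Fin 3) (z : E3) : pds (hk t) i z = hk1 t i z := by
  have h1 : HasFDerivAt (fun z : E3 => ‖z‖ ^ 2) (2 • (innerSL ℝ z)) z := by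
    simpa using (hasFDerivAt_id z).norm_sq
  have h2 := (((h1.mul_const (4 * t)⁻¹).neg).exp).const_mul ((4 * π * t) ^ (-(3/2:ℝ)))
  have e : hk t = fun z => (4 * π * t) ^ (-(3/2:ℝ)) * Real.exp (-(‖z‖ ^ 2 * (4 * t)⁻¹)) := by
    funext z; simp [hk, div_eq_mul_inv]
  have := (h2.congr_of_eventuallyEq (f₁ := hk t) (Eventually.of_forall fun y => congrFun e y)).fderiv
  unfold pds
  rw [this]
  simp [hk1, hk, ee, EuclideanSpace.inner_single_right]
  rcases eq_or_ne t 0 with rfl | h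
  · simp
  field_simp
  ring

lemma ee_apply (i k : Fin 3) : (ee i) k = if i = k then 1 else 0 := by
  simp [ee, eq_comm]

lemma pds_hk1 (t : ℝ) (i k : Fin 3) (z : E3) : pds (hk1 t i) k z = hk2 t i k z := by
  have h1 : HasFDerivAt (fun z : E3 => z i) (EuclideanSpace.proj i : E3 →L[ℝ] ℝ) z :=
    (EuclideanSpace.proj i : E3 →L[ℝ] ℝ).hasFDerivAt
  have h2 : HasFDerivAt (hk t) (fderiv ℝ (hk t) z) z :=
    ((contDiff_hk t).differentiable (by simp)).differentiableAt.hasFDerivAt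
  have h3 := ((h1.mul_const (2 * t)⁻¹).neg).mul h2
  have e : hk1 t i = fun z => -(z i * (2 * t)⁻¹) * hk t z := by
    funext z; simp [hk1, div_eq_mul_inv]
  have := (h3.congr_of_eventuallyEq (f₁ := hk1 t i) (Eventually.of_forall fun y => congrFun e y)).fderiv
  have e : fderiv ℝ (hk t) z (ee k) = hk1 t k z := pds_hk t k z
  unfold pds
  rw [this]
  simp only [add_apply, smul_apply, neg_apply, smul_eq_mul, e]
  have e2 : (EuclideanSpace.proj i : E3 →L[ℝ] ℝ) (ee k) = if k = i then 1 else 0 := ee_apply k i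
  simp only [e2, hk1, hk2]
  rcases eq_or_ne t 0 with rfl | h
  · simp
  by_cases hik : i = k
  · subst hik; simp; field_simp; ring
  · simp [hik, Ne.symm hik]; field_simp; ring

lemma hk2_symm (t : ℝ) (i k : Fin 3) (z : E3) : hk2 t i k z = hk2 t k i z := by
  unfold hk2
  rw [mul_comm (z i)]
  simp [eq_comm]

lemma hkt_eq {t : ℝ} (ht : 0 < t) (z : E3) : hkt t z = (‖z‖ ^ 2 / (4 * t ^ 2) - 3 / (2 * t)) * hk t z := by
  simp only [hkt, hk2, norm_sq_sum, Fin.sum_univ_three]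
  simp
  field_simp
  ring

lemma hasDerivAt_hk {t : ℝ} (ht : 0 < t) (z : E3) : HasDerivAt (fun s => hk s z) (hkt t z) t := by
  rw [hkt_eq ht]
  unfold hk
  have h0 : HasDerivAt (fun s : ℝ => 4 * π * s) (4 * π) t := by
    simpa using (hasDerivAt_id t).const_mul (4 * π)
  have h1 := h0.rpow_const (p := -(3/2:ℝ)) (Or.inl (by positivity))
  have h2 : HasDerivAt (fun s : ℝ => -(‖z‖ ^ 2 / (4 * s))) (‖z‖ ^ 2 / (4 * t ^ 2)) t := by
    have h4 := (hasDerivAt_inv ht.ne').const_mul (-(‖z‖^2/4))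
    have e : (fun s : ℝ => -(‖z‖ ^ 2 / (4 * s))) = fun s => -(‖z‖^2/4) * s⁻¹ := by
      funext s; rw [div_eq_mul_inv, mul_inv]; ring
    rw [e]
    refine h4.congr_deriv ?_
    field_simp
  have h3 := h1.mul h2.exp
  refine h3.congr_deriv ?_
  rw [Real.rpow_sub_one (by positivity)]
  field_simp
  ring

def hq (t : ℝ) (z : E3) : ℝ := t ^ (-(3/2:ℝ)) * Real.exp (-(‖z‖ ^ 2 / (8 * t)))

lemma hq_pos {t : ℝ} (ht : 0 < t) (z : E3) : 0 < hq t z := by unfold hq; positivity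

lemma hk_le' {t : ℝ} (ht : 0 < t) (z : E3) :
    hk t z ≤ Real.exp (-(‖z‖ ^ 2 / (8 * t))) * hq t z := by
  have e : Real.exp (-(‖z‖ ^ 2 / (4 * t))) =
      Real.exp (-(‖z‖ ^ 2 / (8 * t))) * Real.exp (-(‖z‖ ^ 2 / (8 * t))) := by
    rw [← Real.exp_add]; congr 1; field_simp; ring
  have h1 : (4 * π * t) ^ (-(3/2:ℝ)) ≤ t ^ (-(3/2:ℝ)) := by
    apply Real.rpow_le_rpow_of_nonpos ht _ (by norm_num)
    nlinarith [Real.pi_gt_three]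
  unfold hk hq
  rw [e]
  calc _ ≤ t ^ (-(3/2:ℝ)) * (Real.exp (-(‖z‖ ^ 2 / (8 * t))) * Real.exp (-(‖z‖ ^ 2 / (8 * t)))) := by
        gcongr
    _ = _ := by ring

lemma hk_le {t : ℝ} (ht : 0 < t) (z : E3) : hk t z ≤ hq t z := by
  refine (hk_le' ht z).trans (mul_le_of_le_one_left (hq_pos ht z).le ?_)
  rw [Real.exp_le_one_iff]
  have : 0 ≤ ‖z‖ ^ 2 / (8 * t) := by positivity
  linarith

lemma hk1_le {t : ℝ} (ht : 0 < t) (i : Fin 3) (z : E3) :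
    |hk1 t i z| ≤ 2 * t ^ (-(1/2:ℝ)) * hq t z := by
  have h1 : |z i| / (2 * t) ≤ 2 * t ^ (-(1/2:ℝ)) * Real.exp (‖z‖ ^ 2 / (8 * t)) := by
    have hs : t ^ (-(1/2:ℝ)) = (Real.sqrt t)⁻¹ := by
      rw [Real.rpow_neg ht.le, Real.sqrt_eq_rpow]
    have hst : 0 < Real.sqrt t := Real.sqrt_pos.2 ht
    have hsq : Real.sqrt t * Real.sqrt t = t := Real.mul_self_sqrt ht.le
    set q := Real.sqrt t
    have h2 := Real.add_one_le_exp (‖z‖ ^ 2 / (8 * t))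
    rw [hs]
    calc _ ≤ ‖z‖ / (2 * t) := by gcongr; exact coord_le_norm z i
      _ ≤ 2 * q⁻¹ * (‖z‖ ^ 2 / (8 * t) + 1) := by
          rw [← hsq]
          rw [← sub_nonneg]
          have : 2 * q⁻¹ * (‖z‖ ^ 2 / (8 * (q * q)) + 1) - ‖z‖ / (2 * (q * q)) =
            q⁻¹ * ((‖z‖ / q - 1) ^ 2 + 7) / 4 := by field_simp; ring
          rw [this]; positivity
      _ ≤ _ := by gcongr
  unfold hk1
  rw [abs_mul, abs_neg, abs_div, abs_of_pos (by positivity : 0 < 2 * t), abs_of_pos (hk_pos ht z)]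
  calc _ ≤ (2 * t ^ (-(1/2:ℝ)) * Real.exp (‖z‖ ^ 2 / (8 * t))) *
        (Real.exp (-(‖z‖ ^ 2 / (8 * t))) * hq t z) := by
        gcongr
        · exact (hk_pos ht z).le
        · exact hk_le' ht z
    _ = 2 * t ^ (-(1/2:ℝ)) * (Real.exp (‖z‖ ^ 2 / (8 * t)) * Real.exp (-(‖z‖ ^ 2 / (8 * t)))) * hq t z := by ring
    _ = _ := by rw [← Real.exp_add, add_neg_cancel, Real.exp_zero, mul_one]

lemma hk2_le {t : ℝ} (ht : 0 < t) (i k : Fin 3) (z : E3) :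
    |hk2 t i k z| ≤ 2 * t⁻¹ * hq t z := by
  have h1 : |z i * z k / (4 * t ^ 2) - (if i = k then 1 else 0) / (2 * t)| ≤
      2 * t⁻¹ * Real.exp (‖z‖ ^ 2 / (8 * t)) := by
    have h2 := Real.add_one_le_exp (‖z‖ ^ 2 / (8 * t))
    have hs : 0 ≤ ‖z‖ ^ 2 / (8 * t) := by positivity
    calc _ ≤ |z i * z k / (4 * t ^ 2)| + |(if i = k then (1:ℝ) else 0) / (2 * t)| := abs_sub _ _
      _ ≤ ‖z‖ ^ 2 / (4 * t ^ 2) + 1 / (2 * t) := by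
          rw [abs_div, abs_div, abs_mul, abs_of_pos (by positivity : 0 < 2 * t),
            abs_of_pos (by positivity : 0 < 4 * t ^ 2), sq ‖z‖]
          gcongr
          · exact coord_le_norm z i
          · exact coord_le_norm z k
          · split_ifs <;> simp
      _ ≤ 2 * t⁻¹ * (‖z‖ ^ 2 / (8 * t) + 1) := by
          rw [← sub_nonneg]
          have : 2 * t⁻¹ * (‖z‖ ^ 2 / (8 * t) + 1) - (‖z‖ ^ 2 / (4 * t ^ 2) + 1 / (2 * t)) =
            3 / 2 * t⁻¹ := by field_simp; ring
          rw [this]; positivity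
      _ ≤ _ := by gcongr
  unfold hk2
  rw [abs_mul, abs_of_pos (hk_pos ht z)]
  calc _ ≤ (2 * t⁻¹ * Real.exp (‖z‖ ^ 2 / (8 * t))) *
        (Real.exp (-(‖z‖ ^ 2 / (8 * t))) * hq t z) := by
        gcongr
        · exact (hk_pos ht z).le
        · exact hk_le' ht z
    _ = 2 * t⁻¹ * (Real.exp (‖z‖ ^ 2 / (8 * t)) * Real.exp (-(‖z‖ ^ 2 / (8 * t)))) * hq t z := by ring
    _ = _ := by rw [← Real.exp_add, add_neg_cancel, Real.exp_zero, mul_one]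

lemma hkt_le {t : ℝ} (ht : 0 < t) (z : E3) : |hkt t z| ≤ 6 * t⁻¹ * hq t z := by
  unfold hkt
  calc _ ≤ ∑ i, |hk2 t i i z| := Finset.abs_sum_le_sum_abs _ _
    _ ≤ ∑ _i : Fin 3, 2 * t⁻¹ * hq t z := Finset.sum_le_sum fun i _ => hk2_le ht i i z
    _ = _ := by simp; ring

lemma hq_le {a b t : ℝ} (ha : 0 < a) (hat : a ≤ t) (htb : t ≤ b) (z : E3) :
    hq t z ≤ a ^ (-(3/2:ℝ)) * Real.exp (-(‖z‖ ^ 2 / (8 * b))) := by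
  have ht : 0 < t := ha.trans_le hat
  unfold hq
  have h1 : t ^ (-(3/2:ℝ)) ≤ a ^ (-(3/2:ℝ)) := Real.rpow_le_rpow_of_nonpos ha hat (by norm_num)
  gcongr

/-- Time integral bound. -/
lemma time_int (a : ℝ) (ha : 1 < a) : ∃ C : ℝ, 0 < C ∧ ∀ r : ℝ, 0 < r →
    ∫⁻ t in Set.Ioi (0:ℝ), ENNReal.ofReal (t ^ (-a) * Real.exp (-(r ^ 2 / (8 * t)))) ≤
      ENNReal.ofReal (C * r ^ (2 - 2 * a)) := by
  refine ⟨(8 * a) ^ a + 1 / (a - 1), by have : 0 < a - 1 := by linarith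
                                        positivity, ?_⟩
  intro r hr
  have hr2 : 0 < r ^ 2 := by positivity
  have ha1 : 0 < a - 1 := by linarith
  have e2 : r ^ 2 = r ^ (2:ℝ) := by simp
  have hexp : ∀ s : ℝ, 0 < s → Real.exp (-s) ≤ a ^ a * s ^ (-a) := by
    intro s hs
    have h1 : s / a ≤ Real.exp (s / a) := by linarith [Real.add_one_le_exp (s / a)]
    have h2 := Real.rpow_le_rpow (by positivity) h1 (by linarith : 0 ≤ a)
    rw [← Real.exp_mul, div_mul_cancel₀ _ (by linarith), Real.div_rpow hs.le (by linarith)] at h2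
    rw [Real.exp_neg, Real.rpow_neg hs.le]
    rw [div_le_iff₀ (by positivity)] at h2
    rw [inv_le_iff_one_le_mul₀ (by positivity)]
    have : 0 < s ^ a := by positivity
    field_simp
    linarith
  have hsplit : Set.Ioi (0:ℝ) = Set.Ioc 0 (r^2) ∪ Set.Ioi (r^2) := (Set.Ioc_union_Ioi_eq_Ioi hr2.le).symm
  rw [hsplit]
  refine (lintegral_union_le _ _ _).trans ?_
  rw [add_mul, ENNReal.ofReal_add (by positivity) (by positivity)]
  apply add_le_add
  · calc _ ≤ ∫⁻ t in Set.Ioc 0 (r^2), ENNReal.ofReal ((8 * a) ^ a * (r ^ 2) ^ (-a)) := by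
          apply setLIntegral_mono' measurableSet_Ioc
          rintro t ⟨ht, -⟩
          apply ENNReal.ofReal_le_ofReal
          calc _ ≤ t ^ (-a) * (a ^ a * (r ^ 2 / (8 * t)) ^ (-a)) := by
                gcongr; exact hexp _ (by positivity)
            _ = _ := by
                rw [Real.div_rpow hr2.le (by positivity), Real.mul_rpow (by norm_num) ht.le,
                  Real.mul_rpow (by norm_num) (by linarith), Real.rpow_neg (by norm_num : (0:ℝ) ≤ 8)]
                have : 0 < t ^ (-a) := by positivity
                field_simp
      _ = ENNReal.ofReal ((8 * a) ^ a * (r ^ 2) ^ (-a)) * ENNReal.ofReal (r ^ 2) := by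
          rw [setLIntegral_const, Real.volume_Ioc, sub_zero]
      _ = _ := by
          rw [← ENNReal.ofReal_mul (by positivity)]
          congr 1
          rw [mul_assoc, ← Real.rpow_add_one hr2.ne', e2, ← Real.rpow_mul hr.le]
          congr 2; ring
  · calc _ ≤ ∫⁻ t in Set.Ioi (r^2), ENNReal.ofReal (t ^ (-a)) := by
          apply setLIntegral_mono' measurableSet_Ioi
          intro t ht
          have ht0 : 0 < t := hr2.trans ht
          apply ENNReal.ofReal_le_ofReal
          apply mul_le_of_le_one_right (by positivity)
          rw [Real.exp_le_one_iff]
          have : 0 ≤ r ^ 2 / (8 * t) := by positivity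
          linarith
      _ = ENNReal.ofReal (∫ t in Set.Ioi (r^2), t ^ (-a)) := by
          rw [ofReal_integral_eq_lintegral_ofReal (integrableOn_Ioi_rpow_of_lt (by linarith) hr2)]
          filter_upwards [ae_restrict_mem measurableSet_Ioi] with t ht
          have ht0 : 0 < t := hr2.trans ht
          positivity
      _ ≤ _ := by
          apply ENNReal.ofReal_le_ofReal
          rw [integral_Ioi_rpow_of_lt (by linarith) hr2, e2, ← Real.rpow_mul hr.le]
          apply le_of_eq
          rw [show 2 * (-a + 1) = 2 - 2 * a by ring, show -a + 1 = -(a-1) by ring]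
          field_simp

lemma time_int_hk1 : ∃ C : ℝ, 0 < C ∧ ∀ (i : Fin 3) (z : E3), z ≠ 0 →
    ∫⁻ t in Set.Ioi (0:ℝ), ENNReal.ofReal |hk1 t i z| ≤ ENNReal.ofReal (C * ‖z‖ ^ (-2:ℝ)) := by
  obtain ⟨C, hC, h⟩ := time_int 2 (by norm_num)
  refine ⟨2 * C, by positivity, fun i z hz => ?_⟩
  have := h ‖z‖ (norm_pos_iff.2 hz)
  calc _ ≤ ∫⁻ t in Set.Ioi (0:ℝ), ENNReal.ofReal 2 * ENNReal.ofReal (t ^ (-2:ℝ) * Real.exp (-(‖z‖ ^ 2 / (8 * t)))) := by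
        apply setLIntegral_mono' measurableSet_Ioi
        intro t ht
        have ht : 0 < t := ht
        rw [← ENNReal.ofReal_mul (by norm_num)]
        apply ENNReal.ofReal_le_ofReal
        refine (hk1_le ht i z).trans_eq ?_
        unfold hq
        rw [← mul_assoc, mul_assoc 2, ← Real.rpow_add ht]; norm_num; ring
    _ = ENNReal.ofReal 2 * ∫⁻ t in Set.Ioi (0:ℝ), ENNReal.ofReal (t ^ (-2:ℝ) * Real.exp (-(‖z‖ ^ 2 / (8 * t)))) := by
        apply lintegral_const_mul; fun_prop
    _ ≤ ENNReal.ofReal 2 * ENNReal.ofReal (C * ‖z‖ ^ (2 - 2 * 2:ℝ)) := by gcongr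
    _ = _ := by rw [← ENNReal.ofReal_mul (by norm_num), ← mul_assoc]; congr 2; norm_num

lemma time_int_hk2 : ∃ C : ℝ, 0 < C ∧ ∀ (i k : Fin 3) (z : E3), z ≠ 0 →
    ∫⁻ t in Set.Ioi (0:ℝ), ENNReal.ofReal |hk2 t i k z| ≤ ENNReal.ofReal (C * ‖z‖ ^ (-3:ℝ)) := by
  obtain ⟨C, hC, h⟩ := time_int (5/2) (by norm_num)
  refine ⟨2 * C, by positivity, fun i k z hz => ?_⟩
  have := h ‖z‖ (norm_pos_iff.2 hz)
  calc _ ≤ ∫⁻ t in Set.Ioi (0:ℝ), ENNReal.ofReal 2 * ENNReal.ofReal (t ^ (-(5/2):ℝ) * Real.exp (-(‖z‖ ^ 2 / (8 * t)))) := by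
        apply setLIntegral_mono' measurableSet_Ioi
        intro t ht
        have ht : 0 < t := ht
        rw [← ENNReal.ofReal_mul (by norm_num)]
        apply ENNReal.ofReal_le_ofReal
        refine (hk2_le ht i k z).trans_eq ?_
        unfold hq
        rw [← Real.rpow_neg_one t, ← mul_assoc, mul_assoc 2, ← Real.rpow_add ht]; norm_num; ring
    _ = ENNReal.ofReal 2 * ∫⁻ t in Set.Ioi (0:ℝ), ENNReal.ofReal (t ^ (-(5/2):ℝ) * Real.exp (-(‖z‖ ^ 2 / (8 * t)))) := by
        apply lintegral_const_mul; fun_prop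
    _ ≤ ENNReal.ofReal 2 * ENNReal.ofReal (C * ‖z‖ ^ (2 - 2 * (5/2):ℝ)) := by gcongr
    _ = _ := by rw [← ENNReal.ofReal_mul (by norm_num), ← mul_assoc]; congr 2; norm_num

end HeatSec

section ConvSec

/-- Convolution. -/
def cv (K f : E3 → ℝ) (x : E3) : ℝ := ∫ y, K (x - y) * f y

lemma cv_integrable {K f : E3 → ℝ} (hK : Continuous K) (hf : Continuous f) (hfs : HasCompactSupport f)
    (x : E3) : Integrable fun y => K (x - y) * f y :=
  ((hK.comp (continuous_const.sub continuous_id)).mul hf).integrable_of_hasCompactSupport hfs.mul_left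

lemma cv_hasFDerivAt {K f : E3 → ℝ} (hK : ContDiff ℝ 1 K) (hf : Continuous f)
    (hfs : HasCompactSupport f) (x : E3) :
    HasFDerivAt (cv K f) (∫ y, f y • fderiv ℝ K (x - y)) x := by
  have hK' : Continuous (fderiv ℝ K) := hK.continuous_fderiv (by simp)
  obtain ⟨C, hC⟩ := (((isCompact_closedBall x 1).prod (show IsCompact (tsupport f) from hfs)).image continuous_sub).exists_bound_of_continuousOn
    hK'.continuousOn
  have := hasFDerivAt_integral_of_dominated_of_fderiv_le (μ := volume) (𝕜 := ℝ)
    (F := fun x y => K (x - y) * f y)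
    (F' := fun x y => f y • fderiv ℝ K (x - y)) (x₀ := x) (bound := fun y => |f y| * C)
    (Metric.closedBall_mem_nhds x one_pos)
    (Eventually.of_forall fun x' => (cv_integrable hK.continuous hf hfs x').aestronglyMeasurable)
    (cv_integrable hK.continuous hf hfs x)
    (hf.smul (hK'.comp (continuous_const.sub continuous_id))).aestronglyMeasurable
    (Eventually.of_forall fun y x' hx' => ?_)
    ((hf.integrable_of_hasCompactSupport hfs).abs.mul_const C)
    (Eventually.of_forall fun y x' hx' => ?_)
  · exact this
  · rw [norm_smul, Real.norm_eq_abs]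
    by_cases hy : y ∈ tsupport f
    · gcongr
      exact hC _ ⟨(x', y), ⟨hx', hy⟩, rfl⟩
    · rw [image_eq_zero_of_notMem_tsupport hy]; simp
  · have h1 : HasFDerivAt K (fderiv ℝ K (x' - y)) (x' - y) :=
      (hK.differentiable (by simp)).differentiableAt.hasFDerivAt
    have h2 := (h1.comp x' ((hasFDerivAt_id x').sub_const y)).mul_const (f y)
    simpa using h2

lemma cv_differentiable {K f : E3 → ℝ} (hK : ContDiff ℝ 1 K) (hf : Continuous f)
    (hfs : HasCompactSupport f) : Differentiable ℝ (cv K f) :=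
  fun x => (cv_hasFDerivAt hK hf hfs x).differentiableAt

lemma cv_continuous {K f : E3 → ℝ} (hK : ContDiff ℝ 1 K) (hf : Continuous f)
    (hfs : HasCompactSupport f) : Continuous (cv K f) := (cv_differentiable hK hf hfs).continuous

lemma cv_pds {K f : E3 → ℝ} (hK : ContDiff ℝ 1 K) (hf : Continuous f)
    (hfs : HasCompactSupport f) (i : Fin 3) (x : E3) :
    pds (cv K f) i x = cv (pds K i) f x := by
  unfold pds
  have hK' : Continuous (fderiv ℝ K) := hK.continuous_fderiv (by simp)
  rw [(cv_hasFDerivAt hK hf hfs x).fderiv, ContinuousLinearMap.integral_apply]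
  · unfold cv
    congr 1; funext y; simp [mul_comm, pds]
  · exact (hf.smul (hK'.comp (continuous_const.sub continuous_id))).integrable_of_hasCompactSupport hfs.smul_right

/-- integration by parts inside the convolution. -/
lemma cv_ibp {K φ : E3 → ℝ} (hK : ContDiff ℝ 1 K) (hφ : ContDiff ℝ 1 φ)
    (hfs : HasCompactSupport φ) (i : Fin 3) (x : E3) :
    cv (pds K i) φ x = cv K (pds φ i) x := by
  have hK' : Continuous (fderiv ℝ K) := hK.continuous_fderiv (by simp)
  have hφ' : Continuous (fderiv ℝ φ) := hφ.continuous_fderiv (by simp)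
  have hd : ∀ y, fderiv ℝ (fun y => K (x - y)) y (ee i) = - pds K i (x - y) := by
    intro y
    have h1 : HasFDerivAt K (fderiv ℝ K (x - y)) (x - y) :=
      (hK.differentiable (by simp)).differentiableAt.hasFDerivAt
    have h2 := (h1.comp y ((hasFDerivAt_id y).const_sub x)).fderiv
    have h3 : fderiv ℝ (fun y => K (x - y)) y = _ := h2
    rw [h3]; simp [pds]
  have hc1 : Continuous fun y => pds K i (x - y) := by
    unfold pds; exact (hK'.comp (continuous_const.sub continuous_id)).clm_apply continuous_const
  have hc2 : Continuous fun y => pds φ i y := by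
    unfold pds; exact hφ'.clm_apply continuous_const
  have hcK : Continuous fun y => K (x - y) := hK.continuous.comp (continuous_const.sub continuous_id)
  have := integral_mul_fderiv_eq_neg_fderiv_mul_of_integrable (μ := (volume : Measure E3))
    (f := fun y => K (x - y)) (g := φ) (v := ee i) ?_ ?_ ?_ ?_ ?_
  · unfold cv
    simp only [hd] at this
    simp only [neg_mul, integral_neg, neg_neg] at this
    exact this.symm
  · simp only [hd]
    exact (hc1.neg.mul hφ.continuous).integrable_of_hasCompactSupport hfs.mul_left
  · exact (hcK.mul hc2).integrable_of_hasCompactSupport ((hfs.fderiv_apply (𝕜 := ℝ) (ee i)).mul_left)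
  · exact (hcK.mul hφ.continuous).integrable_of_hasCompactSupport hfs.mul_left
  · intro y _
    exact ((hK.differentiable (by simp)).comp (differentiable_id.const_sub x)).differentiableAt
  · intro y _
    exact (hφ.differentiable (by simp)).differentiableAt

/-- time derivative -/
lemma cv_time {f : E3 → ℝ} (hf : Continuous f) (hfs : HasCompactSupport f) {t : ℝ} (ht : 0 < t) (x : E3) :
    HasDerivAt (fun s => cv (hk s) f x) (cv (hkt t) f x) t := by
  have hb : ∀ s ∈ Set.Icc (t/2) (2*t), ∀ z : E3, |hkt s z| ≤ 6 * (t/2)⁻¹ * (t/2) ^ (-(3/2:ℝ)) := by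
    rintro s ⟨hs1, hs2⟩ z
    have hs : 0 < s := by linarith
    have h1 := hq_le (by linarith : 0 < t/2) hs1 hs2 z
    have h2 : Real.exp (-(‖z‖ ^ 2 / (8 * (2 * t)))) ≤ 1 := by
      rw [Real.exp_le_one_iff]
      have : 0 ≤ ‖z‖ ^ 2 / (8 * (2 * t)) := by positivity
      linarith
    calc _ ≤ 6 * s⁻¹ * hq s z := hkt_le hs z
      _ ≤ 6 * (t/2)⁻¹ * ((t/2) ^ (-(3/2:ℝ)) * 1) := by
          gcongr
          · exact (hq_pos hs z).le
          · exact h1.trans (by gcongr)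
      _ = _ := by rw [mul_one]
  have := hasDerivAt_integral_of_dominated_loc_of_deriv_le (μ := (volume : Measure E3)) (𝕜 := ℝ)
    (F := fun s y => hk s (x - y) * f y)
    (F' := fun s y => hkt s (x - y) * f y) (x₀ := t)
    (bound := fun y => 6 * (t/2)⁻¹ * (t/2) ^ (-(3/2:ℝ)) * |f y|)
    (Icc_mem_nhds (by linarith : t/2 < t) (by linarith : t < 2*t))
    (Eventually.of_forall fun s => (cv_integrable (contDiff_hk s).continuous hf hfs x).aestronglyMeasurable)
    (cv_integrable (contDiff_hk t).continuous hf hfs x)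
    (cv_integrable (continuous_hkt t) hf hfs x).aestronglyMeasurable
    (Eventually.of_forall fun y s hs => ?_)
    ((hf.integrable_of_hasCompactSupport hfs).abs.const_mul _)
    (Eventually.of_forall fun y s hs => ?_)
  · exact this.2
  · rw [Real.norm_eq_abs, abs_mul]
    gcongr
    exact hb s hs _
  · exact (hasDerivAt_hk (by linarith [hs.1]) _).mul_const _

lemma cv_decay {K f : E3 → ℝ} (hf : Continuous f) (hfs : HasCompactSupport f) {A c R : ℝ} (hA : 0 ≤ A) (hc : 0 ≤ c)
    (hR : tsupport f ⊆ Metric.closedBall 0 R) (hK : ∀ z, |K z| ≤ A * Real.exp (-(c * ‖z‖ ^ 2))) (x : E3) :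
    |cv K f x| ≤ A * Real.exp (c * R ^ 2) * (∫ y, |f y|) * Real.exp (-(c / 2 * ‖x‖ ^ 2)) := by
  unfold cv
  calc _ ≤ ∫ y, (A * Real.exp (c * R ^ 2) * Real.exp (-(c / 2 * ‖x‖ ^ 2))) * |f y| := by
        rw [← Real.norm_eq_abs]
        apply norm_integral_le_of_norm_le ((hf.integrable_of_hasCompactSupport hfs).abs.const_mul _)
        filter_upwards with y
        rw [Real.norm_eq_abs, abs_mul]
        by_cases hy : y ∈ tsupport f
        · have h1 : ‖y‖ ≤ R := by simpa using hR hy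
          have h2 : ‖x‖ ≤ ‖x - y‖ + ‖y‖ := by simpa using norm_add_le (x - y) y
          gcongr
          refine (hK _).trans ?_
          rw [mul_assoc A, ← Real.exp_add]
          gcongr
          have h3 : ‖x‖ ^ 2 ≤ 2 * ‖x - y‖ ^ 2 + 2 * R ^ 2 := by
            have : ‖x‖ ^ 2 ≤ (‖x - y‖ + ‖y‖) ^ 2 := by gcongr
            have : ‖y‖ ^ 2 ≤ R ^ 2 := by gcongr
            nlinarith [sq_nonneg (‖x - y‖ - ‖y‖)]
          nlinarith
        · rw [image_eq_zero_of_notMem_tsupport hy]; simp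
    _ = _ := by rw [integral_const_mul]; ring

/-- Uniform Gaussian decay of heat extensions. -/
lemma heat_decay {f : E3 → ℝ} (hf : Continuous f) (hfs : HasCompactSupport f) {a b : ℝ} (ha : 0 < a) (hb : 0 < b) :
    ∃ A : ℝ, 0 < A ∧ ∀ t, a ≤ t → t ≤ b → ∀ x,
      |cv (hk t) f x| ≤ A * Real.exp (-(1 / (16 * b) * ‖x‖ ^ 2)) ∧
      (∀ i, |cv (hk1 t i) f x| ≤ A * Real.exp (-(1 / (16 * b) * ‖x‖ ^ 2))) ∧
      (∀ i k, |cv (hk2 t i k) f x| ≤ A * Real.exp (-(1 / (16 * b) * ‖x‖ ^ 2))) ∧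
      |cv (hkt t) f x| ≤ A * Real.exp (-(1 / (16 * b) * ‖x‖ ^ 2)) := by
  obtain ⟨R, hR⟩ := hfs.isBounded.subset_closedBall (0:E3)
  set M : ℝ := (1 + 2 * a ^ (-(1/2:ℝ)) + 6 * a⁻¹) * a ^ (-(3/2:ℝ)) with hM
  have hM0 : 0 < M := by positivity
  have key : ∀ (K : E3 → ℝ), (∀ z, |K z| ≤ M * Real.exp (-(1 / (8 * b) * ‖z‖ ^ 2))) → ∀ x,
      |cv K f x| ≤ (M * Real.exp (1 / (8 * b) * R ^ 2) * (∫ y, |f y|) + 1) * Real.exp (-(1 / (16 * b) * ‖x‖ ^ 2)) := by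
    intro K hK x
    refine (cv_decay hf hfs hM0.le (by positivity) hR hK x).trans ?_
    have e : 1 / (8 * b) / 2 = 1 / (16 * b) := by field_simp; norm_num
    rw [e]
    gcongr
    linarith
  have hI : 0 ≤ ∫ y, |f y| := integral_nonneg fun y => abs_nonneg _
  refine ⟨M * Real.exp (1 / (8 * b) * R ^ 2) * (∫ y, |f y|) + 1, by positivity, ?_⟩
  intro t hat htb x
  have ht : 0 < t := ha.trans_le hat
  have e2 : ∀ z : E3, Real.exp (-(‖z‖ ^ 2 / (8 * b))) = Real.exp (-(1 / (8 * b) * ‖z‖ ^ 2)) := by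
    intro z; congr 2; ring
  have h1 : t ^ (-(1/2:ℝ)) ≤ a ^ (-(1/2:ℝ)) := Real.rpow_le_rpow_of_nonpos ha hat (by norm_num)
  have h2 : t⁻¹ ≤ a⁻¹ := by gcongr
  have p1 : 0 < a ^ (-(1/2:ℝ)) := by positivity
  have p2 : 0 < a⁻¹ := by positivity
  have fin : ∀ (c : ℝ) (z : E3), 0 ≤ c → c ≤ 1 + 2 * a ^ (-(1/2:ℝ)) + 6 * a⁻¹ →
      c * hq t z ≤ M * Real.exp (-(1 / (8 * b) * ‖z‖ ^ 2)) := by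
    intro c z hc0 hc
    have := hq_le ha hat htb z
    rw [e2] at this
    rw [hM, mul_assoc]
    exact mul_le_mul hc this (hq_pos ht z).le (by positivity)
  refine ⟨key _ (fun z => ?_) x, fun i => key _ (fun z => ?_) x, fun i k => key _ (fun z => ?_) x, key _ (fun z => ?_) x⟩
  · rw [abs_of_pos (hk_pos ht z)]
    refine (hk_le ht z).trans ?_
    have := fin 1 z zero_le_one (by linarith)
    rwa [one_mul] at this
  · exact (hk1_le ht i z).trans (fin _ z (by positivity) (by linarith))
  · exact (hk2_le ht i k z).trans (fin _ z (by positivity) (by linarith))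
  · exact (hkt_le ht z).trans (fin _ z (by positivity) (by linarith))

lemma integrable_gauss {c : ℝ} (hc : 0 < c) : Integrable fun x : E3 => Real.exp (-(c * ‖x‖ ^ 2)) := by
  have := GaussianFourier.integrable_cexp_neg_mul_sq_norm_add (V := E3) (b := (c:ℂ)) (by simpa using hc) 0 0
  have h2 := this.norm
  refine h2.congr (Eventually.of_forall fun x => ?_)
  simp only [Complex.norm_exp]
  congr 1
  simp
  norm_cast
  simp

lemma integrable_of_gauss {F : E3 → ℝ} (hF : AEStronglyMeasurable F volume) {A c : ℝ} (hc : 0 < c)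
    (h : ∀ x, |F x| ≤ A * Real.exp (-(c * ‖x‖ ^ 2))) : Integrable F :=
  ((integrable_gauss hc).const_mul A).mono' hF (Eventually.of_forall h)

lemma integral_hk {t : ℝ} (ht : 0 < t) : ∫ z : E3, hk t z = 1 := by
  unfold hk
  rw [integral_const_mul]
  have h := GaussianFourier.integral_rexp_neg_mul_sq_norm (V := E3) (b := 1 / (4 * t)) (by positivity)
  have e : ∀ z : E3, Real.exp (-(‖z‖ ^ 2 / (4 * t))) = Real.exp (-(1 / (4 * t)) * ‖z‖ ^ 2) := by
    intro z; congr 1; ring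
  simp_rw [e]
  rw [h, finrank_euclideanSpace_fin, show π / (1 / (4 * t)) = 4 * π * t by field_simp,
    ← Real.rpow_add (by positivity)]
  norm_num

lemma integrable_hk {t : ℝ} (ht : 0 < t) : Integrable (hk t) :=
  integrable_of_integral_eq_one (integral_hk ht)

end ConvSec

section EnergySec

/-- A `C²` function on the plane vanishing at the origin, with explicit partial derivatives. -/
structure PlaneC2 (B Bu Bv Buu Buv Bvv : ℝ × ℝ → ℝ) : Prop where
  zero : B 0 = 0
  d0 : ∀ p, HasFDerivAt B (Bu p • ContinuousLinearMap.fst ℝ ℝ ℝ + Bv p • ContinuousLinearMap.snd ℝ ℝ ℝ) p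
  du : ∀ p, HasFDerivAt Bu (Buu p • ContinuousLinearMap.fst ℝ ℝ ℝ + Buv p • ContinuousLinearMap.snd ℝ ℝ ℝ) p
  dv : ∀ p, HasFDerivAt Bv (Buv p • ContinuousLinearMap.fst ℝ ℝ ℝ + Bvv p • ContinuousLinearMap.snd ℝ ℝ ℝ) p
  cuu : Continuous Buu
  cuv : Continuous Buv
  cvv : Continuous Bvv

lemma hk_pds_fun (t : ℝ) (i : Fin 3) : pds (hk t) i = hk1 t i := funext (pds_hk t i)
lemma hk1_pds_fun (t : ℝ) (i k : Fin 3) : pds (hk1 t i) k = hk2 t i k := funext (pds_hk1 t i k)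

lemma c1 {f : E3 → ℝ} (h : ContDiff ℝ (⊤ : ℕ∞) f) : ContDiff ℝ 1 f := h.of_le (by exact_mod_cast le_top)

lemma cv_hkt {f : E3 → ℝ} (hf : Continuous f) (hfs : HasCompactSupport f) (t : ℝ) (x : E3) :
    cv (hkt t) f x = ∑ i, cv (hk2 t i i) f x := by
  unfold cv hkt
  rw [← integral_finsetSum]
  · congr 1; funext y; rw [Finset.sum_mul]
  · intro i _
    exact cv_integrable (contDiff_hk2 t i i).continuous hf hfs x

lemma cv_hkt_continuous {f : E3 → ℝ} (hf : Continuous f) (hfs : HasCompactSupport f) (t : ℝ) :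
    Continuous (cv (hkt t) f) := by
  rw [funext (cv_hkt hf hfs t)]
  exact continuous_finsetSum _ fun i _ => cv_continuous (c1 (contDiff_hk2 t i i)) hf hfs

lemma fderiv_cv_hk {f : E3 → ℝ} (hf : Continuous f) (hfs : HasCompactSupport f) (t : ℝ) (i : Fin 3) (x : E3) :
    fderiv ℝ (cv (hk t) f) x (ee i) = cv (hk1 t i) f x := by
  rw [← hk_pds_fun, ← cv_pds (c1 (contDiff_hk t)) hf hfs]; rfl

lemma fderiv_cv_hk1 {f : E3 → ℝ} (hf : Continuous f) (hfs : HasCompactSupport f) (t : ℝ) (i k : Fin 3) (x : E3) :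
    fderiv ℝ (cv (hk1 t i) f) x (ee k) = cv (hk2 t i k) f x := by
  rw [← hk1_pds_fun, ← cv_pds (c1 (contDiff_hk1 t i)) hf hfs]; rfl

/-- local bounds -/
lemma PlaneC2.bound {B Bu Bv Buu Buv Bvv : ℝ × ℝ → ℝ} (h : PlaneC2 B Bu Bv Buu Buv Bvv) (A : ℝ) :
    ∃ M : ℝ, 0 ≤ M ∧ ∀ p : ℝ × ℝ, |p.1| ≤ A → |p.2| ≤ A →
      |B p| ≤ M * (|p.1| + |p.2|) ∧ |Bu p| ≤ M ∧ |Bv p| ≤ M ∧ |Buu p| ≤ M ∧ |Buv p| ≤ M ∧ |Bvv p| ≤ M := by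
  have hcu : Continuous Bu := continuous_iff_continuousAt.2 fun p => (h.du p).continuousAt
  have hcv : Continuous Bv := continuous_iff_continuousAt.2 fun p => (h.dv p).continuousAt
  have hcp : IsCompact (Metric.closedBall (0 : ℝ × ℝ) A) := isCompact_closedBall _ _
  obtain ⟨M1, h1⟩ := hcp.exists_bound_of_continuousOn hcu.continuousOn
  obtain ⟨M2, h2⟩ := hcp.exists_bound_of_continuousOn hcv.continuousOn
  obtain ⟨M3, h3⟩ := hcp.exists_bound_of_continuousOn h.cuu.continuousOn
  obtain ⟨M4, h4⟩ := hcp.exists_bound_of_continuousOn h.cuv.continuousOn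
  obtain ⟨M5, h5⟩ := hcp.exists_bound_of_continuousOn h.cvv.continuousOn
  set M := |M1| + |M2| + |M3| + |M4| + |M5| with hM
  have q1 := abs_nonneg M1
  have q2 := abs_nonneg M2
  have q3 := abs_nonneg M3
  have q4 := abs_nonneg M4
  have q5 := abs_nonneg M5
  have w1 := le_abs_self M1
  have w2 := le_abs_self M2
  have w3 := le_abs_self M3
  have w4 := le_abs_self M4
  have w5 := le_abs_self M5
  simp only [Real.norm_eq_abs] at h1 h2 h3 h4 h5
  refine ⟨2 * M, by positivity, fun p hp1 hp2 => ?_⟩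
  have hp : p ∈ Metric.closedBall (0 : ℝ × ℝ) A := by
    simp only [mem_closedBall_zero_iff, Prod.norm_def, Real.norm_eq_abs, sup_le_iff]; exact ⟨hp1, hp2⟩
  have hA : 0 ≤ A := (abs_nonneg _).trans hp1
  refine ⟨?_, ?_, ?_, ?_, ?_, ?_⟩
  · have := (convex_closedBall (0 : ℝ × ℝ) A).norm_image_sub_le_of_norm_hasFDerivWithin_le (C := 2 * M) (f := B)
      (fun q hq => (h.d0 q).hasFDerivWithinAt) (fun q hq => ?_) (Metric.mem_closedBall_self hA) hp
    · rw [h.zero, sub_zero, sub_zero, Real.norm_eq_abs] at this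
      refine this.trans ?_
      gcongr
      simp only [Prod.norm_def, Real.norm_eq_abs, sup_le_iff]
      constructor <;> linarith [abs_nonneg p.1, abs_nonneg p.2]
    · refine (norm_add_le _ _).trans ?_
      rw [norm_smul, norm_smul]
      have e1 := ContinuousLinearMap.norm_fst_le ℝ ℝ ℝ
      have e2 := ContinuousLinearMap.norm_snd_le ℝ ℝ ℝ
      have := h1 q hq
      have := h2 q hq
      rw [Real.norm_eq_abs, Real.norm_eq_abs]
      have a1 : |Bu q| * ‖ContinuousLinearMap.fst ℝ ℝ ℝ‖ ≤ |Bu q| * 1 := by gcongr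
      have a2 : |Bv q| * ‖ContinuousLinearMap.snd ℝ ℝ ℝ‖ ≤ |Bv q| * 1 := by gcongr
      linarith
  · linarith [h1 p hp]
  · linarith [h2 p hp]
  · linarith [h3 p hp]
  · linarith [h4 p hp]
  · linarith [h5 p hp]

lemma heat_pair_bound {f g : E3 → ℝ} (hf : Continuous f) (hfs : HasCompactSupport f) (hg : Continuous g)
    (hgs : HasCompactSupport g) {a b : ℝ} (ha : 0 < a) (hb : 0 < b) :
    ∃ A : ℝ, 0 < A ∧ ∃ c : ℝ, 0 < c ∧ ∀ t, a ≤ t → t ≤ b → ∀ x,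
      (|cv (hk t) f x| ≤ A * Real.exp (-(c * ‖x‖ ^ 2)) ∧ |cv (hk t) g x| ≤ A * Real.exp (-(c * ‖x‖ ^ 2))) ∧
      (|cv (hkt t) f x| ≤ A * Real.exp (-(c * ‖x‖ ^ 2)) ∧ |cv (hkt t) g x| ≤ A * Real.exp (-(c * ‖x‖ ^ 2))) ∧
      (∀ i, |cv (hk1 t i) f x| ≤ A * Real.exp (-(c * ‖x‖ ^ 2)) ∧ |cv (hk1 t i) g x| ≤ A * Real.exp (-(c * ‖x‖ ^ 2))) ∧
      (∀ i k, |cv (hk2 t i k) f x| ≤ A * Real.exp (-(c * ‖x‖ ^ 2)) ∧ |cv (hk2 t i k) g x| ≤ A * Real.exp (-(c * ‖x‖ ^ 2))) := by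
  obtain ⟨A1, hA1, h1⟩ := heat_decay hf hfs ha hb
  obtain ⟨A2, hA2, h2⟩ := heat_decay hg hgs ha hb
  refine ⟨A1 + A2, by positivity, 1 / (16 * b), by positivity, fun t hat htb x => ?_⟩
  obtain ⟨p1, p2, p3, p4⟩ := h1 t hat htb x
  obtain ⟨r1, r2, r3, r4⟩ := h2 t hat htb x
  have e1 : A1 * Real.exp (-(1 / (16 * b) * ‖x‖ ^ 2)) ≤ (A1 + A2) * Real.exp (-(1 / (16 * b) * ‖x‖ ^ 2)) := by
    gcongr; linarith
  have e2 : A2 * Real.exp (-(1 / (16 * b) * ‖x‖ ^ 2)) ≤ (A1 + A2) * Real.exp (-(1 / (16 * b) * ‖x‖ ^ 2)) := by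
    gcongr; linarith
  exact ⟨⟨p1.trans e1, r1.trans e2⟩, ⟨p4.trans e1, r4.trans e2⟩, fun i => ⟨(p2 i).trans e1, (r2 i).trans e2⟩,
    fun i k => ⟨(p3 i k).trans e1, (r3 i k).trans e2⟩⟩

lemma exp_gauss_le_one {c : ℝ} (hc : 0 < c) (x : E3) : Real.exp (-(c * ‖x‖ ^ 2)) ≤ 1 := by
  rw [Real.exp_le_one_iff]
  have : 0 ≤ c * ‖x‖ ^ 2 := by positivity
  linarith

/-- one integration by parts -/
lemma heat_ibp {f : E3 → ℝ} (hf : Continuous f) (hfs : HasCompactSupport f) (t : ℝ) (i k : Fin 3)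
    {U : E3 → ℝ} (hU : Differentiable ℝ U) {DU : E3 → ℝ} (hDU : ∀ x, fderiv ℝ U x (ee k) = DU x)
    (h1 : Integrable fun x => DU x * cv (hk1 t i) f x) (h2 : Integrable fun x => U x * cv (hk2 t i k) f x)
    (h3 : Integrable fun x => U x * cv (hk1 t i) f x) :
    ∫ x, U x * cv (hk2 t i k) f x = - ∫ x, DU x * cv (hk1 t i) f x := by
  have := integral_mul_fderiv_eq_neg_fderiv_mul_of_integrable (μ := (volume : Measure E3))
    (f := U) (g := cv (hk1 t i) f) (v := ee k) ?_ ?_ ?_ ?_ ?_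
  · simpa only [hDU, fderiv_cv_hk1 hf hfs] using this
  · simpa only [hDU] using h1
  · simpa only [fderiv_cv_hk1 hf hfs] using h2
  · exact h3
  · exact fun x _ => hU x
  · exact fun x _ => cv_differentiable (c1 (contDiff_hk1 t i)) hf hfs x

lemma heat_energy {B Bu Bv Buu Buv Bvv : ℝ × ℝ → ℝ} (h : PlaneC2 B Bu Bv Buu Buv Bvv)
    {f g : E3 → ℝ} (hf : Continuous f) (hfs : HasCompactSupport f) (hg : Continuous g)
    (hgs : HasCompactSupport g) {t : ℝ} (ht : 0 < t) :
    (∀ i, Integrable fun x => Buu (cv (hk t) f x, cv (hk t) g x) * cv (hk1 t i) f x ^ 2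
        + 2 * Buv (cv (hk t) f x, cv (hk t) g x) * cv (hk1 t i) f x * cv (hk1 t i) g x
        + Bvv (cv (hk t) f x, cv (hk t) g x) * cv (hk1 t i) g x ^ 2) ∧
    HasDerivAt (fun s => ∫ x, B (cv (hk s) f x, cv (hk s) g x))
      (- ∑ i, ∫ x, (Buu (cv (hk t) f x, cv (hk t) g x) * cv (hk1 t i) f x ^ 2
        + 2 * Buv (cv (hk t) f x, cv (hk t) g x) * cv (hk1 t i) f x * cv (hk1 t i) g x
        + Bvv (cv (hk t) f x, cv (hk t) g x) * cv (hk1 t i) g x ^ 2)) t := by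
  obtain ⟨A, hA, c, hc, hb⟩ := heat_pair_bound hf hfs hg hgs (by linarith : 0 < t/2) (by linarith : 0 < 2 * t)
  obtain ⟨M, hM, hB⟩ := h.bound A
  have hcu : Continuous Bu := continuous_iff_continuousAt.2 fun p => (h.du p).continuousAt
  have hcv : Continuous Bv := continuous_iff_continuousAt.2 fun p => (h.dv p).continuousAt
  have hc0 : Continuous B := continuous_iff_continuousAt.2 fun p => (h.d0 p).continuousAt
  set P : ℝ → E3 → ℝ × ℝ := fun s x => (cv (hk s) f x, cv (hk s) g x) with hP
  have hPc : ∀ s, Continuous (P s) := fun s =>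
    (cv_continuous (c1 (contDiff_hk s)) hf hfs).prodMk (cv_continuous (c1 (contDiff_hk s)) hg hgs)
  have e1 := exp_gauss_le_one hc
  have hmA : ∀ s, t/2 ≤ s → s ≤ 2*t → ∀ x, |(P s x).1| ≤ A ∧ |(P s x).2| ≤ A := by
    intro s h1 h2 x
    obtain ⟨⟨p1, p2⟩, -⟩ := hb s h1 h2 x
    have : A * Real.exp (-(c * ‖x‖ ^ 2)) ≤ A * 1 := by gcongr; exact e1 x
    exact ⟨by linarith, by linarith⟩
  have ht1 : t/2 ≤ t := by linarith
  have ht2 : t ≤ 2 * t := by linarith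
  have c1f := fun i => cv_continuous (c1 (contDiff_hk1 t i)) hf hfs
  have c1g := fun i => cv_continuous (c1 (contDiff_hk1 t i)) hg hgs
  have c2f := fun i k => cv_continuous (c1 (contDiff_hk2 t i k)) hf hfs
  have c2g := fun i k => cv_continuous (c1 (contDiff_hk2 t i k)) hg hgs
  -- generic integrability
  have gi : ∀ (X Y : E3 → ℝ) (N : ℝ), Continuous X → Continuous Y → (∀ x, |X x| ≤ N) →
      (∀ x, |Y x| ≤ A * Real.exp (-(c * ‖x‖ ^ 2))) → Integrable fun x => X x * Y x := by
    intro X Y N hX hY hXN hYA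
    refine integrable_of_gauss (A := N * A) (hX.mul hY).aestronglyMeasurable hc fun x => ?_
    rw [abs_mul, mul_assoc]
    exact mul_le_mul (hXN x) (hYA x) (abs_nonneg _) ((abs_nonneg _).trans (hXN x))
  have hb1f : ∀ i x, |cv (hk1 t i) f x| ≤ A * Real.exp (-(c * ‖x‖ ^ 2)) := fun i x => ((hb t ht1 ht2 x).2.2.1 i).1
  have hb1g : ∀ i x, |cv (hk1 t i) g x| ≤ A * Real.exp (-(c * ‖x‖ ^ 2)) := fun i x => ((hb t ht1 ht2 x).2.2.1 i).2
  have hbA : ∀ (y : ℝ) (x : E3), |y| ≤ A * Real.exp (-(c * ‖x‖ ^ 2)) → |y| ≤ A := by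
    intro y x hy
    have : A * Real.exp (-(c * ‖x‖ ^ 2)) ≤ A * 1 := by gcongr; exact e1 x
    linarith
  have bd := fun x => hB (P t x) (hmA t ht1 ht2 x).1 (hmA t ht1 ht2 x).2
  have Iuu : ∀ i, Integrable fun x => Buu (P t x) * cv (hk1 t i) f x ^ 2 := by
    intro i
    have := gi (fun x => Buu (P t x) * cv (hk1 t i) f x) (cv (hk1 t i) f) (M * A)
      ((h.cuu.comp (hPc t)).mul (c1f i)) (c1f i) (fun x => ?_) (hb1f i)
    · refine this.congr (Eventually.of_forall fun x => ?_); ring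
    · rw [abs_mul]; exact mul_le_mul (bd x).2.2.2.1 (hbA _ x (hb1f i x)) (abs_nonneg _) hM
  have Ivv : ∀ i, Integrable fun x => Bvv (P t x) * cv (hk1 t i) g x ^ 2 := by
    intro i
    have := gi (fun x => Bvv (P t x) * cv (hk1 t i) g x) (cv (hk1 t i) g) (M * A)
      ((h.cvv.comp (hPc t)).mul (c1g i)) (c1g i) (fun x => ?_) (hb1g i)
    · refine this.congr (Eventually.of_forall fun x => ?_); ring
    · rw [abs_mul]; exact mul_le_mul (bd x).2.2.2.2.2 (hbA _ x (hb1g i x)) (abs_nonneg _) hM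
  have Iuv : ∀ i, Integrable fun x => Buv (P t x) * cv (hk1 t i) f x * cv (hk1 t i) g x := by
    intro i
    exact gi (fun x => Buv (P t x) * cv (hk1 t i) f x) (cv (hk1 t i) g) (M * A)
      ((h.cuv.comp (hPc t)).mul (c1f i)) (c1g i) (fun x => by
        rw [abs_mul]; exact mul_le_mul (bd x).2.2.2.2.1 (hbA _ x (hb1f i x)) (abs_nonneg _) hM) (hb1g i)
  have Iall : ∀ i, Integrable fun x => Buu (P t x) * cv (hk1 t i) f x ^ 2
        + 2 * Buv (P t x) * cv (hk1 t i) f x * cv (hk1 t i) g x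
        + Bvv (P t x) * cv (hk1 t i) g x ^ 2 := by
    intro i
    refine (((Iuu i).add ((Iuv i).const_mul 2)).add (Ivv i)).congr (Eventually.of_forall fun x => ?_)
    simp; ring
  refine ⟨Iall, ?_⟩
  have hPd : ∀ x, HasFDerivAt (P t) ((fderiv ℝ (cv (hk t) f) x).prod (fderiv ℝ (cv (hk t) g) x)) x := fun x =>
    (cv_differentiable (c1 (contDiff_hk t)) hf hfs x).hasFDerivAt.prodMk
      (cv_differentiable (c1 (contDiff_hk t)) hg hgs x).hasFDerivAt
  have hDu : ∀ x i, fderiv ℝ (fun x => Bu (P t x)) x (ee i) =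
      Buu (P t x) * cv (hk1 t i) f x + Buv (P t x) * cv (hk1 t i) g x := by
    intro x i
    have := ((h.du (P t x)).comp x (hPd x)).fderiv
    have h2 : fderiv ℝ (fun x => Bu (P t x)) x = _ := this
    rw [h2]
    simp [fderiv_cv_hk hf hfs, fderiv_cv_hk hg hgs]
  have hDv : ∀ x i, fderiv ℝ (fun x => Bv (P t x)) x (ee i) =
      Buv (P t x) * cv (hk1 t i) f x + Bvv (P t x) * cv (hk1 t i) g x := by
    intro x i
    have := ((h.dv (P t x)).comp x (hPd x)).fderiv
    have h2 : fderiv ℝ (fun x => Bv (P t x)) x = _ := this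
    rw [h2]
    simp [fderiv_cv_hk hf hfs, fderiv_cv_hk hg hgs]
  have Du : Differentiable ℝ fun x => Bu (P t x) := fun x => ((h.du (P t x)).comp x (hPd x)).differentiableAt
  have Dv : Differentiable ℝ fun x => Bv (P t x) := fun x => ((h.dv (P t x)).comp x (hPd x)).differentiableAt
  have Tu : ∀ i, Integrable fun x => Bu (P t x) * cv (hk2 t i i) f x := fun i =>
    gi _ _ M (hcu.comp (hPc t)) (c2f i i) (fun x => (bd x).2.1) (fun x => ((hb t ht1 ht2 x).2.2.2 i i).1)
  have Tv : ∀ i, Integrable fun x => Bv (P t x) * cv (hk2 t i i) g x := fun i =>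
    gi _ _ M (hcv.comp (hPc t)) (c2g i i) (fun x => (bd x).2.2.1) (fun x => ((hb t ht1 ht2 x).2.2.2 i i).2)
  have hu : ∀ i, ∫ x, Bu (P t x) * cv (hk2 t i i) f x =
      - ∫ x, (Buu (P t x) * cv (hk1 t i) f x + Buv (P t x) * cv (hk1 t i) g x) * cv (hk1 t i) f x := by
    intro i
    refine heat_ibp hf hfs t i i Du (fun x => hDu x i) ?_ (Tu i) ?_
    · refine ((Iuu i).add (Iuv i)).congr (Eventually.of_forall fun x => ?_)
      simp; ring
    · exact gi _ _ M (hcu.comp (hPc t)) (c1f i) (fun x => (bd x).2.1) (hb1f i)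
  have hv : ∀ i, ∫ x, Bv (P t x) * cv (hk2 t i i) g x =
      - ∫ x, (Buv (P t x) * cv (hk1 t i) f x + Bvv (P t x) * cv (hk1 t i) g x) * cv (hk1 t i) g x := by
    intro i
    refine heat_ibp hg hgs t i i Dv (fun x => hDv x i) ?_ (Tv i) ?_
    · refine ((Iuv i).add (Ivv i)).congr (Eventually.of_forall fun x => ?_)
      simp; ring
    · exact gi _ _ M (hcv.comp (hPc t)) (c1g i) (fun x => (bd x).2.2.1) (hb1g i)
  have main := hasDerivAt_integral_of_dominated_loc_of_deriv_le (μ := (volume : Measure E3)) (𝕜 := ℝ)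
    (F := fun s x => B (P s x))
    (F' := fun s x => Bu (P s x) * cv (hkt s) f x + Bv (P s x) * cv (hkt s) g x) (x₀ := t)
    (bound := fun x => 2 * M * A * Real.exp (-(c * ‖x‖ ^ 2)))
    (Icc_mem_nhds (by linarith : t/2 < t) (by linarith : t < 2*t))
    (Eventually.of_forall fun s => (hc0.comp (hPc s)).aestronglyMeasurable)
    (integrable_of_gauss (A := 2 * M * A) (hc0.comp (hPc t)).aestronglyMeasurable hc fun x => ?_)
    (((hcu.comp (hPc t)).mul (cv_hkt_continuous hf hfs t)).add
      ((hcv.comp (hPc t)).mul (cv_hkt_continuous hg hgs t))).aestronglyMeasurable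
    (Eventually.of_forall fun x s hs => ?_)
    ((integrable_gauss hc).const_mul _)
    (Eventually.of_forall fun x s hs => ?_)
  · refine main.2.congr_deriv ?_
    have e2 : ∀ x, Bu (P t x) * cv (hkt t) f x + Bv (P t x) * cv (hkt t) g x =
        ∑ i, (Bu (P t x) * cv (hk2 t i i) f x + Bv (P t x) * cv (hk2 t i i) g x) := by
      intro x
      rw [cv_hkt hf hfs, cv_hkt hg hgs, Finset.mul_sum, Finset.mul_sum, Finset.sum_add_distrib]
    simp_rw [e2]
    have Tuv : ∀ i ∈ Finset.univ, Integrable fun x => Bu (P t x) * cv (hk2 t i i) f x + Bv (P t x) * cv (hk2 t i i) g x :=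
      fun i _ => (Tu i).add (Tv i)
    rw [integral_finsetSum _ Tuv, ← Finset.sum_neg_distrib]
    refine Finset.sum_congr rfl fun i _ => ?_
    rw [integral_add (Tu i) (Tv i), hu, hv, ← neg_add, ← integral_add]
    · congr 1
      refine integral_congr_ae (Eventually.of_forall fun x => ?_)
      simp only [hP]; ring
    · refine ((Iuu i).add (Iuv i)).congr (Eventually.of_forall fun x => ?_)
      simp; ring
    · refine ((Iuv i).add (Ivv i)).congr (Eventually.of_forall fun x => ?_)
      simp; ring
  · refine (bd x).1.trans ?_
    obtain ⟨⟨p1, p2⟩, -⟩ := hb t ht1 ht2 x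
    have : M * (|(P t x).1| + |(P t x).2|) ≤ M * (A * Real.exp (-(c * ‖x‖ ^ 2)) + A * Real.exp (-(c * ‖x‖ ^ 2))) := by
      gcongr
    linarith
  · obtain ⟨-, ⟨p1, p2⟩, -⟩ := hb s hs.1 hs.2 x
    have b2 := hB (P s x) (hmA s hs.1 hs.2 x).1 (hmA s hs.1 hs.2 x).2
    rw [Real.norm_eq_abs]
    refine (abs_add_le _ _).trans ?_
    rw [abs_mul, abs_mul]
    have a1 := mul_le_mul b2.2.1 p1 (abs_nonneg _) hM
    have a2 := mul_le_mul b2.2.2.1 p2 (abs_nonneg _) hM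
    linarith
  · have hs0 : 0 < s := by linarith [hs.1]
    have := (h.d0 (P s x)).comp_hasDerivAt s ((cv_time hf hfs hs0 x).prodMk (cv_time hg hgs hs0 x))
    refine this.congr_deriv ?_
    simp

end EnergySec

section BellmanSec

def bh (s v : ℝ) : ℝ := √(s ^ 4 + v ^ 2)
def bm (s : ℝ) (p : ℝ × ℝ) : ℝ := √(p.1 ^ 2 + bh s p.2)

lemma bh_pos {s : ℝ} (hs : 0 < s) (v : ℝ) : 0 < bh s v := by unfold bh; positivity
lemma bh_sq {s : ℝ} (v : ℝ) : bh s v ^ 2 = s ^ 4 + v ^ 2 := Real.sq_sqrt (by positivity)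
lemma bm_pos {s : ℝ} (hs : 0 < s) (p : ℝ × ℝ) : 0 < bm s p := by
  have := bh_pos hs p.2
  unfold bm; positivity
lemma bm_sq {s : ℝ} (hs : 0 < s) (p : ℝ × ℝ) : bm s p ^ 2 = p.1 ^ 2 + bh s p.2 := by
  have := bh_pos hs p.2
  exact Real.sq_sqrt (by positivity)

lemma bh_deriv {s : ℝ} (hs : 0 < s) (v : ℝ) : HasDerivAt (bh s) (v / bh s v) v := by
  have h1 : HasDerivAt (fun v : ℝ => s ^ 4 + v ^ 2) (2 * v) v := by
    simpa using ((hasDerivAt_id v).pow 2).const_add (s ^ 4)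
  have h2 := h1.sqrt (by positivity)
  refine h2.congr_deriv ?_
  have := bh_pos hs v
  unfold bh at *
  field_simp

lemma bh_deriv2 {s : ℝ} (hs : 0 < s) (v : ℝ) : HasDerivAt (fun v => v / bh s v) (s ^ 4 / bh s v ^ 3) v := by
  have hp := bh_pos hs v
  refine ((hasDerivAt_id v).div (bh_deriv hs v) hp.ne').congr_deriv ?_
  have := bh_sq (s := s) v
  simp only [id]
  field_simp
  linarith

lemma bm_deriv {s : ℝ} (hs : 0 < s) (p : ℝ × ℝ) : HasFDerivAt (bm s)
    ((p.1 / bm s p) • ContinuousLinearMap.fst ℝ ℝ ℝ + (p.2 / bh s p.2 / (2 * bm s p)) • ContinuousLinearMap.snd ℝ ℝ ℝ) p := by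
  have hp := bh_pos hs p.2
  have hm := bm_pos hs p
  have h1 : HasFDerivAt (fun p : ℝ × ℝ => p.1) (ContinuousLinearMap.fst ℝ ℝ ℝ) p := hasFDerivAt_fst
  have h2 : HasFDerivAt (fun p : ℝ × ℝ => p.2) (ContinuousLinearMap.snd ℝ ℝ ℝ) p := hasFDerivAt_snd
  have h3 := (h1.pow 2).add ((bh_deriv hs p.2).comp_hasFDerivAt p h2)
  have h4 := h3.sqrt (by simp; positivity)
  have h5 : HasFDerivAt (bm s) _ p := h4
  refine h5.congr_fderiv ?_
  have e : √(p.1 ^ 2 + bh s p.2) = bm s p := rfl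
  ext
  · simp [e]; field_simp
  · simp [e]; field_simp

lemma bm_contDiff {s : ℝ} (hs : 0 < s) : Continuous (bm s) :=
  continuous_iff_continuousAt.2 fun p => (bm_deriv hs p).continuousAt

lemma bh_cont {s : ℝ} : Continuous (bh s) := by unfold bh; fun_prop

lemma bellman_C2 {s : ℝ} (hs : 0 < s) : PlaneC2 (fun p => bm s p ^ 3 - s ^ 3) (fun p => 3 * p.1 * bm s p)
    (fun p => 3 / 2 * (bm s p * (p.2 / bh s p.2))) (fun p => 3 * bm s p + 3 * p.1 ^ 2 / bm s p)
    (fun p => 3 * p.1 * (p.2 / bh s p.2) / (2 * bm s p))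
    (fun p => 3 / 2 * (bm s p * (s ^ 4 / bh s p.2 ^ 3) + (p.2 / bh s p.2) ^ 2 / (2 * bm s p))) := by
  have h1 : ∀ p, HasFDerivAt (fun p : ℝ × ℝ => p.1) (ContinuousLinearMap.fst ℝ ℝ ℝ) p := fun p => hasFDerivAt_fst
  have h2 : ∀ p, HasFDerivAt (fun p : ℝ × ℝ => p.2) (ContinuousLinearMap.snd ℝ ℝ ℝ) p := fun p => hasFDerivAt_snd
  have cm := bm_contDiff hs
  have ch : Continuous fun p : ℝ × ℝ => bh s p.2 := bh_cont.comp continuous_snd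
  have hm0 : ∀ p, bm s p ≠ 0 := fun p => (bm_pos hs p).ne'
  have hh0 : ∀ p : ℝ × ℝ, bh s p.2 ≠ 0 := fun p => (bh_pos hs p.2).ne'
  constructor
  · have : bh s 0 = s ^ 2 := by
      unfold bh; rw [show s ^ 4 + 0 ^ 2 = (s ^ 2) ^ 2 by ring]; exact Real.sqrt_sq (by positivity)
    have h3 : bm s 0 = s := by
      unfold bm; simp [this]; exact Real.sqrt_sq hs.le
    simp [h3]
  · intro p
    have := ((bm_deriv hs p).pow 3).sub_const (s ^ 3)
    refine this.congr_fderiv ?_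
    have := hm0 p
    have := hh0 p
    ext <;> simp <;> field_simp
  · intro p
    have := ((h1 p).const_mul 3).mul (bm_deriv hs p)
    refine this.congr_fderiv ?_
    have := hm0 p
    have := hh0 p
    ext
    · simp; field_simp; ring
    · simp; field_simp
  · intro p
    have := ((bm_deriv hs p).mul ((bh_deriv2 hs p.2).comp_hasFDerivAt p (h2 p))).const_mul (3/2)
    have h5 : HasFDerivAt (fun p : ℝ × ℝ => 3 / 2 * (bm s p * (p.2 / bh s p.2))) _ p := this
    refine h5.congr_fderiv ?_
    have := hm0 p
    have := hh0 p
    ext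
    · simp; field_simp
    · simp; field_simp
  · exact (continuous_const.mul cm).add (Continuous.div (by fun_prop) cm hm0)
  · exact Continuous.div ((by fun_prop : Continuous fun p : ℝ × ℝ => 3 * p.1).mul (continuous_snd.div ch hh0)) (by fun_prop)
      (fun p => mul_ne_zero two_ne_zero (hm0 p))
  · refine continuous_const.mul ((cm.mul (Continuous.div continuous_const (ch.pow 3) fun p => pow_ne_zero _ (hh0 p))).add
      (((continuous_snd.div ch hh0).pow 2).div (by fun_prop) (fun p => mul_ne_zero two_ne_zero (hm0 p))))

lemma bellman_Q {s : ℝ} (hs : 0 < s) (p : ℝ × ℝ) (a b : ℝ) :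
    3 / 2 * bm s p * a ^ 2 + 3 / 16 * (b ^ 2 / bm s p) ≤ (3 * bm s p + 3 * p.1 ^ 2 / bm s p) * a ^ 2
      + 2 * (3 * p.1 * (p.2 / bh s p.2) / (2 * bm s p)) * a * b
      + (3 / 2 * (bm s p * (s ^ 4 / bh s p.2 ^ 3) + (p.2 / bh s p.2) ^ 2 / (2 * bm s p))) * b ^ 2 := by
  have hm := bm_pos hs p
  have hh := bh_pos hs p.2
  have hm2 := bm_sq hs p
  have hh2 := bh_sq (s := s) p.2
  set m := bm s p
  set h := bh s p.2
  set w := p.2 / h with hw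
  set k := s ^ 4 / h ^ 3 with hk
  have hk0 : 0 < k := by positivity
  have e1 : w ^ 2 + h * k = 1 := by
    rw [hw, hk]; field_simp; linarith
  have e2 : h * k ≤ m ^ 2 * k := by
    gcongr; nlinarith [sq_nonneg p.1]
  have e3 : (3 * m + 3 * p.1 ^ 2 / m) * a ^ 2 + 2 * (3 * p.1 * w / (2 * m)) * a * b + (3 / 2 * (m * k + w ^ 2 / (2 * m))) * b ^ 2
      - (3 / 2 * m * a ^ 2 + 3 / 16 * (b ^ 2 / m))
      = (3/2 * (m ^ 2 - p.1 ^ 2) * a ^ 2 + (3/2) * (p.1 * a + w * b / 2) ^ 2 + 3 / 2 * (2 * (p.1 * a) ^ 2 + 2 * (p.1 * a) * (w * b / 2) + (w * b / 2) ^ 2 / 2)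
        + (3/16) * (w ^ 2 + h * k - 1) * b ^ 2 + (3/16) * (8 * m ^ 2 * k - h * k) * b ^ 2) / m := by
    field_simp
    ring
  rw [← sub_nonneg, e3]
  apply div_nonneg _ hm.le
  rw [e1]
  have t1 : 0 ≤ 3/2 * (m ^ 2 - p.1 ^ 2) * a ^ 2 := by rw [hm2]; ring_nf; positivity
  have t2 : 0 ≤ (3/16) * (8 * m ^ 2 * k - h * k) * b ^ 2 := by
    have : 0 ≤ 8 * m ^ 2 * k - h * k := by nlinarith [mul_pos (pow_pos hm 2) hk0]
    positivity
  nlinarith [sq_nonneg (p.1 * a + w * b / 2), sq_nonneg (2 * (p.1 * a) + w * b / 2)]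

lemma bellman_Q_nonneg {s : ℝ} (hs : 0 < s) (p : ℝ × ℝ) (a b : ℝ) :
    0 ≤ 3 / 2 * bm s p * a ^ 2 + 3 / 16 * (b ^ 2 / bm s p) := by
  have := bm_pos hs p
  positivity

lemma bellman_Q_mul {m : ℝ} (hm : 0 < m) (a b : ℝ) :
    |a| * |b| ≤ 3 / 2 * m * a ^ 2 + 3 / 16 * (b ^ 2 / m) := by
  have : 3 / 2 * m * a ^ 2 + 3 / 16 * (b ^ 2 / m) - |a| * |b| = (3 / 2 * (m * |a|) ^ 2 + 3 / 16 * |b| ^ 2 - (m * |a|) * |b|) / m := by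
    field_simp
    rw [sq_abs, sq_abs]
    ring
  rw [← sub_nonneg, this]
  apply div_nonneg _ hm.le
  nlinarith [sq_nonneg (3 * (m * |a|) - |b|), sq_nonneg (m * |a|), sq_nonneg b, sq_abs b, abs_nonneg b, mul_nonneg hm.le (abs_nonneg a)]

lemma bellman_nonneg {s : ℝ} (hs : 0 < s) (p : ℝ × ℝ) : 0 ≤ bm s p ^ 3 - s ^ 3 := by
  have h1 : s ^ 2 ≤ bh s p.2 := by
    unfold bh; apply Real.le_sqrt_of_sq_le; nlinarith [sq_nonneg p.2]
  have h2 : s ≤ bm s p := by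
    unfold bm; apply Real.le_sqrt_of_sq_le; nlinarith [sq_nonneg p.1]
  have : s ^ 3 ≤ bm s p ^ 3 := by gcongr
  linarith

lemma bellman_upper {s : ℝ} (hs : 0 < s) (p : ℝ × ℝ) :
    bm s p ^ 3 - s ^ 3 ≤ 2 * s * (p.1 ^ 2 + |p.2|) + 3 * (|p.1| ^ (3:ℝ) + |p.2| ^ (3/2:ℝ)) := by
  set A := p.1 ^ 2 + |p.2| with hA
  have hA0 : 0 ≤ A := by positivity
  have h0 : bh s p.2 ≤ s ^ 2 + |p.2| := by
    unfold bh
    rw [Real.sqrt_le_left (by positivity)]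
    nlinarith [sq_abs p.2, abs_nonneg p.2, mul_nonneg (sq_nonneg s) (abs_nonneg p.2)]
  have hm := bm_pos hs p
  have hm2 := bm_sq hs p
  have h1 : bm s p ^ 2 ≤ s ^ 2 + A := by rw [hm2]; linarith
  have hsA : √A ^ 2 = A := Real.sq_sqrt hA0
  have h2 : bm s p ≤ s + √A := by
    refine (sq_le_sq₀ hm.le (by positivity)).1 ?_
    nlinarith [mul_nonneg hs.le (Real.sqrt_nonneg A)]
  have h3 : s ≤ bm s p := by
    have h1 : s ^ 2 ≤ bh s p.2 := by
      unfold bh; apply Real.le_sqrt_of_sq_le; nlinarith [sq_nonneg p.2]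
    unfold bm; apply Real.le_sqrt_of_sq_le; nlinarith [sq_nonneg p.1]
  have h4 : bm s p ^ 3 - s ^ 3 ≤ A * (bm s p + s) := by
    have : (bm s p ^ 3 - s ^ 3) ≤ (bm s p ^ 2 - s ^ 2) * (bm s p + s) := by nlinarith [mul_pos hm hs]
    refine this.trans ?_
    gcongr
    linarith
  have h5 : A * √A ≤ 3 * (|p.1| ^ (3:ℝ) + |p.2| ^ (3/2:ℝ)) := by
    have e1 : A * √A = A ^ (3/2:ℝ) := by
      rw [Real.sqrt_eq_rpow]
      rcases hA0.eq_or_lt with h | h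
      · rw [← h]; norm_num
      · nth_rw 1 [← Real.rpow_one A]; rw [← Real.rpow_add h]; norm_num
    have e2 : (p.1 ^ 2) ^ (3/2:ℝ) = |p.1| ^ (3:ℝ) := by
      rw [← sq_abs, ← Real.rpow_natCast, ← Real.rpow_mul (abs_nonneg _)]; norm_num
    have e3 : (2:ℝ) ^ (3/2:ℝ) ≤ 3 := by
      have : (2:ℝ) ^ (3/2:ℝ) = 2 * √2 := by
        rw [Real.sqrt_eq_rpow, show (3/2:ℝ) = 1 + 1/2 by norm_num, Real.rpow_add two_pos, Real.rpow_one]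
      rw [this]
      have := Real.sqrt_le_sqrt (show (2:ℝ) ≤ 1.5 ^ 2 by norm_num)
      rw [Real.sqrt_sq (by norm_num)] at this
      linarith
    rw [e1, ← e2]
    set X := p.1 ^ 2
    set Y := |p.2|
    have hX : 0 ≤ X := sq_nonneg _
    have hY : 0 ≤ Y := abs_nonneg _
    have hmx : A ≤ 2 * max X Y := by
      rw [hA]; linarith [le_max_left X Y, le_max_right X Y]
    have hm0 : 0 ≤ max X Y := hX.trans (le_max_left _ _)
    calc A ^ (3/2:ℝ) ≤ (2 * max X Y) ^ (3/2:ℝ) := by gcongr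
      _ = 2 ^ (3/2:ℝ) * (max X Y) ^ (3/2:ℝ) := Real.mul_rpow two_pos.le hm0
      _ ≤ 3 * (X ^ (3/2:ℝ) + Y ^ (3/2:ℝ)) := by
        gcongr
        have : 0 ≤ X ^ (3/2:ℝ) := by positivity
        have : 0 ≤ Y ^ (3/2:ℝ) := by positivity
        rcases max_cases X Y with ⟨h, _⟩ | ⟨h, _⟩ <;> rw [h] <;> linarith
  nlinarith

end BellmanSec

section BellmanIntSec

lemma lintegral_hk {t : ℝ} (ht : 0 < t) : ∫⁻ z : E3, ENNReal.ofReal (hk t z) = 1 := by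
  rw [← ofReal_integral_eq_lintegral_ofReal (integrable_hk ht) (Eventually.of_forall fun z => (hk_pos ht z).le),
    integral_hk ht, ENNReal.ofReal_one]

lemma enorm_cv_le (K f : E3 → ℝ) (x : E3) : ‖cv K f x‖ₑ ≤ ∫⁻ y, ‖K (x - y)‖ₑ * ‖f y‖ₑ := by
  unfold cv
  refine (enorm_integral_le_lintegral_enorm _).trans (le_of_eq ?_)
  simp only [enorm_mul]

lemma heat_jensen {f : E3 → ℝ} (hf : Continuous f) {t q : ℝ} (ht : 0 < t) (hq : 1 ≤ q) :
    ∫⁻ x, ‖cv (hk t) f x‖ₑ ^ q ≤ ∫⁻ x, ‖f x‖ₑ ^ q := by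
  have hq0 : 0 < q := by linarith
  have hkm : Measurable (hk t) := (contDiff_hk t).continuous.measurable
  have hfm : Measurable f := hf.measurable
  have key : ∀ x, ‖cv (hk t) f x‖ₑ ^ q ≤ ∫⁻ y, ENNReal.ofReal (hk t (x - y)) * ‖f y‖ₑ ^ q := by
    intro x
    have hm : Measurable fun y => ENNReal.ofReal (hk t (x - y)) :=
      (hkm.comp (measurable_const.sub measurable_id)).ennreal_ofReal
    set ν : Measure E3 := volume.withDensity fun y => ENNReal.ofReal (hk t (x - y)) with hν
    have : IsProbabilityMeasure ν := ⟨by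
      rw [hν, withDensity_apply _ MeasurableSet.univ, Measure.restrict_univ,
        lintegral_sub_left_eq_self (fun z => ENNReal.ofReal (hk t z)) x, lintegral_hk ht]⟩
    have h1 := eLpNorm'_le_eLpNorm'_of_exponent_le one_pos hq ν hfm.aestronglyMeasurable
    have h2 : ‖cv (hk t) f x‖ₑ ≤ eLpNorm' f 1 ν := by
      refine (enorm_cv_le _ _ _).trans (le_of_eq ?_)
      rw [eLpNorm'_eq_lintegral_enorm, hν]
      simp only [ENNReal.rpow_one, div_one]
      rw [lintegral_withDensity_eq_lintegral_mul _ hm hfm.enorm]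
      refine lintegral_congr fun y => ?_
      rw [Pi.mul_apply, Real.enorm_eq_ofReal (hk_pos ht _).le]
    calc ‖cv (hk t) f x‖ₑ ^ q ≤ (eLpNorm' f q ν) ^ q := by gcongr; exact h2.trans h1
      _ = _ := by
        rw [eLpNorm'_eq_lintegral_enorm, ← ENNReal.rpow_mul, one_div, inv_mul_cancel₀ hq0.ne', ENNReal.rpow_one, hν,
          lintegral_withDensity_eq_lintegral_mul _ hm (hfm.enorm.pow_const q)]
        rfl
  calc _ ≤ ∫⁻ x, ∫⁻ y, ENNReal.ofReal (hk t (x - y)) * ‖f y‖ₑ ^ q := lintegral_mono key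
    _ = ∫⁻ y, ∫⁻ x, ENNReal.ofReal (hk t (x - y)) * ‖f y‖ₑ ^ q := by
        apply lintegral_lintegral_swap
        apply Measurable.aemeasurable
        exact ((hkm.comp (measurable_fst.sub measurable_snd)).ennreal_ofReal).mul
          ((hfm.comp measurable_snd).enorm.pow_const q)
    _ = _ := by
        refine lintegral_congr fun y => ?_
        rw [lintegral_mul_const, lintegral_sub_right_eq_self (fun z => ENNReal.ofReal (hk t z)) y, lintegral_hk ht, one_mul]
        exact (hkm.comp (measurable_id.sub measurable_const)).ennreal_ofReal

lemma ofReal_integral_le_lint {F : E3 → ℝ} (hF : ∀ x, 0 ≤ F x) :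
    ENNReal.ofReal (∫ x, F x) ≤ ∫⁻ x, ENNReal.ofReal (F x) := by
  rw [← Real.enorm_eq_ofReal (integral_nonneg hF)]
  refine (enorm_integral_le_lintegral_enorm _).trans (le_of_eq ?_)
  exact lintegral_congr fun x => Real.enorm_eq_ofReal (hF x)

/-- Integral inequality on a time window. -/
lemma bellman_window {f g : E3 → ℝ} (hf : Continuous f) (hfs : HasCompactSupport f) (hg : Continuous g)
    (hgs : HasCompactSupport g) (i j : Fin 3) {a b : ℝ} (ha : 0 < a) (hab : a ≤ b) {s : ℝ} (hs : 0 < s) :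
    ∫⁻ t in Set.Ioc a b, ∫⁻ x, ‖cv (hk1 t i) f x‖ₑ * ‖cv (hk1 t j) g x‖ₑ ≤
      ENNReal.ofReal (∫ x, (bm s (cv (hk a) f x, cv (hk a) g x) ^ 3 - s ^ 3)) := by
  have hC := bellman_C2 hs
  set Q : Fin 3 → ℝ → E3 → ℝ := fun k t x => (3 * bm s (cv (hk t) f x, cv (hk t) g x) + 3 * (cv (hk t) f x) ^ 2 / bm s (cv (hk t) f x, cv (hk t) g x)) * cv (hk1 t k) f x ^ 2
      + 2 * (3 * (cv (hk t) f x) * (cv (hk t) g x / bh s (cv (hk t) g x)) / (2 * bm s (cv (hk t) f x, cv (hk t) g x))) * cv (hk1 t k) f x * cv (hk1 t k) g x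
      + (3 / 2 * (bm s (cv (hk t) f x, cv (hk t) g x) * (s ^ 4 / bh s (cv (hk t) g x) ^ 3) + (cv (hk t) g x / bh s (cv (hk t) g x)) ^ 2 / (2 * bm s (cv (hk t) f x, cv (hk t) g x)))) * cv (hk1 t k) g x ^ 2 with hQ
  have hI : ∀ t, 0 < t → ∀ k, Integrable (Q k t) := fun t ht k => (heat_energy hC hf hfs hg hgs ht).1 k
  set m : ℝ → ℝ := fun t => ∫ x, (bm s (cv (hk t) f x, cv (hk t) g x) ^ 3 - s ^ 3) with hm
  have hD : ∀ t, 0 < t → HasDerivAt m (- ∑ k, ∫ x, Q k t x) t := fun t ht => (heat_energy hC hf hfs hg hgs ht).2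
  have hQ0 : ∀ k t x, 3 / 2 * bm s (cv (hk t) f x, cv (hk t) g x) * cv (hk1 t k) f x ^ 2
      + 3 / 16 * (cv (hk1 t k) g x ^ 2 / bm s (cv (hk t) f x, cv (hk t) g x)) ≤ Q k t x := fun k t x =>
    bellman_Q hs (cv (hk t) f x, cv (hk t) g x) _ _
  have hQn : ∀ k t x, 0 ≤ Q k t x := fun k t x => (bellman_Q_nonneg hs _ _ _).trans (hQ0 k t x)
  have hpt : ∀ t x, |cv (hk1 t i) f x| * |cv (hk1 t j) g x| ≤ ∑ k, Q k t x := by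
    intro t x
    have hmp := bm_pos hs (cv (hk t) f x, cv (hk t) g x)
    refine (bellman_Q_mul hmp _ _).trans ?_
    rcases eq_or_ne i j with rfl | hij
    · exact (hQ0 i t x).trans (Finset.single_le_sum (f := fun k => Q k t x) (fun k _ => hQn k t x) (Finset.mem_univ i))
    · have h2 : Q i t x + Q j t x ≤ ∑ k, Q k t x := by
        rw [← Finset.sum_pair (f := fun k => Q k t x) hij]
        exact Finset.sum_le_sum_of_subset_of_nonneg (Finset.subset_univ _) fun k _ _ => hQn k t x
      refine le_trans ?_ h2
      refine add_le_add ((le_add_of_nonneg_right ?_).trans (hQ0 i t x)) ((le_add_of_nonneg_left ?_).trans (hQ0 j t x)) <;> positivity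
  have hIs : ∀ t, 0 < t → Integrable fun x => ∑ k, Q k t x := fun t ht => integrable_finsetSum _ fun k _ => hI t ht k
  have hsum : ∀ t, 0 < t → ∑ k, ∫ x, Q k t x = ∫ x, ∑ k, Q k t x := fun t ht =>
    (integral_finsetSum _ fun k _ => hI t ht k).symm
  have hn : ∀ t, 0 ≤ ∑ k, ∫ x, Q k t x := fun t => Finset.sum_nonneg fun k _ => integral_nonneg (hQn k t)
  have hcont : ContinuousOn (fun t => - m t) (Set.Icc a b) := fun t ht =>
    (hD t (ha.trans_le ht.1)).neg.continuousAt.continuousWithinAt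
  have hdn : ∀ t ∈ Set.Ioo a b, HasDerivAt (fun t => - m t) (∑ k, ∫ x, Q k t x) t := fun t ht => by
    exact (hD t (ha.trans ht.1)).neg.congr_deriv (neg_neg _)
  have hIntg := intervalIntegral.integrableOn_deriv_of_nonneg hcont hdn fun t _ => hn t
  have hftc := intervalIntegral.integral_eq_sub_of_hasDerivAt_of_le hab hcont hdn
    ((intervalIntegrable_iff_integrableOn_Ioc_of_le hab).2 hIntg)
  calc _ ≤ ∫⁻ t in Set.Ioc a b, ENNReal.ofReal (∑ k, ∫ x, Q k t x) := by
        refine setLIntegral_mono' measurableSet_Ioc fun t ht => ?_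
        have ht0 : 0 < t := ha.trans ht.1
        rw [hsum t ht0, ofReal_integral_eq_lintegral_ofReal (hIs t ht0)
          (Eventually.of_forall fun x => Finset.sum_nonneg fun k _ => hQn k t x)]
        refine lintegral_mono fun x => ?_
        rw [← enorm_mul, Real.enorm_eq_ofReal_abs, abs_mul]
        exact ENNReal.ofReal_le_ofReal (hpt t x)
    _ = ENNReal.ofReal (∫ t in Set.Ioc a b, ∑ k, ∫ x, Q k t x) :=
        (ofReal_integral_eq_lintegral_ofReal hIntg (Eventually.of_forall hn)).symm
    _ ≤ _ := by
        apply ENNReal.ofReal_le_ofReal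
        rw [← intervalIntegral.integral_of_le hab, hftc]
        have : 0 ≤ m b := integral_nonneg fun x => bellman_nonneg hs _
        linarith

lemma bellman_window0 {f g : E3 → ℝ} (hf : Continuous f) (hfs : HasCompactSupport f) (hg : Continuous g)
    (hgs : HasCompactSupport g) (i j : Fin 3) {a b : ℝ} (ha : 0 < a) (hab : a ≤ b) :
    ∫⁻ t in Set.Ioc a b, ∫⁻ x, ‖cv (hk1 t i) f x‖ₑ * ‖cv (hk1 t j) g x‖ₑ ≤
      3 * ((∫⁻ x, ‖f x‖ₑ ^ (3:ℝ)) + ∫⁻ x, ‖g x‖ₑ ^ (3/2:ℝ)) := by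
  set u := cv (hk a) f with hu
  set v := cv (hk a) g with hv
  have cu : Continuous u := cv_continuous (c1 (contDiff_hk a)) hf hfs
  have cv' : Continuous v := cv_continuous (c1 (contDiff_hk a)) hg hgs
  obtain ⟨A, hA, c, hc, hb⟩ := heat_pair_bound hf hfs hg hgs ha ha
  have hb1 : ∀ x, |u x| ≤ A * Real.exp (-(c * ‖x‖ ^ 2)) := fun x => (hb a le_rfl le_rfl x).1.1
  have hb2 : ∀ x, |v x| ≤ A * Real.exp (-(c * ‖x‖ ^ 2)) := fun x => (hb a le_rfl le_rfl x).1.2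
  have hI : Integrable fun x => u x ^ 2 + |v x| := by
    refine integrable_of_gauss (A := A * A + A) ((cu.pow 2).add cv'.abs).aestronglyMeasurable hc fun x => ?_
    have e1 := exp_gauss_le_one hc x
    have e2 : |u x| ≤ A := (hb1 x).trans (mul_le_of_le_one_right hA.le e1)
    rw [abs_of_nonneg (by positivity), ← sq_abs]
    nlinarith [hb1 x, hb2 x, abs_nonneg (u x), mul_le_mul e2 (hb1 x) (abs_nonneg _) hA.le]
  set L := ∫⁻ x, ENNReal.ofReal (u x ^ 2 + |v x|) with hL
  have hLf : L ≠ ∞ := by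
    rw [hL, ← ofReal_integral_eq_lintegral_ofReal hI (Eventually.of_forall fun x => by positivity)]
    exact ENNReal.ofReal_ne_top
  have step : ∀ s : ℝ, 0 < s → ∫⁻ t in Set.Ioc a b, ∫⁻ x, ‖cv (hk1 t i) f x‖ₑ * ‖cv (hk1 t j) g x‖ₑ ≤
      ENNReal.ofReal (2 * s) * L + 3 * ((∫⁻ x, ‖f x‖ₑ ^ (3:ℝ)) + ∫⁻ x, ‖g x‖ₑ ^ (3/2:ℝ)) := by
    intro s hs
    refine (bellman_window hf hfs hg hgs i j ha hab hs).trans ?_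
    refine (ofReal_integral_le_lint fun x => bellman_nonneg hs _).trans ?_
    calc _ ≤ ∫⁻ x, (ENNReal.ofReal (2 * s) * ENNReal.ofReal (u x ^ 2 + |v x|) + 3 * (‖u x‖ₑ ^ (3:ℝ) + ‖v x‖ₑ ^ (3/2:ℝ))) := by
          refine lintegral_mono fun x => ?_
          refine (ENNReal.ofReal_le_ofReal (bellman_upper hs (u x, v x))).trans (le_of_eq ?_)
          dsimp only
          have r1 : ENNReal.ofReal (|u x| ^ (3:ℝ)) = ‖u x‖ₑ ^ (3:ℝ) := by
            rw [Real.enorm_eq_ofReal_abs, ENNReal.ofReal_rpow_of_nonneg (abs_nonneg _) (by norm_num)]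
          have r2 : ENNReal.ofReal (|v x| ^ (3/2:ℝ)) = ‖v x‖ₑ ^ (3/2:ℝ) := by
            rw [Real.enorm_eq_ofReal_abs, ENNReal.ofReal_rpow_of_nonneg (abs_nonneg _) (by norm_num)]
          rw [← r1, ← r2, ENNReal.ofReal_add (by positivity) (by positivity), ENNReal.ofReal_mul (p := 2 * s) (by positivity),
            ENNReal.ofReal_mul (p := 3) (by positivity), ENNReal.ofReal_add (p := |u x| ^ (3:ℝ)) (by positivity) (by positivity)]
          norm_num
      _ = ENNReal.ofReal (2 * s) * L + 3 * ((∫⁻ x, ‖u x‖ₑ ^ (3:ℝ)) + ∫⁻ x, ‖v x‖ₑ ^ (3/2:ℝ)) := by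
          have m1 : Measurable fun x => ‖u x‖ₑ ^ (3:ℝ) := cu.measurable.enorm.pow_const _
          have m2 : Measurable fun x => ‖v x‖ₑ ^ (3/2:ℝ) := cv'.measurable.enorm.pow_const _
          have m3 : Measurable fun x => ENNReal.ofReal (u x ^ 2 + |v x|) := ((cu.pow 2).add cv'.abs).measurable.ennreal_ofReal
          have m12 : Measurable fun x => ‖u x‖ₑ ^ (3:ℝ) + ‖v x‖ₑ ^ (3/2:ℝ) := m1.add m2
          rw [lintegral_add_right _ (m12.const_mul 3), lintegral_const_mul _ m3, lintegral_const_mul _ m12,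
            lintegral_add_left m1]
      _ ≤ _ := by
          have j1 := heat_jensen (q := 3) hf ha (by norm_num)
          have j2 := heat_jensen (q := 3/2) hg ha (by norm_num)
          gcongr
  have lim : Tendsto (fun s : ℝ => ENNReal.ofReal (2 * s) * L + 3 * ((∫⁻ x, ‖f x‖ₑ ^ (3:ℝ)) + ∫⁻ x, ‖g x‖ₑ ^ (3/2:ℝ)))
      (𝓝[>] 0) (𝓝 (0 * L + 3 * ((∫⁻ x, ‖f x‖ₑ ^ (3:ℝ)) + ∫⁻ x, ‖g x‖ₑ ^ (3/2:ℝ)))) := by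
    refine Tendsto.add_const _ (ENNReal.Tendsto.mul_const ?_ (Or.inr hLf))
    have : Tendsto (fun s : ℝ => ENNReal.ofReal (2 * s)) (𝓝 0) (𝓝 (ENNReal.ofReal (2 * 0))) :=
      (ENNReal.continuous_ofReal.comp (by fun_prop : Continuous fun s : ℝ => 2 * s)).tendsto 0
    simp only [mul_zero, ENNReal.ofReal_zero] at this
    exact this.mono_left nhdsWithin_le_nhds
  rw [zero_mul, zero_add] at lim
  exact ge_of_tendsto lim (eventually_nhdsWithin_of_forall fun s hs => step s hs)

lemma lintegral_Ioi_le_of_Ioc {F : ℝ → ℝ≥0∞} {C : ℝ≥0∞} (h : ∀ a b : ℝ, 0 < a → a ≤ b → ∫⁻ t in Set.Ioc a b, F t ≤ C) :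
    ∫⁻ t in Set.Ioi (0:ℝ), F t ≤ C := by
  have e : Set.Ioi (0:ℝ) = ⋃ n : ℕ, Set.Ioc (1 / ((n:ℝ) + 1)) ((n:ℝ) + 1) := by
    ext t
    simp only [Set.mem_Ioi, Set.mem_iUnion, Set.mem_Ioc]
    constructor
    · intro ht
      obtain ⟨n, hn⟩ := exists_nat_gt (max t (1 / t))
      refine ⟨n, ?_, by linarith [le_max_left t (1/t)]⟩
      rw [div_lt_comm₀ (by positivity) ht]
      linarith [le_max_right t (1/t)]
    · rintro ⟨n, h1, -⟩
      exact lt_trans (by positivity) h1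
  rw [e, setLIntegral_iUnion_of_directed]
  · refine iSup_le fun n => h _ _ (by positivity) ?_
    rw [div_le_iff₀ (by positivity)]
    have : (0:ℝ) ≤ n := by positivity
    nlinarith
  · apply Monotone.directed_le
    intro n k hnk
    apply Set.Ioc_subset_Ioc
    · gcongr
    · gcongr

lemma bellman_est {f g : E3 → ℝ} (hf : Continuous f) (hfs : HasCompactSupport f) (hg : Continuous g)
    (hgs : HasCompactSupport g) (i j : Fin 3) :
    ∫⁻ t in Set.Ioi (0:ℝ), ∫⁻ x, ‖cv (hk1 t i) f x‖ₑ * ‖cv (hk1 t j) g x‖ₑ ≤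
      3 * ((∫⁻ x, ‖f x‖ₑ ^ (3:ℝ)) + ∫⁻ x, ‖g x‖ₑ ^ (3/2:ℝ)) :=
  lintegral_Ioi_le_of_Ioc fun _ _ ha hab => bellman_window0 hf hfs hg hgs i j ha hab

end BellmanIntSec

section RepSec

lemma ftc_lint {I I' : ℝ → ℝ} {L : ℝ} (hD : ∀ t, 0 < t → HasDerivAt I (I' t) t)
    (h0 : Tendsto I (𝓝[>] 0) (𝓝 L)) (hi : Tendsto I atTop (𝓝 0)) :
    ‖L‖ₑ ≤ ∫⁻ t in Set.Ioi (0:ℝ), ‖I' t‖ₑ := by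
  by_cases htop : ∫⁻ t in Set.Ioi (0:ℝ), ‖I' t‖ₑ = ∞
  · rw [htop]; exact le_top
  have hm : AEStronglyMeasurable I' (volume.restrict (Set.Ioi (0:ℝ))) := by
    refine ((measurable_deriv I).aestronglyMeasurable).congr ?_
    filter_upwards [ae_restrict_mem measurableSet_Ioi] with t ht using (hD t ht).deriv
  have hIntg : IntegrableOn I' (Set.Ioi 0) := ⟨hm, lt_top_iff_ne_top.2 htop⟩
  have := integral_Ioi_of_hasDerivAt_of_tendsto' (a := 0) (f := Function.update I 0 L) (f' := I') (m := 0)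
  have h2 := integral_Ioi_of_hasDerivAt_of_tendsto (a := 0) (f := Function.update I 0 L) (f' := I') (m := 0) ?_ ?_ hIntg ?_
  · simp only [Function.update_self, zero_sub] at h2
    rw [← enorm_neg, ← h2]
    exact enorm_integral_le_lintegral_enorm _
  · refine (continuousWithinAt_update_same).2 (h0.mono_left ?_)
    apply nhdsWithin_mono
    rintro t ⟨h1, h2⟩
    exact lt_of_le_of_ne h1 (fun h => h2 h.symm)
  · intro t ht
    refine (hD t ht).congr_of_eventuallyEq ?_
    filter_upwards [Ioi_mem_nhds ht] with s hs
    exact Function.update_of_ne (ne_of_gt hs) _ _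
  · refine hi.congr' ?_
    filter_upwards [Ioi_mem_atTop (0:ℝ)] with s hs
    exact (Function.update_of_ne (ne_of_gt hs) _ _).symm

lemma hq_eq {t : ℝ} (ht : 0 < t) (z : E3) : hq t z = (8 * π) ^ (3/2:ℝ) * hk (2 * t) z := by
  unfold hq hk
  rw [show 4 * π * (2 * t) = (8 * π) * t by ring, Real.mul_rpow (by positivity) ht.le,
    show 4 * (2 * t) = 8 * t by ring, ← mul_assoc, ← mul_assoc, ← Real.rpow_add (by positivity)]
  norm_num

/-- second moment -/
lemma hk_moment {t : ℝ} (ht : 0 < t) (z : E3) : ‖z‖ ^ 2 * hk t z ≤ 30 * t * ((8 * π) ^ (3/2:ℝ) * hk (2 * t) z) := by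
  have h1 := hkt_le ht z
  have h2 := hk_le ht z
  have h3 := hkt_eq ht z
  rw [← hq_eq ht]
  have : ‖z‖ ^ 2 * hk t z = 4 * t ^ 2 * hkt t z + 6 * t * hk t z := by
    rw [h3]; field_simp; ring
  rw [this]
  have h4 : 4 * t ^ 2 * hkt t z ≤ 4 * t ^ 2 * (6 * t⁻¹ * hq t z) := by
    gcongr; exact (le_abs_self _).trans h1
  have h5 : 4 * t ^ 2 * (6 * t⁻¹ * hq t z) = 24 * t * hq t z := by field_simp; ring
  nlinarith

lemma heat_unif {f : E3 → ℝ} (hf : Continuous f) (hfs : HasCompactSupport f) {ε : ℝ} (hε : 0 < ε) :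
    ∀ᶠ t in 𝓝[>] (0:ℝ), ∀ x, |cv (hk t) f x - f x| ≤ ε := by
  obtain ⟨M, hM⟩ := hf.bounded_above_of_compact_support hfs
  have hM0 : 0 ≤ M := (norm_nonneg _).trans (hM 0)
  have huc := hfs.uniformContinuous_of_continuous hf
  obtain ⟨δ, hδ, hδ'⟩ := Metric.uniformContinuous_iff.1 huc (ε / 2) (by positivity)
  set C : ℝ := 2 * M / δ ^ 2 * (30 * (8 * π) ^ (3/2:ℝ)) with hC
  have hC0 : 0 ≤ C := by positivity
  have hsmall : ∀ᶠ t in 𝓝[>] (0:ℝ), C * t ≤ ε / 2 := by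
    have : Tendsto (fun t : ℝ => C * t) (𝓝 0) (𝓝 (C * 0)) := (by fun_prop : Continuous fun t : ℝ => C * t).tendsto 0
    rw [mul_zero] at this
    exact ((this.eventually (ge_mem_nhds (by positivity : (0:ℝ) < ε / 2))).filter_mono nhdsWithin_le_nhds)
  filter_upwards [hsmall, self_mem_nhdsWithin] with t hCt ht x
  have ht0 : (0:ℝ) < t := ht
  have i1 : Integrable fun y => hk t (x - y) := (integrable_hk ht0).comp_sub_left x
  have i2 : Integrable fun y => hk (2 * t) (x - y) := (integrable_hk (by positivity : 0 < 2 * t)).comp_sub_left x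
  have e0 : ∀ s, 0 < s → ∫ y, hk s (x - y) = 1 := fun s hs => by
    rw [integral_sub_left_eq_self (fun z => hk s z) volume x, integral_hk hs]
  have e1 : cv (hk t) f x - f x = ∫ y, hk t (x - y) * (f y - f x) := by
    have : ∀ y, hk t (x - y) * (f y - f x) = hk t (x - y) * f y - hk t (x - y) * f x := fun y => by ring
    simp_rw [this]
    rw [integral_sub (cv_integrable (contDiff_hk t).continuous hf hfs x) (i1.mul_const _), integral_mul_const, e0 t ht0, one_mul]
    rfl
  have pt : ∀ y, ‖hk t (x - y) * (f y - f x)‖ ≤ ε / 2 * hk t (x - y) + C * t * hk (2 * t) (x - y) := by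
    intro y
    have hp := hk_pos ht0 (x - y)
    have hp2 := hk_pos (by positivity : 0 < 2 * t) (x - y)
    rw [norm_mul, Real.norm_eq_abs, abs_of_pos hp]
    by_cases hd : dist y x < δ
    · have := (hδ' hd).le
      rw [dist_eq_norm] at this
      have h2 : 0 ≤ C * t * hk (2 * t) (x - y) := by positivity
      nlinarith
    · push Not at hd
      have h1 : ‖f y - f x‖ ≤ 2 * M := (norm_sub_le _ _).trans (by linarith [hM x, hM y])
      have h2 : δ ^ 2 ≤ ‖x - y‖ ^ 2 := by
        rw [← dist_eq_norm, dist_comm]; gcongr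
      have h3 := hk_moment ht0 (x - y)
      have h4 : hk t (x - y) * (2 * M) ≤ C * t * hk (2 * t) (x - y) := by
        have : hk t (x - y) * (2 * M) ≤ 2 * M / δ ^ 2 * (‖x - y‖ ^ 2 * hk t (x - y)) := by
          rw [div_mul_eq_mul_div, le_div_iff₀ (by positivity)]
          nlinarith [mul_le_mul_of_nonneg_left h2 (by positivity : 0 ≤ hk t (x - y) * (2 * M))]
        refine this.trans ?_
        have := mul_le_mul_of_nonneg_left h3 (by positivity : 0 ≤ 2 * M / δ ^ 2)
        refine this.trans (le_of_eq ?_)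
        rw [hC]; ring
      have h5 : 0 ≤ ε / 2 * hk t (x - y) := by positivity
      nlinarith
  rw [e1, ← Real.norm_eq_abs]
  refine (norm_integral_le_of_norm_le ((i1.const_mul (ε/2)).add (i2.const_mul (C * t))) (Eventually.of_forall pt)).trans ?_
  have : ∫ y, ((fun y => ε / 2 * hk t (x - y)) + fun y => C * t * hk (2 * t) (x - y)) y = ε / 2 + C * t := by
    rw [integral_add' (i1.const_mul (ε/2)) (i2.const_mul (C * t)), integral_const_mul, integral_const_mul, e0 t ht0,
      e0 (2 * t) (by positivity)]
    ring
  rw [this]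
  linarith

lemma heat_sup {f : E3 → ℝ} (hf : Continuous f) (hfs : HasCompactSupport f) {t : ℝ} (ht : 0 < t) (x : E3) :
    |cv (hk t) f x| ≤ t ^ (-(3/2:ℝ)) * ∫ y, |f y| := by
  unfold cv
  rw [← integral_const_mul, ← Real.norm_eq_abs]
  refine norm_integral_le_of_norm_le ((hf.integrable_of_hasCompactSupport hfs).abs.const_mul _) (Eventually.of_forall fun y => ?_)
  rw [norm_mul, Real.norm_eq_abs, Real.norm_eq_abs, abs_of_pos (hk_pos ht _)]
  gcongr
  refine (hk_le ht _).trans ?_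
  unfold hq
  refine mul_le_of_le_one_right (by positivity) ?_
  rw [Real.exp_le_one_iff]
  have : 0 ≤ ‖x - y‖ ^ 2 / (8 * t) := by positivity
  linarith

lemma tendsto_rpow_neg_mul (C : ℝ) : Tendsto (fun t : ℝ => t ^ (-(3/2:ℝ)) * C) atTop (𝓝 0) := by
  simpa using (tendsto_rpow_neg_atTop (by norm_num : (0:ℝ) < 3/2)).mul_const C

lemma heat_L1 {f : E3 → ℝ} (hf : Continuous f) (hfs : HasCompactSupport f) {t : ℝ} (ht : 0 < t) :
    Integrable (cv (hk t) f) ∧ ∫ x, |cv (hk t) f x| ≤ ∫ x, |f x| := by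
  have h := heat_jensen (q := 1) hf ht le_rfl
  simp only [ENNReal.rpow_one] at h
  have hi := hf.integrable_of_hasCompactSupport (μ := volume) hfs
  have hI : Integrable (cv (hk t) f) := ⟨(cv_continuous (c1 (contDiff_hk t)) hf hfs).aestronglyMeasurable,
    h.trans_lt hi.2⟩
  refine ⟨hI, ?_⟩
  have e1 := integral_norm_eq_lintegral_enorm hI.aestronglyMeasurable
  have e2 := integral_norm_eq_lintegral_enorm hi.aestronglyMeasurable
  simp only [Real.norm_eq_abs] at e1 e2
  rw [e1, e2]
  exact ENNReal.toReal_mono hi.2.ne h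

lemma point_rep {h : E3 → ℝ} (hh : ContDiff ℝ 1 h) (hhs : HasCompactSupport h) (x : E3) :
    ‖h x‖ₑ ≤ ∑ k, ∫⁻ t in Set.Ioi (0:ℝ), ‖cv (hk1 t k) (pds h k) x‖ₑ := by
  have hc := hh.continuous
  have hder : ∀ t, 0 < t → HasDerivAt (fun s => cv (hk s) h x) (∑ k, cv (hk1 t k) (pds h k) x) t := by
    intro t ht
    refine (cv_time hc hhs ht x).congr_deriv ?_
    rw [cv_hkt hc hhs]
    refine Finset.sum_congr rfl fun k _ => ?_
    rw [← cv_ibp (c1 (contDiff_hk1 t k)) hh hhs, hk1_pds_fun]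
  have h0 : Tendsto (fun s => cv (hk s) h x) (𝓝[>] 0) (𝓝 (h x)) := by
    rw [Metric.tendsto_nhds]
    intro ε hε
    filter_upwards [heat_unif hc hhs (half_pos hε)] with t ht
    rw [Real.dist_eq]
    linarith [ht x]
  have hi : Tendsto (fun s => cv (hk s) h x) atTop (𝓝 0) := by
    refine squeeze_zero_norm' ?_ (tendsto_rpow_neg_mul (∫ y, |h y|))
    filter_upwards [Ioi_mem_atTop (0:ℝ)] with t ht
    exact heat_sup hc hhs ht x
  refine (ftc_lint hder h0 hi).trans ?_
  have hpc : ∀ k, Continuous (pds h k) := fun k => by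
    unfold pds; exact (hh.continuous_fderiv (by simp)).clm_apply continuous_const
  have hmeas : ∀ k, Measurable fun t : ℝ => ‖cv (hk1 t k) (pds h k) x‖ₑ := by
    intro k
    have : Measurable fun t : ℝ => cv (hk1 t k) (pds h k) x := by
      unfold cv
      refine (StronglyMeasurable.integral_prod_right (f := fun (t : ℝ) (y : E3) => hk1 t k (x - y) * pds h k y) ?_).measurable
      apply Measurable.stronglyMeasurable
      have h1 : Measurable fun p : ℝ × E3 => pds h k p.2 := (hpc k).measurable.comp measurable_snd
      refine Measurable.mul ?_ h1
      unfold hk1 hk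
      have h2 : Measurable fun p : ℝ × E3 => x - p.2 := measurable_const.sub measurable_snd
      have h3 : Measurable fun p : ℝ × E3 => (x - p.2) k := (contDiff_coord k).continuous.measurable.comp h2
      have h4 : Measurable fun p : ℝ × E3 => p.1 := measurable_fst
      exact ((h3.div (h4.const_mul 2)).neg).mul (((h4.const_mul _).pow_const _).mul ((h2.norm.pow_const 2).div (h4.const_mul 4)).neg.exp)
    exact this.enorm
  rw [← lintegral_finsetSum _ (fun k _ => hmeas k)]
  exact lintegral_mono fun t => enorm_sum_le _ _

lemma mul_C2 : PlaneC2 (fun p => p.1 * p.2) (fun p => p.2) (fun p => p.1) (fun _ => 0) (fun _ => 1) (fun _ => 0) := by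
  constructor
  · simp
  · intro p
    refine (hasFDerivAt_fst.mul hasFDerivAt_snd).congr_fderiv ?_
    ext <;> simp
  · intro p
    refine hasFDerivAt_snd.congr_fderiv ?_
    ext <;> simp
  · intro p
    refine hasFDerivAt_fst.congr_fderiv ?_
    ext <;> simp
  all_goals exact continuous_const

lemma pairing_lim0 {f g : E3 → ℝ} (hf : Continuous f) (hfs : HasCompactSupport f) (hg : Continuous g)
    (hgs : HasCompactSupport g) :
    Tendsto (fun t => ∫ x, cv (hk t) f x * cv (hk t) g x) (𝓝[>] 0) (𝓝 (∫ x, f x * g x)) := by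
  rw [Metric.tendsto_nhds]
  intro ε hε
  set A := (∫ x, |f x|) + (∫ x, |g x|) + 1 with hA
  have hA1 : 0 ≤ ∫ x, |f x| := integral_nonneg fun _ => abs_nonneg _
  have hA2 : 0 ≤ ∫ x, |g x| := integral_nonneg fun _ => abs_nonneg _
  have hA0 : 0 < A := by positivity
  filter_upwards [heat_unif hf hfs (by positivity : 0 < ε / A), heat_unif hg hgs (by positivity : 0 < ε / A),
    self_mem_nhdsWithin] with t h1 h2 ht
  have ht0 : (0:ℝ) < t := ht
  obtain ⟨ig, hgL⟩ := heat_L1 hg hgs ht0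
  have cf := cv_continuous (c1 (contDiff_hk t)) hf hfs
  have cg := cv_continuous (c1 (contDiff_hk t)) hg hgs
  have iF := hf.integrable_of_hasCompactSupport (μ := volume) hfs
  have i1 : Integrable fun x => (cv (hk t) f x - f x) * cv (hk t) g x :=
    ig.bdd_mul (c := ε / A) (cf.sub hf).aestronglyMeasurable (Eventually.of_forall h1)
  have i2 : Integrable fun x => (cv (hk t) g x - g x) * f x :=
    iF.bdd_mul (c := ε / A) (cg.sub hg).aestronglyMeasurable (Eventually.of_forall h2)
  have i3 : Integrable fun x => f x * g x := (hf.mul hg).integrable_of_hasCompactSupport hfs.mul_right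
  have e : ∫ x, cv (hk t) f x * cv (hk t) g x = (∫ x, f x * g x) + ((∫ x, (cv (hk t) f x - f x) * cv (hk t) g x)
      + ∫ x, (cv (hk t) g x - g x) * f x) := by
    have i12 : Integrable fun x => (cv (hk t) f x - f x) * cv (hk t) g x + (cv (hk t) g x - g x) * f x := i1.add i2
    rw [← integral_add i1 i2, ← integral_add i3 i12]
    congr 1; funext x; ring
  rw [Real.dist_eq, e, add_sub_cancel_left]
  have b1 : |∫ x, (cv (hk t) f x - f x) * cv (hk t) g x| ≤ ε / A * ∫ x, |g x| := by
    refine le_trans ?_ (mul_le_mul_of_nonneg_left hgL (by positivity))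
    rw [← integral_const_mul, ← Real.norm_eq_abs]
    refine norm_integral_le_of_norm_le (ig.abs.const_mul _) (Eventually.of_forall fun x => ?_)
    rw [norm_mul]; exact mul_le_mul_of_nonneg_right (h1 x) (abs_nonneg _)
  have b2 : |∫ x, (cv (hk t) g x - g x) * f x| ≤ ε / A * ∫ x, |f x| := by
    rw [← integral_const_mul, ← Real.norm_eq_abs]
    refine norm_integral_le_of_norm_le (iF.abs.const_mul _) (Eventually.of_forall fun x => ?_)
    rw [norm_mul]; exact mul_le_mul_of_nonneg_right (h2 x) (abs_nonneg _)
  refine (abs_add_le _ _).trans_lt ?_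
  have : ε / A * A = ε := by field_simp
  have h3 : 0 < ε / A := by positivity
  nlinarith

lemma pairing_liminf {f g : E3 → ℝ} (hf : Continuous f) (hfs : HasCompactSupport f) (hg : Continuous g)
    (hgs : HasCompactSupport g) :
    Tendsto (fun t => ∫ x, cv (hk t) f x * cv (hk t) g x) atTop (𝓝 0) := by
  refine squeeze_zero_norm' ?_ (tendsto_rpow_neg_mul ((∫ y, |f y|) * ∫ y, |g y|))
  filter_upwards [Ioi_mem_atTop (0:ℝ)] with t ht
  have ht0 : (0:ℝ) < t := ht
  obtain ⟨ig, hgL⟩ := heat_L1 hg hgs ht0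
  have hA1 : 0 ≤ ∫ x, |f x| := integral_nonneg fun _ => abs_nonneg _
  rw [← mul_assoc]
  refine le_trans ?_ (mul_le_mul_of_nonneg_left hgL (by positivity))
  rw [← integral_const_mul]
  refine norm_integral_le_of_norm_le (ig.abs.const_mul _) (Eventually.of_forall fun x => ?_)
  rw [norm_mul]; exact mul_le_mul_of_nonneg_right (heat_sup hf hfs ht0 x) (abs_nonneg _)

/-- integrability of products of heat extensions -/
lemma heat_mul_integrable {F G : E3 → ℝ} (hF : Continuous F) (hG : Continuous G) {A c : ℝ} (hA : 0 < A) (hc : 0 < c)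
    (h1 : ∀ x, |F x| ≤ A * Real.exp (-(c * ‖x‖ ^ 2))) (h2 : ∀ x, |G x| ≤ A * Real.exp (-(c * ‖x‖ ^ 2))) :
    Integrable fun x => F x * G x := by
  refine integrable_of_gauss (A := A * A) (hF.mul hG).aestronglyMeasurable hc fun x => ?_
  have e2 : |F x| ≤ A := (h1 x).trans (mul_le_of_le_one_right hA.le (exp_gauss_le_one hc x))
  rw [abs_mul, mul_assoc]
  exact mul_le_mul e2 (h2 x) (abs_nonneg _) hA.le

/-- moving derivatives: `∫ ∂ᵢ∂ₖu · ∂ₖ v = ∫ ∂ₖ∂ₖ u · ∂ᵢ v`. -/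
lemma heat_swap {φ g : E3 → ℝ} (hφ : Continuous φ) (hφs : HasCompactSupport φ) (hg : Continuous g)
    (hgs : HasCompactSupport g) {t : ℝ} (ht : 0 < t) (i k : Fin 3) :
    ∫ x, cv (hk2 t k i) φ x * cv (hk1 t k) g x = ∫ x, cv (hk2 t k k) φ x * cv (hk1 t i) g x := by
  obtain ⟨A, hA, c, hc, hb⟩ := heat_pair_bound hφ hφs hg hgs ht ht
  have hb := hb t le_rfl le_rfl
  have cf1 := fun i => cv_continuous (c1 (contDiff_hk1 t i)) hφ hφs
  have cg1 := fun i => cv_continuous (c1 (contDiff_hk1 t i)) hg hgs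
  have cf2 := fun i k => cv_continuous (c1 (contDiff_hk2 t i k)) hφ hφs
  have cg2 := fun i k => cv_continuous (c1 (contDiff_hk2 t i k)) hg hgs
  have bf1 := fun i x => ((hb x).2.2.1 i).1
  have bg1 := fun i x => ((hb x).2.2.1 i).2
  have bf2 := fun i k x => ((hb x).2.2.2 i k).1
  have bg2 := fun i k x => ((hb x).2.2.2 i k).2
  have s1 := heat_ibp hφ hφs t k i (U := cv (hk1 t k) g) (DU := cv (hk2 t k i) g)
    (cv_differentiable (c1 (contDiff_hk1 t k)) hg hgs) (fderiv_cv_hk1 hg hgs t k i)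
    (heat_mul_integrable (cg2 k i) (cf1 k) hA hc (bg2 k i) (bf1 k))
    (heat_mul_integrable (cg1 k) (cf2 k i) hA hc (bg1 k) (bf2 k i))
    (heat_mul_integrable (cg1 k) (cf1 k) hA hc (bg1 k) (bf1 k))
  have s2 := heat_ibp hg hgs t i k (U := cv (hk1 t k) φ) (DU := cv (hk2 t k k) φ)
    (cv_differentiable (c1 (contDiff_hk1 t k)) hφ hφs) (fderiv_cv_hk1 hφ hφs t k k)
    (heat_mul_integrable (cf2 k k) (cg1 i) hA hc (bf2 k k) (bg1 i))
    (heat_mul_integrable (cf1 k) (cg2 i k) hA hc (bf1 k) (bg2 i k))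
    (heat_mul_integrable (cf1 k) (cg1 i) hA hc (bf1 k) (bg1 i))
  have e1 : ∫ x, cv (hk2 t k i) φ x * cv (hk1 t k) g x = ∫ x, cv (hk1 t k) g x * cv (hk2 t k i) φ x := by
    congr 1; funext x; ring
  have e2 : ∫ x, cv (hk2 t k i) g x * cv (hk1 t k) φ x = ∫ x, cv (hk1 t k) φ x * cv (hk2 t i k) g x := by
    rw [show hk2 t k i = hk2 t i k from funext (hk2_symm t k i)]
    congr 1; funext x; ring
  rw [e1, s1, e2, s2, neg_neg]

end RepSec

section PairRep

lemma meas_hk1 (k : Fin 3) : Measurable fun p : ℝ × E3 => hk1 p.1 k p.2 := by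
  unfold hk1 hk
  have h2 : Measurable fun p : ℝ × E3 => p.2 := measurable_snd
  have h3 : Measurable fun p : ℝ × E3 => p.2 k := (contDiff_coord k).continuous.measurable.comp h2
  have h4 : Measurable fun p : ℝ × E3 => p.1 := measurable_fst
  exact ((h3.div (h4.const_mul 2)).neg).mul (((h4.const_mul _).pow_const _).mul ((h2.norm.pow_const 2).div (h4.const_mul 4)).neg.exp)

lemma meas_cv_hk1 {f : E3 → ℝ} (hf : Measurable f) (k : Fin 3) :
    Measurable fun p : ℝ × E3 => cv (hk1 p.1 k) f p.2 := by
  unfold cv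
  refine (StronglyMeasurable.integral_prod_right (f := fun (p : ℝ × E3) (y : E3) => hk1 p.1 k (p.2 - y) * f y) ?_).measurable
  apply Measurable.stronglyMeasurable
  have h1 : Measurable fun q : (ℝ × E3) × E3 => f q.2 := hf.comp measurable_snd
  refine Measurable.mul ?_ h1
  exact (meas_hk1 k).comp ((measurable_fst.comp measurable_fst).prodMk ((measurable_snd.comp measurable_fst).sub measurable_snd))

lemma heat1_mul_integrable {f g : E3 → ℝ} (hf : Continuous f) (hfs : HasCompactSupport f) (hg : Continuous g)
    (hgs : HasCompactSupport g) {t : ℝ} (ht : 0 < t) (i k : Fin 3) :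
    Integrable fun x => cv (hk1 t k) f x * cv (hk1 t i) g x := by
  obtain ⟨A, hA, c, hc, hb⟩ := heat_pair_bound hf hfs hg hgs ht ht
  have hb := hb t le_rfl le_rfl
  exact heat_mul_integrable (cv_continuous (c1 (contDiff_hk1 t k)) hf hfs) (cv_continuous (c1 (contDiff_hk1 t i)) hg hgs)
    hA hc (fun x => ((hb x).2.2.1 k).1) (fun x => ((hb x).2.2.1 i).2)

lemma pds_continuous {h : E3 → ℝ} (hh : ContDiff ℝ 1 h) (k : Fin 3) : Continuous (pds h k) := by
  unfold pds; exact (hh.continuous_fderiv (by simp)).clm_apply continuous_const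

lemma pds_supp {h : E3 → ℝ} (hhs : HasCompactSupport h) (k : Fin 3) : HasCompactSupport (pds h k) := by
  unfold pds; exact hhs.fderiv_apply ℝ (ee k)

lemma cv_sub {K f g : E3 → ℝ} (hK : Continuous K) (hf : Continuous f) (hfs : HasCompactSupport f) (hg : Continuous g)
    (hgs : HasCompactSupport g) (x : E3) : cv K (fun y => f y - g y) x = cv K f x - cv K g x := by
  unfold cv
  rw [← integral_sub]
  · congr 1; funext y; ring
  · exact ((hK.comp (continuous_const.sub continuous_id)).mul hf).integrable_of_hasCompactSupport hfs.mul_left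
  · exact ((hK.comp (continuous_const.sub continuous_id)).mul hg).integrable_of_hasCompactSupport hgs.mul_left

lemma cv_sum {K : E3 → ℝ} {f : Fin 3 → E3 → ℝ} (hK : Continuous K) (hf : ∀ k, Continuous (f k)) (hfs : ∀ k, HasCompactSupport (f k))
    (x : E3) : cv K (fun y => ∑ k, f k y) x = ∑ k, cv K (f k) x := by
  unfold cv
  rw [← integral_finsetSum]
  · congr 1; funext y; rw [Finset.mul_sum]
  · intro k _
    exact ((hK.comp (continuous_const.sub continuous_id)).mul (hf k)).integrable_of_hasCompactSupport (hfs k).mul_left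

lemma pair_deriv {φ : Fin 3 → E3 → ℝ} (hφ : ∀ j, ContDiff ℝ 2 (φ j)) (hφs : ∀ j, HasCompactSupport (φ j))
    (hdiv : ∀ x, ∑ k, pds (φ k) k x = 0) {g : E3 → ℝ} (hg : Continuous g) (hgs : HasCompactSupport g) (i j : Fin 3)
    {t : ℝ} (ht : 0 < t) :
    ∑ k, ∫ x, cv (hk1 t k) (pds (φ j) i) x * cv (hk1 t k) g x =
    ∑ k, ∫ x, cv (hk1 t k) (fun y => pds (φ j) k y - pds (φ k) j y) x * cv (hk1 t i) g x := by
  have hφ1 : ∀ j, ContDiff ℝ 1 (φ j) := fun j => (hφ j).of_le (by norm_num)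
  have pc : ∀ j k, Continuous (pds (φ j) k) := fun j k => pds_continuous (hφ1 j) k
  have ps : ∀ j k, HasCompactSupport (pds (φ j) k) := fun j k => pds_supp (hφs j) k
  have ib : ∀ j k l x, cv (hk1 t k) (pds (φ j) l) x = cv (hk2 t k l) (φ j) x := by
    intro j k l x
    rw [← cv_ibp (c1 (contDiff_hk1 t k)) (hφ1 j) (hφs j), hk1_pds_fun]
  have e1 : ∀ k, ∫ x, cv (hk1 t k) (pds (φ j) i) x * cv (hk1 t k) g x =
      ∫ x, cv (hk1 t k) (pds (φ j) k) x * cv (hk1 t i) g x := by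
    intro k
    simp only [ib]
    exact heat_swap (hφ1 j).continuous (hφs j) hg hgs ht i k
  rw [Finset.sum_congr rfl fun k _ => e1 k, ← integral_finsetSum, ← integral_finsetSum]
  · congr 1; funext x
    rw [← Finset.sum_mul, ← Finset.sum_mul]
    congr 1
    have h0 : ∑ k, cv (hk1 t k) (pds (φ k) j) x = 0 := by
      have : ∀ k, cv (hk1 t k) (pds (φ k) j) x = cv (hk1 t j) (pds (φ k) k) x := by
        intro k
        rw [ib, ib, show hk2 t k j = hk2 t j k from funext (hk2_symm t k j)]
      rw [Finset.sum_congr rfl fun k _ => this k, ← cv_sum (contDiff_hk1 t j).continuous (fun k => pc k k) (fun k => ps k k)]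
      simp [cv, hdiv]
    rw [Finset.sum_congr rfl fun k _ => cv_sub (contDiff_hk1 t k).continuous (pc j k) (ps j k) (pc k j) (ps k j) x,
      Finset.sum_sub_distrib, h0, sub_zero]
  · intro k _
    exact heat1_mul_integrable ((pc j k).sub (pc k j)) ((ps j k).sub (ps k j)) hg hgs ht i k
  · intro k _
    exact heat1_mul_integrable (pc j k) (ps j k) hg hgs ht i k

lemma pair_rep {φ : Fin 3 → E3 → ℝ} (hφ : ∀ j, ContDiff ℝ 2 (φ j)) (hφs : ∀ j, HasCompactSupport (φ j))
    (hdiv : ∀ x, ∑ k, pds (φ k) k x = 0) {g : E3 → ℝ} (hg : Continuous g) (hgs : HasCompactSupport g) (i j : Fin 3) :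
    ‖∫ x, pds (φ j) i x * g x‖ₑ ≤ 2 * ∑ k, ∫⁻ t in Set.Ioi (0:ℝ), ∫⁻ x,
      ‖cv (hk1 t k) (fun y => pds (φ j) k y - pds (φ k) j y) x‖ₑ * ‖cv (hk1 t i) g x‖ₑ := by
  have hφ1 : ∀ j, ContDiff ℝ 1 (φ j) := fun j => (hφ j).of_le (by norm_num)
  have pc : ∀ j k, Continuous (pds (φ j) k) := fun j k => pds_continuous (hφ1 j) k
  have ps : ∀ j k, HasCompactSupport (pds (φ j) k) := fun j k => pds_supp (hφs j) k
  have hD : ∀ t, 0 < t → HasDerivAt (fun s => ∫ x, cv (hk s) (pds (φ j) i) x * cv (hk s) g x)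
      (-(2 * ∑ k, ∫ x, cv (hk1 t k) (fun y => pds (φ j) k y - pds (φ k) j y) x * cv (hk1 t i) g x)) t := by
    intro t ht
    refine ((heat_energy mul_C2 (pc j i) (ps j i) hg hgs ht).2).congr_deriv ?_
    rw [← pair_deriv hφ hφs hdiv hg hgs i j ht, Finset.mul_sum]
    congr 1
    refine Finset.sum_congr rfl fun k _ => ?_
    rw [← integral_const_mul]
    congr 1; funext x; ring
  refine (ftc_lint hD (pairing_lim0 (pc j i) (ps j i) hg hgs) (pairing_liminf (pc j i) (ps j i) hg hgs)).trans ?_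
  have hm : ∀ k, Measurable fun p : ℝ × E3 => ‖cv (hk1 p.1 k) (fun y => pds (φ j) k y - pds (φ k) j y) p.2‖ₑ * ‖cv (hk1 p.1 i) g p.2‖ₑ :=
    fun k => (meas_cv_hk1 ((pc j k).sub (pc k j)).measurable k).enorm.mul (meas_cv_hk1 hg.measurable i).enorm
  rw [← lintegral_finsetSum _ (fun k _ => (hm k).lintegral_prod_right'), ← lintegral_const_mul']
  · refine lintegral_mono fun t => ?_
    rw [enorm_neg, enorm_mul]
    gcongr
    · simp [enorm_eq_nnnorm]
    · refine (enorm_sum_le _ _).trans (Finset.sum_le_sum fun k _ => ?_)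
      refine (enorm_integral_le_lintegral_enorm _).trans (lintegral_mono fun x => ?_)
      rw [enorm_mul]
  · simp

end PairRep

section WeightedSec

lemma comm_pt {K1 K2 f g w : E3 → ℝ} (hK1 : Continuous K1) (hK2 : Continuous K2) (hf : Continuous f)
    (hfs : HasCompactSupport f) (hg : Continuous g) (hgs : HasCompactSupport g) (hw : Continuous w) (s : E3) :
    ‖cv K1 f s‖ₑ * ‖cv K2 (fun x => w x * g x) s‖ₑ ≤
      ‖cv K1 (fun x => w x * f x) s‖ₑ * ‖cv K2 g s‖ₑ +
      ∫⁻ x, ∫⁻ y, (‖K1 (s - y)‖ₑ * ‖K2 (s - x)‖ₑ) * (‖w x - w y‖ₑ * ‖f y‖ₑ * ‖g x‖ₑ) := by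
  have c1 : Continuous fun y => K1 (s - y) := hK1.comp (continuous_const.sub continuous_id)
  have c2 : Continuous fun y => K2 (s - y) := hK2.comp (continuous_const.sub continuous_id)
  have i1 : Integrable fun y => K1 (s - y) * f y := (c1.mul hf).integrable_of_hasCompactSupport hfs.mul_left
  have i2 : Integrable fun y => K1 (s - y) * (w y * f y) :=
    (c1.mul (hw.mul hf)).integrable_of_hasCompactSupport (hfs.mul_left.mul_left)
  have i3 : Integrable fun y => K2 (s - y) * g y := (c2.mul hg).integrable_of_hasCompactSupport hgs.mul_left
  have i4 : Integrable fun y => K2 (s - y) * (w y * g y) :=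
    (c2.mul (hw.mul hg)).integrable_of_hasCompactSupport (hgs.mul_left.mul_left)
  have key : cv K1 f s * cv K2 (fun x => w x * g x) s - cv K1 (fun x => w x * f x) s * cv K2 g s
      = ∫ x, K2 (s - x) * g x * ∫ y, K1 (s - y) * ((w x - w y) * f y) := by
    have e : ∀ x, ∫ y, K1 (s - y) * ((w x - w y) * f y) = w x * cv K1 f s - cv K1 (fun x => w x * f x) s := by
      intro x
      unfold cv
      rw [← integral_const_mul, ← integral_sub (i1.const_mul _) i2]
      congr 1; funext y; ring
    simp only [e]
    conv_lhs => unfold cv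
    rw [← integral_const_mul, ← integral_const_mul, ← integral_sub (i4.const_mul _) (i3.const_mul _)]
    congr 1; funext x; unfold cv; ring
  have hle : ‖∫ x, K2 (s - x) * g x * ∫ y, K1 (s - y) * ((w x - w y) * f y)‖ₑ ≤
      ∫⁻ x, ∫⁻ y, (‖K1 (s - y)‖ₑ * ‖K2 (s - x)‖ₑ) * (‖w x - w y‖ₑ * ‖f y‖ₑ * ‖g x‖ₑ) := by
    refine (enorm_integral_le_lintegral_enorm _).trans (lintegral_mono fun x => ?_)
    rw [enorm_mul]
    calc _ ≤ ‖K2 (s - x) * g x‖ₑ * ∫⁻ y, ‖K1 (s - y) * ((w x - w y) * f y)‖ₑ := by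
          gcongr; exact enorm_integral_le_lintegral_enorm _
      _ = _ := by
          rw [← lintegral_const_mul' _ _ enorm_ne_top]
          congr 1; funext y
          simp only [enorm_mul]; ring
  rw [← enorm_mul, ← enorm_mul]
  calc _ = ‖cv K1 (fun x => w x * f x) s * cv K2 g s + (cv K1 f s * cv K2 (fun x => w x * g x) s - cv K1 (fun x => w x * f x) s * cv K2 g s)‖ₑ := by
        congr 1; ring
    _ ≤ _ := (enorm_add_le _ _).trans (by gcongr; rw [key]; exact hle)

lemma hk1_prod_le {t : ℝ} (ht : 0 < t) (k i : Fin 3) (s x y : E3) :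
    |hk1 t k (s - y)| * |hk1 t i (s - x)| ≤
      4 * (4 * π) ^ (3/2:ℝ) * (t ^ (-(5/2:ℝ)) * Real.exp (-((dist x y / Real.sqrt 2) ^ 2 / (8 * t)))) *
        hk t (s - (1/2:ℝ) • (x + y)) := by
  have e1 : ‖s - x‖ ^ 2 + ‖s - y‖ ^ 2 = 2 * ‖s - (1/2:ℝ) • (x + y)‖ ^ 2 + dist x y ^ 2 / 2 := by
    rw [dist_eq_norm]
    simp only [norm_sq_sum, Fin.sum_univ_three, PiLp.sub_apply, PiLp.smul_apply, PiLp.add_apply, smul_eq_mul]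
    ring
  have hs2 : (dist x y / Real.sqrt 2) ^ 2 = dist x y ^ 2 / 2 := by
    rw [div_pow, Real.sq_sqrt (by norm_num)]
  have e2 : Real.exp (-(‖s - y‖ ^ 2 / (8 * t))) * Real.exp (-(‖s - x‖ ^ 2 / (8 * t))) =
      Real.exp (-((dist x y / Real.sqrt 2) ^ 2 / (8 * t))) * Real.exp (-(‖s - (1/2:ℝ) • (x + y)‖ ^ 2 / (4 * t))) := by
    rw [← Real.exp_add, ← Real.exp_add, hs2]
    congr 1
    have : ‖s - x‖ ^ 2 = 2 * ‖s - (1/2:ℝ) • (x + y)‖ ^ 2 + dist x y ^ 2 / 2 - ‖s - y‖ ^ 2 := by linarith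
    rw [this]; field_simp; ring
  have e3 : t ^ (-(1/2:ℝ)) * t ^ (-(3/2:ℝ)) * (t ^ (-(1/2:ℝ)) * t ^ (-(3/2:ℝ))) =
      (4 * π) ^ (3/2:ℝ) * (t ^ (-(5/2:ℝ)) * (4 * π * t) ^ (-(3/2:ℝ))) := by
    rw [Real.mul_rpow (by positivity) ht.le, show (4 * π) ^ (3/2:ℝ) * (t ^ (-(5/2:ℝ)) * ((4 * π) ^ (-(3/2:ℝ)) * t ^ (-(3/2:ℝ)))) =
      ((4 * π) ^ (3/2:ℝ) * (4 * π) ^ (-(3/2:ℝ))) * (t ^ (-(5/2:ℝ)) * t ^ (-(3/2:ℝ))) by ring,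
      ← Real.rpow_add (by positivity : (0:ℝ) < 4 * π), ← Real.rpow_add ht, ← Real.rpow_add ht, ← Real.rpow_add ht]
    norm_num
  calc _ ≤ (2 * t ^ (-(1/2:ℝ)) * hq t (s - y)) * (2 * t ^ (-(1/2:ℝ)) * hq t (s - x)) :=
        mul_le_mul (hk1_le ht k _) (hk1_le ht i _) (abs_nonneg _) (by have := hq_pos ht (s - y); positivity)
    _ = 4 * (t ^ (-(1/2:ℝ)) * t ^ (-(3/2:ℝ)) * (t ^ (-(1/2:ℝ)) * t ^ (-(3/2:ℝ)))) *
        (Real.exp (-(‖s - y‖ ^ 2 / (8 * t))) * Real.exp (-(‖s - x‖ ^ 2 / (8 * t)))) := by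
          unfold hq; ring
    _ = _ := by rw [e2, e3]; unfold hk; ring

lemma time_int_pair : ∃ C : ℝ, 0 < C ∧ ∀ (k i : Fin 3) (x y : E3), x ≠ y →
    ∫⁻ t in Set.Ioi (0:ℝ), ∫⁻ s, ‖hk1 t k (s - y)‖ₑ * ‖hk1 t i (s - x)‖ₑ ≤ ENNReal.ofReal (C * dist x y ^ (-3:ℝ)) := by
  obtain ⟨C, hC, h⟩ := time_int (5/2) (by norm_num)
  refine ⟨4 * (4 * π) ^ (3/2:ℝ) * (C * (Real.sqrt 2)⁻¹ ^ (-3:ℝ)), by positivity, fun k i x y hxy => ?_⟩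
  have hd : 0 < dist x y := dist_pos.2 hxy
  have h1 := h (dist x y / Real.sqrt 2) (by positivity)
  calc _ ≤ ∫⁻ t in Set.Ioi (0:ℝ), ENNReal.ofReal (4 * (4 * π) ^ (3/2:ℝ)) *
        ENNReal.ofReal (t ^ (-(5/2:ℝ)) * Real.exp (-((dist x y / Real.sqrt 2) ^ 2 / (8 * t)))) := by
        refine setLIntegral_mono' measurableSet_Ioi fun t ht => ?_
        have ht0 : (0:ℝ) < t := ht
        calc _ ≤ ∫⁻ s, (ENNReal.ofReal (4 * (4 * π) ^ (3/2:ℝ)) *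
              ENNReal.ofReal (t ^ (-(5/2:ℝ)) * Real.exp (-((dist x y / Real.sqrt 2) ^ 2 / (8 * t))))) *
                ENNReal.ofReal (hk t (s - (1/2:ℝ) • (x + y))) := by
              refine lintegral_mono fun s => ?_
              rw [← ENNReal.ofReal_mul (by positivity), ← ENNReal.ofReal_mul (by positivity), ← enorm_mul,
                ← ofReal_norm_eq_enorm, Real.norm_eq_abs, abs_mul]
              exact ENNReal.ofReal_le_ofReal (hk1_prod_le ht0 k i s x y)
          _ = _ := by
              rw [lintegral_const_mul' _ _ (ENNReal.mul_ne_top ENNReal.ofReal_ne_top ENNReal.ofReal_ne_top),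
                lintegral_sub_right_eq_self (fun z => ENNReal.ofReal (hk t z)), lintegral_hk ht0, mul_one]
    _ ≤ _ := by
        rw [lintegral_const_mul' _ _ ENNReal.ofReal_ne_top]
        refine (mul_le_mul_right h1 _).trans (le_of_eq ?_)
        rw [← ENNReal.ofReal_mul (by positivity)]
        congr 1
        rw [Real.div_rpow hd.le (by positivity), Real.inv_rpow (by positivity)]
        norm_num
        ring

variable {Ω : Set E3}

lemma young_ennreal (a b : ℝ≥0∞) : a ^ (1/3:ℝ) * b ^ (2/3:ℝ) ≤ a + b := by
  rcases le_total a b with h | h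
  · calc _ ≤ b ^ (1/3:ℝ) * b ^ (2/3:ℝ) := by gcongr
      _ = b := by rw [← ENNReal.rpow_add_of_nonneg _ _ (by norm_num) (by norm_num)]; norm_num
      _ ≤ _ := le_add_self
  · calc _ ≤ a ^ (1/3:ℝ) * a ^ (2/3:ℝ) := by gcongr
      _ = a := by rw [← ENNReal.rpow_add_of_nonneg _ _ (by norm_num) (by norm_num)]; norm_num
      _ ≤ _ := le_self_add

lemma continuous_dB_rpow (Ω : Set E3) {β : ℝ} (hβ : 0 ≤ β) : Continuous fun x => dB Ω x ^ β :=
  (continuous_dB Ω).rpow_const fun _ => Or.inr hβ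

/-- restricting lintegrals to the domain for functions supported there -/
lemma lint_restrict_eq (hΩ : IsOpen Ω) {F : E3 → ℝ≥0∞} (hF : ∀ x, x ∉ Ω → F x = 0) : ∫⁻ x, F x = ∫⁻ x in Ω, F x := by
  rw [← lintegral_indicator hΩ.measurableSet]
  congr 1; funext x
  by_cases hx : x ∈ Ω
  · simp [hx]
  · simp [hx, hF x hx]

lemma comm_est (hΩ : IsLipschitzDomain Ω) (β : ℝ) (hβ0 : 0 ≤ β) (hβ : β < 2/5) :
    ∃ C : ℝ, 0 < C ∧ ∀ (f g : E3 → ℝ), Continuous f → (∀ x, x ∉ Ω → f x = 0) → 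
      Continuous g → (∀ x, x ∉ Ω → g x = 0) → ∀ i k : Fin 3,
      ∫⁻ t in Set.Ioi (0:ℝ), ∫⁻ s, ∫⁻ x, ∫⁻ y, (‖hk1 t k (s - y)‖ₑ * ‖hk1 t i (s - x)‖ₑ) *
        (‖dB Ω x ^ β - dB Ω y ^ β‖ₑ * ‖f y‖ₑ * ‖g x‖ₑ) ≤
      ENNReal.ofReal C * ((∫⁻ x, ‖dB Ω x ^ β * f x‖ₑ ^ (3:ℝ)) + ∫⁻ x, ‖g x‖ₑ ^ (3/2:ℝ)) := by
  obtain ⟨C1, hC1, h1⟩ := time_int_pair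
  obtain ⟨C2, hC2, h2⟩ := schur_a hΩ β hβ0 hβ
  refine ⟨C1 * C2, by positivity, fun f g hf hfΩ hg hgΩ i k => ?_⟩
  have hw := continuous_dB_rpow Ω hβ0
  -- measurability
  have mK : Measurable fun q : ℝ × E3 × E3 × E3 => (‖hk1 q.1 k (q.2.1 - q.2.2.2)‖ₑ * ‖hk1 q.1 i (q.2.1 - q.2.2.1)‖ₑ) := by
    exact ((meas_hk1 k).comp (f := fun q : ℝ × E3 × E3 × E3 => (q.1, q.2.1 - q.2.2.2)) (by fun_prop)).enorm.mul
      ((meas_hk1 i).comp (f := fun q : ℝ × E3 × E3 × E3 => (q.1, q.2.1 - q.2.2.1)) (by fun_prop)).enorm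
  have mR : Measurable fun p : E3 × E3 => ‖dB Ω p.1 ^ β - dB Ω p.2 ^ β‖ₑ * ‖f p.2‖ₑ * ‖g p.1‖ₑ := by
    have := hw.measurable
    have := hf.measurable
    have := hg.measurable
    exact ((((hw.measurable.comp measurable_fst).sub (hw.measurable.comp measurable_snd)).enorm).mul
      (hf.measurable.comp measurable_snd).enorm).mul (hg.measurable.comp measurable_fst).enorm
  have mF : Measurable fun q : ℝ × E3 × E3 × E3 => (‖hk1 q.1 k (q.2.1 - q.2.2.2)‖ₑ * ‖hk1 q.1 i (q.2.1 - q.2.2.1)‖ₑ) *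
        (‖dB Ω q.2.2.1 ^ β - dB Ω q.2.2.2 ^ β‖ₑ * ‖f q.2.2.2‖ₑ * ‖g q.2.2.1‖ₑ) :=
    mK.mul (mR.comp (f := fun q : ℝ × E3 × E3 × E3 => (q.2.2.1, q.2.2.2)) (by fun_prop))
  -- Tonelli
  have tonelli : ∫⁻ t in Set.Ioi (0:ℝ), ∫⁻ s, ∫⁻ x, ∫⁻ y, (‖hk1 t k (s - y)‖ₑ * ‖hk1 t i (s - x)‖ₑ) *
        (‖dB Ω x ^ β - dB Ω y ^ β‖ₑ * ‖f y‖ₑ * ‖g x‖ₑ) =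
      ∫⁻ x, ∫⁻ y, (∫⁻ t in Set.Ioi (0:ℝ), ∫⁻ s, ‖hk1 t k (s - y)‖ₑ * ‖hk1 t i (s - x)‖ₑ) *
        (‖dB Ω x ^ β - dB Ω y ^ β‖ₑ * ‖f y‖ₑ * ‖g x‖ₑ) := by
    set F : ℝ → E3 → E3 → E3 → ℝ≥0∞ := fun t s x y => (‖hk1 t k (s - y)‖ₑ * ‖hk1 t i (s - x)‖ₑ) *
        (‖dB Ω x ^ β - dB Ω y ^ β‖ₑ * ‖f y‖ₑ * ‖g x‖ₑ) with hF
    have m4 : Measurable fun q : ((ℝ × E3) × E3) × E3 => F q.1.1.1 q.1.1.2 q.1.2 q.2 :=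
      mF.comp (f := fun q : ((ℝ × E3) × E3) × E3 => (q.1.1.1, q.1.1.2, q.1.2, q.2)) (by fun_prop)
    have m3 : Measurable fun q : (ℝ × E3) × E3 => ∫⁻ y, F q.1.1 q.1.2 q.2 y := m4.lintegral_prod_right'
    have s1 : ∀ t, ∫⁻ s, ∫⁻ x, ∫⁻ y, F t s x y = ∫⁻ x, ∫⁻ s, ∫⁻ y, F t s x y := fun t =>
      lintegral_lintegral_swap (m3.comp (f := fun p : E3 × E3 => ((t, p.1), p.2)) (by fun_prop)).aemeasurable
    have s2 : ∀ t x, ∫⁻ s, ∫⁻ y, F t s x y = ∫⁻ y, ∫⁻ s, F t s x y := fun t x =>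
      lintegral_lintegral_swap (m4.comp (f := fun p : E3 × E3 => (((t, p.1), x), p.2)) (by fun_prop)).aemeasurable
    have m4' : Measurable fun q : ((ℝ × E3) × E3) × E3 => F q.1.1.1 q.2 q.1.1.2 q.1.2 :=
      mF.comp (f := fun q : ((ℝ × E3) × E3) × E3 => (q.1.1.1, q.2, q.1.1.2, q.1.2)) (by fun_prop)
    have m3' : Measurable fun q : (ℝ × E3) × E3 => ∫⁻ s, F q.1.1 s q.1.2 q.2 := m4'.lintegral_prod_right'
    have m2' : Measurable fun q : ℝ × E3 => ∫⁻ y, ∫⁻ s, F q.1 s q.2 y := m3'.lintegral_prod_right'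
    have s3 : ∫⁻ t in Set.Ioi (0:ℝ), ∫⁻ x, ∫⁻ y, ∫⁻ s, F t s x y = ∫⁻ x, ∫⁻ t in Set.Ioi (0:ℝ), ∫⁻ y, ∫⁻ s, F t s x y :=
      lintegral_lintegral_swap m2'.aemeasurable
    have s4 : ∀ x, ∫⁻ t in Set.Ioi (0:ℝ), ∫⁻ y, ∫⁻ s, F t s x y = ∫⁻ y, ∫⁻ t in Set.Ioi (0:ℝ), ∫⁻ s, F t s x y := fun x =>
      lintegral_lintegral_swap (m3'.comp (f := fun p : ℝ × E3 => ((p.1, x), p.2)) (by fun_prop)).aemeasurable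
    change ∫⁻ t in Set.Ioi (0:ℝ), ∫⁻ s, ∫⁻ x, ∫⁻ y, F t s x y = _
    simp only [s1, s2]
    rw [s3, lintegral_congr s4]
    refine lintegral_congr fun x => lintegral_congr fun y => ?_
    rw [← lintegral_mul_const' _ _ (by simp [ENNReal.mul_ne_top])]
    refine lintegral_congr fun t => ?_
    rw [← lintegral_mul_const' _ _ (by simp [ENNReal.mul_ne_top])]
  rw [tonelli]
  have pt : ∀ x y, (∫⁻ t in Set.Ioi (0:ℝ), ∫⁻ s, ‖hk1 t k (s - y)‖ₑ * ‖hk1 t i (s - x)‖ₑ) *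
        (‖dB Ω x ^ β - dB Ω y ^ β‖ₑ * ‖f y‖ₑ * ‖g x‖ₑ) ≤
      ENNReal.ofReal C1 * (ENNReal.ofReal (kerA Ω β x y) * ‖dB Ω y ^ β * f y‖ₑ * ‖g x‖ₑ) := by
    intro x y
    by_cases hxy : x = y
    · simp [hxy]
    by_cases hy : y ∈ Ω
    swap
    · simp [hfΩ y hy]
    have hdy := dB_pos hΩ hy
    have hd : 0 < dist x y := dist_pos.2 hxy
    refine (mul_le_mul_left (h1 k i x y hxy) _).trans (le_of_eq ?_)
    have e : ENNReal.ofReal (kerA Ω β x y) * ‖dB Ω y ^ β * f y‖ₑ = ENNReal.ofReal (dist x y ^ (-3:ℝ)) * (‖dB Ω x ^ β - dB Ω y ^ β‖ₑ * ‖f y‖ₑ) := by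
      rw [← ofReal_norm_eq_enorm, ← ofReal_norm_eq_enorm, ← ofReal_norm_eq_enorm, ← ENNReal.ofReal_mul (kerA_nonneg _ _ _ _),
        ← ENNReal.ofReal_mul (norm_nonneg _), ← ENNReal.ofReal_mul (by positivity)]
      congr 1
      rw [norm_mul, Real.norm_eq_abs, Real.norm_eq_abs, Real.norm_eq_abs, abs_of_pos (by positivity : 0 < dB Ω y ^ β)]
      unfold kerA
      rw [Real.rpow_neg hdy.le]
      field_simp
    rw [e, ENNReal.ofReal_mul hC1.le]
    ring
  calc _ ≤ ∫⁻ x, ∫⁻ y, ENNReal.ofReal C1 * (ENNReal.ofReal (kerA Ω β x y) * ‖dB Ω y ^ β * f y‖ₑ * ‖g x‖ₑ) :=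
        lintegral_mono fun x => lintegral_mono fun y => pt x y
    _ = ENNReal.ofReal C1 * ∫⁻ x in Ω, ∫⁻ y in Ω, ENNReal.ofReal (kerA Ω β x y) * ‖dB Ω y ^ β * f y‖ₑ * ‖g x‖ₑ := by
        rw [← lintegral_const_mul' _ _ ENNReal.ofReal_ne_top, lint_restrict_eq hΩ.isOpen]
        · refine lintegral_congr fun x => ?_
          rw [lintegral_const_mul' _ _ ENNReal.ofReal_ne_top]
          congr 1
          refine lint_restrict_eq hΩ.isOpen fun y hy => ?_
          simp [hfΩ y hy]
        · intro x hx
          simp [hgΩ x hx]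
    _ ≤ ENNReal.ofReal C1 * (ENNReal.ofReal C2 * ((∫⁻ x, ‖dB Ω x ^ β * f x‖ₑ ^ (3:ℝ)) + ∫⁻ x, ‖g x‖ₑ ^ (3/2:ℝ))) := by
        gcongr
        refine (h2 (fun y => ‖dB Ω y ^ β * f y‖ₑ) (fun x => ‖g x‖ₑ) (hw.mul hf).measurable.enorm hg.measurable.enorm).trans ?_
        rw [mul_assoc]
        gcongr
        refine (young_ennreal _ _).trans (add_le_add (setLIntegral_le_lintegral _ _) (setLIntegral_le_lintegral _ _))
    _ = _ := by rw [ENNReal.ofReal_mul hC1.le, mul_assoc]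

end WeightedSec

section WeightedSec2

variable {Ω : Set E3}

lemma tsupp_zero {h : E3 → ℝ} (hs : tsupport h ⊆ Ω) (x : E3) (hx : x ∉ Ω) : h x = 0 :=
  image_eq_zero_of_notMem_tsupport fun hh => hx (hs hh)

lemma wcont (hΩ : IsLipschitzDomain Ω) {h : E3 → ℝ} (hh : Continuous h) (hs : tsupport h ⊆ Ω) (s : ℝ) :
    Continuous fun x => dB Ω x ^ s * h x := by
  rw [continuous_iff_continuousAt]
  intro x
  by_cases hx : x ∈ tsupport h
  · have := dB_pos hΩ (hs hx)
    exact ((continuous_dB Ω).continuousAt.rpow_const (Or.inl this.ne')).mul hh.continuousAt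
  · have : (fun x => dB Ω x ^ s * h x) =ᶠ[𝓝 x] fun _ => 0 := by
      filter_upwards [(isClosed_tsupport h).isOpen_compl.mem_nhds hx] with y hy
      simp [image_eq_zero_of_notMem_tsupport hy]
    exact (continuousAt_const).congr this.symm

lemma lint2_add (A B : ℝ → E3 → ℝ≥0∞) (hA : Measurable fun p : ℝ × E3 => A p.1 p.2) :
    ∫⁻ t in Set.Ioi (0:ℝ), ∫⁻ s, (A t s + B t s) =
      (∫⁻ t in Set.Ioi (0:ℝ), ∫⁻ s, A t s) + ∫⁻ t in Set.Ioi (0:ℝ), ∫⁻ s, B t s := by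
  have h1 : Measurable fun t => ∫⁻ s, A t s := hA.lintegral_prod_right'
  rw [← lintegral_add_left h1]
  refine lintegral_congr fun t => ?_
  have h2 : Measurable fun s => A t s := hA.comp (measurable_const.prodMk measurable_id)
  exact lintegral_add_left h2 _

lemma split_est (hΩ : IsLipschitzDomain Ω) (β : ℝ) (hβ0 : 0 ≤ β) (hβ : β < 2/5) :
    ∃ C : ℝ, 0 < C ∧ ∀ (f g : E3 → ℝ), Continuous f → HasCompactSupport f → (∀ x, x ∉ Ω → f x = 0) → 
      Continuous g → HasCompactSupport g → (∀ x, x ∉ Ω → g x = 0) → ∀ i k : Fin 3,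
      ∫⁻ t in Set.Ioi (0:ℝ), ∫⁻ s, ‖cv (hk1 t k) f s‖ₑ * ‖cv (hk1 t i) (fun x => dB Ω x ^ β * g x) s‖ₑ ≤
      ENNReal.ofReal C * ((∫⁻ x, ‖dB Ω x ^ β * f x‖ₑ ^ (3:ℝ)) + ∫⁻ x, ‖g x‖ₑ ^ (3/2:ℝ)) := by
  obtain ⟨C, hC, h⟩ := comm_est hΩ β hβ0 hβ
  refine ⟨3 + C, by positivity, fun f g hf hfs hfΩ hg hgs hgΩ i k => ?_⟩
  have hw := continuous_dB_rpow Ω hβ0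
  have h1 := h f g hf hfΩ hg hgΩ i k
  have h2 := bellman_est (f := fun x => dB Ω x ^ β * f x) (hw.mul hf) (hfs.mul_left (f := fun x => dB Ω x ^ β)) hg hgs k i
  have m1 : Measurable fun p : ℝ × E3 => ‖cv (hk1 p.1 k) (fun x => dB Ω x ^ β * f x) p.2‖ₑ * ‖cv (hk1 p.1 i) g p.2‖ₑ :=
    (meas_cv_hk1 (hw.mul hf).measurable k).enorm.mul (meas_cv_hk1 hg.measurable i).enorm
  calc _ ≤ ∫⁻ t in Set.Ioi (0:ℝ), ∫⁻ s, ((‖cv (hk1 t k) (fun x => dB Ω x ^ β * f x) s‖ₑ * ‖cv (hk1 t i) g s‖ₑ) +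
        ∫⁻ x, ∫⁻ y, (‖hk1 t k (s - y)‖ₑ * ‖hk1 t i (s - x)‖ₑ) *
        (‖dB Ω x ^ β - dB Ω y ^ β‖ₑ * ‖f y‖ₑ * ‖g x‖ₑ)) := by
        refine lintegral_mono fun t => lintegral_mono fun s => ?_
        exact comm_pt (contDiff_hk1 t k).continuous (contDiff_hk1 t i).continuous hf hfs hg hgs hw s
    _ = (∫⁻ t in Set.Ioi (0:ℝ), ∫⁻ s, ‖cv (hk1 t k) (fun x => dB Ω x ^ β * f x) s‖ₑ * ‖cv (hk1 t i) g s‖ₑ) +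
        ∫⁻ t in Set.Ioi (0:ℝ), ∫⁻ s, ∫⁻ x, ∫⁻ y, (‖hk1 t k (s - y)‖ₑ * ‖hk1 t i (s - x)‖ₑ) *
        (‖dB Ω x ^ β - dB Ω y ^ β‖ₑ * ‖f y‖ₑ * ‖g x‖ₑ) := by
        exact lint2_add (fun t s => ‖cv (hk1 t k) (fun x => dB Ω x ^ β * f x) s‖ₑ * ‖cv (hk1 t i) g s‖ₑ) _ m1
    _ ≤ _ := by
        refine (add_le_add h2 h1).trans (le_of_eq ?_)
        rw [← add_mul, ENNReal.ofReal_add (by norm_num) hC.le]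
        norm_num

lemma cv_smul (K f : E3 → ℝ) (c : ℝ) (x : E3) : cv K (fun y => c * f y) x = c * cv K f x := by
  unfold cv
  rw [← integral_const_mul]
  congr 1; funext y; ring

lemma split_est' (hΩ : IsLipschitzDomain Ω) (β : ℝ) (hβ0 : 0 ≤ β) (hβ : β < 2/5) :
    ∃ C : ℝ, 0 < C ∧ ∀ (f g : E3 → ℝ), Continuous f → HasCompactSupport f → (∀ x, x ∉ Ω → f x = 0) → 
      Continuous g → HasCompactSupport g → (∀ x, x ∉ Ω → g x = 0) → ∀ i k : Fin 3,
      ∫⁻ t in Set.Ioi (0:ℝ), ∫⁻ s, ‖cv (hk1 t k) f s‖ₑ * ‖cv (hk1 t i) (fun x => dB Ω x ^ β * g x) s‖ₑ ≤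
      ENNReal.ofReal C * (∫⁻ x, ‖dB Ω x ^ β * f x‖ₑ ^ (3:ℝ)) + ENNReal.ofReal (1/12) * ∫⁻ x, ‖g x‖ₑ ^ (3/2:ℝ) := by
  obtain ⟨C, hC, h⟩ := split_est hΩ β hβ0 hβ
  set l : ℝ := (12 * C) ^ (2/3:ℝ) with hl
  have hl0 : 0 < l := by positivity
  refine ⟨C * l ^ (3:ℝ), by positivity, fun f g hf hfs hfΩ hg hgs hgΩ i k => ?_⟩
  have h1 := h (fun x => l * f x) (fun x => l⁻¹ * g x) (continuous_const.mul hf) hfs.mul_left (fun x hx => by simp [hfΩ x hx])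
    (continuous_const.mul hg) hgs.mul_left (fun x hx => by simp [hgΩ x hx]) i k
  have e1 : ∀ t s, ‖cv (hk1 t k) (fun x => l * f x) s‖ₑ * ‖cv (hk1 t i) (fun x => dB Ω x ^ β * (l⁻¹ * g x)) s‖ₑ =
      ‖cv (hk1 t k) f s‖ₑ * ‖cv (hk1 t i) (fun x => dB Ω x ^ β * g x) s‖ₑ := by
    intro t s
    have : (fun x => dB Ω x ^ β * (l⁻¹ * g x)) = fun x => l⁻¹ * (dB Ω x ^ β * g x) := by funext x; ring
    rw [this, cv_smul, cv_smul, ← enorm_mul, ← enorm_mul]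
    congr 1
    field_simp
  simp only [e1] at h1
  refine h1.trans (le_of_eq ?_)
  have e2 : ∀ x, ‖dB Ω x ^ β * (l * f x)‖ₑ ^ (3:ℝ) = ENNReal.ofReal (l ^ (3:ℝ)) * ‖dB Ω x ^ β * f x‖ₑ ^ (3:ℝ) := by
    intro x
    rw [show dB Ω x ^ β * (l * f x) = l * (dB Ω x ^ β * f x) by ring, enorm_mul, ENNReal.mul_rpow_of_nonneg _ _ (by norm_num),
      Real.enorm_of_nonneg hl0.le, ENNReal.ofReal_rpow_of_pos hl0]
  have e3 : ∀ x, ‖l⁻¹ * g x‖ₑ ^ (3/2:ℝ) = ENNReal.ofReal (l⁻¹ ^ (3/2:ℝ)) * ‖g x‖ₑ ^ (3/2:ℝ) := by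
    intro x
    rw [enorm_mul, ENNReal.mul_rpow_of_nonneg _ _ (by norm_num),
      Real.enorm_of_nonneg (by positivity), ENNReal.ofReal_rpow_of_pos (by positivity)]
  simp only [e2, e3]
  rw [lintegral_const_mul' _ _ ENNReal.ofReal_ne_top, lintegral_const_mul' _ _ ENNReal.ofReal_ne_top, mul_add, ← mul_assoc,
    ← mul_assoc, ← ENNReal.ofReal_mul hC.le, ← ENNReal.ofReal_mul hC.le]
  congr 3
  rw [hl, ← Real.rpow_neg_one, ← Real.rpow_mul (by positivity), ← Real.rpow_mul (by positivity)]
  norm_num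
  rw [Real.rpow_neg_one]
  field_simp

lemma pd_eq {φ : E3 → E3} (hφ : Differentiable ℝ φ) (i j : Fin 3) (x : E3) :
    pd φ i j x = pds (fun y => φ y j) i x := by
  unfold pd pds
  have h : HasFDerivAt (fun y => φ y j) ((EuclideanSpace.proj j : E3 →L[ℝ] ℝ).comp (fderiv ℝ φ x)) x :=
    (EuclideanSpace.proj j : E3 →L[ℝ] ℝ).hasFDerivAt.comp x (hφ x).hasFDerivAt
  rw [h.fderiv]; rfl

lemma absorb {X A : ℝ≥0∞} (hX : X ≠ ∞) (h : X ≤ A + ENNReal.ofReal (1/2) * X) : X ≤ 2 * A := by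
  have h2 : (2:ℝ≥0∞) * ENNReal.ofReal (1/2) = 1 := by
    rw [show (2:ℝ≥0∞) = ENNReal.ofReal 2 by norm_num, ← ENNReal.ofReal_mul (by norm_num)]; norm_num
  have h1 : X + X ≤ 2 * A + X := by
    calc X + X = 2 * X := by ring
      _ ≤ 2 * (A + ENNReal.ofReal (1/2) * X) := by gcongr
      _ = _ := by rw [mul_add, ← mul_assoc, h2, one_mul]
  exact (ENNReal.add_le_add_iff_right hX).1 h1

lemma comp_tsupp {φ : E3 → E3} (hs : tsupport φ ⊆ Ω) (j : Fin 3) : tsupport (fun y => φ y j) ⊆ Ω :=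
  (closure_mono fun x hx => by
    intro h; exact hx (by simp [h])).trans hs

lemma comp_supp {φ : E3 → E3} (hs : HasCompactSupport φ) (j : Fin 3) : HasCompactSupport (fun y => φ y j) :=
  hs.comp_left (g := fun v : E3 => v j) rfl

lemma comp_smooth {φ : E3 → E3} (hs : ContDiff ℝ (⊤ : ℕ∞) φ) (j : Fin 3) : ContDiff ℝ (⊤ : ℕ∞) (fun y => φ y j) :=
  (contDiff_coord j).comp hs

lemma pds_tsupp {h : E3 → ℝ} (hs : tsupport h ⊆ Ω) (k : Fin 3) : tsupport (pds h k) ⊆ Ω := by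
  unfold pds; exact (tsupport_fderiv_apply_subset ℝ (ee k)).trans hs

lemma lint_cube_finite {u : E3 → ℝ} (hu : Continuous u) (hus : HasCompactSupport u) :
    Integrable (fun x => |u x| ^ (3:ℝ)) ∧ ∫⁻ x, ‖u x‖ₑ ^ (3:ℝ) = ENNReal.ofReal (∫ x, |u x| ^ (3:ℝ)) := by
  have h1 : Integrable (fun x => |u x| ^ (3:ℝ)) := by
    refine (hu.abs.rpow_const fun _ => Or.inr (by norm_num)).integrable_of_hasCompactSupport ?_
    exact hus.comp_left (g := fun y : ℝ => |y| ^ (3:ℝ)) (by norm_num)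
  refine ⟨h1, ?_⟩
  rw [ofReal_integral_eq_lintegral_ofReal h1 (Eventually.of_forall fun x => by positivity)]
  congr 1; funext x
  rw [← ofReal_norm_eq_enorm, Real.norm_eq_abs, ENNReal.ofReal_rpow_of_nonneg (abs_nonneg _) (by norm_num)]

theorem grad_est (hΩ : IsLipschitzDomain Ω) (β : ℝ) (hβ0 : 0 ≤ β) (hβ : β < 2/5) :
    ∃ C : ℝ, 0 < C ∧ ∀ φ : E3 → E3, IsTestSol Ω φ → ∀ i j : Fin 3,
      ∫⁻ x, ‖dB Ω x ^ β * pd φ i j x‖ₑ ^ (3:ℝ) ≤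
      ENNReal.ofReal C * ∑ k, ∫⁻ x, ‖dB Ω x ^ β * (pd φ k j x - pd φ j k x)‖ₑ ^ (3:ℝ) := by
  obtain ⟨C, hC, h⟩ := split_est' hΩ β hβ0 hβ
  refine ⟨4 * C, by positivity, fun φ hφ i j => ?_⟩
  have hw := continuous_dB_rpow Ω hβ0
  have hsm := fun j => comp_smooth hφ.smooth j
  have hsu := fun j => comp_supp hφ.compsupp j
  have hts := fun j => comp_tsupp hφ.suppin j
  have hd : Differentiable ℝ φ := hφ.smooth.differentiable (by simp)
  simp only [pd_eq hd]
  set ψ : Fin 3 → E3 → ℝ := fun j y => φ y j with hψ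
  have hdiv : ∀ x, ∑ k, pds (ψ k) k x = 0 := by
    intro x
    rw [← hφ.sol x]
    exact Finset.sum_congr rfl fun k _ => (pd_eq hd k k x).symm
  have hc1 : ∀ j, ContDiff ℝ 1 (ψ j) := fun j => c1 (hsm j)
  have hc2 : ∀ j, ContDiff ℝ 2 (ψ j) := fun j => contDiff_infty.1 (hsm j) 2
  set u : E3 → ℝ := fun x => dB Ω x ^ β * pds (ψ j) i x with hu
  have cu : Continuous u := hw.mul (pds_continuous (hc1 j) i)
  have su : HasCompactSupport u := (pds_supp (hsu j) i).mul_left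
  have u0 : ∀ x, x ∉ Ω → u x = 0 := fun x hx => by
    rw [hu]; simp only; rw [tsupp_zero (pds_tsupp (hts j) i) x hx, mul_zero]
  set g : E3 → ℝ := fun x => |u x| * u x with hg
  have cg : Continuous g := cu.abs.mul cu
  have sg : HasCompactSupport g := su.mul_left
  have g0 : ∀ x, x ∉ Ω → g x = 0 := fun x hx => by simp [hg, u0 x hx]
  obtain ⟨iu, eu⟩ := lint_cube_finite cu su
  have e1 : ∫⁻ x, ‖g x‖ₑ ^ (3/2:ℝ) = ∫⁻ x, ‖u x‖ₑ ^ (3:ℝ) := by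
    congr 1; funext x
    rw [hg, enorm_mul, enorm_abs, ← sq, ← ENNReal.rpow_natCast, ← ENNReal.rpow_mul]
    norm_num
  have e2 : ‖∫ x, pds (ψ j) i x * (dB Ω x ^ β * g x)‖ₑ = ∫⁻ x, ‖u x‖ₑ ^ (3:ℝ) := by
    rw [eu, Real.enorm_eq_ofReal_abs]
    congr 1
    rw [abs_of_nonneg]
    · congr 1; funext x
      have : |u x| ^ (3:ℝ) = |u x| * (u x * u x) := by
        rw [← abs_mul_abs_self (u x)]
        rw [show (3:ℝ) = ((3:ℕ):ℝ) by norm_num, Real.rpow_natCast]; ring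
      rw [this]; simp only [hg, hu]; ring
    · refine integral_nonneg fun x => ?_
      have : pds (ψ j) i x * (dB Ω x ^ β * g x) = |u x| * (u x * u x) := by simp only [hg, hu]; ring
      simp only [this]
      exact mul_nonneg (abs_nonneg _) (mul_self_nonneg _)
  have h1 := pair_rep hc2 hsu hdiv (hw.mul cg) (sg.mul_left (f := fun x => dB Ω x ^ β)) i j
  rw [show (fun x => dB Ω x ^ β) * g = fun x => dB Ω x ^ β * g x from rfl] at h1
  rw [e2] at h1
  set Y : Fin 3 → ℝ≥0∞ := fun k => ∫⁻ x, ‖dB Ω x ^ β * (pds (ψ j) k x - pds (ψ k) j x)‖ₑ ^ (3:ℝ) with hY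
  set X := ∫⁻ x, ‖u x‖ₑ ^ (3:ℝ) with hX
  have h3 : X ≤ 2 * ∑ k, (ENNReal.ofReal C * Y k + ENNReal.ofReal (1/12) * X) := by
    refine h1.trans ?_
    gcongr with k
    have := h (fun y => pds (ψ j) k y - pds (ψ k) j y) g ((pds_continuous (hc1 j) k).sub (pds_continuous (hc1 k) j))
      ((pds_supp (hsu j) k).sub (pds_supp (hsu k) j))
      (fun x hx => by rw [tsupp_zero (pds_tsupp (hts j) k) x hx, tsupp_zero (pds_tsupp (hts k) j) x hx, sub_zero]) cg sg g0 i k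
    rw [e1] at this
    exact this
  have hXt : X ≠ ∞ := by rw [eu]; exact ENNReal.ofReal_ne_top
  have h4 := absorb (A := 2 * (ENNReal.ofReal C * ∑ k, Y k)) hXt (h3.trans (le_of_eq ?_))
  · refine h4.trans (le_of_eq ?_)
    rw [ENNReal.ofReal_mul (by norm_num)]
    norm_num
    ring
  · rw [Finset.sum_add_distrib, Finset.mul_sum, mul_add]
    congr 1
    rw [Finset.sum_const, Finset.card_univ, Fintype.card_fin, nsmul_eq_mul, ← mul_assoc, ← mul_assoc]
    congr 1
    rw [show (2:ℝ≥0∞) = ENNReal.ofReal 2 by norm_num, show ((3:ℕ):ℝ≥0∞) = ENNReal.ofReal 3 by norm_num,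
      ← ENNReal.ofReal_mul (by norm_num), ← ENNReal.ofReal_mul (by norm_num)]
    norm_num

lemma point_est : ∃ C : ℝ, 0 < C ∧ ∀ h : E3 → ℝ, ContDiff ℝ 1 h → HasCompactSupport h → ∀ x,
    ‖h x‖ₑ ≤ ENNReal.ofReal C * ∑ k, ∫⁻ y, ENNReal.ofReal (dist x y ^ (-2:ℝ)) * ‖pds h k y‖ₑ := by
  obtain ⟨C, hC, h1⟩ := time_int_hk1
  refine ⟨C, hC, fun h hh hs x => ?_⟩
  refine (point_rep hh hs x).trans ?_
  rw [Finset.mul_sum]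
  refine Finset.sum_le_sum fun k _ => ?_
  have mp := (pds_continuous hh k).measurable
  calc _ ≤ ∫⁻ t in Set.Ioi (0:ℝ), ∫⁻ y, ‖hk1 t k (x - y)‖ₑ * ‖pds h k y‖ₑ := lintegral_mono fun t => enorm_cv_le _ _ _
    _ = ∫⁻ y, ∫⁻ t in Set.Ioi (0:ℝ), ‖hk1 t k (x - y)‖ₑ * ‖pds h k y‖ₑ := by
        refine lintegral_lintegral_swap (Measurable.aemeasurable ?_)
        exact ((meas_hk1 k).comp (f := fun q : ℝ × E3 => (q.1, x - q.2)) (by fun_prop)).enorm.mul (mp.comp measurable_snd).enorm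
    _ ≤ ∫⁻ y, ENNReal.ofReal C * (ENNReal.ofReal (dist x y ^ (-2:ℝ)) * ‖pds h k y‖ₑ) := by
        refine lintegral_mono_ae ?_
        have : ∀ᵐ y : E3, y ≠ x := by simp [ae_iff, measure_singleton]
        filter_upwards [this] with y hy
        rw [lintegral_mul_const' _ _ enorm_ne_top, ← mul_assoc, ← ENNReal.ofReal_mul hC.le, dist_eq_norm]
        gcongr
        refine le_trans (le_of_eq ?_) (h1 k (x - y) (sub_ne_zero.2 hy.symm))
        refine lintegral_congr fun t => ?_
        rw [← ofReal_norm_eq_enorm, Real.norm_eq_abs]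
    _ = _ := lintegral_const_mul' _ _ ENNReal.ofReal_ne_top

theorem pot_est (hΩ : IsLipschitzDomain Ω) (β : ℝ) (hβ0 : 0 ≤ β) (hβ : β < 2/5) :
    ∃ C : ℝ, 0 < C ∧ ∀ h : E3 → ℝ, ContDiff ℝ 1 h → HasCompactSupport h → tsupport h ⊆ Ω →
      ∫⁻ x, ‖dB Ω x ^ (-(β/2)) * h x‖ₑ ^ (3:ℝ) ≤
      ENNReal.ofReal C * ∑ k, ∫⁻ x, ‖dB Ω x ^ β * pds h k x‖ₑ ^ (3:ℝ) := by
  obtain ⟨C1, hC1, h1⟩ := point_est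
  obtain ⟨C2, hC2, h2⟩ := schur_b hΩ β hβ0 hβ
  set A : ℝ := (C1 * C2) ^ 3 * 36 with hA
  refine ⟨2 * A, by positivity, fun h hh hs hts => ?_⟩
  have hw := continuous_dB_rpow Ω hβ0
  set u : E3 → ℝ := fun x => dB Ω x ^ (-(β/2)) * h x with hu
  have cu : Continuous u := wcont hΩ hh.continuous hts _
  have su : HasCompactSupport u := hs.mul_left
  obtain ⟨iu, eu⟩ := lint_cube_finite cu su
  have pc := fun k => pds_continuous hh k
  have p0 : ∀ k x, x ∉ Ω → pds h k x = 0 := fun k x hx => tsupp_zero (pds_tsupp hts k) x hx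
  have u0 : ∀ x, x ∉ Ω → u x = 0 := fun x hx => by simp [hu, tsupp_zero hts x hx]
  set X := ∫⁻ x, ‖u x‖ₑ ^ (3:ℝ) with hX
  set Y : Fin 3 → ℝ≥0∞ := fun k => ∫⁻ x, ‖dB Ω x ^ β * pds h k x‖ₑ ^ (3:ℝ) with hY
  have hXt : X ≠ ∞ := by rw [eu]; exact ENNReal.ofReal_ne_top
  have pt : ∀ x ∈ Ω, ‖u x‖ₑ ^ (3:ℝ) ≤ ENNReal.ofReal C1 * ∑ k, ∫⁻ y in Ω, ENNReal.ofReal (kerB Ω β x y) * ‖dB Ω y ^ β * pds h k y‖ₑ * ‖u x‖ₑ ^ (2:ℝ) := by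
    intro x hx
    have hdx := dB_pos hΩ hx
    have e : ‖u x‖ₑ ^ (3:ℝ) = ‖u x‖ₑ * ‖u x‖ₑ ^ (2:ℝ) := by
      rw [show (3:ℝ) = 1 + 2 by norm_num, ENNReal.rpow_add_of_nonneg _ _ (by norm_num) (by norm_num), ENNReal.rpow_one]
    have ht : ‖u x‖ₑ ^ (2:ℝ) ≠ ∞ := ENNReal.rpow_ne_top_of_nonneg (by norm_num) enorm_ne_top
    have hx1 : ‖u x‖ₑ ≤ ENNReal.ofReal C1 * ∑ k, ∫⁻ y in Ω, ENNReal.ofReal (kerB Ω β x y) * ‖dB Ω y ^ β * pds h k y‖ₑ := by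
      rw [hu, enorm_mul, Real.enorm_of_nonneg (by positivity)]
      refine (mul_le_mul_right (h1 h hh hs x) _).trans (le_of_eq ?_)
      rw [← mul_assoc, mul_comm (ENNReal.ofReal _) (ENNReal.ofReal C1), mul_assoc]
      congr 1
      rw [Finset.mul_sum]
      refine Finset.sum_congr rfl fun k _ => ?_
      rw [lint_restrict_eq hΩ.isOpen (fun y hy => by simp [p0 k y hy]), ← lintegral_const_mul' _ _ ENNReal.ofReal_ne_top]
      refine setLIntegral_congr_fun hΩ.isOpen.measurableSet fun y hy => ?_
      have hdy := dB_pos hΩ hy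
      have hdd : 0 ≤ dist x y := dist_nonneg
      rw [enorm_mul, Real.enorm_of_nonneg (by positivity : 0 ≤ dB Ω y ^ β), ← mul_assoc, ← mul_assoc,
        ← ENNReal.ofReal_mul (by positivity), ← ENNReal.ofReal_mul (by unfold kerB; positivity)]
      congr 2
      unfold kerB
      rw [mul_assoc, ← Real.rpow_add hdy]
      norm_num
    rw [e]
    refine (mul_le_mul_left hx1 _).trans (le_of_eq ?_)
    rw [mul_assoc, Finset.sum_mul]
    congr 1
    refine Finset.sum_congr rfl fun k _ => ?_
    rw [lintegral_mul_const' _ _ ht]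
  have hmB : Measurable fun p : E3 × E3 => ENNReal.ofReal (kerB Ω β p.1 p.2) := by
    unfold kerB
    exact ((((continuous_dB Ω).measurable.comp measurable_fst).pow_const _).mul ((measurable_fst.dist measurable_snd).pow_const _)
      |>.mul (((continuous_dB Ω).measurable.comp measurable_snd).pow_const _)).ennreal_ofReal
  have hm : ∀ k, Measurable fun x => ∫⁻ y in Ω, ENNReal.ofReal (kerB Ω β x y) * ‖dB Ω y ^ β * pds h k y‖ₑ * ‖u x‖ₑ ^ (2:ℝ) := by
    intro k
    have : Measurable fun p : E3 × E3 => ENNReal.ofReal (kerB Ω β p.1 p.2) * ‖dB Ω p.2 ^ β * pds h k p.2‖ₑ * ‖u p.1‖ₑ ^ (2:ℝ) :=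
      (hmB.mul ((hw.mul (pc k)).measurable.comp measurable_snd).enorm).mul ((cu.measurable.comp measurable_fst).enorm.pow_const _)
    exact this.lintegral_prod_right'
  have h3 : X ≤ ∑ k, (ENNReal.ofReal A * Y k + ENNReal.ofReal (1/6) * X) := by
    have s1 : X = ∫⁻ x in Ω, ‖u x‖ₑ ^ (3:ℝ) := lint_restrict_eq hΩ.isOpen fun x hx => by simp [u0 x hx]
    calc X = ∫⁻ x in Ω, ‖u x‖ₑ ^ (3:ℝ) := s1
      _ ≤ ∫⁻ x in Ω, ENNReal.ofReal C1 * ∑ k, ∫⁻ y in Ω, ENNReal.ofReal (kerB Ω β x y) * ‖dB Ω y ^ β * pds h k y‖ₑ * ‖u x‖ₑ ^ (2:ℝ) :=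
          setLIntegral_mono' hΩ.isOpen.measurableSet pt
      _ = ∑ k, ENNReal.ofReal C1 * ∫⁻ x in Ω, ∫⁻ y in Ω, ENNReal.ofReal (kerB Ω β x y) * ‖dB Ω y ^ β * pds h k y‖ₑ * ‖u x‖ₑ ^ (2:ℝ) := by
          rw [lintegral_const_mul' _ _ ENNReal.ofReal_ne_top, lintegral_finsetSum _ (fun k _ => hm k), Finset.mul_sum]
      _ ≤ _ := by
          refine Finset.sum_le_sum fun k _ => ?_
          have h4 := h2 (fun y => ‖dB Ω y ^ β * pds h k y‖ₑ) (fun x => ‖u x‖ₑ ^ (2:ℝ)) (hw.mul (pc k)).measurable.enorm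
            (cu.measurable.enorm.pow_const _)
          have e5 : ∫⁻ x in Ω, (‖u x‖ₑ ^ (2:ℝ)) ^ (3/2:ℝ) = X := by
            rw [s1]
            refine lintegral_congr fun x => ?_
            rw [← ENNReal.rpow_mul]; norm_num
          have e6 : ∫⁻ y in Ω, ‖dB Ω y ^ β * pds h k y‖ₑ ^ (3:ℝ) = Y k := by
            rw [← lint_restrict_eq hΩ.isOpen fun y hy => by simp [p0 k y hy]]
          rw [e5, e6] at h4
          refine (mul_le_mul_right h4 _).trans ?_
          refine le_trans (le_of_eq ?_) (young_ennreal (ENNReal.ofReal A * Y k) (ENNReal.ofReal (1/6) * X))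
          rw [ENNReal.mul_rpow_of_nonneg _ _ (by norm_num), ENNReal.mul_rpow_of_nonneg _ _ (by norm_num),
            ENNReal.ofReal_rpow_of_pos (by positivity), ENNReal.ofReal_rpow_of_pos (by positivity)]
          have : ENNReal.ofReal (A ^ (1/3:ℝ)) * ENNReal.ofReal ((1/6) ^ (2/3:ℝ)) = ENNReal.ofReal C1 * ENNReal.ofReal C2 := by
            rw [← ENNReal.ofReal_mul (by positivity), ← ENNReal.ofReal_mul (by positivity)]
            congr 1
            rw [hA, show ((C1 * C2) ^ 3 * 36 : ℝ) = (C1 * C2) ^ (3:ℝ) * (6:ℝ) ^ (2:ℝ) by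
              rw [show (3:ℝ) = ((3:ℕ):ℝ) by norm_num, Real.rpow_natCast]; norm_num,
              Real.mul_rpow (by positivity) (by positivity), ← Real.rpow_mul (by positivity), ← Real.rpow_mul (by positivity),
              show (1/6:ℝ) = 6⁻¹ by norm_num, Real.inv_rpow (by positivity)]
            norm_num
          calc _ = (ENNReal.ofReal C1 * ENNReal.ofReal C2) * (Y k ^ (1/3:ℝ) * X ^ (2/3:ℝ)) := by ring
            _ = _ := by rw [← this]; ring
  have h4 := absorb (A := ENNReal.ofReal A * ∑ k, Y k) hXt (h3.trans (le_of_eq ?_))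
  · refine h4.trans (le_of_eq ?_)
    rw [ENNReal.ofReal_mul (p := 2) (by norm_num)]
    norm_num
    ring
  · rw [Finset.sum_add_distrib, Finset.mul_sum]
    congr 1
    rw [Finset.sum_const, Finset.card_univ, Fintype.card_fin, nsmul_eq_mul, ← mul_assoc]
    congr 1
    rw [show ((3:ℕ):ℝ≥0∞) = ENNReal.ofReal 3 by norm_num, ← ENNReal.ofReal_mul (by norm_num)]
    norm_num

end WeightedSec2

/-! ### The Banach space setting -/

instance hT1 : ENNReal.HolderTriple 3 3 (3/2) := ⟨by
  rw [ENNReal.inv_div (by simp) (by simp), ENNReal.div_eq_inv_mul, mul_comm, two_mul, ← two_mul, two_mul, add_comm]⟩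

instance hT2 : ENNReal.HolderTriple (3/2) 3 1 := ⟨by
  rw [ENNReal.inv_div (by simp) (by simp), inv_one, ENNReal.div_eq_inv_mul]
  rw [← mul_one (3:ℝ≥0∞)⁻¹, mul_assoc, ← mul_add, one_mul]
  have : (2:ℝ≥0∞) + 1 = 3 := by norm_num
  rw [this]
  exact ENNReal.inv_mul_cancel (by simp) (by simp)⟩

instance hF3 : Fact ((1:ℝ≥0∞) ≤ 3) := ⟨by norm_num⟩

instance hF32 : Fact ((1:ℝ≥0∞) ≤ 3/2) := ⟨by
  rw [ENNReal.le_div_iff_mul_le (by simp) (by simp)]; norm_num⟩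

section LpGen

variable {X : Type*} [MeasurableSpace X] {μ : Measure X}
variable {V : Type*} [NormedAddCommGroup V] [InnerProductSpace ℝ V]

lemma norm_three {a : V} {n : ℕ} (h : n = 3) : ‖a‖ ^ n = ‖a‖ ^ 3 := by rw [h]

lemma eLp3 (f : X → V) : eLpNorm f 3 μ = (∫⁻ x, ‖f x‖ₑ ^ (3:ℝ) ∂μ) ^ ((1:ℝ)/3) := by
  rw [eLpNorm_eq_lintegral_rpow_enorm_toReal (by simp) (by simp)]
  simp

lemma integrable_cube (f : Lp V 3 μ) : Integrable (fun x => ‖f x‖ ^ 3) μ := by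
  have := (Lp.memLp f).integrable_norm_rpow (by simp) (by simp)
  refine this.congr (ae_of_all _ fun x => ?_)
  simp only [ENNReal.toReal_ofNat]
  exact_mod_cast rfl

lemma Lp3_norm (f : Lp V 3 μ) : ‖f‖ ^ 3 = ∫ x, ‖f x‖ ^ 3 ∂μ := by
  rw [Lp.norm_def, eLp3]
  rw [integral_eq_lintegral_of_nonneg_ae (ae_of_all _ fun x => by positivity) (integrable_cube f).1]
  rw [← ENNReal.toReal_pow, ← ENNReal.rpow_natCast, ← ENNReal.rpow_mul]
  norm_num

lemma clarkson_pt (a b : V) :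
    ‖(1/2:ℝ) • (a + b)‖ ^ 3 + ‖(1/2:ℝ) • (a - b)‖ ^ 3 ≤ (‖a‖ ^ 3 + ‖b‖ ^ 3) / 2 := by
  have h := parallelogram_law_with_norm ℝ a b
  rw [norm_smul, norm_smul]
  have h2 : ‖(1/2:ℝ)‖ = 1/2 := by norm_num
  rw [h2]
  set A := ‖a‖
  set B := ‖b‖
  set s := ‖a + b‖
  set t := ‖a - b‖
  have hA : 0 ≤ A := norm_nonneg _
  have hB : 0 ≤ B := norm_nonneg _
  have hs : 0 ≤ s := norm_nonneg _
  have ht : 0 ≤ t := norm_nonneg _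
  refine (pow_le_pow_iff_left₀ (by positivity) (by positivity) two_ne_zero).1 ?_
  have e1 : ((1/2*s)^3 + (1/2*t)^3)^2 ≤ ((s*s+t*t)/4)^3 := by
    have : 0 ≤ s^2*t^2*((s-t)^2 + (s^2+t^2)/2) := by positivity
    have e : ((s*s+t*t)/4)^3 - ((1/2*s)^3 + (1/2*t)^3)^2 = (3*s^4*t^2+3*s^2*t^4 - 2*s^3*t^3)/64 := by ring
    have e' : 3*s^4*t^2+3*s^2*t^4 - 2*s^3*t^3 = s^2*t^2*((s-t)^2 + 2*(s^2+t^2)) := by ring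
    have : 0 ≤ s^2*t^2*((s-t)^2 + 2*(s^2+t^2)) := by positivity
    linarith
  have e2 : ((A*A+B*B)/2)^3 ≤ ((A^3+B^3)/2)^2 := by
    have : 0 ≤ (A-B)^2*(A^4+2*A^3*B+2*A*B^3+B^4) := by positivity
    have e : ((A^3+B^3)/2)^2 - ((A*A+B*B)/2)^3 = (A-B)^2*(A^4+2*A^3*B+2*A*B^3+B^4)/8 := by ring
    linarith
  have e3 : (s*s+t*t)/4 = (A*A+B*B)/2 := by linarith
  rw [e3] at e1
  exact e1.trans e2

lemma clarkson3_Lp : Clarkson3 (Lp V 3 μ) := by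
  intro f g
  rw [Lp3_norm, Lp3_norm, Lp3_norm, Lp3_norm]
  rw [← integral_add (integrable_cube _) (integrable_cube _),
    ← integral_add (integrable_cube _) (integrable_cube _), ← integral_div]
  refine integral_mono_ae ((integrable_cube _).add (integrable_cube _))
    (((integrable_cube _).add (integrable_cube _)).div_const _) ?_
  filter_upwards [Lp.coeFn_add f g, Lp.coeFn_sub f g, Lp.coeFn_smul (1/2:ℝ) (f+g),
    Lp.coeFn_smul (1/2:ℝ) (f-g)] with x h1 h2 h3 h4
  rw [h3, h4]
  simp only [Pi.smul_apply, h1, h2, Pi.add_apply, Pi.sub_apply]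
  exact clarkson_pt _ _

lemma mono_pt (a b : V) :
    (1/2) * ‖a - b‖ ^ 3 ≤ inner ℝ (‖a‖ • a - ‖b‖ • b) (a - b) := by
  have h0 := norm_sub_sq_real a b
  have h1 : inner ℝ (‖a‖ • a - ‖b‖ • b) (a - b) = ‖a‖^3 + ‖b‖^3 - (‖a‖+‖b‖) * inner ℝ a b := by
    simp only [inner_sub_left, inner_sub_right, inner_smul_left, real_inner_self_eq_norm_sq,
      real_inner_comm a b]
    simp
    ring
  rw [h1]
  have h2 := norm_sub_le a b
  set A := ‖a‖
  set B := ‖b‖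
  set D := ‖a - b‖
  set p := inner ℝ a b
  have hA : 0 ≤ A := norm_nonneg _
  have hB : 0 ≤ B := norm_nonneg _
  have hp : p = (A^2+B^2-D^2)/2 := by linarith
  rw [hp]
  have : A^3+B^3-(A+B)*((A^2+B^2-D^2)/2) = (A+B)*D^2/2 + (A+B)*(A-B)^2/2 := by ring
  rw [this]
  have h3 : D * D^2 ≤ (A+B)*D^2 := mul_le_mul_of_nonneg_right h2 (sq_nonneg _)
  have h4 : 0 ≤ (A+B)*(A-B)^2/2 := by positivity
  nlinarith

/-- `|y| y`. -/
def nsq (y : Lp V 3 μ) : Lp V (3/2) μ :=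
  (ContinuousLinearMap.lsmul ℝ ℝ : ℝ →L[ℝ] V →L[ℝ] V).holder (3/2)
    (lipschitzWith_one_norm.compLp norm_zero y) y

lemma nsq_ae (y : Lp V 3 μ) : nsq y =ᵐ[μ] fun x => ‖y x‖ • y x := by
  unfold nsq
  filter_upwards [ContinuousLinearMap.coeFn_holder (r := 3/2) (ContinuousLinearMap.lsmul ℝ ℝ : ℝ →L[ℝ] V →L[ℝ] V) 
    (lipschitzWith_one_norm.compLp norm_zero y) y, lipschitzWith_one_norm.coeFn_compLp norm_zero y] with x h1 h2
  rw [h1, h2]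
  simp

lemma nsq_norm (y : Lp V 3 μ) : ‖nsq y‖ ≤ ‖y‖ ^ 2 := by
  have h := (ContinuousLinearMap.lsmul ℝ ℝ : ℝ →L[ℝ] V →L[ℝ] V).norm_holder_apply_apply_le (r := 3/2)
    (lipschitzWith_one_norm.compLp norm_zero y) y
  have h1 : ‖(ContinuousLinearMap.lsmul ℝ ℝ : ℝ →L[ℝ] V →L[ℝ] V)‖ ≤ 1 :=
    ContinuousLinearMap.opNorm_lsmul_le
  have h2 := lipschitzWith_one_norm.norm_compLp_le norm_zero y
  simp only [NNReal.coe_one, one_mul] at h2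
  calc ‖nsq y‖ ≤ _ := h
    _ ≤ 1 * ‖y‖ * ‖y‖ := by gcongr
    _ = _ := by ring

lemma nsq_cont : Continuous (nsq : Lp V 3 μ → Lp V (3/2) μ) := by
  have h : Continuous fun y : Lp V 3 μ => ((ContinuousLinearMap.lsmul ℝ ℝ : ℝ →L[ℝ] V →L[ℝ] V).holderL μ 3 3 (3/2))
    (lipschitzWith_one_norm.compLp norm_zero y) y := by
    have := lipschitzWith_one_norm.continuous_compLp (E := V) (p := 3) (μ := μ) norm_zero
    fun_prop
  exact h

/-- The pairing of `|y| y` with `y'`. -/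
def aF (y : Lp V 3 μ) : Lp V 3 μ →L[ℝ] ℝ :=
  (innerSL ℝ : V →L[ℝ] V →L[ℝ] ℝ).lpPairing μ (3/2) 3 (nsq y)

lemma aF_cont (y' : Lp V 3 μ) : Continuous fun y : Lp V 3 μ => aF y y' := by
  unfold aF
  have := nsq_cont (V := V) (μ := μ)
  fun_prop

lemma aF_eq (y y' : Lp V 3 μ) : aF y y' = ∫ x, ‖y x‖ * inner ℝ (y x) (y' x) ∂μ := by
  unfold aF
  rw [ContinuousLinearMap.lpPairing_eq_integral]
  refine integral_congr_ae ?_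
  filter_upwards [nsq_ae y] with x h
  rw [h]
  simp only [map_smul, ContinuousLinearMap.smul_apply, smul_eq_mul]
  rfl

lemma aF_self (y : Lp V 3 μ) : aF y y = ‖y‖ ^ 3 := by
  rw [aF_eq, Lp3_norm]
  refine integral_congr_ae (ae_of_all _ fun x => ?_)
  simp only [real_inner_self_eq_norm_sq]
  ring

lemma aF_bound (y : Lp V 3 μ) : ‖aF y‖ ≤ ‖y‖ ^ 2 := by
  refine ContinuousLinearMap.opNorm_le_bound _ (by positivity) fun y' => ?_
  unfold aF
  rw [ContinuousLinearMap.lpPairing_eq_integral]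
  have h1 := (innerSL ℝ : V →L[ℝ] V →L[ℝ] ℝ).norm_holder_apply_apply_le (r := 1) (nsq y) y'
  have h2 : ‖(innerSL ℝ : V →L[ℝ] V →L[ℝ] ℝ)‖ ≤ 1 := norm_innerSL_le _
  have h3 := nsq_norm y
  have h4 : ‖∫ x, (innerSL ℝ : V →L[ℝ] V →L[ℝ] ℝ) (nsq y x) (y' x) ∂μ‖ ≤ ‖(innerSL ℝ : V →L[ℝ] V →L[ℝ] ℝ).holder 1 (nsq y) y'‖ := by
    rw [← integral_congr_ae ((innerSL ℝ : V →L[ℝ] V →L[ℝ] ℝ).coeFn_holder (r := 1) (nsq y) y')]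
    rw [← L1.integral_eq_integral]
    exact L1.norm_integral_le _
  calc _ ≤ _ := h4
    _ ≤ _ := h1
    _ ≤ 1 * ‖y‖^2 * ‖y'‖ := by gcongr
    _ = _ := by ring

lemma aF_mono (y y' : Lp V 3 μ) : (1/2) * ‖y - y'‖ ^ 3 ≤ (aF y - aF y') (y - y') := by
  unfold aF
  rw [← map_sub, ContinuousLinearMap.lpPairing_eq_integral, Lp3_norm, ← integral_const_mul]
  refine integral_mono_ae ((integrable_cube _).const_mul _) ?_ ?_
  · exact memLp_one_iff_integrable.1 ((innerSL ℝ : V →L[ℝ] V →L[ℝ] ℝ).memLp_of_bilin 1 (Lp.memLp (nsq y - nsq y')) (Lp.memLp (y - y')))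
  · filter_upwards [nsq_ae y, nsq_ae y', Lp.coeFn_sub (nsq y) (nsq y'), Lp.coeFn_sub y y'] with x h1 h2 h3 h4
    rw [h3, h4]
    simp only [Pi.sub_apply, h1, h2]
    exact mono_pt _ _

end LpGen

section HSpace

/-- Index set for pairs (vector, matrix). -/
abbrev HI : Type := Fin 3 ⊕ (Fin 3 × Fin 3)

/-- Pairs (vector, matrix) with the Euclidean norm. -/
abbrev HH : Type := EuclideanSpace ℝ HI

/-- Build an element of `HH`. -/
def mkH (v : E3) (G : Fin 3 → Fin 3 → ℝ) : HH :=
  WithLp.toLp 2 (Sum.elim (fun j => v j) (fun p => G p.1 p.2))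

@[simp] lemma mkH_inl (v : E3) (G : Fin 3 → Fin 3 → ℝ) (j : Fin 3) : mkH v G (.inl j) = v j := rfl
@[simp] lemma mkH_inr (v : E3) (G : Fin 3 → Fin 3 → ℝ) (p : Fin 3 × Fin 3) :
    mkH v G (.inr p) = G p.1 p.2 := rfl

/-- Vector part. -/
def vP (h : HH) : E3 := mk3 (h (.inl 0)) (h (.inl 1)) (h (.inl 2))

/-- Matrix part. -/
def gP (h : HH) (i j : Fin 3) : ℝ := h (.inr (i, j))

/-- Curl part. -/
def wP (h : HH) : E3 :=
  mk3 (gP h 1 2 - gP h 2 1) (gP h 2 0 - gP h 0 2) (gP h 0 1 - gP h 1 0)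

lemma vP_apply (h : HH) (j : Fin 3) : vP h j = h (.inl j) := by
  fin_cases j <;> simp [vP, mk3_apply0, mk3_apply1, mk3_apply2]

lemma E3_ext {a b : E3} (h0 : a 0 = b 0) (h1 : a 1 = b 1) (h2 : a 2 = b 2) : a = b := by
  ext i; fin_cases i <;> assumption

/-- Vector part as a continuous linear map. -/
def vL : HH →L[ℝ] E3 := LinearMap.toContinuousLinearMap
  { toFun := vP
    map_add' := fun a b => by
      ext j; simp [vP_apply]
    map_smul' := fun c a => by
      ext j; simp [vP_apply] }

/-- Curl part as a continuous linear map. -/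
def wL : HH →L[ℝ] E3 := LinearMap.toContinuousLinearMap
  { toFun := wP
    map_add' := fun a b => by
      apply E3_ext <;> simp only [wP, gP, mk3_apply0, mk3_apply1, mk3_apply2, PiLp.add_apply] <;> ring
    map_smul' := fun c a => by
      apply E3_ext <;> simp only [wP, gP, mk3_apply0, mk3_apply1, mk3_apply2, PiLp.smul_apply,
        RingHom.id_apply, smul_eq_mul] <;> ring }

@[simp] lemma vL_apply (h : HH) : vL h = vP h := rfl
@[simp] lemma wL_apply (h : HH) : wL h = wP h := rfl

/-- Cross product as a continuous bilinear map. -/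
def crossB : E3 →L[ℝ] E3 →L[ℝ] E3 := LinearMap.toContinuousBilinearMap
  (LinearMap.mk₂ ℝ cross3
    (fun a b c => by
      apply E3_ext <;> simp only [cross3, mk3_apply0, mk3_apply1, mk3_apply2, PiLp.add_apply] <;> ring)
    (fun a b c => by
      apply E3_ext <;> simp only [cross3, mk3_apply0, mk3_apply1, mk3_apply2, PiLp.smul_apply,
        smul_eq_mul] <;> ring)
    (fun a b c => by
      apply E3_ext <;> simp only [cross3, mk3_apply0, mk3_apply1, mk3_apply2, PiLp.add_apply] <;> ring)
    (fun a b c => by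
      apply E3_ext <;> simp only [cross3, mk3_apply0, mk3_apply1, mk3_apply2, PiLp.smul_apply,
        smul_eq_mul] <;> ring))

@[simp] lemma crossB_apply (a b : E3) : crossB a b = cross3 a b := rfl

lemma dot3_inner (a b : E3) : dot3 a b = inner ℝ a b := by
  simp [dot3, PiLp.inner_apply, mul_comm]

lemma cross_dot (a b : E3) : dot3 (cross3 a b) b = 0 := by
  simp only [dot3, Fin.sum_univ_three, cross3, mk3_apply0, mk3_apply1, mk3_apply2]
  ring

variable (Ω : Set E3)

/-- The ambient Banach space. -/
abbrev ZZ : Type := Lp HH 3 (volume.restrict Ω)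

/-- The curl map. -/
def KK : ZZ Ω →L[ℝ] Lp E3 3 (volume.restrict Ω) := wL.compLpL 3 _

/-- Pointwise bilinear map for the first factor. -/
def crossH : HH →L[ℝ] HH →L[ℝ] E3 := crossB.bilinearComp wL vL

/-- Pointwise bilinear map for the second factor. -/
def dotH : E3 →L[ℝ] HH →L[ℝ] ℝ := (innerSL ℝ : E3 →L[ℝ] E3 →L[ℝ] ℝ).bilinearComp (.id ℝ E3) vL

lemma crossH_apply (a b : HH) : crossH a b = cross3 (wP a) (vP b) := rfl
lemma dotH_apply (a : E3) (b : HH) : dotH a b = dot3 a (vP b) := by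
  rw [dot3_inner]; rfl

/-- The trilinear form. -/
def bF : ZZ Ω →L[ℝ] ZZ Ω →L[ℝ] ZZ Ω →L[ℝ] ℝ :=
  (ContinuousLinearMap.compL ℝ (ZZ Ω) (Lp E3 (3/2) (volume.restrict Ω)) (ZZ Ω →L[ℝ] ℝ)
    (dotH.lpPairing (volume.restrict Ω) (3/2) 3)) ∘L (crossH.holderL (volume.restrict Ω) 3 3 (3/2))

lemma bF_eq (z z' z'' : ZZ Ω) : bF Ω z z' z'' =
    ∫ x in Ω, dot3 (cross3 (wP (z x)) (vP (z' x))) (vP (z'' x)) := by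
  have : bF Ω z z' z'' = dotH.lpPairing (volume.restrict Ω) (3/2) 3 (crossH.holder (3/2) z z') z'' := rfl
  rw [this, ContinuousLinearMap.lpPairing_eq_integral]
  refine integral_congr_ae ?_
  filter_upwards [crossH.coeFn_holder (r := 3/2) z z'] with x h
  rw [h, dotH_apply, crossH_apply]

lemma bF_self (z : ZZ Ω) : bF Ω z z z = 0 := by
  rw [bF_eq]
  simp [cross_dot]

variable {Ω}

/-- The weighted embedding of a field. -/
def emb (Ω : Set E3) (β : ℝ) (φ : E3 → E3) (x : E3) : HH :=
  mkH (dB Ω x ^ (-(β/2)) • φ x) (fun i j => dB Ω x ^ β * pd φ i j x)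

lemma pd_add {φ ψ : E3 → E3} (hφ : Differentiable ℝ φ) (hψ : Differentiable ℝ ψ) (i j : Fin 3) (x : E3) :
    pd (φ + ψ) i j x = pd φ i j x + pd ψ i j x := by
  unfold pd
  rw [fderiv_add (hφ x) (hψ x)]; simp

lemma pd_smul {φ : E3 → E3} (hφ : Differentiable ℝ φ) (c : ℝ) (i j : Fin 3) (x : E3) :
    pd (c • φ) i j x = c * pd φ i j x := by
  unfold pd
  rw [fderiv_const_smul (hφ x)]; simp

lemma IsTestSol.diff {φ : E3 → E3} (h : IsTestSol Ω φ) : Differentiable ℝ φ :=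
  h.smooth.differentiable (by simp)

/-- Solenoidal test fields as a submodule. -/
def TT (Ω : Set E3) : Submodule ℝ (E3 → E3) where
  carrier := {φ | IsTestSol Ω φ}
  add_mem' := by
    rintro φ ψ h1 h2
    refine ⟨⟨h1.smooth.add h2.smooth, h1.compsupp.add h2.compsupp, ?_⟩, fun x => ?_⟩
    · exact (tsupport_add φ ψ).trans (Set.union_subset h1.suppin h2.suppin)
    · have e1 := h1.sol x
      have e2 := h2.sol x
      unfold vdiv at *
      simp only [pd_add h1.diff h2.diff, Finset.sum_add_distrib, e1, e2, add_zero]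
  zero_mem' := by
    refine ⟨⟨contDiff_const, HasCompactSupport.zero, ?_⟩, fun x => ?_⟩
    · have : tsupport (0 : E3 → E3) = ∅ := by simp [tsupport]
      rw [this]; exact Set.empty_subset _
    · unfold vdiv pd
      simp
  smul_mem' := by
    rintro c φ h
    refine ⟨⟨h.smooth.const_smul c, h.compsupp.mono ?_, (closure_mono ?_).trans h.suppin⟩, fun x => ?_⟩
    · intro x hx h0; exact hx (by simp [h0])
    · intro x hx h0; exact hx (by simp [h0])
    · have e1 := h.sol x
      unfold vdiv at *
      simp only [pd_smul h.diff, ← Finset.mul_sum, e1, mul_zero]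

lemma emb_add (β : ℝ) {φ ψ : E3 → E3} (hφ : Differentiable ℝ φ) (hψ : Differentiable ℝ ψ) (x : E3) :
    emb Ω β (φ + ψ) x = emb Ω β φ x + emb Ω β ψ x := by
  ext k
  rcases k with j | ⟨i, j⟩
  · simp [emb, mul_add]
  · simp [emb, pd_add hφ hψ, mul_add]

lemma emb_smul (β : ℝ) {φ : E3 → E3} (hφ : Differentiable ℝ φ) (c : ℝ) (x : E3) :
    emb Ω β (c • φ) x = c • emb Ω β φ x := by
  ext k
  rcases k with j | ⟨i, j⟩
  · simp [emb]; ring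
  · simp [emb, pd_smul hφ]; ring

lemma IsTestSol.c1 {φ : E3 → E3} (h : IsTestSol Ω φ) (j : Fin 3) : ContDiff ℝ 1 (fun y => φ y j) :=
  (comp_smooth h.smooth j).of_le (by exact_mod_cast le_top)

lemma pd_fun {φ : E3 → E3} (h : IsTestSol Ω φ) (i j : Fin 3) : pd φ i j = pds (fun y => φ y j) i := by
  funext x; exact pd_eq h.diff i j x

lemma pd_cont {φ : E3 → E3} (h : IsTestSol Ω φ) (i j : Fin 3) : Continuous (pd φ i j) := by
  rw [pd_fun h]; exact pds_continuous (h.c1 j) i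

lemma pd_tsupp {φ : E3 → E3} (h : IsTestSol Ω φ) (i j : Fin 3) : tsupport (pd φ i j) ⊆ Ω := by
  rw [pd_fun h]; exact pds_tsupp (comp_tsupp h.suppin j) i

lemma pd_supp {φ : E3 → E3} (h : IsTestSol Ω φ) (i j : Fin 3) : HasCompactSupport (pd φ i j) := by
  rw [pd_fun h]; exact pds_supp (comp_supp h.compsupp j) i

lemma emb_cont (hΩ : IsLipschitzDomain Ω) (β : ℝ) {φ : E3 → E3} (h : IsTestSol Ω φ) :
    Continuous (emb Ω β φ) := by
  unfold emb mkH
  refine (PiLp.continuous_toLp 2 _).comp (continuous_pi fun k => ?_)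
  rcases k with j | ⟨i, j⟩
  · exact wcont hΩ (h.c1 j).continuous (comp_tsupp h.suppin j) _
  · exact wcont hΩ (pd_cont h i j) (pd_tsupp h i j) _

lemma emb_supp (β : ℝ) {φ : E3 → E3} (h : IsTestSol Ω φ) :
    HasCompactSupport (emb Ω β φ) := by
  refine HasCompactSupport.intro h.compsupp (K := tsupport φ) fun x hx => ?_
  have h1 : φ x = 0 := image_eq_zero_of_notMem_tsupport hx
  have h2 : ∀ i j, pd φ i j x = 0 := fun i j => by
    unfold pd
    have : fderiv ℝ φ x = 0 := by
      have := mt (fun hh => (tsupport_fderiv_subset ℝ) hh) hx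
      exact image_eq_zero_of_notMem_tsupport this
    rw [this]; simp
  ext k
  rcases k with j | ⟨i, j⟩
  · simp [emb, h1]
  · simp [emb, h2]

lemma emb_memLp (hΩ : IsLipschitzDomain Ω) (β : ℝ) {φ : E3 → E3} (h : IsTestSol Ω φ) :
    MemLp (emb Ω β φ) 3 (volume.restrict Ω) :=
  ((emb_cont hΩ β h).memLp_of_hasCompactSupport (emb_supp β h)).restrict Ω

/-- The embedding as a linear map. -/
def JJ (hΩ : IsLipschitzDomain Ω) (β : ℝ) : TT Ω →ₗ[ℝ] ZZ Ω where
  toFun φ := (emb_memLp hΩ β φ.2).toLp _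
  map_add' φ ψ := by
    rw [← MemLp.toLp_add]
    exact MemLp.toLp_congr _ _ (ae_of_all _ fun x => emb_add β (IsTestSol.diff φ.2) (IsTestSol.diff ψ.2) x)
  map_smul' c φ := by
    rw [RingHom.id_apply, ← MemLp.toLp_const_smul]
    exact MemLp.toLp_congr _ _ (ae_of_all _ fun x => emb_smul β (IsTestSol.diff φ.2) c x)

lemma JJ_ae (hΩ : IsLipschitzDomain Ω) (β : ℝ) (φ : TT Ω) :
    JJ hΩ β φ =ᵐ[volume.restrict Ω] emb Ω β φ.1 :=
  MemLp.coeFn_toLp (emb_memLp hΩ β φ.2)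

lemma enorm_HH (h : HH) : ‖h‖ₑ ^ (3:ℝ) ≤ 144 * ∑ k, ‖h k‖ₑ ^ (3:ℝ) := by
  have h1 : ‖h‖ₑ ≤ ∑ k, ‖h k‖ₑ := by
    have e : h = ∑ k, EuclideanSpace.single k (h k) := by
      ext k
      rw [WithLp.ofLp_sum, Finset.sum_apply, Finset.sum_eq_single k]
      · simp
      · intro b _ hb; simp [hb.symm]
      · simp
    calc ‖h‖ₑ = ‖∑ k, EuclideanSpace.single k (h k)‖ₑ := by rw [← e]
      _ ≤ ∑ k, ‖(EuclideanSpace.single k (h k) : HH)‖ₑ := enorm_sum_le _ _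
      _ = _ := by
        refine Finset.sum_congr rfl fun k _ => ?_
        rw [← ofReal_norm_eq_enorm, EuclideanSpace.norm_single, ofReal_norm_eq_enorm]
  have h2 := ENNReal.rpow_sum_le_const_mul_sum_rpow (s := (Finset.univ : Finset HI)) (f := fun k => ‖h k‖ₑ)
    (p := 3) (by norm_num)
  have h3 : (((Finset.univ : Finset HI).card : ℝ≥0∞)) ^ ((3:ℝ) - 1) = 144 := by
    have : (Finset.univ : Finset HI).card = 12 := by rfl
    rw [this]
    have : (3:ℝ) - 1 = ((2:ℕ):ℝ) := by norm_num
    rw [this, ENNReal.rpow_natCast]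
    norm_num
  rw [h3] at h2
  exact (ENNReal.rpow_le_rpow h1 (by norm_num)).trans h2

lemma curl_comp (Ω : Set E3) (β : ℝ) (φ : E3 → E3) (k j : Fin 3) (x : E3) :
    ‖dB Ω x ^ β * (pd φ k j x - pd φ j k x)‖ₑ ≤ ‖wP (emb Ω β φ x)‖ₑ := by
  have key : ∃ l : Fin 3, |dB Ω x ^ β * (pd φ k j x - pd φ j k x)| ≤ |wP (emb Ω β φ x) l| := by
    have e0 : wP (emb Ω β φ x) 0 = dB Ω x ^ β * (pd φ 1 2 x - pd φ 2 1 x) := by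
      simp [wP, gP, emb, mk3_apply0]; ring
    have e1 : wP (emb Ω β φ x) 1 = dB Ω x ^ β * (pd φ 2 0 x - pd φ 0 2 x) := by
      simp [wP, gP, emb, mk3_apply1]; ring
    have e2 : wP (emb Ω β φ x) 2 = dB Ω x ^ β * (pd φ 0 1 x - pd φ 1 0 x) := by
      simp [wP, gP, emb, mk3_apply2]; ring
    have hn : ∀ a b c : ℝ, |c * (a - b)| = |c * (b - a)| := fun a b c => by
      rw [abs_mul, abs_mul, abs_sub_comm]
    fin_cases k <;> fin_cases j
    · exact ⟨0, by simp⟩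
    · exact ⟨2, by rw [e2]; simp⟩
    · exact ⟨1, by rw [e1, hn]; simp⟩
    · exact ⟨2, by rw [e2, hn]; simp⟩
    · exact ⟨0, by simp⟩
    · exact ⟨0, by rw [e0]; simp⟩
    · exact ⟨1, by rw [e1]; simp⟩
    · exact ⟨0, by rw [e0, hn]; simp⟩
    · exact ⟨0, by simp⟩
  obtain ⟨l, hl⟩ := key
  rw [Real.enorm_eq_ofReal_abs, ← ofReal_norm_eq_enorm]
  exact ENNReal.ofReal_le_ofReal (hl.trans (coord_le_norm _ _))

lemma emb_bound (hΩ : IsLipschitzDomain Ω) (β : ℝ) (hβ0 : 0 ≤ β) (hβ : β < 2/5) :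
    ∃ C : ℝ, 0 < C ∧ ∀ φ, IsTestSol Ω φ →
      ∫⁻ x in Ω, ‖emb Ω β φ x‖ₑ ^ (3:ℝ) ≤ ENNReal.ofReal C * ∫⁻ x in Ω, ‖wP (emb Ω β φ x)‖ₑ ^ (3:ℝ) := by
  obtain ⟨C1, hC1, H1⟩ := grad_est hΩ β hβ0 hβ
  obtain ⟨C2, hC2, H2⟩ := pot_est hΩ β hβ0 hβ
  refine ⟨144 * (3 * (C2 * (3 * (3 * C1))) + 9 * (3 * C1)), by positivity, fun φ hφ => ?_⟩
  set I := ∫⁻ x in Ω, ‖wP (emb Ω β φ x)‖ₑ ^ (3:ℝ) with hI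
  have hw : ∀ k j, ∫⁻ x, ‖dB Ω x ^ β * (pd φ k j x - pd φ j k x)‖ₑ ^ (3:ℝ) ≤ I := by
    intro k j
    rw [lint_restrict_eq hΩ.isOpen]
    · exact lintegral_mono fun x => ENNReal.rpow_le_rpow (curl_comp Ω β φ k j x) (by norm_num)
    · intro x hx
      rw [tsupp_zero (pd_tsupp hφ k j) x hx, tsupp_zero (pd_tsupp hφ j k) x hx]
      simp
  have hg : ∀ i j, ∫⁻ x, ‖dB Ω x ^ β * pd φ i j x‖ₑ ^ (3:ℝ) ≤ ENNReal.ofReal (3 * C1) * I := by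
    intro i j
    refine (H1 φ hφ i j).trans ?_
    calc _ ≤ ENNReal.ofReal C1 * ∑ k : Fin 3, I := by gcongr with k _; exact hw k j
      _ = _ := by
        rw [Finset.sum_const, Finset.card_univ, Fintype.card_fin, ENNReal.ofReal_mul (by norm_num)]
        simp; ring
  have hv : ∀ j, ∫⁻ x, ‖dB Ω x ^ (-(β/2)) * φ x j‖ₑ ^ (3:ℝ) ≤ ENNReal.ofReal (C2 * (3 * (3 * C1))) * I := by
    intro j
    refine (H2 (fun y => φ y j) (hφ.c1 j) (comp_supp hφ.compsupp j) (comp_tsupp hφ.suppin j)).trans ?_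
    calc _ ≤ ENNReal.ofReal C2 * ∑ k : Fin 3, ENNReal.ofReal (3 * C1) * I := by
          gcongr with k _
          rw [← pd_fun hφ]; exact hg k j
      _ = _ := by
        rw [Finset.sum_const, Finset.card_univ, Fintype.card_fin, ENNReal.ofReal_mul hC2.le,
          ENNReal.ofReal_mul (p := 3) (q := 3 * C1) (by norm_num)]
        simp; ring
  calc ∫⁻ x in Ω, ‖emb Ω β φ x‖ₑ ^ (3:ℝ)
      ≤ ∫⁻ x, ‖emb Ω β φ x‖ₑ ^ (3:ℝ) := setLIntegral_le_lintegral _ _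
    _ ≤ ∫⁻ x, 144 * ∑ k, ‖emb Ω β φ x k‖ₑ ^ (3:ℝ) := lintegral_mono fun x => enorm_HH _
    _ = 144 * ∑ k, ∫⁻ x, ‖emb Ω β φ x k‖ₑ ^ (3:ℝ) := by
      rw [lintegral_const_mul' _ _ (by simp), lintegral_finsetSum']
      intro k _
      have := emb_cont hΩ β hφ
      have h2 : Continuous fun x => emb Ω β φ x k := (PiLp.continuous_apply 2 (fun _ : HI => ℝ) k).comp this
      exact (h2.enorm.measurable.pow_const _).aemeasurable
    _ ≤ 144 * (3 * (ENNReal.ofReal (C2 * (3 * (3 * C1))) * I) + 9 * (ENNReal.ofReal (3 * C1) * I)) := by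
      gcongr
      rw [Fintype.sum_sum_type]
      refine add_le_add ?_ ?_
      · refine (Finset.sum_le_card_nsmul _ _ _ fun j _ => hv j).trans ?_
        simp
      · refine (Finset.sum_le_card_nsmul _ _ _ fun p _ => hg p.1 p.2).trans ?_
        simp
    _ = _ := by
      rw [ENNReal.ofReal_mul (p := 144) (by norm_num), ENNReal.ofReal_add (by positivity) (by positivity),
        ENNReal.ofReal_mul (p := 3) (q := C2 * (3 * (3 * C1))) (by norm_num),
        ENNReal.ofReal_mul (p := 9) (by norm_num)]
      simp; ring

lemma KK_bound (hΩ : IsLipschitzDomain Ω) (β : ℝ) (hβ0 : 0 ≤ β) (hβ : β < 2/5) :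
    ∃ C : ℝ, 0 < C ∧ ∀ z ∈ LinearMap.range (JJ hΩ β), ‖z‖ ≤ C * ‖KK Ω z‖ := by
  obtain ⟨C, hC, H⟩ := emb_bound hΩ β hβ0 hβ
  refine ⟨C ^ ((1:ℝ)/3), by positivity, ?_⟩
  rintro _ ⟨φ, rfl⟩
  have h1 : eLpNorm (JJ hΩ β φ) 3 (volume.restrict Ω) = (∫⁻ x in Ω, ‖emb Ω β φ.1 x‖ₑ ^ (3:ℝ)) ^ ((1:ℝ)/3) := by
    rw [eLpNorm_congr_ae (JJ_ae hΩ β φ), eLp3]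
  have h2 : eLpNorm (KK Ω (JJ hΩ β φ)) 3 (volume.restrict Ω) = (∫⁻ x in Ω, ‖wP (emb Ω β φ.1 x)‖ₑ ^ (3:ℝ)) ^ ((1:ℝ)/3) := by
    have : KK Ω (JJ hΩ β φ) =ᵐ[volume.restrict Ω] fun x => wP (emb Ω β φ.1 x) := by
      filter_upwards [wL.coeFn_compLpL (p := 3) (JJ hΩ β φ), JJ_ae hΩ β φ] with x h1 h2
      unfold KK
      rw [h1, h2]; rfl
    rw [eLpNorm_congr_ae this, eLp3]
  rw [Lp.norm_def, Lp.norm_def]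
  have h3 : C ^ ((1:ℝ)/3) = (ENNReal.ofReal (C ^ ((1:ℝ)/3))).toReal := by
    rw [ENNReal.toReal_ofReal (by positivity)]
  rw [h3, ← ENNReal.toReal_mul]
  refine ENNReal.toReal_mono (ENNReal.mul_ne_top (by simp) (Lp.eLpNorm_ne_top _)) ?_
  rw [h1, h2, ← ENNReal.ofReal_rpow_of_pos hC, ← ENNReal.mul_rpow_of_nonneg _ _ (by norm_num)]
  exact ENNReal.rpow_le_rpow (H _ φ.2) (by norm_num)

end HSpace

section CompactSec

lemma trans_pt {f : E3 → ℝ} (hf : ContDiff ℝ 1 f) (x z : E3) :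
    ‖f x - f (x - z)‖ₑ ≤ ∫⁻ s in Set.Ioc (0:ℝ) 1, ‖fderiv ℝ f (x + (s - 1) • z)‖ₑ * ‖z‖ₑ := by
  have hc : Continuous (fderiv ℝ f) := hf.continuous_fderiv (by simp)
  have hd : ∀ s ∈ Set.uIcc (0:ℝ) 1, HasDerivAt (fun s : ℝ => f (x + (s - 1) • z)) (fderiv ℝ f (x + (s - 1) • z) z) s := by
    intro s _
    have h1 : HasDerivAt (fun s : ℝ => x + (s - 1) • z) ((1:ℝ) • z) s :=
      (((hasDerivAt_id s).sub_const 1).smul_const z).const_add x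
    have h2 := (hf.differentiable (by simp) (x + (s - 1) • z)).hasFDerivAt.comp_hasDerivAt s h1
    rw [one_smul] at h2
    exact h2
  have hIntg : IntervalIntegrable (fun s : ℝ => fderiv ℝ f (x + (s - 1) • z) z) volume 0 1 := by
    apply Continuous.intervalIntegrable
    have : Continuous fun s : ℝ => fderiv ℝ f (x + (s - 1) • z) := hc.comp (by fun_prop)
    fun_prop
  have h := intervalIntegral.integral_eq_sub_of_hasDerivAt hd hIntg
  have e : f x - f (x - z) = ∫ s in Set.Ioc (0:ℝ) 1, fderiv ℝ f (x + (s - 1) • z) z := by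
    rw [← intervalIntegral.integral_of_le zero_le_one, h]
    simp [sub_eq_add_neg]
  rw [e]
  refine (enorm_integral_le_lintegral_enorm _).trans (lintegral_mono fun s => ?_)
  exact ContinuousLinearMap.le_opENorm _ _

lemma trans_est {f : E3 → ℝ} (hf : ContDiff ℝ 1 f) (z : E3) :
    ∫⁻ x, ‖f x - f (x - z)‖ₑ ≤ (∫⁻ x, ‖fderiv ℝ f x‖ₑ) * ‖z‖ₑ := by
  have hc : Continuous (fderiv ℝ f) := hf.continuous_fderiv (by simp)
  calc ∫⁻ x, ‖f x - f (x - z)‖ₑ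
      ≤ ∫⁻ x, ∫⁻ s in Set.Ioc (0:ℝ) 1, ‖fderiv ℝ f (x + (s - 1) • z)‖ₑ * ‖z‖ₑ :=
        lintegral_mono fun x => trans_pt hf x z
    _ = ∫⁻ s in Set.Ioc (0:ℝ) 1, ∫⁻ x, ‖fderiv ℝ f (x + (s - 1) • z)‖ₑ * ‖z‖ₑ := by
        refine lintegral_lintegral_swap ?_
        have : Continuous fun q : E3 × ℝ => fderiv ℝ f (q.1 + (q.2 - 1) • z) := hc.comp (by fun_prop)
        exact (this.enorm.measurable.mul_const _).aemeasurable
    _ = ∫⁻ s in Set.Ioc (0:ℝ) 1, (∫⁻ x, ‖fderiv ℝ f x‖ₑ) * ‖z‖ₑ := by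
        refine lintegral_congr fun s => ?_
        rw [lintegral_mul_const' _ _ enorm_ne_top,
          lintegral_add_right_eq_self (μ := volume) (fun x => ‖fderiv ℝ f x‖ₑ)]
    _ = _ := by simp

/-- Constant in the first moment bound. -/
def cM : ℝ := 1 + 30 * (8 * π) ^ (3/2:ℝ)

lemma cM_pos : 0 < cM := by unfold cM; positivity

lemma hk_first {t : ℝ} (ht : 0 < t) :
    ∫⁻ z : E3, ENNReal.ofReal (hk t z) * ‖z‖ₑ ≤ ENNReal.ofReal (√t * cM) := by
  have hs : 0 < √t := Real.sqrt_pos.2 ht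
  have hss : √t * √t = t := Real.mul_self_sqrt ht.le
  have hpt : ∀ z : E3, ENNReal.ofReal (hk t z) * ‖z‖ₑ ≤ ENNReal.ofReal (√t) * ENNReal.ofReal (hk t z) +
      ENNReal.ofReal (√t * (30 * (8 * π) ^ (3/2:ℝ))) * ENNReal.ofReal (hk (2 * t) z) := by
    intro z
    have hp := (hk_pos ht z).le
    have hp2 := (hk_pos (by positivity : 0 < 2 * t) z).le
    rw [← ofReal_norm_eq_enorm, ← ENNReal.ofReal_mul hp, ← ENNReal.ofReal_mul hs.le,
      ← ENNReal.ofReal_mul (by positivity), ← ENNReal.ofReal_add (by positivity) (by positivity)]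
    refine ENNReal.ofReal_le_ofReal ?_
    have h1 := hk_moment ht z
    have h2 : √t * ‖z‖ ≤ t + ‖z‖ ^ 2 := by nlinarith [sq_nonneg (√t - ‖z‖), sq_nonneg (√t), sq_nonneg ‖z‖]
    have h3 : √t * (hk t z * ‖z‖) ≤ √t * (√t * hk t z + √t * (30 * (8 * π) ^ (3/2:ℝ)) * hk (2 * t) z) := by
      calc √t * (hk t z * ‖z‖) = (√t * ‖z‖) * hk t z := by ring
        _ ≤ (t + ‖z‖ ^ 2) * hk t z := by gcongr
        _ = t * hk t z + ‖z‖ ^ 2 * hk t z := by ring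
        _ ≤ t * hk t z + 30 * t * ((8 * π) ^ (3/2:ℝ) * hk (2 * t) z) := by gcongr
        _ = (√t * √t) * hk t z + 30 * (√t * √t) * ((8 * π) ^ (3/2:ℝ) * hk (2 * t) z) := by rw [hss]
        _ = _ := by ring
    exact le_of_mul_le_mul_left h3 hs
  refine (lintegral_mono hpt).trans (le_of_eq ?_)
  rw [lintegral_add_left, lintegral_const_mul' _ _ ENNReal.ofReal_ne_top, lintegral_const_mul' _ _ ENNReal.ofReal_ne_top, lintegral_hk ht,
    lintegral_hk (by positivity), mul_one, mul_one, ← ENNReal.ofReal_add (by positivity) (by positivity)]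
  · unfold cM; congr 1; ring
  · exact ((contDiff_hk t).continuous.measurable.ennreal_ofReal).const_mul _

lemma heat_L1diff {f : E3 → ℝ} (hf : ContDiff ℝ 1 f) (hfs : HasCompactSupport f) {t : ℝ} (ht : 0 < t) :
    ∫⁻ x, ‖f x - cv (hk t) f x‖ₑ ≤ ENNReal.ofReal (√t * cM) * ∫⁻ x, ‖fderiv ℝ f x‖ₑ := by
  have hfc := hf.continuous
  have hkc : Continuous (hk t) := (contDiff_hk t).continuous
  have hpt : ∀ x, ‖f x - cv (hk t) f x‖ₑ ≤ ∫⁻ z, ENNReal.ofReal (hk t z) * ‖f x - f (x - z)‖ₑ := by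
    intro x
    have e1 : cv (hk t) f x = ∫ z, hk t z * f (x - z) := by
      unfold cv
      rw [← integral_sub_left_eq_self (fun z => hk t z * f (x - z)) volume x]
      simp
    have i1 : Integrable fun z => hk t z * f (x - z) := by
      obtain ⟨M, hM⟩ := hfc.bounded_above_of_compact_support hfs
      refine (integrable_hk ht).mul_bdd (c := M) ?_ (ae_of_all _ fun z => hM _)
      exact (hfc.comp (by fun_prop : Continuous fun z => x - z)).aestronglyMeasurable
    have e2 : f x = ∫ z, hk t z * f x := by
      rw [integral_mul_const, integral_hk ht, one_mul]
    have e3 : f x - cv (hk t) f x = ∫ z, hk t z * (f x - f (x - z)) := by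
      rw [e1]
      conv_lhs => rw [e2]
      rw [← integral_sub ((integrable_hk ht).mul_const _) i1]
      refine integral_congr_ae (ae_of_all _ fun z => ?_)
      simp only; ring
    rw [e3]
    refine (enorm_integral_le_lintegral_enorm _).trans (le_of_eq (lintegral_congr fun z => ?_))
    rw [enorm_mul, Real.enorm_of_nonneg (hk_pos ht z).le]
  calc ∫⁻ x, ‖f x - cv (hk t) f x‖ₑ ≤ ∫⁻ x, ∫⁻ z, ENNReal.ofReal (hk t z) * ‖f x - f (x - z)‖ₑ := lintegral_mono hpt
    _ = ∫⁻ z, ∫⁻ x, ENNReal.ofReal (hk t z) * ‖f x - f (x - z)‖ₑ := by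
      refine lintegral_lintegral_swap ?_
      have h1 : Continuous fun q : E3 × E3 => hk t q.2 := hkc.comp continuous_snd
      have h2 : Continuous fun q : E3 × E3 => f q.1 - f (q.1 - q.2) :=
        (hfc.comp continuous_fst).sub (hfc.comp (by fun_prop))
      exact (h1.measurable.ennreal_ofReal.mul h2.enorm.measurable).aemeasurable
    _ ≤ ∫⁻ z, ENNReal.ofReal (hk t z) * ‖z‖ₑ * (∫⁻ x, ‖fderiv ℝ f x‖ₑ) := by
      refine lintegral_mono fun z => ?_
      rw [lintegral_const_mul' _ _ (by simp), mul_assoc, mul_comm ‖z‖ₑ]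
      gcongr
      exact trans_est hf z
    _ = (∫⁻ z, ENNReal.ofReal (hk t z) * ‖z‖ₑ) * (∫⁻ x, ‖fderiv ℝ f x‖ₑ) := by
      refine lintegral_mul_const _ ?_
      exact hkc.measurable.ennreal_ofReal.mul continuous_enorm.measurable
    _ ≤ _ := by gcongr; exact hk_first ht

lemma fderiv_norm_le (f : E3 → ℝ) (x : E3) : ‖fderiv ℝ f x‖ ≤ ∑ i, |pds f i x| := by
  refine ContinuousLinearMap.opNorm_le_bound _ (Finset.sum_nonneg fun _ _ => abs_nonneg _) fun z => ?_
  have hz : z = ∑ i, z i • ee i := by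
    ext k
    rw [WithLp.ofLp_sum, Finset.sum_apply, Finset.sum_eq_single k]
    · simp [ee_apply]
    · intro b _ hb
      simp only [PiLp.smul_apply, ee_apply, smul_eq_mul]
      rw [if_neg (by first | exact hb | exact hb.symm), mul_zero]
    · simp
  conv_lhs => rw [hz, map_sum]
  rw [Finset.sum_mul]
  refine (norm_sum_le _ _).trans (Finset.sum_le_sum fun i _ => ?_)
  rw [map_smul, norm_smul, mul_comm, Real.norm_eq_abs, Real.norm_eq_abs]
  unfold pds
  gcongr
  exact coord_le_norm _ _

lemma hk_lip {t : ℝ} (ht : 0 < t) : ∃ L : ℝ, 0 < L ∧ ∀ a b : E3, |hk t a - hk t b| ≤ L * ‖a - b‖ := by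
  refine ⟨3 * (2 * t ^ (-(1/2:ℝ)) * t ^ (-(3/2:ℝ))), by positivity, fun a b => ?_⟩
  have hb : ∀ x ∈ (Set.univ : Set E3), ‖fderiv ℝ (hk t) x‖ ≤ 3 * (2 * t ^ (-(1/2:ℝ)) * t ^ (-(3/2:ℝ))) := by
    intro x _
    refine (fderiv_norm_le _ _).trans ?_
    refine (Finset.sum_le_card_nsmul _ _ (2 * t ^ (-(1/2:ℝ)) * t ^ (-(3/2:ℝ))) fun i _ => ?_).trans (by simp)
    rw [hk_pds_fun]
    refine (hk1_le ht i x).trans ?_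
    gcongr
    unfold hq
    refine mul_le_of_le_one_right (by positivity) ?_
    rw [Real.exp_le_one_iff]
    have : 0 ≤ ‖x‖ ^ 2 / (8 * t) := by positivity
    linarith
  exact convex_univ.norm_image_sub_le_of_norm_fderiv_le
    (fun x _ => (contDiff_hk t).differentiable (by simp) x) hb (Set.mem_univ _) (Set.mem_univ _)

variable {Ω : Set E3}

lemma memLp_cont (hΩ : IsLipschitzDomain Ω) {V : Type*} [NormedAddCommGroup V] {g : E3 → V} (hg : Continuous g)
    (hgm : AEStronglyMeasurable g (volume.restrict Ω)) (p : ℝ≥0∞) :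
    MemLp g p (volume.restrict Ω) := by
  have hc := hΩ.isBounded.isCompact_closure
  obtain ⟨M, hM⟩ := hc.exists_bound_of_continuousOn hg.continuousOn
  haveI : IsFiniteMeasure (volume.restrict Ω) := ⟨by
    rw [Measure.restrict_apply_univ]; exact hΩ.isBounded.measure_lt_top⟩
  refine MemLp.of_bound hgm M ?_
  filter_upwards [ae_restrict_mem hΩ.isOpen.measurableSet] with x hx
  exact hM x (subset_closure hx)

lemma JJ_norm (hΩ : IsLipschitzDomain Ω) (β : ℝ) (φ : TT Ω) :
    ENNReal.ofReal ‖JJ hΩ β φ‖ = (∫⁻ x in Ω, ‖emb Ω β φ.1 x‖ₑ ^ (3:ℝ)) ^ ((1:ℝ)/3) := by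
  rw [Lp.norm_def, ENNReal.ofReal_toReal (Lp.eLpNorm_ne_top _), eLpNorm_congr_ae (JJ_ae hΩ β φ), eLp3]

lemma enorm_coord_HH (h : HH) (k : HI) : ‖h k‖ₑ ≤ ‖h‖ₑ := by
  rw [← ofReal_norm_eq_enorm, ← ofReal_norm_eq_enorm]
  exact ENNReal.ofReal_le_ofReal (PiLp.norm_apply_le h k)

lemma hold_emb (hΩ : IsLipschitzDomain Ω) (β : ℝ) {g : E3 → ℝ≥0∞} (hg : Measurable g)
    (hfin : ∫⁻ x in Ω, g x ^ (3/2:ℝ) ≠ ∞) :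
    ∃ A : ℝ, 0 < A ∧ ∀ (φ : TT Ω) (k : HI), ∫⁻ x in Ω, g x * ‖emb Ω β φ.1 x k‖ₑ ≤ ENNReal.ofReal (A * ‖JJ hΩ β φ‖) := by
  set B := (∫⁻ x in Ω, g x ^ (3/2:ℝ)) ^ (1/(3/2):ℝ) with hB
  have hBf : B ≠ ∞ := ENNReal.rpow_ne_top_of_nonneg (by norm_num) hfin
  refine ⟨B.toReal + 1, by positivity, fun φ k => ?_⟩
  have hc : Continuous fun x => emb Ω β φ.1 x k :=
    (PiLp.continuous_apply 2 (fun _ : HI => ℝ) k).comp (emb_cont hΩ β φ.2)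
  have hpq : Real.HolderConjugate (3/2) 3 := by
    rw [Real.holderConjugate_iff]; norm_num
  have h := ENNReal.lintegral_mul_le_Lp_mul_Lq (volume.restrict Ω) hpq hg.aemeasurable hc.enorm.measurable.aemeasurable
  refine h.trans ?_
  rw [ENNReal.ofReal_mul (by positivity), JJ_norm]
  refine mul_le_mul' ?_ ?_
  · refine le_trans ?_ (ENNReal.ofReal_le_ofReal (le_add_of_nonneg_right zero_le_one))
    rw [ENNReal.ofReal_toReal hBf]
  · refine ENNReal.rpow_le_rpow (lintegral_mono fun x => ENNReal.rpow_le_rpow ?_ (by norm_num)) (by norm_num)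
    exact enorm_coord_HH _ k

lemma grad_L1 (hΩ : IsLipschitzDomain Ω) (β : ℝ) (hβ0 : 0 ≤ β) (hβ : β < 2/5) :
    ∃ A : ℝ, 0 < A ∧ ∀ (φ : TT Ω) (i j : Fin 3), ∫⁻ x, ‖pd φ.1 i j x‖ₑ ≤ ENNReal.ofReal (A * ‖JJ hΩ β φ‖) := by
  have hm : Measurable fun x => ENNReal.ofReal (dB Ω x ^ (-β)) :=
    ((continuous_dB Ω).measurable.pow_const _).ennreal_ofReal
  have hfin : ∫⁻ x in Ω, ENNReal.ofReal (dB Ω x ^ (-β)) ^ (3/2:ℝ) ≠ ∞ := by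
    obtain ⟨C, hC, H⟩ := lint_dB hΩ (3/2*β) (by positivity) (by linarith)
    obtain ⟨R, hR⟩ := hΩ.isBounded.subset_ball (0:E3)
    have hsub : Ω ⊆ Metric.ball (0:E3) (max R 1) := hR.trans (Metric.ball_subset_ball (le_max_left _ _))
    have h := H 0 (max R 1) (by positivity)
    rw [Set.inter_eq_left.2 hsub] at h
    refine ne_top_of_le_ne_top ENNReal.ofReal_ne_top (le_trans (le_of_eq ?_) h)
    refine lintegral_congr fun x => ?_
    rw [ENNReal.ofReal_rpow_of_nonneg (Real.rpow_nonneg (dB_nonneg Ω x) _) (by norm_num),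
      ← Real.rpow_mul (dB_nonneg Ω x)]
    congr 2; ring
  obtain ⟨A, hA, H⟩ := hold_emb hΩ β hm hfin
  refine ⟨A, hA, fun φ i j => le_trans (le_of_eq ?_) (H φ (.inr (i, j)))⟩
  rw [lint_restrict_eq hΩ.isOpen]
  · refine setLIntegral_congr_fun hΩ.isOpen.measurableSet fun x hx => ?_
    have hd := dB_pos hΩ hx
    simp only [emb, mkH_inr, enorm_mul]
    rw [Real.enorm_of_nonneg (Real.rpow_nonneg hd.le _), ← mul_assoc, ← ENNReal.ofReal_mul (by positivity),
      ← Real.rpow_add hd]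
    simp
  · intro x hx
    rw [tsupp_zero (pd_tsupp φ.2 i j) x hx]; simp

lemma val_L1 (hΩ : IsLipschitzDomain Ω) (β : ℝ) (hβ0 : 0 ≤ β) :
    ∃ A : ℝ, 0 < A ∧ ∀ (φ : TT Ω) (j : Fin 3), ∫⁻ x, ‖φ.1 x j‖ₑ ≤ ENNReal.ofReal (A * ‖JJ hΩ β φ‖) := by
  have hm : Measurable fun x => ENNReal.ofReal (dB Ω x ^ (β/2)) :=
    ((continuous_dB Ω).measurable.pow_const _).ennreal_ofReal
  have hfin : ∫⁻ x in Ω, ENNReal.ofReal (dB Ω x ^ (β/2)) ^ (3/2:ℝ) ≠ ∞ := by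
    have hc := continuous_dB_rpow Ω (β := β/2) (by positivity)
    have h := memLp_cont hΩ hc hc.aestronglyMeasurable (3/2)
    have h2 := lintegral_rpow_enorm_lt_top_of_eLpNorm_lt_top (by simp) (by simp [ENNReal.div_eq_top]) h.2
    refine ne_top_of_le_ne_top h2.ne (le_of_eq (lintegral_congr fun x => ?_))
    rw [Real.enorm_of_nonneg (Real.rpow_nonneg (dB_nonneg Ω x) _)]
    simp
  obtain ⟨A, hA, H⟩ := hold_emb hΩ β hm hfin
  refine ⟨A, hA, fun φ j => le_trans (le_of_eq ?_) (H φ (.inl j))⟩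
  rw [lint_restrict_eq hΩ.isOpen]
  · refine setLIntegral_congr_fun hΩ.isOpen.measurableSet fun x hx => ?_
    have hd := dB_pos hΩ hx
    simp only [emb, mkH_inl, PiLp.smul_apply, smul_eq_mul, enorm_mul]
    rw [Real.enorm_of_nonneg (Real.rpow_nonneg hd.le _), ← mul_assoc, ← ENNReal.ofReal_mul (by positivity),
      ← Real.rpow_add hd]
    simp
  · intro x hx
    have := tsupp_zero (comp_tsupp (IsTestSol.toIsTest φ.2).suppin j) x hx
    simp only [this]; simp

/-- Pointwise pairing with one coordinate. -/
def Bj (k : HI) : ℝ →L[ℝ] HH →L[ℝ] ℝ :=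
  (ContinuousLinearMap.lsmul ℝ ℝ : ℝ →L[ℝ] ℝ →L[ℝ] ℝ).bilinearComp (.id ℝ ℝ) (EuclideanSpace.proj k)

lemma Bj_apply (k : HI) (a : ℝ) (h : HH) : Bj k a h = a * h k := rfl

/-- Testing functionals. -/
lemma test_functional (hΩ : IsLipschitzDomain Ω) {g : E3 → ℝ} (hg : MemLp g (3/2) (volume.restrict Ω)) (k : HI) :
    ∃ l : ZZ Ω →L[ℝ] ℝ, ∀ z : ZZ Ω, l z = ∫ x in Ω, g x * z x k := by
  refine ⟨(Bj k).lpPairing (volume.restrict Ω) (3/2) 3 (hg.toLp g), fun z => ?_⟩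
  rw [ContinuousLinearMap.lpPairing_eq_integral]
  refine integral_congr_ae ?_
  filter_upwards [hg.coeFn_toLp] with x hx
  rw [hx, Bj_apply]

lemma heat_functional (hΩ : IsLipschitzDomain Ω) (β : ℝ) (hβ0 : 0 ≤ β) (t : ℝ) (y : E3) (j : Fin 3) :
    ∃ l : ZZ Ω →L[ℝ] ℝ, ∀ φ : TT Ω, l (JJ hΩ β φ) = cv (hk t) (fun x => φ.1 x j) y := by
  have hc : Continuous fun w => dB Ω w ^ (β/2) * hk t (y - w) :=
    (continuous_dB_rpow Ω (by positivity)).mul ((contDiff_hk t).continuous.comp (by fun_prop))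
  obtain ⟨l, hl⟩ := test_functional hΩ (memLp_cont hΩ hc hc.aestronglyMeasurable _) (.inl j)
  refine ⟨l, fun φ => ?_⟩
  rw [hl]
  have e : ∫ x in Ω, hk t (y - x) * φ.1 x j = cv (hk t) (fun x => φ.1 x j) y := by
    refine setIntegral_eq_integral_of_forall_compl_eq_zero fun x hx => ?_
    have := tsupp_zero (comp_tsupp (IsTestSol.toIsTest φ.2).suppin j) x hx
    simp only [this, mul_zero]
  rw [← e]
  · refine integral_congr_ae ?_
    filter_upwards [JJ_ae hΩ β φ, ae_restrict_mem hΩ.isOpen.measurableSet] with x h1 hx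
    have hd := dB_pos hΩ hx
    rw [h1]
    simp only [emb, mkH_inl, PiLp.smul_apply, smul_eq_mul]
    have : dB Ω x ^ (β/2) * dB Ω x ^ (-(β/2)) = 1 := by rw [← Real.rpow_add hd]; simp
    linear_combination (hk t (y - x) * φ.1 x j) * this

end CompactSec

section EhrlingSec
variable {Ω : Set E3}

lemma cv_diff {t : ℝ} {L : ℝ} (hL : 0 < L) (hl : ∀ a b : E3, |hk t a - hk t b| ≤ L * ‖a - b‖)
    {f : E3 → ℝ} (hf : Continuous f) (hfs : HasCompactSupport f) (x y : E3) :
    ‖cv (hk t) f x - cv (hk t) f y‖ₑ ≤ ENNReal.ofReal (L * ‖x - y‖) * ∫⁻ w, ‖f w‖ₑ := by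
  have hkc : Continuous (hk t) := (contDiff_hk t).continuous
  unfold cv
  rw [← integral_sub (cv_integrable hkc hf hfs x) (cv_integrable hkc hf hfs y)]
  refine (enorm_integral_le_lintegral_enorm _).trans ?_
  rw [← lintegral_const_mul' _ _ ENNReal.ofReal_ne_top]
  refine lintegral_mono fun w => ?_
  rw [← sub_mul, enorm_mul, Real.enorm_eq_ofReal_abs (hk t _ - _)]
  gcongr
  refine (hl _ _).trans (le_of_eq ?_)
  congr 2; abel

lemma cM_nonneg' : 0 ≤ cM := by
  unfold cM; positivity

lemma ehr_comp (hΩ : IsLipschitzDomain Ω) (β : ℝ) (hβ0 : 0 ≤ β) (hβ : β < 2/5) (j : Fin 3) {ε : ℝ} (hε : 0 < ε) :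
    ∃ (s : Finset E3) (l : E3 → ZZ Ω →L[ℝ] ℝ), ∀ φ : TT Ω,
      ∫⁻ x in Ω, ‖φ.1 x j‖ₑ ≤ ENNReal.ofReal (ε * ‖JJ hΩ β φ‖ + ∑ y ∈ s, |l y (JJ hΩ β φ)|) := by
  obtain ⟨A1, hA1, H1⟩ := grad_L1 hΩ β hβ0 hβ
  obtain ⟨A2, hA2, H2⟩ := val_L1 hΩ β hβ0
  have hVf : volume Ω ≠ ∞ := hΩ.isBounded.measure_lt_top.ne
  set V := (volume Ω).toReal with hV
  have hV0 : 0 ≤ V := ENNReal.toReal_nonneg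
  set c := cM * 3 * A1 with hc
  have hc0 : 0 ≤ c := by have := cM_nonneg'; positivity
  set r := ε / (2 * (c + 1)) with hr
  have hr0 : 0 < r := by positivity
  set t := r ^ 2 with ht
  have ht0 : 0 < t := by positivity
  have hst : √t = r := Real.sqrt_sq hr0.le
  have hrc : r * c ≤ ε / 2 := by
    rw [hr, div_mul_eq_mul_div, div_le_div_iff₀ (by positivity) (by positivity)]
    nlinarith
  obtain ⟨L, hL, hlip⟩ := hk_lip ht0
  set η := ε / (2 * (V * L * A2 + 1)) with hη
  have hη0 : 0 < η := by positivity
  have hηc : η * (V * L * A2) ≤ ε / 2 := by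
    have : 0 ≤ V * L * A2 := by positivity
    rw [hη, div_mul_eq_mul_div, div_le_div_iff₀ (by positivity) (by positivity)]
    nlinarith
  obtain ⟨net, hnf, hnet⟩ := Metric.totallyBounded_iff.1 (hΩ.isBounded.isCompact_closure.totallyBounded.subset subset_closure) η hη0
  choose l hl using fun y => heat_functional hΩ β hβ0 t y j
  refine ⟨hnf.toFinset, fun y => V • l y, fun φ => ?_⟩
  set f : E3 → ℝ := fun x => φ.1 x j with hf
  have hfc1 : ContDiff ℝ 1 f := IsTestSol.c1 φ.2 j
  have hfs : HasCompactSupport f := comp_supp (IsTestSol.toIsTest φ.2).compsupp j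
  set N := ‖JJ hΩ β φ‖ with hN
  have hN0 : 0 ≤ N := norm_nonneg _
  set Sg := ∑ y ∈ hnf.toFinset, |l y (JJ hΩ β φ)| with hSg
  have hSg0 : 0 ≤ Sg := Finset.sum_nonneg fun _ _ => abs_nonneg _
  have hfirst : ∫⁻ x in Ω, ‖f x - cv (hk t) f x‖ₑ ≤ ENNReal.ofReal (ε / 2 * N) := by
    refine (setLIntegral_le_lintegral _ _).trans ((heat_L1diff hfc1 hfs ht0).trans ?_)
    have h3 : ∫⁻ x, ‖fderiv ℝ f x‖ₑ ≤ ENNReal.ofReal (3 * (A1 * N)) := by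
      calc ∫⁻ x, ‖fderiv ℝ f x‖ₑ ≤ ∫⁻ x, ∑ i, ‖pd φ.1 i j x‖ₑ := by
            refine lintegral_mono fun x => ?_
            rw [← ofReal_norm_eq_enorm]
            refine (ENNReal.ofReal_le_ofReal (fderiv_norm_le f x)).trans ?_
            rw [ENNReal.ofReal_sum_of_nonneg fun _ _ => abs_nonneg _]
            refine le_of_eq (Finset.sum_congr rfl fun i _ => ?_)
            rw [Real.enorm_eq_ofReal_abs, pd_fun φ.2]
        _ = ∑ i, ∫⁻ x, ‖pd φ.1 i j x‖ₑ := 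
            lintegral_finsetSum' _ fun i _ => (pd_cont φ.2 i j).enorm.measurable.aemeasurable
        _ ≤ ∑ i : Fin 3, ENNReal.ofReal (A1 * N) := Finset.sum_le_sum fun i _ => H1 φ i j
        _ = _ := by
            rw [Finset.sum_const, Finset.card_univ, Fintype.card_fin, nsmul_eq_mul, ENNReal.ofReal_mul (by norm_num : (0:ℝ) ≤ 3)]
            simp
    have hcM := cM_nonneg'
    rw [hst]
    calc ENNReal.ofReal (r * cM) * ∫⁻ x, ‖fderiv ℝ f x‖ₑ
        ≤ ENNReal.ofReal (r * cM) * ENNReal.ofReal (3 * (A1 * N)) := by gcongr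
      _ = ENNReal.ofReal (r * cM * (3 * (A1 * N))) := (ENNReal.ofReal_mul (by positivity)).symm
      _ ≤ _ := by
        refine ENNReal.ofReal_le_ofReal ?_
        have : r * cM * (3 * (A1 * N)) = (r * c) * N := by rw [hc]; ring
        rw [this]; gcongr
  have hsec : ∫⁻ x in Ω, ‖cv (hk t) f x‖ₑ ≤ ENNReal.ofReal (ε / 2 * N + V * Sg) := by
    have hp : ∀ x ∈ Ω, ‖cv (hk t) f x‖ₑ ≤ ENNReal.ofReal (L * η * (A2 * N) + Sg) := by
      intro x hx
      obtain ⟨y, hy, hxy⟩ := Set.mem_iUnion₂.1 (hnet hx)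
      rw [Metric.mem_ball, dist_eq_norm] at hxy
      have e : cv (hk t) f x = (cv (hk t) f x - cv (hk t) f y) + cv (hk t) f y := by ring
      rw [e]
      refine (enorm_add_le _ _).trans ?_
      rw [ENNReal.ofReal_add (by positivity) hSg0, ENNReal.ofReal_mul (by positivity)]
      refine add_le_add ?_ ?_
      · refine (cv_diff hL hlip hfc1.continuous hfs x y).trans ?_
        exact mul_le_mul' (ENNReal.ofReal_le_ofReal (by gcongr)) (H2 φ j)
      · rw [Real.enorm_eq_ofReal_abs]
        refine ENNReal.ofReal_le_ofReal ?_
        rw [← hl y φ]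
        exact Finset.single_le_sum (f := fun y => |l y (JJ hΩ β φ)|) (fun _ _ => abs_nonneg _) (hnf.mem_toFinset.2 hy)
    refine (setLIntegral_mono' hΩ.isOpen.measurableSet hp).trans ?_
    rw [setLIntegral_const, ← ENNReal.ofReal_toReal hVf, ← ENNReal.ofReal_mul (by positivity)]
    refine ENNReal.ofReal_le_ofReal ?_
    rw [← hV]
    have : (L * η * (A2 * N) + Sg) * V = η * (V * L * A2) * N + V * Sg := by ring
    rw [this]
    gcongr
  have hsum : ∑ y ∈ hnf.toFinset, |(V • l y) (JJ hΩ β φ)| = V * Sg := by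
    rw [hSg, Finset.mul_sum]
    refine Finset.sum_congr rfl fun y _ => ?_
    simp [abs_mul, abs_of_nonneg hV0]
  rw [hsum]
  have hcvc : Continuous (cv (hk t) f) := by
    have := cv_continuous ((contDiff_hk t).of_le (by simp)) hfc1.continuous hfs
    exact this
  calc ∫⁻ x in Ω, ‖f x‖ₑ ≤ ∫⁻ x in Ω, (‖f x - cv (hk t) f x‖ₑ + ‖cv (hk t) f x‖ₑ) := by
        refine lintegral_mono fun x => ?_
        refine le_trans (le_of_eq ?_) (enorm_add_le _ _)
        congr 1; ring
    _ = (∫⁻ x in Ω, ‖f x - cv (hk t) f x‖ₑ) + ∫⁻ x in Ω, ‖cv (hk t) f x‖ₑ :=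
        lintegral_add_left (hfc1.continuous.sub hcvc).enorm.measurable _
    _ ≤ ENNReal.ofReal (ε / 2 * N) + ENNReal.ofReal (ε / 2 * N + V * Sg) := add_le_add hfirst hsec
    _ = _ := by
        rw [← ENNReal.ofReal_add (by positivity) (by positivity)]
        congr 1; ring

/-- Weighted component. -/
def gw (hΩ : IsLipschitzDomain Ω) (β : ℝ) (hβ0 : 0 ≤ β) : Lp ℝ (3/2) (volume.restrict Ω) :=
  (memLp_cont hΩ (continuous_dB_rpow Ω (β := β/2) (by positivity))
    (continuous_dB_rpow Ω (β := β/2) (by positivity)).aestronglyMeasurable (3/2)).toLp (fun x => dB Ω x ^ (β/2))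

/-- The weighted component map into `L¹`. -/
def Tj (hΩ : IsLipschitzDomain Ω) (β : ℝ) (hβ0 : 0 ≤ β) (j : Fin 3) : ZZ Ω →L[ℝ] Lp ℝ 1 (volume.restrict Ω) :=
  (Bj (.inl j)).holderL (volume.restrict Ω) (3/2) 3 1 (gw hΩ β hβ0)

lemma Tj_ae (hΩ : IsLipschitzDomain Ω) (β : ℝ) (hβ0 : 0 ≤ β) (j : Fin 3) (z : ZZ Ω) :
    Tj hΩ β hβ0 j z =ᵐ[volume.restrict Ω] fun x => dB Ω x ^ (β/2) * z x (.inl j) := by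
  have e : Tj hΩ β hβ0 j z = (Bj (.inl j)).holder 1 (gw hΩ β hβ0) z := rfl
  rw [e]
  filter_upwards [(Bj (.inl j)).coeFn_holder (r := 1) (gw hΩ β hβ0) z, MemLp.coeFn_toLp (memLp_cont hΩ (continuous_dB_rpow Ω (β := β/2) (by positivity))
    (continuous_dB_rpow Ω (β := β/2) (by positivity)).aestronglyMeasurable (3/2))] with x h1 h2
  rw [h1, Bj_apply, gw, h2]

lemma Tj_norm (hΩ : IsLipschitzDomain Ω) (β : ℝ) (hβ0 : 0 ≤ β) (j : Fin 3) (z : ZZ Ω) :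
    ‖Tj hΩ β hβ0 j z‖ = ∫ x in Ω, dB Ω x ^ (β/2) * |z x (.inl j)| := by
  rw [L1.norm_eq_integral_norm]
  refine integral_congr_ae ?_
  filter_upwards [Tj_ae hΩ β hβ0 j z] with x h
  rw [h, norm_mul, Real.norm_of_nonneg (Real.rpow_nonneg (dB_nonneg Ω x) _), Real.norm_eq_abs]

lemma Tj_integrable (hΩ : IsLipschitzDomain Ω) (β : ℝ) (hβ0 : 0 ≤ β) (j : Fin 3) (z : ZZ Ω) :
    IntegrableOn (fun x => dB Ω x ^ (β/2) * |z x (.inl j)|) Ω := by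
  refine (L1.integrable_coeFn (Tj hΩ β hβ0 j z)).norm.congr ?_
  filter_upwards [Tj_ae hΩ β hβ0 j z] with x h
  rw [h, norm_mul, Real.norm_of_nonneg (Real.rpow_nonneg (dB_nonneg Ω x) _), Real.norm_eq_abs]

lemma Tj_JJ (hΩ : IsLipschitzDomain Ω) (β : ℝ) (hβ0 : 0 ≤ β) (j : Fin 3) (φ : TT Ω) :
    ENNReal.ofReal ‖Tj hΩ β hβ0 j (JJ hΩ β φ)‖ = ∫⁻ x in Ω, ‖φ.1 x j‖ₑ := by
  rw [ofReal_norm_eq_enorm, Lp.enorm_def, eLpNorm_one_eq_lintegral_enorm]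
  refine lintegral_congr_ae ?_
  filter_upwards [Tj_ae hΩ β hβ0 j (JJ hΩ β φ), JJ_ae hΩ β φ, ae_restrict_mem hΩ.isOpen.measurableSet] with x h1 h2 hx
  have hd := dB_pos hΩ hx
  rw [h1, h2]
  simp only [emb, mkH_inl, PiLp.smul_apply, smul_eq_mul]
  rw [← mul_assoc, ← Real.rpow_add hd]
  simp

lemma ehr (hΩ : IsLipschitzDomain Ω) (β : ℝ) (hβ0 : 0 ≤ β) (hβ : β < 2/5) (j : Fin 3) {ε : ℝ} (hε : 0 < ε) :
    ∃ (s : Finset E3) (l : E3 → ZZ Ω →L[ℝ] ℝ), ∀ z ∈ closure (LinearMap.range (JJ hΩ β) : Set (ZZ Ω)),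
      ‖Tj hΩ β hβ0 j z‖ ≤ ε * ‖z‖ + ∑ y ∈ s, |l y z| := by
  obtain ⟨s, l, H⟩ := ehr_comp hΩ β hβ0 hβ j hε
  refine ⟨s, l, fun z hz => ?_⟩
  have hcl : IsClosed {z : ZZ Ω | ‖Tj hΩ β hβ0 j z‖ ≤ ε * ‖z‖ + ∑ y ∈ s, |l y z|} :=
    isClosed_le (by fun_prop) (by fun_prop)
  refine closure_minimal ?_ hcl hz
  rintro _ ⟨φ, rfl⟩
  have h := H φ
  rw [← Tj_JJ hΩ β hβ0] at h
  exact (ENNReal.ofReal_le_ofReal_iff (by positivity)).1 h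

/-- Weak limits of elements of a closed subspace stay in the subspace. -/
lemma weak_mem_closure {Z : Type*} [NormedAddCommGroup Z] [NormedSpace ℝ Z] (S : Submodule ℝ Z) {ι : Type*}
    {U : Filter ι} [U.NeBot] {z : ι → Z} (hz : ∀ i, z i ∈ S) {x : Z}
    (hw : ∀ l : Z →L[ℝ] ℝ, Tendsto (fun i => l (z i)) U (𝓝 (l x))) : x ∈ closure (S : Set Z) := by
  by_contra hx
  obtain ⟨f, u, h1, h2⟩ := geometric_hahn_banach_closed_point (s := closure (S : Set Z)) S.convex.closure isClosed_closure hx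
  have h0 : ∀ i, f (z i) = 0 := by
    intro i
    by_contra hne
    have := h1 (((u + 1) / f (z i)) • z i) (subset_closure (S.smul_mem _ (hz i)))
    rw [map_smul, smul_eq_mul, div_mul_cancel₀ _ hne] at this
    linarith
  have hlim := hw f
  simp only [h0] at hlim
  have e := tendsto_nhds_unique hlim tendsto_const_nhds
  have := h1 0 (subset_closure S.zero_mem)
  rw [map_zero] at this
  linarith

lemma Tj_tendsto (hΩ : IsLipschitzDomain Ω) (β : ℝ) (hβ0 : 0 ≤ β) (hβ : β < 2/5) (j : Fin 3) {ι : Type*}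
    {U : Filter ι} [U.NeBot] {z : ι → ZZ Ω} {M : ℝ} (hz : ∀ i, z i ∈ LinearMap.range (JJ hΩ β)) (hM : ∀ i, ‖z i‖ ≤ M) {x : ZZ Ω}
    (hw : ∀ l : ZZ Ω →L[ℝ] ℝ, Tendsto (fun i => l (z i)) U (𝓝 (l x))) :
    Tendsto (fun i => ‖Tj hΩ β hβ0 j (z i - x)‖) U (𝓝 0) := by
  have hx := weak_mem_closure _ hz hw
  have hmem : ∀ i, z i - x ∈ closure (LinearMap.range (JJ hΩ β) : Set (ZZ Ω)) := by
    intro i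
    have h1 : x ∈ (LinearMap.range (JJ hΩ β)).topologicalClosure := hx
    have h2 := Submodule.le_topologicalClosure _ (hz i)
    exact Submodule.sub_mem _ h2 h1
  have hnb := (inferInstance : U.NeBot).nonempty
  obtain ⟨i0⟩ := U.nonempty_of_neBot
  have hM0 : 0 ≤ M := (norm_nonneg _).trans (hM i0)
  rw [Metric.tendsto_nhds]
  intro ε hε
  set δ := ε / (2 * (M + ‖x‖ + 1)) with hδ
  have hδ0 : 0 < δ := by positivity
  have hδb : δ * (M + ‖x‖) ≤ ε / 2 := by
    have : 0 ≤ M + ‖x‖ := by positivity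
    rw [hδ, div_mul_eq_mul_div, div_le_div_iff₀ (by positivity) (by positivity)]
    nlinarith
  obtain ⟨s, l, H⟩ := ehr hΩ β hβ0 hβ j hδ0
  have hs : Tendsto (fun i => ∑ y ∈ s, |l y (z i - x)|) U (𝓝 0) := by
    have : Tendsto (fun i => ∑ y ∈ s, |l y (z i - x)|) U (𝓝 (∑ y ∈ s, 0)) := by
      refine tendsto_finset_sum _ fun y _ => ?_
      have h1 := ((hw (l y)).sub_const (l y x)).abs
      simpa using h1
    simpa using this
  filter_upwards [(Metric.tendsto_nhds.1 hs) (ε/2) (by positivity)] with i hi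
  rw [Real.dist_eq, sub_zero, abs_of_nonneg (by positivity)] at hi ⊢
  have h1 := H _ (hmem i)
  have h2 : ‖z i - x‖ ≤ M + ‖x‖ := (norm_sub_le _ _).trans (by gcongr; exact hM i)
  have h3 : δ * ‖z i - x‖ ≤ δ * (M + ‖x‖) := by gcongr
  linarith

end EhrlingSec

section TriSec
variable {Ω : Set E3}

lemma young_R {a b R : ℝ} (ha : 0 ≤ a) (hb : 0 ≤ b) (hR : 0 < R) : a * b ≤ (a ^ 3 + b ^ 3) / R + R * b := by
  have h3 : 0 ≤ a ^ 3 := by positivity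
  have h4 : 0 ≤ b ^ 3 := by positivity
  rcases le_total a R with h | h
  · have : a * b ≤ R * b := by gcongr
    have : 0 ≤ (a ^ 3 + b ^ 3) / R := by positivity
    linarith
  · have hRb : 0 ≤ R * b := by positivity
    have : a * b ≤ (a ^ 3 + b ^ 3) / R := by
      rw [le_div_iff₀ hR]
      rcases le_total b a with h' | h'
      · have : a * b * R ≤ a * a * a := by gcongr
        nlinarith
      · have : a * b * R ≤ b * b * b := by
          have : R ≤ b := h.trans h'
          gcongr
        nlinarith
    linarith

lemma norm_vP_le (h : HH) : ‖vP h‖ ≤ ∑ j : Fin 3, |h (.inl j)| := by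
  have hz : vP h = ∑ i, vP h i • ee i := by
    ext k
    rw [WithLp.ofLp_sum, Finset.sum_apply, Finset.sum_eq_single k]
    · simp [ee_apply]
    · intro b _ hb
      simp only [PiLp.smul_apply, ee_apply, smul_eq_mul]
      rw [if_neg hb, mul_zero]
    · simp
  conv_lhs => rw [hz]
  refine (norm_sum_le _ _).trans (Finset.sum_le_sum fun i _ => ?_)
  rw [norm_smul, vP_apply, Real.norm_eq_abs]
  simp [ee]

lemma vP_emb_bound (hΩ : IsLipschitzDomain Ω) (β : ℝ) (ψ : TT Ω) :
    ∃ Q : ℝ, 0 ≤ Q ∧ ∀ x ∈ Ω, ‖vP (emb Ω β ψ.1 x)‖ ≤ dB Ω x ^ (β/2) * Q := by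
  have hb : ∀ j : Fin 3, ∃ Q : ℝ, ∀ x, ‖dB Ω x ^ (-β) * ψ.1 x j‖ ≤ Q := by
    intro j
    have hc := wcont hΩ (IsTestSol.c1 ψ.2 j).continuous (comp_tsupp (IsTestSol.toIsTest ψ.2).suppin j) (-β)
    have hs : HasCompactSupport fun x => dB Ω x ^ (-β) * ψ.1 x j :=
      (comp_supp (IsTestSol.toIsTest ψ.2).compsupp j).mul_left
    exact hs.exists_bound_of_continuous hc
  choose Q hQ using hb
  refine ⟨∑ j, Q j, Finset.sum_nonneg fun j _ => (norm_nonneg _).trans (hQ j 0), fun x hx => ?_⟩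
  have hd := dB_pos hΩ hx
  refine (norm_vP_le _).trans ?_
  rw [Finset.mul_sum]
  refine Finset.sum_le_sum fun j _ => ?_
  have e : emb Ω β ψ.1 x (.inl j) = dB Ω x ^ (β/2) * (dB Ω x ^ (-β) * ψ.1 x j) := by
    simp only [emb, mkH_inl, PiLp.smul_apply, smul_eq_mul]
    rw [← mul_assoc, ← Real.rpow_add hd]
    congr 2; ring
  rw [e, abs_mul, abs_of_nonneg (Real.rpow_nonneg hd.le _)]
  gcongr
  exact hQ j x

lemma dB_rpow_bound (hΩ : IsLipschitzDomain Ω) {β : ℝ} (hβ0 : 0 ≤ β) :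
    ∃ D : ℝ, 0 < D ∧ ∀ x ∈ Ω, dB Ω x ^ β ≤ D := by
  have hc := hΩ.isBounded.isCompact_closure
  obtain ⟨M, hM⟩ := hc.exists_bound_of_continuousOn (continuous_dB_rpow Ω hβ0).continuousOn
  refine ⟨max M 1, by positivity, fun x hx => ?_⟩
  exact ((le_abs_self _).trans (hM x (subset_closure hx))).trans (le_max_left _ _)

lemma bF_bound (hΩ : IsLipschitzDomain Ω) (β : ℝ) (hβ0 : 0 ≤ β) (ψ : TT Ω) :
    ∃ C : ℝ, 0 < C ∧ ∀ (R : ℝ), 0 < R → ∀ z u : ZZ Ω,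
      |bF Ω z u (JJ hΩ β ψ)| ≤ C * ((‖z‖ ^ 3 + ‖u‖ ^ 3) / R + R * ∑ j, ‖Tj hΩ β hβ0 j u‖) := by
  obtain ⟨Q, hQ0, hQ⟩ := vP_emb_bound hΩ β ψ
  obtain ⟨D, hD0, hD⟩ := dB_rpow_bound hΩ (β := β/2) (by positivity)
  set c0 := ‖crossB‖ * ‖wL‖ * Q with hc0
  have hc00 : 0 ≤ c0 := by positivity
  refine ⟨c0 * (3 * (1 + D ^ 3)) + 1, by positivity, fun R hR z u => ?_⟩
  rw [bF_eq]
  have hIntg : Integrable (fun x => c0 * ∑ j : Fin 3, ((‖z x‖ ^ 3 + D ^ 3 * ‖u x‖ ^ 3) / R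
      + R * (dB Ω x ^ (β/2) * |u x (.inl j)|))) (volume.restrict Ω) := by
    refine Integrable.const_mul ?_ _
    refine integrable_finsetSum _ fun j _ => ?_
    refine Integrable.add ?_ ((Tj_integrable hΩ β hβ0 j u).const_mul _)
    exact ((integrable_cube z).add ((integrable_cube u).const_mul _)).div_const _
  have hb := norm_integral_le_of_norm_le (f := fun x => dot3 (cross3 (wP (z x)) (vP (u x))) (vP (JJ hΩ β ψ x))) hIntg (by
    filter_upwards [JJ_ae hΩ β ψ, ae_restrict_mem hΩ.isOpen.measurableSet] with x h1 hx
    have hd := dB_pos hΩ hx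
    rw [h1, dot3_inner]
    refine (norm_inner_le_norm _ _).trans ?_
    have e1 : ‖cross3 (wP (z x)) (vP (u x))‖ ≤ ‖crossB‖ * (‖wL‖ * ‖z x‖) * ∑ j : Fin 3, |u x (.inl j)| := by
      have := crossB.le_opNorm₂ (wL (z x)) (vL (u x))
      rw [crossB_apply, wL_apply, vL_apply] at this
      refine this.trans ?_
      gcongr
      · exact wL.le_opNorm (z x)
      · exact norm_vP_le _
    calc ‖cross3 (wP (z x)) (vP (u x))‖ * ‖vP (emb Ω β ψ.1 x)‖
        ≤ (‖crossB‖ * (‖wL‖ * ‖z x‖) * ∑ j : Fin 3, |u x (.inl j)|) * (dB Ω x ^ (β/2) * Q) := by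
          gcongr
          exact hQ x hx
      _ = c0 * ∑ j : Fin 3, ‖z x‖ * (dB Ω x ^ (β/2) * |u x (.inl j)|) := by
          rw [hc0, ← Finset.mul_sum, ← Finset.mul_sum]; ring
      _ ≤ _ := by
          refine mul_le_mul_of_nonneg_left (Finset.sum_le_sum fun j _ => ?_) hc00
          refine (young_R (norm_nonneg _) (by positivity) hR).trans ?_
          gcongr
          have : |u x (.inl j)| ≤ ‖u x‖ := PiLp.norm_apply_le (u x) (.inl j)
          rw [mul_pow]
          gcongr
          exact hD x hx)
  rw [Real.norm_eq_abs] at hb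
  refine hb.trans ?_
  rw [integral_const_mul, integral_finsetSum]
  swap
  · intro j _
    refine Integrable.add ?_ ((Tj_integrable hΩ β hβ0 j u).const_mul _)
    exact ((integrable_cube z).add ((integrable_cube u).const_mul _)).div_const _
  have e : ∀ j : Fin 3, ∫ x in Ω, ((‖z x‖ ^ 3 + D ^ 3 * ‖u x‖ ^ 3) / R
      + R * (dB Ω x ^ (β/2) * |u x (.inl j)|)) = (‖z‖ ^ 3 + D ^ 3 * ‖u‖ ^ 3) / R + R * ‖Tj hΩ β hβ0 j u‖ := by
    intro j
    rw [integral_add, integral_div, integral_add, integral_const_mul, integral_const_mul, ← Lp3_norm, ← Lp3_norm, Tj_norm]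
    · exact integrable_cube z
    · exact (integrable_cube u).const_mul _
    · exact ((integrable_cube z).add ((integrable_cube u).const_mul _)).div_const _
    · exact (Tj_integrable hΩ β hβ0 j u).const_mul _
  simp only [e]
  rw [Finset.sum_add_distrib, Finset.sum_const, Finset.card_univ, Fintype.card_fin, ← Finset.mul_sum]
  set W := ∑ j, ‖Tj hΩ β hβ0 j u‖ with hW
  have hW0 : 0 ≤ W := Finset.sum_nonneg fun _ _ => norm_nonneg _
  have hD3 : 0 < D ^ 3 := by positivity
  have hz3 : 0 ≤ ‖z‖ ^ 3 := by positivity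
  have hu3 : 0 ≤ ‖u‖ ^ 3 := by positivity
  have hX : (‖z‖ ^ 3 + D ^ 3 * ‖u‖ ^ 3) / R ≤ (1 + D ^ 3) * ((‖z‖ ^ 3 + ‖u‖ ^ 3) / R) := by
    rw [← mul_div_assoc]
    gcongr
    nlinarith
  have hY : 0 ≤ (‖z‖ ^ 3 + ‖u‖ ^ 3) / R := by positivity
  have hRW : 0 ≤ R * W := by positivity
  have key : 3 • ((‖z‖ ^ 3 + D ^ 3 * ‖u‖ ^ 3) / R) + R * W ≤ (3 * (1 + D ^ 3)) * ((‖z‖ ^ 3 + ‖u‖ ^ 3) / R + R * W) := by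
    rw [nsmul_eq_mul]
    push_cast
    nlinarith [mul_nonneg hD3.le hRW]
  calc c0 * (3 • ((‖z‖ ^ 3 + D ^ 3 * ‖u‖ ^ 3) / R) + R * W)
      ≤ c0 * ((3 * (1 + D ^ 3)) * ((‖z‖ ^ 3 + ‖u‖ ^ 3) / R + R * W)) := by gcongr
    _ ≤ _ := by nlinarith

lemma bF_comp (hΩ : IsLipschitzDomain Ω) (β : ℝ) (hβ0 : 0 ≤ β) (hβ : β < 2/5) {ι : Type*}
    {U : Filter ι} [U.NeBot] {z : ι → ZZ Ω} {M : ℝ} (hz : ∀ i, z i ∈ LinearMap.range (JJ hΩ β)) (hM : ∀ i, ‖z i‖ ≤ M) {x : ZZ Ω}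
    (hw : ∀ l : ZZ Ω →L[ℝ] ℝ, Tendsto (fun i => l (z i)) U (𝓝 (l x))) (w : ZZ Ω) (hwm : w ∈ LinearMap.range (JJ hΩ β)) :
    Tendsto (fun i => bF Ω (z i) (z i) w) U (𝓝 (bF Ω x x w)) := by
  obtain ⟨ψ, rfl⟩ := hwm
  obtain ⟨C, hC, H⟩ := bF_bound hΩ β hβ0 ψ
  obtain ⟨i0⟩ := U.nonempty_of_neBot
  have hM0 : 0 ≤ M := (norm_nonneg _).trans (hM i0)
  have hT : Tendsto (fun i => ∑ j, ‖Tj hΩ β hβ0 j (z i - x)‖) U (𝓝 0) := by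
    have : Tendsto (fun i => ∑ j, ‖Tj hΩ β hβ0 j (z i - x)‖) U (𝓝 (∑ j : Fin 3, 0)) :=
      tendsto_finset_sum _ fun j _ => Tj_tendsto hΩ β hβ0 hβ j hz hM hw
    simpa using this
  have h1 : Tendsto (fun i => bF Ω (z i) (z i - x) (JJ hΩ β ψ)) U (𝓝 0) := by
    rw [Metric.tendsto_nhds]
    intro ε hε
    set A := C * (M ^ 3 + (M + ‖x‖) ^ 3) with hA
    have hA0 : 0 ≤ A := by positivity
    set R := 2 * (A + 1) / ε with hR
    have hR0 : 0 < R := by positivity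
    have hAR : A / R < ε / 2 := by
      rw [hR, div_div_eq_mul_div, div_lt_div_iff₀ (by positivity) (by positivity)]
      nlinarith
    filter_upwards [Metric.tendsto_nhds.1 hT (ε / (2 * C * R)) (by positivity)] with i hi
    rw [Real.dist_eq, sub_zero] at hi ⊢
    rw [abs_of_nonneg (Finset.sum_nonneg fun _ _ => norm_nonneg _)] at hi
    refine (H R hR0 (z i) (z i - x)).trans_lt ?_
    have hu : ‖z i - x‖ ≤ M + ‖x‖ := (norm_sub_le _ _).trans (by gcongr; exact hM i)
    have b1 : C * ((‖z i‖ ^ 3 + ‖z i - x‖ ^ 3) / R) ≤ A / R := by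
      rw [hA, ← mul_div_assoc]
      gcongr
      exact hM i
    have b2 : C * (R * ∑ j, ‖Tj hΩ β hβ0 j (z i - x)‖) < ε / 2 := by
      rw [lt_div_iff₀ (by positivity)] at hi
      nlinarith
    rw [mul_add]
    linarith
  have h2 : Tendsto (fun i => bF Ω (z i) x (JJ hΩ β ψ)) U (𝓝 (bF Ω x x (JJ hΩ β ψ))) := by
    exact hw (((bF Ω).flip x).flip (JJ hΩ β ψ))
  have h3 := h1.add h2
  rw [zero_add] at h3
  refine h3.congr fun i => ?_
  rw [map_sub, ContinuousLinearMap.sub_apply]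
  ring

end TriSec

section FinalSec
variable {Ω : Set E3}

lemma ibp_test {ψ : E3 → ℝ} (hψ : IsTestS Ω ψ) {φ : E3 → E3} (hφ : IsTestSol Ω φ) (i j : Fin 3) :
    ∫ x, φ x j * pds ψ i x = - ∫ x, pd φ i j x * ψ x := by
  have cψ := hψ.smooth.continuous
  have cφ := (hφ.c1 j).continuous
  have dψ : Continuous (pds ψ i) := pds_continuous (hψ.smooth.of_le (by simp)) i
  have h := integral_mul_fderiv_eq_neg_fderiv_mul_of_integrable (μ := (volume : Measure E3))
    (f := fun x => φ x j) (g := ψ) (v := ee i) ?_ ?_ ?_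
    (fun x _ => (hφ.c1 j).differentiable (by simp) x) (fun x _ => hψ.smooth.differentiable (by simp) x)
  · rw [pd_fun hφ]
    exact h
  · have : Continuous fun x => pd φ i j x * ψ x := (pd_cont hφ i j).mul cψ
    rw [pd_fun hφ] at this
    exact this.integrable_of_hasCompactSupport hψ.compsupp.mul_left
  · have : Continuous fun x => φ x j * pds ψ i x := cφ.mul dψ
    exact this.integrable_of_hasCompactSupport (comp_supp hφ.compsupp j).mul_right
  · exact (cφ.mul cψ).integrable_of_hasCompactSupport hψ.compsupp.mul_left

/-- The velocity associated with `z`. -/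
def vel (Ω : Set E3) (β : ℝ) (h : E3 → HH) (x : E3) : E3 := dB Ω x ^ (β/2) • vP (h x)

/-- The gradient associated with `z`. -/
def gra (Ω : Set E3) (β : ℝ) (h : E3 → HH) (x : E3) (i j : Fin 3) : ℝ := dB Ω x ^ (-β) * gP (h x) i j

lemma vel_emb (hΩ : IsLipschitzDomain Ω) (β : ℝ) (φ : E3 → E3) {x : E3} (hx : x ∈ Ω) :
    vel Ω β (emb Ω β φ) x = φ x := by
  have hd := dB_pos hΩ hx
  ext j
  simp only [vel, PiLp.smul_apply, vP_apply, emb, mkH_inl, smul_eq_mul]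
  rw [← mul_assoc, ← Real.rpow_add hd]
  simp

lemma gra_emb (hΩ : IsLipschitzDomain Ω) (β : ℝ) (φ : E3 → E3) {x : E3} (hx : x ∈ Ω) (i j : Fin 3) :
    gra Ω β (emb Ω β φ) x i j = pd φ i j x := by
  have hd := dB_pos hΩ hx
  simp only [gra, gP, emb, mkH_inr]
  rw [← mul_assoc, ← Real.rpow_add hd]
  simp

lemma curl_gra (β : ℝ) (h : E3 → HH) (x : E3) : curlOf (gra Ω β h) x = dB Ω x ^ (-β) • wP (h x) := by
  apply E3_ext <;> simp only [curlOf, gra, wP, mk3_apply0, mk3_apply1, mk3_apply2, PiLp.smul_apply, smul_eq_mul] <;> ring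

lemma vcurl_emb (hΩ : IsLipschitzDomain Ω) (β : ℝ) (φ : E3 → E3) {x : E3} (hx : x ∈ Ω) :
    vcurl φ x = dB Ω x ^ (-β) • wP (emb Ω β φ x) := by
  rw [← curl_gra]
  unfold vcurl curlOf
  simp only [gra_emb hΩ β φ hx]

lemma weak_grad_z (hΩ : IsLipschitzDomain Ω) (β : ℝ) (hβ0 : 0 ≤ β) (z : ZZ Ω)
    (hz : z ∈ closure (LinearMap.range (JJ hΩ β) : Set (ZZ Ω))) :
    HasWeakGrad Ω (vel Ω β z) (gra Ω β z) := by
  intro ψ hψ i j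
  have dψ : Continuous (pds ψ i) := pds_continuous (hψ.smooth.of_le (by simp)) i
  have hc1 : Continuous fun x => dB Ω x ^ (β/2) * pds ψ i x :=
    (continuous_dB_rpow Ω (by positivity)).mul dψ
  have hc2 : Continuous fun x => dB Ω x ^ (-β) * ψ x := wcont hΩ hψ.smooth.continuous hψ.suppin _
  obtain ⟨l1, H1⟩ := test_functional hΩ (memLp_cont hΩ hc1 hc1.aestronglyMeasurable _) (.inl j)
  obtain ⟨l2, H2⟩ := test_functional hΩ (memLp_cont hΩ hc2 hc2.aestronglyMeasurable _) (.inr (i, j))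
  have hcl : IsClosed {z : ZZ Ω | l1 z = - l2 z} := isClosed_eq (by fun_prop) (by fun_prop)
  have key : l1 z = - l2 z := by
    refine closure_minimal ?_ hcl hz
    rintro _ ⟨φ, rfl⟩
    show l1 _ = - l2 _
    have e := ibp_test hψ φ.2 i j
    have e1 : l1 (JJ hΩ β φ) = ∫ x, φ.1 x j * pds ψ i x := by
      have e0 : ∫ x in Ω, φ.1 x j * pds ψ i x = ∫ x, φ.1 x j * pds ψ i x := by
        refine setIntegral_eq_integral_of_forall_compl_eq_zero fun x hx => ?_
        have := tsupp_zero (comp_tsupp (IsTestSol.toIsTest φ.2).suppin j) x hx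
        simp only [this, zero_mul]
      rw [← e0, H1]
      refine integral_congr_ae ?_
      filter_upwards [JJ_ae hΩ β φ, ae_restrict_mem hΩ.isOpen.measurableSet] with x h1 hx
      rw [h1]
      have := congrArg (fun w : E3 => w j) (vel_emb hΩ β φ.1 hx)
      simp only [vel, PiLp.smul_apply, vP_apply, smul_eq_mul] at this
      rw [← this]; ring
    have e2 : l2 (JJ hΩ β φ) = ∫ x, pd φ.1 i j x * ψ x := by
      have e0 : ∫ x in Ω, pd φ.1 i j x * ψ x = ∫ x, pd φ.1 i j x * ψ x := by
        refine setIntegral_eq_integral_of_forall_compl_eq_zero fun x hx => ?_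
        rw [tsupp_zero (pd_tsupp φ.2 i j) x hx, zero_mul]
      rw [← e0, H2]
      refine integral_congr_ae ?_
      filter_upwards [JJ_ae hΩ β φ, ae_restrict_mem hΩ.isOpen.measurableSet] with x h1 hx
      rw [h1, ← gra_emb hΩ β φ.1 hx]
      simp only [gra, gP]; ring
    rw [e1, e2, e]
  rw [H1, H2] at key
  have a1 : ∫ x in Ω, vel Ω β z x j * pds ψ i x = ∫ x in Ω, dB Ω x ^ (β/2) * pds ψ i x * z x (.inl j) := by
    refine integral_congr_ae (ae_of_all _ fun x => ?_)
    simp only [vel, PiLp.smul_apply, vP_apply, smul_eq_mul]; ring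
  have a2 : ∫ x in Ω, gra Ω β z x i j * ψ x = ∫ x in Ω, dB Ω x ^ (-β) * ψ x * z x (.inr (i, j)) := by
    refine integral_congr_ae (ae_of_all _ fun x => ?_)
    simp only [gra, gP]; ring
  rw [a1, a2, key]

lemma norm_sq_HH (h : HH) : ‖vP h‖ ^ 2 + frob (gP h) ^ 2 = ‖h‖ ^ 2 := by
  rw [EuclideanSpace.norm_sq_eq, EuclideanSpace.norm_sq_eq, frob,
    Real.sq_sqrt (Finset.sum_nonneg fun _ _ => Finset.sum_nonneg fun _ _ => sq_nonneg _),
    Fintype.sum_sum_type, Fintype.sum_prod_type]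
  simp [vP_apply, gP]

lemma frob_nonneg' (M : Fin 3 → Fin 3 → ℝ) : 0 ≤ frob M := Real.sqrt_nonneg _

lemma frob_smul (c : ℝ) (hc : 0 ≤ c) (M : Fin 3 → Fin 3 → ℝ) : frob (fun i j => c * M i j) = c * frob M := by
  unfold frob
  simp only [mul_pow, ← Finset.mul_sum]
  rw [Real.sqrt_mul (sq_nonneg _), Real.sqrt_sq hc]

lemma norm_vP_le' (h : HH) : ‖vP h‖ ≤ ‖h‖ := by
  have := norm_sq_HH h
  exact (sq_le_sq₀ (norm_nonneg _) (norm_nonneg _)).1 (by nlinarith [sq_nonneg (frob (gP h))])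

lemma frob_gP_le (h : HH) : frob (gP h) ≤ ‖h‖ := by
  have := norm_sq_HH h
  exact (sq_le_sq₀ (frob_nonneg' _) (norm_nonneg _)).1 (by nlinarith [sq_nonneg (‖vP h‖)])

lemma rpow_three (x : ℝ) : x ^ (3:ℝ) = x ^ (3:ℕ) := by
  exact_mod_cast Real.rpow_natCast x 3

lemma dens_bound (hΩ : IsLipschitzDomain Ω) (β : ℝ) (hβ0 : 0 ≤ β) :
    ∃ D : ℝ, 0 < D ∧ ∀ (h : E3 → HH), ∀ x ∈ Ω,
      dB Ω x ^ (3 * β) * (‖vel Ω β h x‖ ^ (3:ℝ) + frob (gra Ω β h x) ^ (3:ℝ)) ≤ D * ‖h x‖ ^ 3 := by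
  obtain ⟨D, hD0, hD⟩ := dB_rpow_bound hΩ (β := 3 * β + 3 * (β/2)) (by positivity)
  refine ⟨D + 1, by positivity, fun h x hx => ?_⟩
  have hd := dB_pos hΩ hx
  have e1 : frob (gra Ω β h x) = dB Ω x ^ (-β) * frob (gP (h x)) :=
    frob_smul _ (Real.rpow_nonneg hd.le _) _
  have e2 : ‖vel Ω β h x‖ = dB Ω x ^ (β/2) * ‖vP (h x)‖ := by
    unfold vel
    rw [norm_smul, Real.norm_of_nonneg (Real.rpow_nonneg hd.le _)]
  rw [e1, e2, rpow_three, rpow_three, mul_pow, mul_pow, ← Real.rpow_mul_natCast hd.le, ← Real.rpow_mul_natCast hd.le,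
    mul_add, ← mul_assoc, ← mul_assoc, ← Real.rpow_add hd, ← Real.rpow_add hd]
  have e3 : 3 * β + -β * ((3:ℕ):ℝ) = 0 := by push_cast; ring
  have e4 : 3 * β + β / 2 * ((3:ℕ):ℝ) = 3 * β + 3 * (β/2) := by push_cast; ring
  rw [e3, e4, Real.rpow_zero, one_mul, add_mul, one_mul]
  have f1 := norm_vP_le' (h x)
  have f2 := frob_gP_le (h x)
  have f3 := frob_nonneg' (gP (h x))
  gcongr
  exact hD x hx

lemma vel_meas (hΩ : IsLipschitzDomain Ω) (β : ℝ) (hβ0 : 0 ≤ β) (z : ZZ Ω) :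
    AEStronglyMeasurable (vel Ω β z) (volume.restrict Ω) := by
  have h1 : AEStronglyMeasurable (fun x => vL (z x)) (volume.restrict Ω) :=
    vL.continuous.comp_aestronglyMeasurable (Lp.aestronglyMeasurable z)
  exact (continuous_dB_rpow Ω (β := β/2) (by positivity)).aestronglyMeasurable.smul h1

lemma gra_meas (β : ℝ) (z : ZZ Ω) (i j : Fin 3) :
    AEStronglyMeasurable (fun x => gra Ω β z x i j) (volume.restrict Ω) := by
  have h1 : AEStronglyMeasurable (fun x => z x (.inr (i, j))) (volume.restrict Ω) :=
    (PiLp.continuous_apply 2 (fun _ : HI => ℝ) (.inr (i, j))).comp_aestronglyMeasurable (Lp.aestronglyMeasurable z)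
  have h2 : Measurable fun x => dB Ω x ^ (-β) := (continuous_dB Ω).measurable.pow_const _
  exact h2.aestronglyMeasurable.mul h1

lemma frob_meas {M : E3 → Fin 3 → Fin 3 → ℝ} {μ : Measure E3} (hM : ∀ i j, AEStronglyMeasurable (fun x => M x i j) μ) :
    AEStronglyMeasurable (fun x => frob (M x)) μ := by
  unfold frob
  refine Real.continuous_sqrt.comp_aestronglyMeasurable ?_
  have : AEMeasurable (fun x => ∑ i, ∑ j, M x i j ^ 2) μ := by
    refine Finset.aemeasurable_fun_sum _ fun i _ => Finset.aemeasurable_fun_sum _ fun j _ => ?_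
    exact (hM i j).aemeasurable.pow_const 2
  exact this.aestronglyMeasurable

lemma mem_W (hΩ : IsLipschitzDomain Ω) (β : ℝ) (hβ0 : 0 ≤ β) (z : ZZ Ω)
    (hz : z ∈ closure (LinearMap.range (JJ hΩ β) : Set (ZZ Ω))) :
    MemW1pSigma Ω 3 (3 * β) (vel Ω β z) (gra Ω β z) := by
  obtain ⟨D, hD0, hD⟩ := dens_bound hΩ β hβ0
  refine ⟨vel_meas hΩ β hβ0 z, weak_grad_z hΩ β hβ0 z hz, ?_, ?_⟩
  · refine Integrable.mono' ((integrable_cube z).const_mul D) ?_ ?_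
    · have h1 := (vel_meas hΩ β hβ0 z).norm.aemeasurable
      have h2 := (frob_meas (fun i j => gra_meas β z i j)).aemeasurable
      have h3 : Measurable fun x => dB Ω x ^ (3 * β) := (continuous_dB Ω).measurable.pow_const _
      exact (h3.aemeasurable.mul ((h1.pow_const _).add (h2.pow_const _))).aestronglyMeasurable
    · filter_upwards [ae_restrict_mem hΩ.isOpen.measurableSet] with x hx
      rw [Real.norm_of_nonneg]
      · exact hD z x hx
      · have := frob_nonneg' (gra Ω β z x)
        have := dB_nonneg Ω x
        positivity
  · obtain ⟨y, hy, hlim⟩ := mem_closure_iff_seq_limit.1 hz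
    choose φ hφ using hy
    refine ⟨fun n => (φ n).1, fun n => (φ n).2, ?_⟩
    have hup : Tendsto (fun n => D * ‖z - y n‖ ^ 3) atTop (𝓝 0) := by
      have h1 : Tendsto (fun n => z - y n) atTop (𝓝 (z - z)) := tendsto_const_nhds.sub hlim
      have := (h1.norm.pow 3).const_mul D
      simpa using this
    refine squeeze_zero (fun n => ?_) (fun n => ?_) hup
    · refine integral_nonneg fun x => ?_
      have := frob_nonneg' (fun i j => gra Ω β z x i j - gradv (φ n).1 x i j)
      have := dB_nonneg Ω x
      simp only [Pi.zero_apply]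
      positivity
    · rw [Lp3_norm, ← integral_const_mul]
      refine integral_mono_of_nonneg ?_ ((integrable_cube _).const_mul _) ?_
      · refine ae_of_all _ fun x => ?_
        have := frob_nonneg' (fun i j => gra Ω β z x i j - gradv (φ n).1 x i j)
        have := dB_nonneg Ω x
        simp only [Pi.zero_apply]
        positivity
      · have hJ := JJ_ae hΩ β (φ n)
        rw [hφ n] at hJ
        filter_upwards [hJ, Lp.coeFn_sub z (y n), ae_restrict_mem hΩ.isOpen.measurableSet] with x h1 h2 hx
        have h3 : ((z - y n : ZZ Ω) : E3 → HH) x = z x - emb Ω β (φ n).1 x := by rw [h2, Pi.sub_apply, h1]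
        have h4 := hD ((z - y n : ZZ Ω) : E3 → HH) x hx
        have e1 : vel Ω β ((z - y n : ZZ Ω) : E3 → HH) x = vel Ω β z x - (φ n).1 x := by
          rw [← vel_emb hΩ β (φ n).1 hx]
          simp only [vel]
          rw [h3, ← smul_sub]
          congr 1
          exact vL.map_sub _ _
        have e2 : gra Ω β ((z - y n : ZZ Ω) : E3 → HH) x = fun i j => gra Ω β z x i j - gradv (φ n).1 x i j := by
          funext i j
          rw [gradv, ← gra_emb hΩ β (φ n).1 hx]
          simp only [gra, gP]
          rw [h3, PiLp.sub_apply]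
          ring
        rw [e1, e2] at h4
        exact h4

lemma F_functional (hΩ : IsLipschitzDomain Ω) (β : ℝ) (F : E3 → Fin 3 → Fin 3 → ℝ)
    (hFmeas : ∀ i j, Measurable fun x => F x i j)
    (hFint : IntegrableOn (fun x => dB Ω x ^ (-(3 * β)/2) * frob (F x) ^ ((3:ℝ)/2)) Ω) :
    ∃ l : ZZ Ω →L[ℝ] ℝ, ∀ z : ZZ Ω, l z = ∫ x in Ω, mdot (F x) (gra Ω β z x) := by
  have hm : ∀ i j, MemLp (fun x => dB Ω x ^ (-β) * F x i j) (3/2) (volume.restrict Ω) := by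
    intro i j
    have h2 : Measurable fun x => dB Ω x ^ (-β) := (continuous_dB Ω).measurable.pow_const _
    have hms : AEStronglyMeasurable (fun x => dB Ω x ^ (-β) * F x i j) (volume.restrict Ω) :=
      (h2.mul (hFmeas i j)).aestronglyMeasurable
    refine (integrable_norm_rpow_iff (p := 3/2) hms (by simp) (by simp [ENNReal.div_eq_top])).1 ?_
    have e32 : ((3/2 : ℝ≥0∞)).toReal = 3/2 := by simp
    rw [e32]
    refine Integrable.mono' hFint ((h2.mul (hFmeas i j)).norm.pow_const _).aestronglyMeasurable ?_
    filter_upwards [ae_restrict_mem hΩ.isOpen.measurableSet] with x hx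
    have hd := dB_pos hΩ hx
    rw [Real.norm_of_nonneg (by positivity)]
    rw [norm_mul, Real.norm_of_nonneg (Real.rpow_nonneg hd.le _), Real.mul_rpow (by positivity) (by positivity),
      ← Real.rpow_mul hd.le]
    have e : -β * (3/2) = -(3*β)/2 := by ring
    rw [e]
    gcongr
    rw [Real.norm_eq_abs]
    refine Real.abs_le_sqrt ?_
    refine le_trans ?_ (Finset.single_le_sum (f := fun i => ∑ j, F x i j ^ 2)
      (fun i _ => Finset.sum_nonneg fun _ _ => sq_nonneg _) (Finset.mem_univ i))
    exact Finset.single_le_sum (f := fun j => F x i j ^ 2) (fun _ _ => sq_nonneg _) (Finset.mem_univ j)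
  choose l hl using fun i j => test_functional hΩ (hm i j) (.inr (i, j))
  refine ⟨∑ i, ∑ j, l i j, fun z => ?_⟩
  have hI : ∀ i j, Integrable (fun x => dB Ω x ^ (-β) * F x i j * z x (.inr (i, j))) (volume.restrict Ω) := by
    intro i j
    exact memLp_one_iff_integrable.1 ((Bj (.inr (i, j))).memLp_of_bilin 1 (hm i j) (Lp.memLp z))
  simp only [ContinuousLinearMap.sum_apply, hl]
  have e : ∀ x, mdot (F x) (gra Ω β z x) = ∑ i, ∑ j, dB Ω x ^ (-β) * F x i j * z x (.inr (i, j)) := by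
    intro x
    unfold mdot
    refine Finset.sum_congr rfl fun i _ => Finset.sum_congr rfl fun j _ => ?_
    simp only [gra, gP]; ring
  simp only [e]
  rw [integral_finsetSum _ fun i _ => integrable_finsetSum _ fun j _ => hI i j]
  refine Finset.sum_congr rfl fun i _ => ?_
  rw [integral_finsetSum _ fun j _ => hI i j]

lemma KK_ae (z : ZZ Ω) : KK Ω z =ᵐ[volume.restrict Ω] fun x => wP (z x) :=
  ContinuousLinearMap.coeFn_compLpL wL z

lemma dot3_smul (a b : ℝ) (u v : E3) : dot3 (a • u) (b • v) = a * b * dot3 u v := by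
  simp only [dot3, PiLp.smul_apply, smul_eq_mul, Finset.mul_sum]
  exact Finset.sum_congr rfl fun i _ => by ring

lemma cross3_smul (a b : ℝ) (u v : E3) : cross3 (a • u) (b • v) = (a * b) • cross3 u v := by
  rw [← crossB_apply, ← crossB_apply, map_smul, map_smul, ContinuousLinearMap.smul_apply, smul_smul, mul_comm b a]

lemma form_eq (hΩ : IsLipschitzDomain Ω) (β : ℝ) (z : ZZ Ω) (φ : TT Ω) :
    bF Ω z z (JJ hΩ β φ) + aF (KK Ω z) (KK Ω (JJ hΩ β φ)) =
    ∫ x in Ω, (dot3 (cross3 (curlOf (gra Ω β z) x) (vel Ω β z x)) (φ.1 x)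
          + dB Ω x ^ (3 * β) * ‖curlOf (gra Ω β z) x‖ * dot3 (curlOf (gra Ω β z) x) (vcurl φ.1 x)) := by
  rw [bF_eq, aF_eq, ← integral_add]
  · refine integral_congr_ae ?_
    filter_upwards [JJ_ae hΩ β φ, KK_ae z, KK_ae (JJ hΩ β φ), ae_restrict_mem hΩ.isOpen.measurableSet] with x h1 h2 h3 hx
    have hd := dB_pos hΩ hx
    rw [h2, h3, h1, curl_gra, vcurl_emb hΩ β φ.1 hx, ← dot3_inner]
    conv_rhs => rw [← vel_emb hΩ β φ.1 hx]
    simp only [vel]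
    rw [cross3_smul, dot3_smul, dot3_smul, norm_smul, Real.norm_of_nonneg (Real.rpow_nonneg hd.le _)]
    have e1 : dB Ω x ^ (-β) * dB Ω x ^ (β/2) * dB Ω x ^ (β/2) = 1 := by
      rw [← Real.rpow_add hd, ← Real.rpow_add hd]
      have : -β + β/2 + β/2 = 0 := by ring
      rw [this, Real.rpow_zero]
    have e2 : dB Ω x ^ (3 * β) * dB Ω x ^ (-β) * (dB Ω x ^ (-β) * dB Ω x ^ (-β)) = 1 := by
      rw [← Real.rpow_add hd, ← Real.rpow_add hd, ← Real.rpow_add hd]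
      have : 3 * β + -β + (-β + -β) = 0 := by ring
      rw [this, Real.rpow_zero]
    linear_combination (-(dot3 (cross3 (wP (z x)) (vP (z x))) (vP (emb Ω β φ.1 x)))) * e1
      - (‖wP (z x)‖ * dot3 (wP (z x)) (wP (emb Ω β φ.1 x))) * e2
  · have h1 := crossH.memLp_of_bilin (3/2) (Lp.memLp z) (Lp.memLp z)
    have h2 := memLp_one_iff_integrable.1 (dotH.memLp_of_bilin 1 h1 (Lp.memLp (JJ hΩ β φ)))
    refine h2.congr (ae_of_all _ fun x => ?_)
    simp only [dotH_apply, crossH_apply]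
  · have h2 := memLp_one_iff_integrable.1 ((innerSL ℝ : E3 →L[ℝ] E3 →L[ℝ] ℝ).memLp_of_bilin 1
      (Lp.memLp (nsq (KK Ω z))) (Lp.memLp (KK Ω (JJ hΩ β φ))))
    refine h2.congr ?_
    filter_upwards [nsq_ae (KK Ω z)] with x h
    rw [h, innerSL_apply_apply, real_inner_smul_left]

lemma energy_eq (hΩ : IsLipschitzDomain Ω) (β : ℝ) (z : ZZ Ω) :
    aF (KK Ω z) (KK Ω z) = ∫ x in Ω, dB Ω x ^ (3 * β) * ‖curlOf (gra Ω β z) x‖ ^ (3:ℝ) := by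
  rw [aF_self, Lp3_norm]
  refine integral_congr_ae ?_
  filter_upwards [KK_ae z, ae_restrict_mem hΩ.isOpen.measurableSet] with x h2 hx
  have hd := dB_pos hΩ hx
  rw [h2, curl_gra, norm_smul, Real.norm_of_nonneg (Real.rpow_nonneg hd.le _), rpow_three, mul_pow,
    ← Real.rpow_mul_natCast hd.le, ← mul_assoc, ← Real.rpow_add hd]
  have : 3 * β + -β * ((3:ℕ):ℝ) = 0 := by push_cast; ring
  rw [this, Real.rpow_zero, one_mul]

theorem main_exist (hΩ : IsLipschitzDomain Ω) (β : ℝ) (hβ0 : 0 ≤ β) (hβ : β < 2/5)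
    (F : E3 → Fin 3 → Fin 3 → ℝ)
    (hFmeas : ∀ i j, Measurable fun x => F x i j)
    (hFint : IntegrableOn (fun x => dB Ω x ^ (-(3 * β)/2) * frob (F x) ^ ((3:ℝ)/2)) Ω) :
    ∃ (v : E3 → E3) (G : E3 → Fin 3 → Fin 3 → ℝ),
      MemW1pSigma Ω 3 (3 * β) v G ∧
      (∀ φ : E3 → E3, IsTestSol Ω φ →
        ∫ x in Ω, (dot3 (cross3 (curlOf G x) (v x)) (φ x)
          + dB Ω x ^ (3 * β) * ‖curlOf G x‖ * dot3 (curlOf G x) (vcurl φ x))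
        = - ∫ x in Ω, mdot (F x) (gradv φ x)) ∧
      ∫ x in Ω, dB Ω x ^ (3 * β) * ‖curlOf G x‖ ^ (3:ℝ) = - ∫ x in Ω, mdot (F x) (G x) := by
  obtain ⟨Ff, hFf⟩ := F_functional hΩ β F hFmeas hFint
  obtain ⟨C, hC, hK⟩ := KK_bound hΩ β hβ0 hβ
  obtain ⟨z, hz, H⟩ := galerkin clarkson3_Lp (KK Ω) (bF Ω) (bF_self Ω) aF aF_cont aF_self aF_bound aF_mono Ff
    (LinearMap.range (JJ hΩ β)) C hC hK
    (fun U z M h1 h2 x h3 w h4 => bF_comp hΩ β hβ0 hβ h1 h2 h3 w h4)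
  refine ⟨vel Ω β z, gra Ω β z, mem_W hΩ β hβ0 z hz, fun φ hφ => ?_, ?_⟩
  · have h := H (JJ hΩ β ⟨φ, hφ⟩) (subset_closure ⟨_, rfl⟩)
    have e := form_eq hΩ β z ⟨φ, hφ⟩
    simp only at e
    rw [← e]
    have e2 : Ff (JJ hΩ β ⟨φ, hφ⟩) = ∫ x in Ω, mdot (F x) (gradv φ x) := by
      rw [hFf]
      refine integral_congr_ae ?_
      filter_upwards [JJ_ae hΩ β ⟨φ, hφ⟩, ae_restrict_mem hΩ.isOpen.measurableSet] with x h1 hx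
      congr 1
      funext i j
      rw [gradv, ← gra_emb hΩ β φ hx]
      simp only [gra, h1]
    rw [← e2]
    linarith
  · have h := H z hz
    rw [bF_self, energy_eq hΩ, hFf] at h
    linarith

end FinalSec

end AuxProof

/-- For `0 ≤ α < 6/5` and `F` with `∫_Ω d^{-α/2}|F|^{3/2} < ∞`, there is
a weak solution `v ∈ W^{1,3}_{0,σ}(Ω, d^α)` of `ω × v + curl(d^α|ω|ω) + ∇π = div F`,
`div v = 0`, satisfying the energy-type equality `∫_Ω d^α|ω|³ = -∫_Ω F : ∇v`. -/
theorem generalized_BL_existence_alpha_small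
    (Ω : Set E3) (hΩ : IsLipschitzDomain Ω) (α : ℝ) (hα0 : 0 ≤ α) (hα : α < 6/5)
    (F : E3 → Fin 3 → Fin 3 → ℝ)
    (hFmeas : ∀ i j, Measurable fun x => F x i j)
    (hFint : IntegrableOn (fun x => dB Ω x ^ (-α/2) * frob (F x) ^ ((3:ℝ)/2)) Ω) :
    ∃ (v : E3 → E3) (G : E3 → Fin 3 → Fin 3 → ℝ),
      MemW1pSigma Ω 3 α v G ∧
      (∀ φ : E3 → E3, IsTestSol Ω φ →
        ∫ x in Ω, (dot3 (cross3 (curlOf G x) (v x)) (φ x)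
          + dB Ω x ^ α * ‖curlOf G x‖ * dot3 (curlOf G x) (vcurl φ x))
        = - ∫ x in Ω, mdot (F x) (gradv φ x)) ∧
      ∫ x in Ω, dB Ω x ^ α * ‖curlOf G x‖ ^ (3:ℝ) = - ∫ x in Ω, mdot (F x) (G x) := by
  obtain ⟨v, G, h1, h2, h3⟩ := main_exist hΩ (α / 3) (by positivity) (by linarith) F hFmeas (by
    have e : -(3 * (α / 3)) / 2 = -α / 2 := by ring
    rw [e]; exact hFint)
  have e : 3 * (α / 3) = α := by ring
  rw [e] at h1 h3
  simp only [e] at h2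
  exact ⟨v, G, h1, h2, h3⟩
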